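/- Let Γ and Λ be icc countable groups with Kazhdan's property (T). Let Γ↷X = lim← X_n be a free ergodic profinite pmp action and let Λ↷Y be a free ergodic compact pmp action. Assume Θ: L∞(X)⋊Γ → L∞(Y)⋊Λ is a *-isomorphism. Then Λ↷Y = lim← Y_n is also a profinite action, and moreover there exist l ∈ ℕ and a unitary w ∈ L∞(Y)⋊Λ such that Θ(L∞(X_{k+l})⋊Γ) = w (L∞(Y_{k+1})⋊Λ) w* for every integer k ≥ 0. -/

import Mathlib

/-!
Common framework: we model tracial von Neumann algebras concretely, as von Neumann
algebras `M ⊆ B(H)` (Mathlib's `VonNeumannAlgebra H`, i.e. star-subalgebras equal to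
their double commutant) equipped with a faithful tracial state, and we model the
crossed product `A ⋊ Γ` of a trace-preserving action axiomatically: `M` contains a
copy of `A` and a group `(u γ)` of unitaries normalizing `A`, such that the canonical
trace-preserving conditional expectation `E_A` kills `u γ` for `γ ≠ 1`, and such that
an element of `M` all of whose Fourier coefficients `E_A (x (u γ)*)` vanish is `0`.
Probability-measure-preserving actions `Γ ↷ (X, μ)` are modelled via the associated
trace-preserving action on the abelian von Neumann algebra `A = L^∞(X)`.
-/

noncomputable section

open scoped Classical

namespace CD

/-- A group has infinite conjugacy classes (icc) if every nontrivial conjugacy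
class is infinite. -/
def IsICC (Γ : Type) [Group Γ] : Prop :=
  ∀ γ : Γ, γ ≠ 1 → {g : Γ | ∃ h : Γ, g = h * γ * h⁻¹}.Infinite

/-- A faithful tracial state on (the elements of) a set `M ⊆ B(H)` (in applications,
a von Neumann algebra), given as a globally defined linear functional whose
axioms are imposed on `M`. -/
structure TraceOn (H : Type) [NormedAddCommGroup H] [InnerProductSpace ℂ H] [CompleteSpace H]
    (M : Set (H →L[ℂ] H)) : Type where
  τ : (H →L[ℂ] H) →ₗ[ℂ] ℂ
  unital : τ 1 = 1
  tracial : ∀ x ∈ M, ∀ y ∈ M, τ (x * y) = τ (y * x)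
  star_eq : ∀ x ∈ M, τ (star x) = starRingEnd ℂ (τ x)
  nonneg : ∀ x ∈ M, 0 ≤ (τ (star x * x)).re ∧ (τ (star x * x)).im = 0
  faithful : ∀ x ∈ M, τ (star x * x) = 0 → x = 0

variable {H : Type} [NormedAddCommGroup H] [InnerProductSpace ℂ H] [CompleteSpace H]

/-- The 2-norm `‖x‖₂ = τ(x* x)^{1/2}` associated with a trace. -/
def TraceOn.norm2 {M : Set (H →L[ℂ] H)} (tr : TraceOn H M) (x : H →L[ℂ] H) : ℝ :=
  Real.sqrt (tr.τ (star x * x)).re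

/-- The (unique) trace-preserving conditional expectation from `M` onto a
von Neumann subalgebra `N ⊆ M`. -/
structure CondExpOn (H : Type) [NormedAddCommGroup H] [InnerProductSpace ℂ H] [CompleteSpace H]
    (M N : Set (H →L[ℂ] H)) (tr : TraceOn H M) : Type where
  E : (H →L[ℂ] H) →ₗ[ℂ] (H →L[ℂ] H)
  mem : ∀ x ∈ M, E x ∈ N
  fix : ∀ x ∈ N, E x = x
  bimod : ∀ a ∈ N, ∀ b ∈ N, ∀ x ∈ M, E (a * x * b) = a * E x * b
  star_map : ∀ x ∈ M, E (star x) = star (E x)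
  trace_eq : ∀ x ∈ M, tr.τ (E x) = tr.τ x
  contractive : ∀ x ∈ M, tr.norm2 (E x) ≤ tr.norm2 x

/-- The double commutant of a subset of `B(H)`: the von Neumann algebra
generated by `S` (for `S` a star-closed unital set). -/
def vnGen (S : Set (H →L[ℂ] H)) : Set (H →L[ℂ] H) :=
  Set.centralizer (Set.centralizer S)

/-- Model of the crossed product von Neumann algebra `M = A ⋊ Γ` of a
trace-preserving action `Γ ↷ (A, τ)`: `M` is generated by a copy of `A`
and canonical unitaries `(u γ)` implementing the action, with its canonical
conditional expectation `E_A` onto `A` (characterising the Fourier coefficients),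
together with the group von Neumann algebra `L(Γ) = {u γ : γ}'' ⊆ M` and the
conditional expectation onto it. -/
structure CrossedProduct (Γ : Type) [Group Γ]
    (H : Type) [NormedAddCommGroup H] [InnerProductSpace ℂ H] [CompleteSpace H] : Type where
  M : VonNeumannAlgebra H
  A : VonNeumannAlgebra H
  A_sub : (A : Set (H →L[ℂ] H)) ⊆ (M : Set (H →L[ℂ] H))
  tr : TraceOn H (M : Set (H →L[ℂ] H))
  u : Γ → (H →L[ℂ] H)
  u_mem : ∀ γ, u γ ∈ M
  u_one : u 1 = 1
  u_mul : ∀ γ δ, u γ * u δ = u (γ * δ)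
  u_star : ∀ γ, star (u γ) = u γ⁻¹
  conj_mem : ∀ (γ : Γ), ∀ a ∈ A, u γ * a * star (u γ) ∈ A
  EA : CondExpOn H (M : Set (H →L[ℂ] H)) (A : Set (H →L[ℂ] H)) tr
  EA_u : ∀ γ : Γ, γ ≠ 1 → EA.E (u γ) = 0
  fourier_sep : ∀ x ∈ M, (∀ γ : Γ, EA.E (x * star (u γ)) = 0) → x = 0
  Lg : VonNeumannAlgebra H
  Lg_eq : (Lg : Set (H →L[ℂ] H)) = vnGen (Set.range u)
  Lg_sub : (Lg : Set (H →L[ℂ] H)) ⊆ (M : Set (H →L[ℂ] H))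
  EL : CondExpOn H (M : Set (H →L[ℂ] H)) (Lg : Set (H →L[ℂ] H)) tr

variable {Γ : Type} [Group Γ]

/-- The action `σ_γ = Ad(u γ)` of `Γ` on `B(H)`, restricting to the given
action on `A`. -/
def CrossedProduct.σ (X : CrossedProduct Γ H) (γ : Γ) (x : H →L[ℂ] H) : H →L[ℂ] H :=
  X.u γ * x * star (X.u γ)

/-- The action is properly outer over the center of `P`; for abelian `P` this is
the usual freeness of the action. -/
def ProperlyOuterOn (X : CrossedProduct Γ H) (P : Set (H →L[ℂ] H)) : Prop :=
  ∀ γ : Γ, γ ≠ 1 → ∀ a ∈ P, (∀ b ∈ P, X.σ γ b * a = a * b) → a = 0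

/-- Freeness of the action `Γ ↷ A`. -/
def IsFree (X : CrossedProduct Γ H) : Prop := ProperlyOuterOn X (X.A : Set (H →L[ℂ] H))

/-- Ergodicity of the action `Γ ↷ A`: the fixed points are the scalars. -/
def IsErgodic (X : CrossedProduct Γ H) : Prop :=
  ∀ a ∈ X.A, (∀ γ : Γ, X.σ γ a = a) → ∃ c : ℂ, a = c • (1 : H →L[ℂ] H)

def IsAbelianSet (S : Set (H →L[ℂ] H)) : Prop := ∀ x ∈ S, ∀ y ∈ S, x * y = y * x

/-- `Q` is a `Γ`-invariant subset (in applications, subalgebra). -/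
def InvariantUnder (X : CrossedProduct Γ H) (Q : Set (H →L[ℂ] H)) : Prop :=
  ∀ (γ : Γ), ∀ q ∈ Q, X.σ γ q ∈ Q

/-- The intermediate crossed product `Q ⋊ Γ ⊆ A ⋊ Γ` of a (`Γ`-invariant)
subalgebra `Q ⊆ A`: those elements all of whose Fourier coefficients lie in `Q`. -/
def midCP (X : CrossedProduct Γ H) (Q : Set (H →L[ℂ] H)) : Set (H →L[ℂ] H) :=
  {x | x ∈ X.M ∧ ∀ γ : Γ, X.EA.E (x * star (X.u γ)) ∈ Q}

/-- The intermediate crossed product `A ⋊ K ⊆ A ⋊ Γ` of a subgroup `K ≤ Γ`: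
those elements whose Fourier coefficients are supported on `K`. -/
def subgpCP (X : CrossedProduct Γ H) (K : Subgroup Γ) : Set (H →L[ℂ] H) :=
  {x | x ∈ X.M ∧ ∀ γ : Γ, γ ∉ K → X.EA.E (x * star (X.u γ)) = 0}

/-- The quasinormalizer `QN_M(P)` of `P` inside `M`. -/
def QNset (M P : Set (H →L[ℂ] H)) : Set (H →L[ℂ] H) :=
  {x | x ∈ M ∧ ∃ (n : ℕ) (y : Fin n → (H →L[ℂ] H)), (∀ i, y i ∈ M) ∧
    (∀ p ∈ P, ∃ q : Fin n → (H →L[ℂ] H), (∀ i, q i ∈ P) ∧ p * x = ∑ i, y i * q i) ∧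
    (∀ p ∈ P, ∃ q : Fin n → (H →L[ℂ] H), (∀ i, q i ∈ P) ∧ x * p = ∑ i, q i * y i)}

def IsUnitaryIn (S : Set (H →L[ℂ] H)) (x : H →L[ℂ] H) : Prop :=
  x ∈ S ∧ star x * x = 1 ∧ x * star x = 1

def IsProjIn (S : Set (H →L[ℂ] H)) (p : H →L[ℂ] H) : Prop :=
  p ∈ S ∧ star p = p ∧ p * p = p

/-- The relative commutant `N' ∩ S`. -/
def commutantIn (N S : Set (H →L[ℂ] H)) : Set (H →L[ℂ] H) :=
  {x | x ∈ S ∧ ∀ y ∈ N, x * y = y * x}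

/-- Conjugation `w ( · ) w*` applied to a set. -/
def conjSet (w : H →L[ℂ] H) (S : Set (H →L[ℂ] H)) : Set (H →L[ℂ] H) :=
  (fun y => w * y * star w) '' S

/-- The scalars `ℂ 1 ⊆ B(H)`. -/
def scalars (H : Type) [NormedAddCommGroup H] [InnerProductSpace ℂ H] [CompleteSpace H] :
    Set (H →L[ℂ] H) :=
  Set.range (fun c : ℂ => c • (1 : H →L[ℂ] H))

/-- The extension `P₀ ⊆ P` of `Γ`-algebras is compact: there is a family `F ⊆ P`
with dense `‖·‖₂`-span in `P` such that the `Γ`-orbit of each `f ∈ F` can be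
uniformly approximated by finitely many "`P₀`-finite rank modules". -/
def IsCompactExt (X : CrossedProduct Γ H) (P₀ P : Set (H →L[ℂ] H)) : Prop :=
  ∃ F : Set (H →L[ℂ] H), F ⊆ P ∧
    (∀ p ∈ P, ∀ ε : ℝ, 0 < ε → ∃ (n : ℕ) (c : Fin n → ℂ) (f : Fin n → (H →L[ℂ] H)),
      (∀ i, f i ∈ F) ∧ X.tr.norm2 (p - ∑ i, c i • f i) ≤ ε) ∧
    (∀ f ∈ F, ∀ ε : ℝ, 0 < ε → ∃ (n : ℕ) (ξ : Fin n → (H →L[ℂ] H)) (C : ℝ),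
      (∀ i, ξ i ∈ P) ∧
      ∀ γ : Γ, ∃ κ : Fin n → (H →L[ℂ] H), (∀ i, κ i ∈ P₀) ∧ (∀ i, ‖κ i‖ ≤ C) ∧
        X.tr.norm2 (X.σ γ f - ∑ i, κ i * ξ i) ≤ ε)

/-- The action `Γ ↷ A` is compact: the extension over the scalars is compact. -/
def IsCompactAction (X : CrossedProduct Γ H) : Prop :=
  IsCompactExt X (scalars H) (X.A : Set (H →L[ℂ] H))

/-- The `Γ`-invariant subalgebra `B ⊆ A` gives a mixing extension: for
`t, z ∈ A ⊖ B` one has `‖E_B(t σ_γ(z))‖₂ → 0` as `γ → ∞`. -/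
def IsMixingExt (X : CrossedProduct Γ H) (B : Set (H →L[ℂ] H))
    (EB : CondExpOn H (X.M : Set (H →L[ℂ] H)) B X.tr) : Prop :=
  ∀ t ∈ X.A, ∀ z ∈ X.A, EB.E t = 0 → EB.E z = 0 →
    Filter.Tendsto (fun γ : Γ => X.tr.norm2 (EB.E (t * X.σ γ z))) Filter.cofinite (nhds 0)

/-- A `*`-isomorphism from (the von Neumann algebra with underlying set) `M ⊆ B(H₁)`
onto `N ⊆ B(H₂)`, given as a globally defined map with all axioms imposed on `M`. -/
structure StarIsoOn {H₁ : Type} [NormedAddCommGroup H₁] [InnerProductSpace ℂ H₁]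
    [CompleteSpace H₁] {H₂ : Type} [NormedAddCommGroup H₂] [InnerProductSpace ℂ H₂]
    [CompleteSpace H₂] (M : Set (H₁ →L[ℂ] H₁)) (N : Set (H₂ →L[ℂ] H₂)) : Type where
  Θ : (H₁ →L[ℂ] H₁) → (H₂ →L[ℂ] H₂)
  mem : ∀ x ∈ M, Θ x ∈ N
  map_one : Θ 1 = 1
  map_add : ∀ x ∈ M, ∀ y ∈ M, Θ (x + y) = Θ x + Θ y
  map_smul : ∀ (c : ℂ), ∀ x ∈ M, Θ (c • x) = c • Θ x
  map_mul : ∀ x ∈ M, ∀ y ∈ M, Θ (x * y) = Θ x * Θ y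
  map_star : ∀ x ∈ M, Θ (star x) = star (Θ x)
  inj : ∀ x ∈ M, ∀ y ∈ M, Θ x = Θ y → x = y
  surj : ∀ y ∈ N, ∃ x ∈ M, Θ x = y

/-- `r` is the (Pimsner–Popa/Jones) index of the inclusion `N ⊆ M`, witnessed by a
finite Pimsner–Popa basis `m₁, …, m_k` with `E_N (m_i m_j*) = δ_{ij} p_i`,
`x = ∑ᵢ E_N(x mᵢ*) mᵢ` for `x ∈ M`, and `r = ∑ᵢ τ(pᵢ)`. -/
def HasPPIndex {Mamb : Set (H →L[ℂ] H)} (tr : TraceOn H Mamb)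
    (M N : Set (H →L[ℂ] H)) (r : ℝ) : Prop :=
  ∃ E : (H →L[ℂ] H) →ₗ[ℂ] (H →L[ℂ] H),
    (∀ x ∈ M, E x ∈ N) ∧ (∀ x ∈ N, E x = x) ∧
    (∀ a ∈ N, ∀ b ∈ N, ∀ x ∈ M, E (a * x * b) = a * E x * b) ∧
    (∀ x ∈ M, tr.τ (E x) = tr.τ x) ∧
    ∃ (k : ℕ) (m p : Fin k → (H →L[ℂ] H)),
      (∀ i, m i ∈ M) ∧ (∀ i, p i ∈ N ∧ star (p i) = p i ∧ p i * p i = p i) ∧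
      (∀ i j, E (m i * star (m j)) = if i = j then p i else 0) ∧
      (∀ x ∈ M, x = ∑ i, E (x * star (m i)) * m i) ∧
      r = (∑ i, tr.τ (p i)).re

/-- The inclusion `N ⊆ M` has finite (Pimsner–Popa/Jones) index. -/
def FiniteIndexIn {Mamb : Set (H →L[ℂ] H)} (tr : TraceOn H Mamb)
    (M N : Set (H →L[ℂ] H)) : Prop :=
  ∃ r : ℝ, HasPPIndex tr M N r

/-- `S` (a von Neumann algebra) is a factor: trivial center. -/
def IsFactorSet (S : Set (H →L[ℂ] H)) : Prop :=
  ∀ x ∈ S, (∀ y ∈ S, x * y = y * x) → ∃ c : ℂ, x = c • (1 : H →L[ℂ] H)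

/-- `S` is a II₁ factor (with respect to the trace `tr`): a factor whose
projections realize every trace value in `[0,1]`. -/
def IsII1On {Mamb : Set (H →L[ℂ] H)} (tr : TraceOn H Mamb) (S : Set (H →L[ℂ] H)) : Prop :=
  IsFactorSet S ∧ ∀ r : ℝ, 0 ≤ r → r ≤ 1 →
    ∃ p ∈ S, star p = p ∧ p * p = p ∧ tr.τ p = (r : ℂ)

def IsFinDimSet (S : Set (H →L[ℂ] H)) : Prop :=
  ∃ (n : ℕ) (v : Fin n → (H →L[ℂ] H)), (∀ i, v i ∈ S) ∧
    ∀ x ∈ S, ∃ c : Fin n → ℂ, x = ∑ i, c i • v i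

def IsStarSubalgSet (S : Set (H →L[ℂ] H)) : Prop :=
  (1 : H →L[ℂ] H) ∈ S ∧ (∀ x ∈ S, ∀ y ∈ S, x + y ∈ S) ∧ (∀ x ∈ S, ∀ y ∈ S, x * y ∈ S) ∧
    (∀ (c : ℂ), ∀ x ∈ S, c • x ∈ S) ∧ (∀ x ∈ S, star x ∈ S)

/-- `S` is approximately finite dimensional (with respect to `‖·‖₂`); by Connes'
theorem this is equivalent to amenability for (separable, tracial) von Neumann
algebras. -/
def IsAFD {Mamb : Set (H →L[ℂ] H)} (tr : TraceOn H Mamb) (S : Set (H →L[ℂ] H)) : Prop :=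
  ∃ Q : ℕ → Set (H →L[ℂ] H), (∀ n, Q n ⊆ S) ∧ (∀ n, Q n ⊆ Q (n + 1)) ∧
    (∀ n, IsFinDimSet (Q n)) ∧ (∀ n, IsStarSubalgSet (Q n)) ∧
    ∀ x ∈ S, ∀ ε : ℝ, 0 < ε → ∃ n, ∃ y ∈ Q n, tr.norm2 (x - y) ≤ ε

/-- `S` is diffuse: it has no minimal projections. -/
def IsDiffuseSet (S : Set (H →L[ℂ] H)) : Prop :=
  ∀ p, IsProjIn S p → p ≠ 0 →
    ∃ q, IsProjIn S q ∧ q ≠ 0 ∧ q ≠ p ∧ q * p = q ∧ p * q = q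

/-- The (trace-preserving) action of `Γ` on the subalgebra `Q` is transitive:
`Q` is spanned by finitely many orthogonal minimal projections summing to `1`
which are permuted transitively by `Γ`. -/
def IsTransitiveOn (X : CrossedProduct Γ H) (Q : Set (H →L[ℂ] H)) : Prop :=
  ∃ (n : ℕ) (e : Fin n → (H →L[ℂ] H)),
    (∀ i, e i ∈ Q ∧ star (e i) = e i ∧ e i * e i = e i) ∧
    (∀ i j, i ≠ j → e i * e j = 0) ∧ (∑ i, e i = 1) ∧
    (∀ q ∈ Q, ∃ c : Fin n → ℂ, q = ∑ i, c i • e i) ∧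
    (∀ i j, ∃ γ : Γ, X.σ γ (e i) = e j)

/-- An abelian von Neumann algebra `S` is completely atomic: every nonzero
projection dominates a minimal projection. -/
def IsCompletelyAtomic (S : Set (H →L[ℂ] H)) : Prop :=
  ∀ p, IsProjIn S p → p ≠ 0 →
    ∃ q, IsProjIn S q ∧ q ≠ 0 ∧ q * p = q ∧
      ∀ r, IsProjIn S r → r * q = r → r = 0 ∨ r = q

end CD

namespace CD

/-- Kazhdan's property (T) for a group: there are a finite set `S` and `ε > 0` such
that every unitary representation with an `(S, ε)`-invariant unit vector has a
nonzero invariant vector. -/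
def HasPropertyT (Γ : Type) [Group Γ] : Prop :=
  ∃ (S : Finset Γ) (ε : ℝ), 0 < ε ∧
    ∀ (K : Type) (_i1 : NormedAddCommGroup K) (_i2 : InnerProductSpace ℂ K)
      (_i3 : CompleteSpace K) (π : Γ → K →L[ℂ] K),
      π 1 = 1 → (∀ γ δ : Γ, π (γ * δ) = π γ * π δ) → (∀ (γ : Γ) (ξ : K), ‖π γ ξ‖ = ‖ξ‖) →
      (∃ ξ : K, ‖ξ‖ = 1 ∧ ∀ s ∈ S, ‖π s ξ - ξ‖ < ε) →
      ∃ η : K, η ≠ 0 ∧ ∀ γ : Γ, π γ η = η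

/-- `Γ ↷ X` is profinite, exhibited by an increasing sequence of finite-dimensional
`Γ`-invariant subalgebras of `L^∞(X)` on which `Γ` acts (ergodically, i.e.)
transitively and whose union is `‖·‖₂`-dense: `X = lim← X_n`. -/
def IsProfiniteTower {Γ H : Type} [Group Γ] [NormedAddCommGroup H] [InnerProductSpace ℂ H]
    [CompleteSpace H] (X : CrossedProduct Γ H) (An : ℕ → VonNeumannAlgebra H) : Prop :=
  (∀ n, (An n : Set (H →L[ℂ] H)) ⊆ (X.A : Set (H →L[ℂ] H))) ∧
  (∀ n, (An n : Set (H →L[ℂ] H)) ⊆ (An (n + 1) : Set (H →L[ℂ] H))) ∧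
  (∀ n, InvariantUnder X (An n : Set (H →L[ℂ] H))) ∧
  (∀ n, IsFinDimSet (An n : Set (H →L[ℂ] H))) ∧
  (∀ n, IsTransitiveOn X (An n : Set (H →L[ℂ] H))) ∧
  (∀ a ∈ X.A, ∀ ε : ℝ, 0 < ε → ∃ n, ∃ b ∈ An n, X.tr.norm2 (a - b) ≤ ε)

end CD

set_option linter.all false
namespace CDP
open CD Filter Topology
open scoped ENNReal
open ContinuousLinearMap (mul_apply star_eq_adjoint one_apply adjoint_inner_left le_opNorm opNorm_le_bound eq_adjoint_iff nonneg_iff_isPositive adjoint_inner_right le_opENorm)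
open Complex (coe_smul sub_re re_ofReal_mul add_re ofReal_re conj_ofReal continuous_re norm_real re_le_norm ofReal_add zero_re)
open Submodule (subset_span isClosed_topologicalClosure starProjection_apply_mem mem_orthogonal starProjection_eq_self_iff span_le topologicalClosure_coe le_topologicalClosure topologicalClosure_minimal sub_starProjection_mem_orthogonal norm_starProjection_apply_le mem_bot mem_sup mem_span_singleton map_mono map_span add_mem_sup mul_mem_mul map_coe)
open Set (mem_setOf_eq mem_iUnion₂ MapsTo)
open SetLike (mem_coe)
open ENNReal (mul_lt_top ofReal_mul tsum_le_tsum ofReal_le_ofReal ofReal_natCast ofReal_pow tsum_comm ofReal_ofNat ofReal_tsum_of_nonneg pow_right_strictMono ofReal_eq_ofReal_iff tsum_prod tsum_mul_right toReal le_tsum)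
open Real (norm_of_nonneg sq_sqrt mul_self_sqrt sqrt_pos)
open CStarRing (norm_star_mul_self star_mul_self_eq_zero_iff)
open VonNeumannAlgebra (mem_commutant_iff)
open Subalgebra (toSubmodule)
open Module (finrank)
open StarSubalgebra (mem_centralizer_iff coe_centralizer)
open Metric (closedBall)
open StarAlgEquiv (symm_apply_apply apply_symm_apply refl)
open Module.Finite (iff_fg equiv)
open Finset (sum_mul sum_eq_single sum_eq_zero)
open LinearMap (comp_apply extendOfNorm_eq)
open UniformSpace.Completion (coe_toComplL inner_coe toComplL denseRange_coe coe_injective norm_coe)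
open CStarAlgebra (mem_Icc_iff_norm_le_one)
open FiniteDimensional (span_of_finite of_injective proper)
open Function (Injective comp_def)
open StarMemClass (coe_star)
open IsSelfAdjoint (star_mul_self)
variable {Al : Type} [CStarAlgebra Al] {K : Type} [NormedAddCommGroup K] [InnerProductSpace ℂ K]
  [CompleteSpace K] {H : Type} [NormedAddCommGroup H] [InnerProductSpace ℂ H] [CompleteSpace H]

local notation "B(" E ")" => E →L[ℂ] E
local notation "Span" => Submodule.span ℂ

lemma val_eq {α : Type*} {p : α → Prop} {a b : Subtype p} (h : a = b) : a.1 = b.1 := congrArg _ h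

lemma inner_selfC {K : Type*} [NormedAddCommGroup K] [InnerProductSpace ℂ K] (v : K) :
    inner ℂ v v = ((‖v‖ ^ 2 : ℝ) : ℂ) := by
  rw [inner_self_eq_norm_sq_to_K]; simp

lemma norm_eq_of_inner {K : Type*} [NormedAddCommGroup K] [InnerProductSpace ℂ K] {v w : K}
    (h : inner ℂ v v = inner ℂ w w) : ‖v‖ = ‖w‖ := by
  rw [inner_selfC, inner_selfC] at h
  exact (pow_left_inj₀ (norm_nonneg _) (norm_nonneg _) two_ne_zero).1 (by exact_mod_cast h)

section StdDef

lemma exists_sub_star_mul (x : Al) :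
    ∃ c : Al, star c * c = ((‖x‖ ^ 2 : ℝ) : ℂ) • (1 : Al) - star x * x := by
  letI := CStarAlgebra.spectralOrder Al
  haveI := CStarAlgebra.spectralOrderedRing Al
  have h : star x * x ≤ algebraMap ℝ Al ‖star x * x‖ :=
    IsSelfAdjoint.le_algebraMap_norm_self (star_mul_self x)
  have h2 := sub_nonneg.2 h
  obtain ⟨c, hc⟩ := CStarAlgebra.nonneg_iff_eq_star_mul_self.1 h2
  refine ⟨c, ?_⟩
  rw [← hc, norm_star_mul_self, Algebra.algebraMap_eq_smul_one, ← sq]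
  rw [coe_smul]

/-- Standard form of a tracial C*-algebra. -/
structure Std (Al : Type) [CStarAlgebra Al] (K : Type) [NormedAddCommGroup K]
    [InnerProductSpace ℂ K] [CompleteSpace K] where
  j : Al →ₗ[ℂ] K
  dense : DenseRange j
  inj : ∀ x, j x = 0 → x = 0
  inner_star : ∀ x y, inner ℂ (j x) (j y) = inner ℂ (j (star y)) (j (star x))
  inner_mul : ∀ x y z, inner ℂ (j (x * y)) (j z) = inner ℂ (j y) (j (star x * z))
  norm_one : ‖j 1‖ = 1

namespace Std
variable (s : Std Al K)

lemma inner_mul' (x y z : Al) :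
    inner ℂ (s.j (y * x)) (s.j z) = inner ℂ (s.j y) (s.j (z * star x)) := by
  rw [s.inner_star, star_mul, s.inner_star y, star_mul, star_star]
  rw [← inner_conj_symm, s.inner_mul, inner_conj_symm, star_star]

lemma nj_star (x : Al) : ‖s.j (star x)‖ = ‖s.j x‖ := by
  have h := s.inner_star x x
  rw [inner_self_eq_norm_sq_to_K, inner_self_eq_norm_sq_to_K] at h
  have h' : ‖s.j x‖ ^ 2 = ‖s.j (star x)‖ ^ 2 := by exact_mod_cast h
  exact ((pow_left_inj₀ (norm_nonneg _) (norm_nonneg _) two_ne_zero).1 h').symm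

lemma nj_mul (x y : Al) : ‖s.j (x * y)‖ ≤ ‖x‖ * ‖s.j y‖ := by
  obtain ⟨c, hc⟩ := exists_sub_star_mul x
  have h1 : inner ℂ (s.j (c * y)) (s.j (c * y)) =
      ((‖x‖ ^ 2 : ℝ) : ℂ) * inner ℂ (s.j y) (s.j y) - inner ℂ (s.j (x * y)) (s.j (x * y)) := by
    rw [s.inner_mul c, s.inner_mul x, ← mul_assoc, hc, sub_mul, map_sub, inner_sub_right,
      smul_mul_assoc, one_mul, map_smul, inner_smul_right, mul_assoc]
  rw [inner_selfC, inner_selfC, inner_selfC] at h1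
  have h2 : ‖s.j (c * y)‖ ^ 2 = ‖x‖ ^ 2 * ‖s.j y‖ ^ 2 - ‖s.j (x * y)‖ ^ 2 := by
    exact_mod_cast h1
  refine abs_le_of_sq_le_sq' ?_ (by positivity) |>.2
  nlinarith [sq_nonneg ‖s.j (c * y)‖]

lemma nj_mul' (x y : Al) : ‖s.j (x * y)‖ ≤ ‖s.j x‖ * ‖y‖ := by
  rw [← s.nj_star, star_mul, ← s.nj_star x, mul_comm, ← norm_star y]
  exact s.nj_mul _ _

lemma nj_le (x : Al) : ‖s.j x‖ ≤ ‖x‖ := by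
  simpa [s.norm_one] using s.nj_mul x 1

lemma inj' {x y : Al} (h : s.j x = s.j y) : x = y :=
  sub_eq_zero.1 (s.inj _ (by rw [map_sub, h, sub_self]))

/-- left multiplication -/
def L (x : Al) : B(K) :=
  (s.j.comp (LinearMap.mulLeft ℂ x)).extendOfNorm s.j

/-- right multiplication -/
def R (x : Al) : B(K) :=
  (s.j.comp (LinearMap.mulRight ℂ x)).extendOfNorm s.j

@[simp] theorem L_j (x y : Al) : s.L x (s.j y) = s.j (x * y) :=
  extendOfNorm_eq s.dense ⟨‖x‖, fun y => s.nj_mul x y⟩ y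

@[simp] theorem R_j (x y : Al) : s.R x (s.j y) = s.j (y * x) :=
  extendOfNorm_eq s.dense
    ⟨‖x‖, fun y => by rw [mul_comm ‖x‖]; exact s.nj_mul' y x⟩ y

lemma nL (x : Al) (v : K) : ‖s.L x v‖ ≤ ‖x‖ * ‖v‖ :=
  LinearMap.norm_extendOfNorm_apply_le s.dense _ (fun y => s.nj_mul x y) v

lemma nR (x : Al) (v : K) : ‖s.R x v‖ ≤ ‖x‖ * ‖v‖ :=
  LinearMap.norm_extendOfNorm_apply_le s.dense _
    (fun y => by rw [mul_comm ‖x‖]; exact s.nj_mul' y x) v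

lemma ext_j {S T : B(K)} (h : ∀ x, S (s.j x) = T (s.j x)) : S = T := by
  ext v
  exact congrFun (s.dense.equalizer S.continuous T.continuous (funext h)) v

lemma L_mul (x y : Al) : s.L (x * y) = s.L x * s.L y := s.ext_j fun z => by simp [mul_assoc]
lemma R_mul (x y : Al) : s.R (x * y) = s.R y * s.R x := s.ext_j fun z => by simp [mul_assoc]
@[simp] theorem L_one : s.L 1 = 1 := s.ext_j fun z => by simp
@[simp] theorem R_one : s.R 1 = 1 := s.ext_j fun z => by simp
lemma L_add (x y : Al) : s.L (x + y) = s.L x + s.L y := s.ext_j fun z => by simp [add_mul]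
lemma R_add (x y : Al) : s.R (x + y) = s.R x + s.R y := s.ext_j fun z => by simp [mul_add]
lemma L_smul (c : ℂ) (y : Al) : s.L (c • y) = c • s.L y := s.ext_j fun z => by simp
lemma R_smul (c : ℂ) (y : Al) : s.R (c • y) = c • s.R y := s.ext_j fun z => by simp
@[simp] theorem R_zero : s.R 0 = 0 := s.ext_j fun z => by simp
lemma L_sub (x y : Al) : s.L (x - y) = s.L x - s.L y := s.ext_j fun z => by simp [sub_mul]
lemma R_sub (x y : Al) : s.R (x - y) = s.R x - s.R y := s.ext_j fun z => by simp [mul_sub]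
lemma LR_comm (x y : Al) : s.L x * s.R y = s.R y * s.L x := s.ext_j fun z => by simp [mul_assoc]
lemma LR (x y : Al) (v : K) : s.L x (s.R y v) = s.R y (s.L x v) :=
  congrArg (fun T : B(K) => T v) (s.LR_comm x y)

lemma inner_ext_j {S T : K → K → ℂ} (hS : Continuous fun p : K × K => S p.1 p.2)
    (hT : Continuous fun p : K × K => T p.1 p.2) (h : ∀ x y, S (s.j x) (s.j y) = T (s.j x) (s.j y))
    (v w : K) : S v w = T v w := by
  have hd : DenseRange (Prod.map s.j s.j) := s.dense.prodMap s.dense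
  exact congrFun (hd.equalizer hS hT (funext fun p => h p.1 p.2)) (v, w)

lemma inner_L (x : Al) (v w : K) : inner ℂ (s.L x v) w = inner ℂ v (s.L (star x) w) := by
  refine s.inner_ext_j (S := fun v w => inner ℂ (s.L x v) w)
    (T := fun v w => inner ℂ v (s.L (star x) w)) (by fun_prop) (by fun_prop) (fun y z => ?_) v w
  simp [s.inner_mul]

lemma inner_R (x : Al) (v w : K) : inner ℂ (s.R x v) w = inner ℂ v (s.R (star x) w) := by
  refine s.inner_ext_j (S := fun v w => inner ℂ (s.R x v) w)
    (T := fun v w => inner ℂ v (s.R (star x) w)) (by fun_prop) (by fun_prop) (fun y z => ?_) v w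
  simp [s.inner_mul']

lemma L_star (x : Al) : star (s.L x) = s.L (star x) := by
  rw [star_eq_adjoint]
  exact ((eq_adjoint_iff _ _).2 fun v w => by
    rw [s.inner_L, star_star]).symm

lemma R_star (x : Al) : star (s.R x) = s.R (star x) := by
  rw [star_eq_adjoint]
  exact ((eq_adjoint_iff _ _).2 fun v w => by
    rw [s.inner_R, star_star]).symm

/-- the trace -/
def τ (x : Al) : ℂ := inner ℂ (s.j 1) (s.j x)

lemma τ_star_mul (x y : Al) : s.τ (star x * y) = inner ℂ (s.j x) (s.j y) := by
  rw [τ, ← s.inner_mul, mul_one]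

lemma τ_mul_comm (x y : Al) : s.τ (x * y) = s.τ (y * x) := by
  have h1 := s.τ_star_mul (star x) y
  have h2 := s.τ_star_mul (star y) x
  rw [star_star] at h1 h2
  rw [h1, h2, s.inner_star, star_star]

lemma τ_one : s.τ 1 = 1 := by
  rw [τ, inner_self_eq_norm_sq_to_K, s.norm_one]; simp

lemma τ_norm_le (x : Al) : ‖s.τ x‖ ≤ ‖s.j x‖ := by
  have := norm_inner_le_norm (𝕜 := ℂ) (s.j 1) (s.j x)
  rwa [s.norm_one, one_mul] at this

lemma τ_add (x y : Al) : s.τ (x + y) = s.τ x + s.τ y := by simp [τ, inner_add_right]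
lemma τ_sub (x y : Al) : s.τ (x - y) = s.τ x - s.τ y := by simp [τ, inner_sub_right]
lemma τ_smul (c : ℂ) (x : Al) : s.τ (c • x) = c * s.τ x := by simp [τ, inner_smul_right]

lemma nj_unitary_mul {u : Al} (h : star u * u = 1) (x : Al) : ‖s.j (u * x)‖ = ‖s.j x‖ := by
  have : inner ℂ (s.j (u * x)) (s.j (u * x)) = inner ℂ (s.j x) (s.j x) := by
    rw [s.inner_mul, ← mul_assoc, h, one_mul]
  rw [inner_self_eq_norm_sq_to_K, inner_self_eq_norm_sq_to_K] at this
  have h' : ‖s.j (u * x)‖ ^ 2 = ‖s.j x‖ ^ 2 := by exact_mod_cast this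
  exact (pow_left_inj₀ (norm_nonneg _) (norm_nonneg _) two_ne_zero).1 h'

end Std

/-- a faithful tracial state -/
structure Tr (Al : Type) [CStarAlgebra Al] where
  τ : Al →ₗ[ℂ] ℂ
  one : τ 1 = 1
  comm : ∀ x y, τ (x * y) = τ (y * x)
  star_eq : ∀ x, τ (star x) = starRingEnd ℂ (τ x)
  nonneg : ∀ x, 0 ≤ (τ (star x * x)).re
  faithful : ∀ x, τ (star x * x) = 0 → x = 0

/-- pre-Hilbert space -/
def Pre (_t : Tr Al) : Type := Al
instance (t : Tr Al) : AddCommGroup (Pre t) := inferInstanceAs (AddCommGroup Al)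
instance (t : Tr Al) : Module ℂ (Pre t) := inferInstanceAs (Module ℂ Al)

/-- identity map -/
def toPre (t : Tr Al) : Al ≃ₗ[ℂ] Pre t := LinearEquiv.refl ℂ Al

instance preCore (t : Tr Al) : InnerProductSpace.Core ℂ (Pre t) where
  inner x y := t.τ (star ((toPre t).symm x) * (toPre t).symm y)
  conj_inner_symm x y := by rw [← t.star_eq]; simp
  re_inner_nonneg x := t.nonneg _
  add_left x y z := by simp [add_mul]
  smul_left x y z := by simp
  definite x h := t.faithful _ h

instance (t : Tr Al) : NormedAddCommGroup (Pre t) := (preCore t).toNormedAddCommGroup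
instance (t : Tr Al) : InnerProductSpace ℂ (Pre t) := InnerProductSpace.ofCore (preCore t).toCore

/-- L2 space -/
abbrev L2 (t : Tr Al) : Type := UniformSpace.Completion (Pre t)

lemma pre_inner (t : Tr Al) (x y : Al) :
    inner ℂ (toPre t x) (toPre t y) = t.τ (star x * y) := rfl

/-- standard form of a trace -/
def Tr.std (t : Tr Al) : Std Al (L2 t) where
  j := (toComplL (𝕜 := ℂ) (E := Pre t)).toLinearMap.comp (toPre t).toLinearMap
  dense := by
    have := (denseRange_coe (α := Pre t))
    simpa using! this
  inj x h := by
    have h2 : ((toPre t x : Pre t) : L2 t) = ((0 : Pre t) : L2 t) := by simpa using! h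
    have := coe_injective _ h2
    simpa using this
  inner_star x y := by
    simp only [comp_apply, ContinuousLinearMap.coe_coe, LinearEquiv.coe_coe,
      coe_toComplL, inner_coe, pre_inner]
    rw [t.comm, star_star]
  inner_mul x y z := by
    simp only [comp_apply, ContinuousLinearMap.coe_coe, LinearEquiv.coe_coe,
      coe_toComplL, inner_coe, pre_inner]
    rw [star_mul, mul_assoc]
  norm_one := by
    simp only [comp_apply, ContinuousLinearMap.coe_coe, LinearEquiv.coe_coe,
      coe_toComplL, norm_coe]
    rw [← pow_left_inj₀ (norm_nonneg _) zero_le_one two_ne_zero, ← inner_self_eq_norm_sq (𝕜 := ℂ),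
      pre_inner]
    simp [t.one]

lemma Tr.std_inner (t : Tr Al) (x y : Al) :
    inner ℂ (t.std.j x) (t.std.j y) = t.τ (star x * y) := by
  simp only [Tr.std, comp_apply, ContinuousLinearMap.coe_coe, LinearEquiv.coe_coe,
      coe_toComplL, inner_coe, pre_inner]

end StdDef

section Cstar
variable {𝒜 : Type*} [CStarAlgebra 𝒜]

lemma cfcR_mem {a : 𝒜} (ha : IsSelfAdjoint a) (f : ℝ → ℝ) (S : StarSubalgebra ℂ 𝒜)
    (hS : IsClosed (S : Set 𝒜)) (haS : a ∈ S) : cfc f a ∈ S := by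
  rw [cfc_real_eq_complex f ha]
  exact (StarAlgebra.elemental.le_of_mem hS haS) (cfc_mem_elemental _ _)

lemma cfcR_sa (a : 𝒜) (f : ℝ → ℝ) : star (cfc f a) = cfc f a :=
  (cfc_predicate (p := IsSelfAdjoint) f a).star_eq

/-- approximate inverse square root -/
def ppf (n : ℕ) (x : ℝ) : ℝ := (√(|x| + 1 / ((n : ℝ) + 1)))⁻¹

lemma ppf_pos (n : ℕ) (x : ℝ) : 0 < |x| + 1 / ((n : ℝ) + 1) := by positivity

lemma ppf_cont (n : ℕ) : Continuous (ppf n) := by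
  unfold ppf
  refine Continuous.inv₀ (by fun_prop) fun x => (sqrt_pos.2 (ppf_pos n x)).ne'

lemma ppf_sq (n : ℕ) (x : ℝ) : ppf n x * ppf n x = (|x| + 1 / ((n : ℝ) + 1))⁻¹ := by
  unfold ppf
  rw [← mul_inv, mul_self_sqrt (ppf_pos n x).le]

lemma ppf_nonneg (n : ℕ) (x : ℝ) : 0 ≤ ppf n x := by unfold ppf; positivity

lemma ppf_mono {n k : ℕ} (h : n ≤ k) (x : ℝ) : ppf n x ≤ ppf k x := by
  unfold ppf
  refine inv_anti₀ (sqrt_pos.2 (ppf_pos k x)) (Real.sqrt_le_sqrt ?_)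
  have : (n : ℝ) ≤ k := by exact_mod_cast h
  gcongr

lemma polar_aux (y : 𝒜) : ∃ c : ℕ → 𝒜, (∀ n, star (c n) = c n) ∧
    (∀ n, Commute (c n) (star y * y)) ∧ (∀ n, ‖y * c n‖ ≤ 1) ∧
    (∀ S : StarSubalgebra ℂ 𝒜, IsClosed (S : Set 𝒜) → star y * y ∈ S → ∀ n, c n ∈ S) ∧
    (∀ n, ‖star y * y - star y * y * (c n * (star y * y) * c n)‖ ≤ 1 / ((n : ℝ) + 1)) ∧
    (∀ n k, n ≤ k → ∃ d : 𝒜, star (y * c k) * (y * c k) =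
      star (y * c n) * (y * c n) + star (y * c k - y * c n) * (y * c k - y * c n) + star d * d) := by
  set a := star y * y with ha
  have hsa : IsSelfAdjoint a := star_mul_self y
  have hsp : ∀ x ∈ spectrum ℝ a, 0 ≤ x := spectrum_star_mul_self_nonneg
  have hid : cfc (fun x : ℝ => x) a = a := cfc_id' ℝ a
  have hm : ∀ f g : ℝ → ℝ, Continuous f → Continuous g →
      cfc f a * cfc g a = cfc (fun x => f x * g x) a := fun f g hf hg =>
    (cfc_mul f g a hf.continuousOn hg.continuousOn).symm
  have hcomm : ∀ n, Commute (cfc (ppf n) a) a := fun n => by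
    have := cfc_commute_cfc (ppf n) (fun x : ℝ => x) a
    rwa [hid] at this
  have hq : ∀ n k, star (y * cfc (ppf n) a) * (y * cfc (ppf k) a) =
      cfc (fun x => x * (ppf n x * ppf k x)) a := by
    intro n k
    rw [star_mul, cfcR_sa]
    have : cfc (ppf n) a * star y * (y * cfc (ppf k) a) =
        cfc (fun x : ℝ => x) a * (cfc (ppf n) a * cfc (ppf k) a) := by
      rw [hid, ← mul_assoc a, ← (hcomm n).eq, ha]; simp only [mul_assoc]
    rw [this, hm _ _ (ppf_cont n) (ppf_cont k), hm (fun x : ℝ => x) (fun x => ppf n x * ppf k x)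
      continuous_id ((ppf_cont n).mul (ppf_cont k))]
  refine ⟨fun n => cfc (ppf n) a, fun n => cfcR_sa _ _, hcomm, fun n => ?_,
    fun S hS haS n => cfcR_mem hsa _ S hS haS, fun n => ?_, fun n k hnk => ?_⟩
  · have h1 : ‖y * cfc (ppf n) a‖ * ‖y * cfc (ppf n) a‖ ≤ 1 := by
      rw [← norm_star_mul_self, hq]
      refine norm_cfc_le zero_le_one fun x hx => ?_
      have h0 := hsp x hx
      rw [ppf_sq, abs_of_nonneg h0, norm_of_nonneg (by positivity), ← div_eq_mul_inv]
      exact div_le_one_of_le₀ (by simp; positivity) (by positivity)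
    nlinarith [norm_nonneg (y * cfc (ppf n) a)]
  · have : a - a * (cfc (ppf n) a * a * cfc (ppf n) a) =
        cfc (fun x : ℝ => x - x * (x * (ppf n x * ppf n x))) a := by
      have h2 : cfc (ppf n) a * a * cfc (ppf n) a = cfc (fun x => x * (ppf n x * ppf n x)) a := by
        rw [← hq, star_mul, cfcR_sa, ha]; simp only [mul_assoc]
      rw [h2]
      rw [cfc_sub (fun x : ℝ => x) (fun x => x * (x * (ppf n x * ppf n x))) a
        (continuous_id.continuousOn)
        ((continuous_id.mul (continuous_id.mul ((ppf_cont n).mul (ppf_cont n)))).continuousOn),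
        ← hm (fun x : ℝ => x) (fun x => x * (ppf n x * ppf n x)) continuous_id
          (continuous_id.mul ((ppf_cont n).mul (ppf_cont n))), hid]
    rw [this]
    refine norm_cfc_le (by positivity) fun x hx => ?_
    have h0 := hsp x hx
    have hp := ppf_pos n x
    rw [ppf_sq]
    rw [abs_of_nonneg h0] at hp ⊢
    set e := 1 / ((n : ℝ) + 1) with he
    have he0 : 0 < e := by positivity
    have : x - x * (x * (x + e)⁻¹) = x * e / (x + e) := by field_simp; ring
    rw [this, norm_of_nonneg (by positivity), div_le_iff₀ hp]
    nlinarith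
  · refine ⟨cfc (fun x => √(|x| * (2 * ppf n x * (ppf k x - ppf n x)))) a, ?_⟩
    have c1 : Continuous fun x => √(|x| * (2 * ppf n x * (ppf k x - ppf n x))) := by
      have := ppf_cont n; have := ppf_cont k; fun_prop
    have cc : ∀ i j, Continuous fun x => x * (ppf i x * ppf j x) := fun i j =>
      continuous_id.mul ((ppf_cont i).mul (ppf_cont j))
    rw [cfcR_sa, hm _ _ c1 c1]
    rw [star_sub, sub_mul, mul_sub, mul_sub, hq, hq, hq, hq]
    have h5 : cfc (fun x => √(|x| * (2 * ppf n x * (ppf k x - ppf n x))) *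
        √(|x| * (2 * ppf n x * (ppf k x - ppf n x)))) a =
        cfc (fun x => x * (ppf n x * ppf k x) + x * (ppf k x * ppf n x) -
          (x * (ppf n x * ppf n x) + x * (ppf n x * ppf n x))) a := by
      refine cfc_congr fun x hx => ?_
      have h0 := hsp x hx
      have h1 := ppf_nonneg n x
      have h2 := ppf_mono hnk x
      rw [mul_self_sqrt (mul_nonneg (abs_nonneg _)
        (mul_nonneg (by positivity) (by linarith))), abs_of_nonneg h0]
      ring
    rw [h5, cfc_sub (fun x => x * (ppf n x * ppf k x) + x * (ppf k x * ppf n x))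
      (fun x => x * (ppf n x * ppf n x) + x * (ppf n x * ppf n x)) a (((cc n k).add (cc k n)).continuousOn)
      (((cc n n).add (cc n n)).continuousOn),
      cfc_add _ _ _ (cc n k).continuousOn (cc k n).continuousOn,
      cfc_add _ _ _ (cc n n).continuousOn (cc n n).continuousOn]
    abel

end Cstar

section SP
variable {K : Type*} [NormedAddCommGroup K] [InnerProductSpace ℂ K] [CompleteSpace K]

/-- spectral projection lemma -/
lemma spectral_proj (S : B(K)) (hS : 0 ≤ S) (t : ℝ) (ht : 0 < t) :
    ∃ E k : B(K), star E = E ∧ E * E = E ∧ (∀ X, Commute S X → Commute E X) ∧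
      (∀ X, Commute S X → Commute k X) ∧ S * k * E = E ∧ ‖S * (1 - E)‖ ≤ t ∧
      (∀ x, E x = x → t * ‖x‖ ^ 2 ≤ (inner ℂ (S x) x).re) := by
  have hsa : IsSelfAdjoint S := IsSelfAdjoint.of_nonneg hS
  have hsp : ∀ x ∈ spectrum ℝ S, 0 ≤ x := fun x hx => spectrum_nonneg_of_nonneg hS hx
  have hid : cfc (fun x : ℝ => x) S = S := cfc_id' ℝ S
  set g := cfc (fun x : ℝ => max (x - t) 0) S with hg
  set k := cfc (fun x : ℝ => (max x t)⁻¹) S with hk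
  have gc : Continuous fun x : ℝ => max (x - t) 0 := by fun_prop
  have kc : Continuous fun x : ℝ => (max x t)⁻¹ :=
    Continuous.inv₀ (by fun_prop) fun x => (lt_of_lt_of_le ht (le_max_right _ _)).ne'
  have gsa : star g = g := cfcR_sa _ _
  set U : Submodule ℂ K := (LinearMap.range (g : K →ₗ[ℂ] K)).topologicalClosure with hU
  have : CompleteSpace U := (isClosed_topologicalClosure _).completeSpace_coe
  set E := U.starProjection with hE
  have hEs : IsStarProjection E := isStarProjection_starProjection
  have hEg : ∀ x, E (g x) = g x := fun x =>
    starProjection_eq_self_iff.2 (le_topologicalClosure _ ⟨x, rfl⟩)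
  have hEg' : E * g = g := by ext x; exact hEg x
  have hgE' : g * E = g := by
    have := congrArg star hEg'
    rwa [star_mul, hEs.isSelfAdjoint.star_eq, gsa] at this
  have hzero : ∀ T : B(K), T * g = 0 → T * E = 0 := by
    intro T hT
    ext x
    have h1 : U ≤ LinearMap.ker (T : K →ₗ[ℂ] K) := by
      refine topologicalClosure_minimal _ ?_ T.isClosed_ker
      rintro _ ⟨x, rfl⟩
      exact congrArg (fun A : B(K) => A x) hT
    exact h1 (starProjection_apply_mem U x)
  have hcomm : ∀ X, Commute S X → X * E = E * X * E := by
    intro X hX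
    have hXg : Commute g X := hX.cfc_real _
    have : ((1 - E) * X) * E = 0 := by
      apply hzero
      rw [mul_assoc, ← hXg.eq, ← mul_assoc, sub_mul, one_mul, hEg', sub_self, zero_mul]
    rw [sub_mul, one_mul, sub_mul, sub_eq_zero] at this
    exact this
  have hSkE : S * k * E = E := by
    have h1 : (1 - S * k) * g = 0 := by
      have h2 : S * k * g = g := by
        nth_rewrite 1 [← hid]
        rw [hk, hg, ← cfc_mul (fun x : ℝ => x) (fun x : ℝ => (max x t)⁻¹) S
            continuous_id.continuousOn kc.continuousOn,
          ← cfc_mul (fun x : ℝ => x * (max x t)⁻¹) (fun x : ℝ => max (x - t) 0) S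
            (continuous_id.mul kc).continuousOn gc.continuousOn]
        refine cfc_congr fun x hx => ?_
        rcases le_total x t with h | h
        · rw [max_eq_right (by linarith : x - t ≤ 0)]; simp
        · rw [max_eq_left h, mul_inv_cancel₀ (by linarith), one_mul]
      rw [sub_mul, one_mul, h2, sub_self]
    have h3 := hzero _ h1
    rw [sub_mul, one_mul, sub_eq_zero] at h3
    exact h3.symm
  refine ⟨E, k, hEs.isSelfAdjoint.star_eq, hEs.isIdempotentElem, fun X hX => ?_,
    fun X hX => hX.cfc_real _, hSkE, ?_, fun x hx => ?_⟩
  · have h1 := hcomm X hX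
    have h2 : Commute S (star X) := by
      have := hX.star_star
      rwa [hsa.star_eq] at this
    have h3 := congrArg star (hcomm _ h2)
    simp only [star_mul, star_star, hEs.isSelfAdjoint.star_eq] at h3
    exact h3.trans ((mul_assoc _ _ _).symm.trans h1.symm)
  · have h1 : S * (1 - E) = (S - g) * (1 - E) := by
      rw [sub_mul, mul_sub g, mul_one, hgE', sub_self, sub_zero]
    have h2 : S - g = cfc (fun x : ℝ => x - max (x - t) 0) S := by
      rw [cfc_sub (fun x : ℝ => x) (fun x : ℝ => max (x - t) 0) S continuous_id.continuousOn gc.continuousOn, hid]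
    rw [h1]
    have h3 : ‖S - g‖ ≤ t := by
      rw [h2]
      refine norm_cfc_le ht.le fun x hx => ?_
      have h0 := hsp x hx
      rw [Real.norm_eq_abs, abs_le]
      rcases le_total x t with h | h
      · rw [max_eq_right (by linarith)]; constructor <;> linarith
      · rw [max_eq_left (by linarith)]; constructor <;> linarith
    have h4 : ‖(1 : B(K)) - E‖ ≤ 1 := by
      rw [hE, ← Submodule.starProjection_orthogonal']
      exact Submodule.starProjection_norm_le _
    calc _ ≤ ‖S - g‖ * ‖(1 : B(K)) - E‖ := norm_mul_le _ _
      _ ≤ t * 1 := by gcongr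
      _ = t := mul_one t
  · have h1 : 0 ≤ S - (t : ℝ) • (S * k) := by
      have : S - (t : ℝ) • (S * k) = cfc (fun x : ℝ => x - t * (x * (max x t)⁻¹)) S := by
        rw [cfc_sub (fun x : ℝ => x) (fun x : ℝ => t * (x * (max x t)⁻¹)) S continuous_id.continuousOn
          (continuous_const.mul (continuous_id.mul kc)).continuousOn, hid,
          cfc_const_mul t (fun x : ℝ => x * (max x t)⁻¹) S (continuous_id.mul kc).continuousOn,
          cfc_mul (fun x : ℝ => x) (fun x : ℝ => (max x t)⁻¹) S continuous_id.continuousOn kc.continuousOn, hid]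
      rw [this]
      refine cfc_nonneg fun x hx => ?_
      have h0 := hsp x hx
      have hm : 0 < max x t := lt_of_lt_of_le ht (le_max_right _ _)
      have : t * (x * (max x t)⁻¹) ≤ x := by
        rw [← mul_assoc, ← div_eq_mul_inv, div_le_iff₀ hm]
        nlinarith [le_max_right x t]
      linarith
    have h2 := (nonneg_iff_isPositive _).1 h1 |>.re_inner_nonneg_left x
    have h3 : (S * k) x = x := by
      conv_lhs => rw [← hx]
      have := congrArg (fun A : B(K) => A x) hSkE
      simpa [hx] using! this
    rw [sub_apply, inner_sub_left] at h2
    have h4 : (inner ℂ (((t : ℝ) • (S * k)) x) x).re = t * ‖x‖ ^ 2 := by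
      rw [smul_apply, h3, ← coe_smul, inner_smul_left, inner_selfC]
      simp [← Complex.ofReal_pow]
    simp only [map_sub] at h2
    change 0 ≤ (inner ℂ (S x) x).re - (inner ℂ (((t : ℝ) • (S * k)) x) x).re at h2
    rw [h4] at h2
    linarith

end SP

section SOT

lemma inner_sm (S T : B(H)) (x z : H) :
    inner ℂ ((star S * T) x) z = inner ℂ (T x) (S z) := by
  rw [mul_apply, star_eq_adjoint,
      adjoint_inner_left]

/-- quadratic form -/
def qf (T : B(H)) (x : H) : ℝ := (inner ℂ (T x) x).re

lemma qf_sub (S T : B(H)) (x : H) : qf (S - T) x = qf S x - qf T x := by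
  simp [qf, inner_sub_left]
lemma qf_add (S T : B(H)) (x : H) : qf (S + T) x = qf S x + qf T x := by
  simp [qf, inner_add_left]
lemma qf_one (x : H) : qf (1 : B(H)) x = ‖x‖ ^ 2 := by
  simp only [qf, one_apply, inner_selfC]; norm_cast
lemma qf_zero (x : H) : qf (0 : B(H)) x = 0 := by simp [qf]
lemma qf_star_mul (S : B(H)) (x : H) : qf (star S * S) x = ‖S x‖ ^ 2 := by
  have : inner ℂ ((star S * S) x) x = inner ℂ (S x) (S x) := by
    rw [mul_apply, star_eq_adjoint,
      adjoint_inner_left]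
  rw [qf, this, inner_selfC]; norm_cast

lemma nonneg_of_qf {T : B(H)} (h : ∀ x, 0 ≤ qf T x) (hs : star T = T) : 0 ≤ T := by
  rw [nonneg_iff_isPositive]
  exact ContinuousLinearMap.isPositive_def.2 ⟨(isSelfAdjoint_iff.2 hs).isSymmetric, h⟩

lemma qf_nonneg {T : B(H)} (h : 0 ≤ T) (x : H) : 0 ≤ qf T x :=
  ((nonneg_iff_isPositive _).1 h).re_inner_nonneg_left x

lemma qf_mono {S T : B(H)} (h : S ≤ T) (x : H) : qf S x ≤ qf T x := by
  have := qf_nonneg (sub_nonneg.2 h) x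
  rw [qf_sub] at this; linarith

lemma le_of_qf {S T : B(H)} (h : ∀ x, qf S x ≤ qf T x) (hS : star S = S)
    (hT : star T = T) : S ≤ T := by
  rw [← sub_nonneg]
  refine nonneg_of_qf (fun x => ?_) (by rw [star_sub, hS, hT])
  rw [qf_sub]; linarith [h x]

lemma star_of_nonneg {T : B(H)} (h : 0 ≤ T) : star T = T :=
  (IsSelfAdjoint.of_nonneg h).star_eq

lemma sq_le_qf {T : B(H)} (h : 0 ≤ T) (h1 : T ≤ 1) (x : H) : ‖T x‖ ^ 2 ≤ qf T x := by
  obtain ⟨c, hc⟩ := CStarAlgebra.nonneg_iff_eq_star_mul_self.1 h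
  have hn : ‖T‖ ≤ 1 := (mem_Icc_iff_norm_le_one.1 ⟨h, h1⟩).2
  have hcn : ‖c‖ ≤ 1 := by
    rw [hc, norm_star_mul_self] at hn
    nlinarith [norm_nonneg c]
  rw [hc, qf_star_mul, mul_apply]
  have : ‖(star c) (c x)‖ ≤ 1 * ‖c x‖ :=
    (le_opNorm _ _).trans (by rw [norm_star]; gcongr)
  rw [one_mul] at this
  gcongr

lemma exists_strong_limit {α : Type*} {l : Filter α} [l.NeBot] {T : α → B(H)} {C : ℝ}
    (hC : ∀ i, ‖T i‖ ≤ C) (h : ∀ x, Cauchy (map (fun i => T i x) l)) :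
    ∃ S : B(H), ‖S‖ ≤ C ∧ ∀ x, Tendsto (fun i => T i x) l (𝓝 (S x)) := by
  choose f hf' using fun x => CompleteSpace.complete (h x)
  have hf : ∀ x, Tendsto (fun i => T i x) l (𝓝 (f x)) := hf'
  let S := ContinuousLinearMap.ofTendstoOfBoundedRange f T (tendsto_pi_nhds.2 hf)
    (isBounded_iff_forall_norm_le.2 ⟨C, by rintro _ ⟨i, rfl⟩; exact hC i⟩)
  obtain ⟨i⟩ : Nonempty α := l.nonempty_of_neBot
  refine ⟨S, ?_, hf⟩
  refine opNorm_le_bound _ ((norm_nonneg _).trans (hC i)) fun x => ?_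
  refine le_of_tendsto (hf x).norm (.of_forall fun i => ?_)
  exact (le_opNorm _ _).trans (by gcongr; exact hC i)

lemma exists_strong_limit_mono {α : Type*} [Preorder α] [IsDirectedOrder α] [Nonempty α]
    {T : α → B(H)} {C : ℝ} (hC : ∀ i, ‖T i‖ ≤ C) (f : H → α → ℝ) (B : H → ℝ)
    (hB : ∀ x i, f x i ≤ B x)
    (h : ∀ x i j, i ≤ j → ‖T j x - T i x‖ ^ 2 ≤ f x j - f x i) :
    ∃ S : B(H), ‖S‖ ≤ C ∧ ∀ x, Tendsto (fun i => T i x) atTop (𝓝 (S x)) := by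
  refine exists_strong_limit hC fun x => ?_
  have hb : BddAbove (Set.range (f x)) := ⟨B x, by rintro _ ⟨i, rfl⟩; exact hB x i⟩
  rw [Metric.cauchy_iff]
  refine ⟨inferInstance, fun ε hε => ?_⟩
  obtain ⟨i, hi⟩ : ∃ i, (⨆ i, f x i) - (ε / 3) ^ 2 < f x i := by
    apply exists_lt_of_lt_ciSup; nlinarith [sq_pos_of_pos hε]
  have key : ∀ j, i ≤ j → ‖T j x - T i x‖ ≤ ε / 3 := fun j hj => by
    have h1 := h x i j hj
    have h2 := le_ciSup hb j
    refine abs_le_of_sq_le_sq' ?_ (by positivity) |>.2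
    linarith
  refine ⟨(fun j => T j x) '' Set.Ici i, image_mem_map (Ici_mem_atTop i), ?_⟩
  rintro _ ⟨j, hj, rfl⟩ _ ⟨k, hk, rfl⟩
  have h1 := key j hj
  have h2 := key k hk
  rw [dist_eq_norm]
  calc ‖T j x - T k x‖ = ‖(T j x - T i x) - (T k x - T i x)‖ := by congr 1; abel
    _ ≤ ‖T j x - T i x‖ + ‖T k x - T i x‖ := norm_sub_le _ _
    _ < ε := by linarith

variable (M : VonNeumannAlgebra H)

lemma mem_of_strong {α : Type*} {l : Filter α} [l.NeBot] {T : α → B(H)} {S : B(H)}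
    (hT : ∀ i, T i ∈ M) (h : ∀ x, Tendsto (fun i => T i x) l (𝓝 (S x))) : S ∈ M := by
  rw [← M.commutant_commutant, mem_commutant_iff]
  intro g hg
  ext x
  have h1 : Tendsto (fun i => g (T i x)) l (𝓝 (g (S x))) := (g.continuous.tendsto _).comp (h x)
  have h2 := h (g x)
  refine tendsto_nhds_unique h1 (h2.congr fun i => ?_)
  have := (mem_commutant_iff.1 hg) (T i) (hT i)
  exact congrArg (fun A : B(H) => A x) this

lemma qf_tendsto {α : Type*} {l : Filter α} {T : α → B(H)} {S : B(H)}
    (h : ∀ x, Tendsto (fun i => T i x) l (𝓝 (S x))) (x : H) :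
    Tendsto (fun i => qf (T i) x) l (𝓝 (qf S x)) :=
  (continuous_re.tendsto _).comp ((h x).inner tendsto_const_nhds)

lemma star_of_strong {α : Type*} {l : Filter α} [l.NeBot] {T : α → B(H)} {S : B(H)}
    (hT : ∀ i, star (T i) = T i) (h : ∀ x, Tendsto (fun i => T i x) l (𝓝 (S x))) :
    star S = S := by
  rw [star_eq_adjoint]
  symm
  rw [eq_adjoint_iff]
  intro x y
  refine tendsto_nhds_unique ((h x).inner tendsto_const_nhds)
    ((tendsto_const_nhds.inner (h y)).congr fun i => ?_)
  conv_lhs => rw [← hT i]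
  rw [star_eq_adjoint, adjoint_inner_right]

/-- monotone limits -/
lemma mono_limit {α : Type*} [Preorder α] [IsDirectedOrder α] [Nonempty α]
    {T : α → B(H)} (h0 : ∀ i, 0 ≤ T i) (h1 : ∀ i, T i ≤ 1) (hm : Monotone T) :
    ∃ S : B(H), (∀ x, Tendsto (fun i => T i x) atTop (𝓝 (S x))) ∧ 0 ≤ S ∧ S ≤ 1 ∧
      ∀ i, T i ≤ S := by
  obtain ⟨S, hS, hl⟩ := exists_strong_limit_mono (T := T) (C := 1)
    (fun i => (mem_Icc_iff_norm_le_one.1 ⟨h0 i, h1 i⟩).2) (fun x i => qf (T i) x)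
    (fun x => ‖x‖ ^ 2) (fun x i => by rw [← qf_one]; exact qf_mono (h1 i) x) (fun x i j hij => by
      rw [← qf_sub, ← sub_apply]
      exact sq_le_qf (sub_nonneg.2 (hm hij)) ((sub_le_self _ (h0 i)).trans (h1 j)) x)
  have hst := star_of_strong (fun i => star_of_nonneg (h0 i)) hl
  have hi : ∀ i, T i ≤ S := fun i => le_of_qf (fun x => ge_of_tendsto (qf_tendsto hl x)
    ((eventually_ge_atTop i).mono fun j hj => qf_mono (hm hj) x)) (star_of_nonneg (h0 i)) hst
  refine ⟨S, hl, (h0 (Classical.arbitrary α)).trans (hi _), ?_, hi⟩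
  exact le_of_qf (fun x => le_of_tendsto (qf_tendsto hl x)
    (.of_forall fun j => qf_mono (h1 j) x)) hst (star_one _)

lemma isClosed_vn : IsClosed (M.toStarSubalgebra : Set B(H)) := by
  refine isClosed_of_closure_subset fun S hS => ?_
  obtain ⟨T, hT, hl⟩ := mem_closure_iff_seq_limit.1 hS
  exact mem_of_strong M hT fun x => ((ContinuousLinearMap.apply ℂ H x).continuous.tendsto _).comp hl

lemma exists_sqrt {b : B(H)} (hb : b ∈ M) (h0 : 0 ≤ b) :
    ∃ h ∈ M, star h = h ∧ h * h = b := by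
  have hsa : IsSelfAdjoint b := IsSelfAdjoint.of_nonneg h0
  refine ⟨cfc Real.sqrt b, cfcR_mem hsa _ M.toStarSubalgebra (isClosed_vn M) hb, cfcR_sa _ _, ?_⟩
  rw [← cfc_mul _ _ b Real.continuous_sqrt.continuousOn Real.continuous_sqrt.continuousOn]
  nth_rewrite 2 [← cfc_id' ℝ b]
  exact cfc_congr fun x hx => mul_self_sqrt (spectrum_nonneg_of_nonneg h0 hx)

/-- Zorn for increasing chains of positive contractions -/
lemma zorn_contraction (P : B(H) → Prop) (hP0 : P 0)
    (hP : ∀ (α : Type) [Preorder α] [IsDirectedOrder α] [Nonempty α] (T : α → B(H))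
      (S : B(H)), (∀ i, T i ∈ M) → (∀ i, 0 ≤ T i) → (∀ i, T i ≤ 1) → (∀ i, P (T i)) → S ∈ M →
      (∀ i, T i ≤ S) → 0 ≤ S → S ≤ 1 → (∀ x, Tendsto (fun i => T i x) atTop (𝓝 (S x))) → P S) :
    ∃ b ∈ M, 0 ≤ b ∧ b ≤ 1 ∧ P b ∧
      ∀ b' ∈ M, b ≤ b' → b' ≤ 1 → P b' → b' = b := by
  obtain ⟨b, -, hb⟩ := zorn_le_nonempty₀ {b : B(H) | b ∈ M ∧ 0 ≤ b ∧ b ≤ 1 ∧ P b}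
    (fun c hc hch y hy => by
      have : Nonempty c := ⟨⟨y, hy⟩⟩
      have : IsDirectedOrder c := ⟨fun a b => by
        rcases hch.total a.2 b.2 with h | h
        · exact ⟨b, h, le_rfl⟩
        · exact ⟨a, le_rfl, h⟩⟩
      obtain ⟨S, hl, hS0, hS1, hi⟩ := mono_limit (T := fun i : c => (i : B(H)))
        (fun i => (hc i.2).2.1) (fun i => (hc i.2).2.2.1) (fun i j h => h)
      have hSM : S ∈ M := mem_of_strong M (fun i : c => (hc i.2).1) hl
      exact ⟨S, ⟨hSM, hS0, hS1, hP c (fun i : c => (i : B(H))) S (fun i => (hc i.2).1)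
        (fun i => (hc i.2).2.1) (fun i => (hc i.2).2.2.1) (fun i => (hc i.2).2.2.2) hSM hi hS0 hS1 hl⟩,
        fun z hz => hi ⟨z, hz⟩⟩) 0 ⟨zero_mem M, le_rfl, zero_le_one, hP0⟩
  refine ⟨b, hb.prop.1, hb.prop.2.1, hb.prop.2.2.1, hb.prop.2.2.2, fun b' h1 h2 h3 h4 => ?_⟩
  exact (hb.eq_of_le ⟨h1, hb.prop.2.1.trans h2, h3, h4⟩ h2).symm

/-- projections onto commutant-invariant subspaces -/
lemma proj_mem {U : Submodule ℂ H} [U.HasOrthogonalProjection]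
    (hU : ∀ g ∈ M.commutant, ∀ x ∈ U, g x ∈ U) : U.starProjection ∈ M := by
  rw [← M.commutant_commutant, mem_commutant_iff]
  have hEs : IsStarProjection U.starProjection := isStarProjection_starProjection
  have key : ∀ g ∈ M.commutant, g * U.starProjection = U.starProjection * g * U.starProjection := by
    intro g hg
    ext x
    exact (starProjection_eq_self_iff.2
      (hU g hg _ (starProjection_apply_mem U x))).symm
  intro g hg
  have h1 := key g hg
  have h3 := congrArg star (key (star g) (star_mem hg))
  simp only [star_mul, star_star, hEs.isSelfAdjoint.star_eq] at h3
  exact (h3.trans ((mul_assoc _ _ _).symm.trans h1.symm)).symm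

lemma factor_top (hf : IsFactorSet (M : Set B(H))) {U : Submodule ℂ H}
    (hc : IsClosed (U : Set H)) (h1 : ∀ g ∈ M, ∀ x ∈ U, g x ∈ U)
    (h2 : ∀ g ∈ M.commutant, ∀ x ∈ U, g x ∈ U) (h0 : U ≠ ⊥) : U = ⊤ := by
  have : CompleteSpace U := hc.completeSpace_coe
  have hm := proj_mem M h2
  have hm' : U.starProjection ∈ M.commutant := proj_mem M.commutant (by simpa using h1)
  obtain ⟨c, hc⟩ := hf _ hm fun y hy => ((mem_commutant_iff.1 hm') y hy).symm
  obtain ⟨x, hx, hx0⟩ := Submodule.exists_mem_ne_zero_of_ne_bot h0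
  have h3 : U.starProjection x = x := starProjection_eq_self_iff.2 hx
  rw [hc] at h3
  have hc1 : c = 1 := by
    have : (c - 1) • x = 0 := by rw [sub_smul, one_smul, sub_eq_zero]; exact h3
    rcases smul_eq_zero.1 this with h | h
    · exact sub_eq_zero.1 h
    · exact absurd h hx0
  rw [eq_top_iff]
  intro y _
  rw [← starProjection_eq_self_iff, hc, hc1]; simp

lemma factor_ne (hf : IsFactorSet (M : Set B(H))) {p q : B(H)}
    (hq : q ∈ M) (hp0 : p ≠ 0) (hq0 : q ≠ 0) : ∃ x ∈ M, p * x * q ≠ 0 := by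
  by_contra! hcon
  set U : Submodule ℂ H := (Span {v | ∃ x ∈ M, ∃ w, v = x (q w)}).topologicalClosure
  have inv : ∀ g : B(H), (∀ x ∈ M, ∀ w, g (x (q w)) ∈
      Span {v | ∃ x ∈ M, ∃ w, v = x (q w)}) → ∀ y ∈ U, g y ∈ U := by
    intro g hg
    have : U ≤ U.comap (g : H →ₗ[ℂ] H) := by
      refine topologicalClosure_minimal _ ?_
        ((isClosed_topologicalClosure _).preimage g.continuous)
      rw [span_le]
      rintro _ ⟨x, hx, w, rfl⟩
      exact le_topologicalClosure _ (hg x hx w)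
    exact this
  have hU : U = ⊤ := by
    refine factor_top M hf (isClosed_topologicalClosure _)
      (fun g hg => inv g fun x hx w => subset_span ⟨g * x, mul_mem hg hx, w, rfl⟩)
      (fun g hg => inv g fun x hx w => subset_span ⟨x, hx, g w, ?_⟩) ?_
    · have e1 := mem_commutant_iff.1 hg x hx
      have e2 := mem_commutant_iff.1 hg q hq
      have e1' := congrArg (fun A : B(H) => A (q w)) e1
      have e2' := congrArg (fun A : B(H) => A w) e2
      simp only [mul_apply] at e1' e2'
      rw [← e1', e2']
    · intro hbot
      apply hq0
      ext w
      have : q w ∈ U := le_topologicalClosure _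
        (subset_span ⟨1, one_mem M, w, rfl⟩)
      rw [hbot] at this
      exact this
  apply hp0
  have : U ≤ LinearMap.ker (p : H →ₗ[ℂ] H) := by
    refine topologicalClosure_minimal _ ?_ p.isClosed_ker
    rw [span_le]
    rintro _ ⟨x, hx, w, rfl⟩
    exact congrArg (fun A : B(H) => A w) (hcon x hx)
  ext w
  have h1 : w ∈ U := by rw [hU]; trivial
  exact this h1

/-- polar decomposition inside `M` -/
lemma polarM {y : B(H)} (hy : y ∈ M) : ∃ v ∈ M, v * star v * v = v ∧ y * (star v * v) = y ∧
    (∀ s, s * y = y → s * v = v) ∧ (∀ p, star p = p → y * p = y → v * p = v) := by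
  obtain ⟨c, hcs, hcc, hcn, hcS, hca, hcd⟩ := polar_aux y
  set a := star y * y with ha
  have haM : a ∈ M := mul_mem (star_mem hy) hy
  have hcM : ∀ n, c n ∈ M := hcS M.toStarSubalgebra (isClosed_vn M) haM
  obtain ⟨v, hv1, hv⟩ := exists_strong_limit_mono (T := fun n => y * c n) (C := 1) hcn
    (fun x n => ‖(y * c n) x‖ ^ 2) (fun x => ‖x‖ ^ 2)
    (fun x n => by
      have : ‖(y * c n) x‖ ≤ 1 * ‖x‖ := (le_opNorm _ _).trans (by
        gcongr; exact hcn n)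
      rw [one_mul] at this
      gcongr)
    (fun x n k hnk => by
      obtain ⟨d, hd⟩ := hcd n k hnk
      have := congrArg (fun A => qf A x) hd
      simp only [qf_add, qf_star_mul] at this
      rw [sub_apply] at this
      nlinarith [sq_nonneg ‖d x‖])
  have hvM : v ∈ M := mem_of_strong M (fun n => mul_mem hy (hcM n)) hv
  have hsv : ∀ s : B(H), s * y = y → s * v = v := fun s hs => by
    ext x
    refine tendsto_nhds_unique ((s.continuous.tendsto _).comp (hv x)) ((hv x).congr fun n => ?_)
    have : s * (y * c n) = y * c n := by rw [← mul_assoc, hs]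
    exact (congrArg (fun A : B(H) => A x) this).symm
  have hvp : ∀ p : B(H), star p = p → y * p = y → v * p = v := fun p hp hyp => by
    -- `p` commutes with `a`, and `y c_n p = y p c_n`
    have hap : a * p = a := by rw [ha, mul_assoc, hyp]
    have hpa : p * a = a := by
      have := congrArg star hap
      rwa [star_mul, hp, ha, star_mul, star_star, ← ha] at this
    have hcp : ∀ n, p * c n = c n * p := fun n => by
      have hcl : IsClosed (StarSubalgebra.centralizer ℂ ({p} : Set B(H)) :
          Set B(H)) := by
        have : (StarSubalgebra.centralizer ℂ ({p} : Set B(H)) : Set B(H)) =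
            {z | p * z = z * p} := by
          ext z
          simp only [mem_coe, mem_centralizer_iff, Set.mem_singleton_iff,
            forall_eq, hp, and_self, mem_setOf_eq]
        rw [this]
        exact isClosed_eq (by fun_prop) (by fun_prop)
      have := hcS _ hcl (by
        rw [mem_centralizer_iff]
        rintro g rfl
        rw [hp, hap, hpa]; exact ⟨rfl, rfl⟩) n
      rw [mem_centralizer_iff] at this
      exact (this p rfl).1
    ext x
    refine tendsto_nhds_unique (hv (p x)) ((hv x).congr fun n => ?_)
    have : y * c n * p = y * c n := by rw [mul_assoc, ← hcp, ← mul_assoc, hyp]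
    exact (congrArg (fun A : B(H) => A x) this).symm
  have hEs : star (star v * v) = star v * v := by rw [star_mul, star_star]
  have haE : a * (star v * v) = a := by
    refine ContinuousLinearMap.ext fun x => ext_inner_right ℂ fun z => ?_
    have h1 : inner ℂ ((a * (star v * v)) x) z = inner ℂ (v x) (v (a z)) := by
      have hs : star a = a := by rw [ha, star_mul, star_star]
      rw [mul_apply]
      conv_lhs => rw [← hs]
      rw [star_eq_adjoint, adjoint_inner_left,
        mul_apply, star_eq_adjoint,
        adjoint_inner_left]
    rw [h1]
    refine tendsto_nhds_unique ((hv x).inner (hv (a z))) ?_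
    have h2 : ∀ n, inner ℂ ((y * c n) x) ((y * c n) (a z)) =
        inner ℂ ((a * (c n * a * c n)) x) z := fun n => by
      have e : a * (c n * a * c n) = star a * (star (y * c n) * (y * c n)) := by
        have hs : star a = a := by rw [ha, star_mul, star_star]
        rw [hs, star_mul, hcs, ha]; simp only [mul_assoc]
      rw [e, inner_sm, inner_sm]
    have h3 : Tendsto (fun n => a * (c n * a * c n)) atTop (𝓝 a) := by
      rw [tendsto_iff_norm_sub_tendsto_zero]
      refine squeeze_zero (fun n => norm_nonneg _) (fun n => ?_)
        tendsto_one_div_add_atTop_nhds_zero_nat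
      rw [norm_sub_rev]; exact hca n
    have h4 : Tendsto (fun n => inner ℂ ((a * (c n * a * c n)) x) z) atTop
        (𝓝 (inner ℂ (a x) z)) := (((ContinuousLinearMap.apply ℂ H x).continuous.tendsto _).comp h3).inner
      (tendsto_const_nhds (x := z))
    exact h4.congr fun n => (h2 n).symm
  have hyE : y * (star v * v) = y := by
    have h1 : star (y - y * (star v * v)) * (y - y * (star v * v)) = 0 := by
      have e : star (y - y * (star v * v)) * (y - y * (star v * v)) =
          (a - a * (star v * v)) - (star v * v) * (a - a * (star v * v)) := by
        rw [ha, star_sub, star_mul y, hEs]; noncomm_ring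
      rw [e, haE, sub_self, mul_zero, sub_zero]
    have := (star_mul_self_eq_zero_iff _).1 h1
    exact (sub_eq_zero.1 this).symm
  exact ⟨v, hvM, by rw [mul_assoc]; exact hvp _ hEs hyE, hyE, hsv, hvp⟩
end SOT

section Comp
variable (M : VonNeumannAlgebra H)

structure PI (p s : B(H)) where
  v : B(H)
  mem : v ∈ M
  pi : v * (star v * v) = v
  vp : v * p = v
  sv : s * v = v

variable {M} in
lemma pi_e {v : B(H)} (h : v * (star v * v) = v) :
    (star v * v) * (star v * v) = star v * v := by rw [mul_assoc, h]

instance PI.preorder (p s : B(H)) : Preorder (PI M p s) where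
  le v w := w.v * (star v.v * v.v) = v.v ∧ (star w.v * w.v) * (star v.v * v.v) = star v.v * v.v
  le_refl v := ⟨v.pi, pi_e v.pi⟩
  le_trans a b c hab hbc := by
    constructor
    · rw [← hab.2, ← mul_assoc, hbc.1, hab.1]
    · nth_rewrite 1 [← hab.2]
      rw [← mul_assoc, hbc.2, hab.2]

lemma PI.bdd {p s : B(H)} (c : Set (PI M p s)) (hc : IsChain (· ≤ ·) c)
    (hne : c.Nonempty) : BddAbove c := by
  obtain ⟨y, hy⟩ := hne
  have : Nonempty c := ⟨⟨y, hy⟩⟩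
  have : IsDirectedOrder c := ⟨fun a b => by
    rcases hc.total a.2 b.2 with h | h
    · exact ⟨b, h, le_rfl⟩
    · exact ⟨a, le_rfl, h⟩⟩
  have hle : ∀ i j : c, i ≤ j → star i.1.v * j.1.v = star i.1.v * i.1.v := by
    intro i j hij
    have h1 : j.1.v * (star i.1.v * i.1.v) = i.1.v := hij.1
    have h2 : (star j.1.v * j.1.v) * (star i.1.v * i.1.v) = star i.1.v * i.1.v := hij.2
    have h3 := congrArg star h2
    simp only [star_mul, star_star] at h3
    nth_rewrite 1 [← h1]
    simp only [star_mul, star_star]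
    rw [mul_assoc]; exact h3
  have hle' : ∀ i j : c, i ≤ j → star j.1.v * i.1.v = star i.1.v * i.1.v := by
    intro i j hij
    have := congrArg star (hle i j hij)
    simpa only [star_mul, star_star] using this
  have hqf : ∀ i j : c, i ≤ j → star j.1.v * j.1.v = star i.1.v * i.1.v +
      star (j.1.v - i.1.v) * (j.1.v - i.1.v) := by
    intro i j hij
    rw [star_sub, sub_mul, mul_sub, mul_sub, hle i j hij, hle' i j hij]; abel
  have hn : ∀ i : c, ‖i.1.v‖ ≤ 1 := fun i => by
    have h1 : ‖star i.1.v * i.1.v‖ * ‖star i.1.v * i.1.v‖ = ‖star i.1.v * i.1.v‖ := by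
      rw [← norm_star_mul_self]
      congr 1
      simp only [star_mul, star_star]
      exact pi_e i.1.pi
    rw [norm_star_mul_self] at h1
    by_contra! hcon
    have : 1 < ‖i.1.v‖ * ‖i.1.v‖ := by nlinarith
    nlinarith
  obtain ⟨V, hV1, hV⟩ := exists_strong_limit_mono (T := fun i : c => i.1.v) (C := 1) hn
    (fun x i => ‖i.1.v x‖ ^ 2) (fun x => ‖x‖ ^ 2)
    (fun x i => by
      have : ‖i.1.v x‖ ≤ 1 * ‖x‖ := (le_opNorm _ _).trans (by
        gcongr; exact hn i)
      rw [one_mul] at this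
      gcongr)
    (fun x i j hij => by
      have := congrArg (fun A => qf A x) (hqf i j hij)
      simp only [qf_add, qf_star_mul] at this
      rw [sub_apply] at this
      linarith)
  have hVe : ∀ i : c, V * (star i.1.v * i.1.v) = i.1.v := fun i => by
    ext x
    refine tendsto_nhds_unique (hV _) (tendsto_const_nhds.congr' ?_)
    filter_upwards [eventually_ge_atTop i] with j hj
    exact (congrArg (fun A : B(H) => A x) hj.1).symm
  have hVVe : ∀ i : c, (star V * V) * (star i.1.v * i.1.v) = star i.1.v * i.1.v := fun i => by
    rw [mul_assoc, hVe]
    refine ContinuousLinearMap.ext fun x => ext_inner_right ℂ fun z => ?_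
    rw [inner_sm]
    refine tendsto_nhds_unique (tendsto_const_nhds.inner (hV z)) (tendsto_const_nhds.congr' ?_)
    filter_upwards [eventually_ge_atTop i] with j hj
    rw [← inner_sm, hle' i j hj]
  have hVp : V * (star V * V) = V := by
    ext x
    have h1 : Tendsto (fun i : c => (star V) (i.1.v x)) atTop (𝓝 ((star V) (V x))) :=
      ((star V).continuous.tendsto _).comp (hV x)
    have h2 : Tendsto (fun i : c => V ((star V) (i.1.v x))) atTop (𝓝 (V ((star V) (V x)))) :=
      (V.continuous.tendsto _).comp h1
    refine tendsto_nhds_unique h2 ((hV x).congr fun i => ?_)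
    have h3 : i.1.v = V * (star V * i.1.v) := by
      nth_rewrite 2 [← hVe i]
      rw [← mul_assoc (star V), hVVe, hVe]
    nth_rewrite 1 [h3]; rfl
  refine ⟨⟨V, mem_of_strong M (fun i : c => i.1.mem) hV, hVp, ?_, ?_⟩, ?_⟩
  · ext x
    refine tendsto_nhds_unique (hV (p x)) ((hV x).congr fun i => ?_)
    exact (congrArg (fun A : B(H) => A x) i.1.vp).symm
  · ext x
    refine tendsto_nhds_unique ((s.continuous.tendsto _).comp (hV x)) ((hV x).congr fun i => ?_)
    exact (congrArg (fun A : B(H) => A x) i.1.sv).symm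
  · intro i hi
    exact ⟨hVe ⟨i, hi⟩, hVVe ⟨i, hi⟩⟩

lemma exists_max_pi {p s : B(H)} (hp : p ∈ M) (hs : s ∈ M) (hps : star p = p)
    (hpp : p * p = p) (hss : star s = s) (hss2 : s * s = s) :
    ∃ v ∈ M, v * (star v * v) = v ∧ v * p = v ∧ s * v = v ∧
      ∀ x ∈ M, (s - v * star v) * x * (p - star v * v) = 0 := by
  have : Nonempty (PI M p s) := ⟨⟨0, zero_mem M, by simp, by simp, by simp⟩⟩
  obtain ⟨v, hv⟩ := zorn_le_nonempty (PI.bdd M (p := p) (s := s))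
  refine ⟨v.v, v.mem, v.pi, v.vp, v.sv, fun x hx => ?_⟩
  by_contra hne
  obtain ⟨v, hvM, hpi, hvp, hsv⟩ := v
  simp only at hne
  set p' := p - star v * v with hp'
  set s' := s - v * star v with hs'
  have hpv : p * star v = star v := by
    have := congrArg star hvp; rwa [star_mul, hps] at this
  have hvs : star v * s = star v := by
    have := congrArg star hsv; rwa [star_mul, hss] at this
  have hvp' : v * p' = 0 := by rw [hp', mul_sub, hvp, hpi, sub_self]
  have hsv' : s' * v = 0 := by rw [hs', sub_mul, hsv, mul_assoc, hpi, sub_self]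
  have hpi' : star v * v * star v = star v := by
    have := congrArg star hpi; simpa only [star_mul, star_star] using this
  have hp'p : p' * p' = p' := by
    rw [hp', sub_mul, mul_sub, hpp, mul_sub, mul_assoc (star v) v p, hvp, ← mul_assoc p, hpv,
      pi_e hpi]; abel
  have hs's : s' * s' = s' := by
    have : v * star v * (v * star v) = v * star v := by rw [mul_assoc, ← mul_assoc (star v), hpi']
    rw [hs', sub_mul, mul_sub, hss2, mul_sub, mul_assoc v _ s, hvs, ← mul_assoc s, hsv, this]; abel
  have hp's : star p' = p' := by rw [hp', star_sub, hps, star_mul, star_star]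
  have hp'M : p' ∈ M := sub_mem hp (mul_mem (star_mem hvM) hvM)
  have hs'M : s' ∈ M := sub_mem hs (mul_mem hvM (star_mem hvM))
  obtain ⟨w, hwM, hww, hyw, hws, hwp⟩ := polarM M (mul_mem (mul_mem hs'M hx) hp'M)
  have hwp' : w * p' = w := hwp p' hp's (by rw [mul_assoc, hp'p])
  have hws' : s' * w = w := hws s' (by rw [← mul_assoc, ← mul_assoc, hs's])
  have hvw : v * star w = 0 := by
    rw [← hwp', star_mul, hp's, ← mul_assoc, hvp', zero_mul]
  have hsq : star s' = s' := by rw [hs', star_sub, hss, star_mul, star_star]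
  have hvw' : star v * w = 0 := by
    have := congrArg star hsv'
    rw [star_mul, hsq, star_zero] at this
    rw [← hws', ← mul_assoc, this, zero_mul]
  have hwv : w * star v = 0 := by have := congrArg star hvw; simpa using this
  have hwv' : star w * v = 0 := by have := congrArg star hvw'; simpa using this
  have he : star (v + w) * (v + w) = star v * v + star w * w := by
    rw [star_add, add_mul, mul_add, mul_add, hvw', hwv']; abel
  have hpe : (v + w) * (star (v + w) * (v + w)) = v + w := by
    rw [he, add_mul, mul_add, mul_add, hpi, ← mul_assoc v, hvw, ← mul_assoc w, hwv,
      ← mul_assoc w, hww]; simp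
  have h1 : (⟨v, hvM, hpi, hvp, hsv⟩ : PI M p s) ≤ ⟨v + w, add_mem hvM hwM, hpe, by
      have : w * p = w := by
        conv_lhs => rw [← hwp', hp', mul_sub, sub_mul, mul_assoc, hpp]
        rw [mul_assoc, mul_assoc (star v), hvp, ← mul_sub, ← hp', hwp']
      rw [add_mul, hvp, this], by
      have : s * w = w := by
        conv_lhs => rw [← hws', hs', sub_mul, mul_sub, ← mul_assoc, hss2]
        rw [← mul_assoc, ← mul_assoc, hsv, ← sub_mul, ← hs', hws']
      rw [mul_add, hsv, this]⟩ := by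
    refine ⟨?_, ?_⟩
    · show (v + w) * (star v * v) = v
      rw [add_mul, hpi, ← mul_assoc w, hwv]; simp
    · show (star (v + w) * (v + w)) * (star v * v) = star v * v
      rw [he, add_mul, pi_e hpi, mul_assoc (star w), ← mul_assoc w, hwv]; simp
  have h2 : v * (star (v + w) * (v + w)) = v + w := (hv h1).1
  rw [he, mul_add, hpi, ← mul_assoc, hvw, zero_mul, add_zero] at h2
  have hw0 : w = 0 := by simpa using h2.symm
  rw [hw0] at hyw
  simp at hyw
  exact hne hyw.symm
end Comp

section
/-- bounded completeness -/
def CB (s : Std Al K) : Prop :=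
  ∀ (x : ℕ → Al) (C : ℝ), (∀ k, ‖x k‖ ≤ C) → CauchySeq (fun k => s.j (x k)) →
    ∃ y, ‖y‖ ≤ C ∧ Tendsto (fun k => s.j (x k)) atTop (𝓝 (s.j y))

instance isClosedVN (M : VonNeumannAlgebra H) :
    IsClosed (M.toStarSubalgebra : Set B(H)) := isClosed_vn M

/-- the algebra as a type -/
abbrev MM (M : VonNeumannAlgebra H) : Type := ↥M.toStarSubalgebra

instance cstarMM (M : VonNeumannAlgebra H) : CStarAlgebra (MM M) :=
  StarSubalgebra.cstarAlgebra M.toStarSubalgebra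

section
variable {M : VonNeumannAlgebra H} (s : Std (MM M) K)

lemma re_τ_star_mul {Al : Type} [CStarAlgebra Al] (s : Std Al K) (x : Al) :
    (s.τ (star x * x)).re = ‖s.j x‖ ^ 2 := by
  rw [s.τ_star_mul, inner_selfC]; norm_cast

lemma re_τ_proj {Al : Type} [CStarAlgebra Al] (s : Std Al K) (x : Al) (h1 : star x = x)
    (h2 : x * x = x) : (s.τ x).re = ‖s.j x‖ ^ 2 := by
  rw [← re_τ_star_mul, h1, h2]

lemma τ_mono {a b : MM M} (h : (a : B(H)) ≤ b) : (s.τ a).re ≤ (s.τ b).re := by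
  obtain ⟨g, hg, hgs, hgg⟩ := exists_sqrt M (sub_mem b.2 a.2) (sub_nonneg.2 h)
  have h1 : b - a = star (⟨g, hg⟩ : MM M) * ⟨g, hg⟩ := by
    ext1
    show (b : B(H)) - a = star g * g
    rw [hgs, hgg]
  have h2 := re_τ_star_mul s (⟨g, hg⟩ : MM M)
  rw [← h1, s.τ_sub] at h2
  have := sq_nonneg ‖s.j (⟨g, hg⟩ : MM M)‖
  simp only [sub_re] at h2
  linarith

lemma comparability (hf : IsFactorSet (M : Set B(H))) {p q : MM M}
    (hp : star p = p) (hpp : p * p = p) (hq : star q = q) (hqq : q * q = q)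
    (h : ‖s.j p‖ ≤ ‖s.j q‖) : ∃ v : MM M, star v * v = p ∧ q * v = v := by
  obtain ⟨v, hvM, h1, h2, h3, h4⟩ := exists_max_pi M p.2 q.2 (val_eq hp)
    (val_eq hpp) (val_eq hq) (val_eq hqq)
  set V : MM M := ⟨v, hvM⟩
  have h1' : V * (star V * V) = V := Subtype.ext h1
  have h2' : V * p = V := Subtype.ext h2
  have h3' : q * V = V := Subtype.ext h3
  refine ⟨V, ?_, h3'⟩
  by_contra hne
  have hpv : p * star V = star V := by
    have := congrArg star h2'; rwa [star_mul, hp] at this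
  have hvs : star V * q = star V := by
    have := congrArg star h3'; rwa [star_mul, hq] at this
  have hpe : p * (star V * V) = star V * V := by rw [← mul_assoc, hpv]
  have hp0 : p - star V * V ≠ 0 := fun h => hne (sub_eq_zero.1 h).symm
  have hq0 : q - V * star V ≠ 0 := by
    intro h0
    have e1 : (s.τ q).re = (s.τ (star V * V)).re := by
      rw [s.τ_mul_comm, sub_eq_zero.1 h0]
    have e2 : (s.τ (star (p - star V * V) * (p - star V * V))).re =
        (s.τ p).re - (s.τ (star V * V)).re := by
      rw [← sub_re, ← s.τ_sub]
      congr 2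
      have : star V * V * p = star V * V := by rw [mul_assoc, h2']
      have e3 : star V * V * (star V * V) = star V * V := by rw [mul_assoc, h1']
      rw [star_sub, hp, star_mul, star_star, sub_mul, mul_sub, mul_sub, hpp, hpe, this, e3]; abel
    rw [re_τ_star_mul, re_τ_proj s p hp hpp, ← e1, re_τ_proj s q hq hqq] at e2
    have h5 : ‖s.j (p - star V * V)‖ ^ 2 ≤ 0 := by
      rw [e2]; have : ‖s.j p‖ ^ 2 ≤ ‖s.j q‖ ^ 2 := by gcongr
      linarith
    have h6 : ‖s.j (p - star V * V)‖ = 0 := by nlinarith [norm_nonneg (s.j (p - star V * V))]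
    exact hp0 (s.inj _ (norm_eq_zero.1 h6))
  obtain ⟨x, hx, hx0⟩ := factor_ne M hf (p := ((q - V * star V : MM M) : B(H)))
    (q := ((p - star V * V : MM M) : B(H))) (Subtype.mem _)
    (fun h => hq0 (Subtype.ext h)) (fun h => hp0 (Subtype.ext h))
  exact hx0 (h4 x hx)

/-- the ideal of elements for which strong convergence implies 2-norm convergence -/
def Jset (m : MM M) : Prop := ∀ (l : Filter (MM M)) (C : ℝ), (∀ᶠ x in l, ‖x‖ ≤ C) →
  (∀ η, Tendsto (fun x : MM M => (x : B(H)) η) l (𝓝 0)) →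
  Tendsto (fun x => s.j (x * m)) l (𝓝 0)

lemma Jset.mul_right {m : MM M} (h : Jset s m) (n : MM M) : Jset s (m * n) := by
  intro l C h1 h2
  have := ((s.R n).continuous.tendsto _).comp (h l C h1 h2)
  rw [map_zero] at this
  exact this.congr fun x => by simp [mul_assoc]

lemma Jset.mul_left {m : MM M} (h : Jset s m) (n : MM M) : Jset s (n * m) := by
  intro l C h1 h2
  have := h (map (fun x => x * n) l) (C * ‖n‖) (by
      rw [eventually_map]
      filter_upwards [h1] with x hx
      exact (norm_mul_le _ _).trans (by gcongr)) (fun η => by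
      rw [tendsto_map'_iff]
      exact h2 ((n : B(H)) η))
  rw [tendsto_map'_iff] at this
  exact this.congr fun x => by simp [mul_assoc]

lemma Jset.add {m n : MM M} (h : Jset s m) (h' : Jset s n) : Jset s (m + n) := by
  intro l C h1 h2
  have := (h l C h1 h2).add (h' l C h1 h2)
  rw [add_zero] at this
  exact this.congr fun x => by simp [mul_add]

lemma exists_ne_zero_vec (s : Std (MM M) K) : ∃ ξ : H, ξ ≠ 0 := by
  by_contra! hcon
  have : (1 : MM M) = 0 := by
    ext x; rw [hcon x]; simp
  have h := s.norm_one
  rw [this] at h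
  simp at h

lemma qf_conj {h x : B(H)} (ξ : H) : qf (star (x * h) * (x * h)) ξ = ‖x (h ξ)‖ ^ 2 := by
  rw [qf_star_mul]; rfl

/-- common step for the two domination arguments -/
lemma dom_step (P : B(H) → Prop) {b : B(H)} (hb : b ∈ M) (hb0 : 0 ≤ b) (hb1 : b ≤ 1)
    (hmax : ∀ b' ∈ M, b ≤ b' → b' ≤ 1 → P b' → b' = b) :
    ∃ h : B(H), h ∈ M ∧ star h = h ∧ h * h = 1 - b ∧ ∀ x ∈ M, ‖x‖ ≤ 1 →
      P (b + star (x * h) * (x * h)) → x * h = 0 := by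
  obtain ⟨h, hM, hs, hh⟩ := exists_sqrt M (sub_mem (one_mem M) hb) (sub_nonneg.2 hb1)
  refine ⟨h, hM, hs, hh, fun x hxM hx hP => ?_⟩
  have h1 : (0 : B(H)) ≤ star (x * h) * (x * h) := star_mul_self_nonneg (x * h)
  have h2 := hmax _ (add_mem hb (mul_mem (star_mem (mul_mem hxM hM)) (mul_mem hxM hM)))
    (le_add_of_nonneg_right h1) (by
      rw [add_comm, ← le_sub_iff_add_le, ← hh]
      refine le_of_qf (fun η => ?_) (star_of_nonneg h1) (by rw [star_mul, hs])
      have e2 : qf (h * h) η = ‖h η‖ ^ 2 := by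
        nth_rewrite 1 [← hs]; exact qf_star_mul h η
      rw [qf_conj, e2]
      have : ‖x (h η)‖ ≤ 1 * ‖h η‖ :=
        (le_opNorm _ _).trans (by gcongr)
      rw [one_mul] at this
      gcongr) hP
  have h3 : star (x * h) * (x * h) = 0 := by simpa using h2
  exact (star_mul_self_eq_zero_iff _).1 h3

lemma homog (h : MM M) (ξ : H) (c d : ℝ) (hx : ∀ x : MM M, ‖x‖ ≤ 1 →
    c * ‖s.j (x * h)‖ ^ 2 ≤ d * ‖(x : B(H)) ξ‖ ^ 2) (x : MM M) :
    c * ‖s.j (x * h)‖ ^ 2 ≤ d * ‖(x : B(H)) ξ‖ ^ 2 := by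
  by_cases h0 : x = 0
  · simp [h0]
  have hn : 0 < ‖x‖ := norm_pos_iff.2 h0
  have := hx (((‖x‖⁻¹ : ℝ) : ℂ) • x) (by
    rw [norm_smul, norm_real, norm_inv, norm_norm, inv_mul_cancel₀ hn.ne'])
  rw [smul_mul_assoc, map_smul, norm_smul] at this
  have e : ‖(((((‖x‖⁻¹ : ℝ) : ℂ) • x : MM M)) : B(H)) ξ‖ = ‖x‖⁻¹ * ‖(x : B(H)) ξ‖ := by
    show ‖(((‖x‖⁻¹ : ℝ) : ℂ) • (x : B(H)) ξ)‖ = _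
    rw [norm_smul]; simp
  rw [e] at this
  simp only [norm_real, norm_inv, norm_norm, mul_pow] at this
  have hp : 0 < (‖x‖⁻¹) ^ 2 := by positivity
  nlinarith

lemma exists_J : ∃ h : MM M, h ≠ 0 ∧ star h = h ∧ Jset s h := by
  obtain ⟨ξ, hξ⟩ := exists_ne_zero_vec s
  have hξ' : 0 < ‖ξ‖ ^ 2 := by positivity
  set c := 2 / ‖ξ‖ ^ 2 with hc
  obtain ⟨b, hb, hb0, hb1, ⟨hbM, hPb⟩, hmax⟩ := zorn_contraction M
    (fun b => ∃ hb : b ∈ M, c * qf b ξ ≤ (s.τ ⟨b, hb⟩).re) ⟨zero_mem M, by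
      rw [qf_zero, mul_zero, show (⟨0, zero_mem M⟩ : MM M) = 0 from rfl]; simp [Std.τ]⟩
    (by
      intro α _ _ _ T S hT hT0 hT1 hP hS hi hS0 hS1 hl
      refine ⟨hS, ?_⟩
      refine le_of_tendsto ((qf_tendsto hl ξ).const_mul c) (.of_forall fun i => ?_)
      obtain ⟨h1, h2⟩ := hP i
      exact h2.trans (τ_mono s (hi i)))
  obtain ⟨h', hM, hs', hh, hmain⟩ := dom_step _ hb hb0 hb1 hmax
  set h : MM M := ⟨h', hM⟩ with hhdef
  have hs : star h = h := Subtype.ext hs'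
  refine ⟨h, ?_, hs, ?_⟩
  · intro h0
    have h0' : h' = 0 := val_eq h0
    rw [h0', mul_zero] at hh
    have : b = 1 := by
      exact (sub_eq_zero.1 hh.symm).symm
    subst this
    rw [show (⟨1, hbM⟩ : MM M) = 1 from rfl, s.τ_one, qf_one, hc, div_mul_cancel₀ _ hξ'.ne'] at hPb
    norm_num at hPb
  · have key := homog s h ((h : B(H)) ξ) 1 c (fun x hx => by
      by_contra! hcon
      have h1' := hmain x x.2 hx ⟨add_mem hb (mul_mem (star_mem (mul_mem x.2 hM)) (mul_mem x.2 hM)), by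
        have e : (⟨b + star ((x : B(H)) * h') * ((x : B(H)) * h'),
          add_mem hb (mul_mem (star_mem (mul_mem x.2 hM)) (mul_mem x.2 hM))⟩ : MM M) =
            (⟨b, hb⟩ : MM M) + star (x * h) * (x * h) := rfl
        rw [e, s.τ_add, add_re, re_τ_star_mul, qf_add]
        have e2 : qf (star ((x : B(H)) * h') * ((x : B(H)) * h')) ξ =
          ‖(x : B(H)) (h' ξ)‖ ^ 2 := qf_conj ξ
        rw [e2]
        have hcon' := hcon
        simp only [hhdef] at hcon' ⊢
        linarith⟩
      have h1 : x * h = 0 := Subtype.ext h1'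
      rw [h1] at hcon
      simp only [map_zero, norm_zero] at hcon
      have : 0 ≤ c * ‖(x : B(H)) ((h : B(H)) ξ)‖ ^ 2 := by positivity
      norm_num at hcon
      linarith)
    intro l C h1 h2
    rw [tendsto_zero_iff_norm_tendsto_zero]
    have h3 : Tendsto (fun x : MM M => √(c * ‖(x : B(H)) ((h : B(H)) ξ)‖ ^ 2)) l
        (𝓝 0) := by
      have := (((h2 ((h : B(H)) ξ)).norm.pow 2).const_mul c).sqrt
      simpa using this
    refine squeeze_zero (fun _ => norm_nonneg _) (fun x => ?_) h3
    refine Real.le_sqrt_of_sq_le ?_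
    simpa using key x

lemma J_one (hf : IsFactorSet (M : Set B(H))) : Jset s (1 : MM M) := by
  obtain ⟨S, hSM, hpos, hS0, hJ2⟩ : ∃ (S : B(H)) (hS : S ∈ M), 0 ≤ S ∧ S ≠ 0 ∧
      Jset s ⟨S, hS⟩ := by
    obtain ⟨h, h0, hs, hJ⟩ := exists_J s
    refine ⟨star (h : B(H)) * h, mul_mem (star_mem h.2) h.2, star_mul_self_nonneg _,
      fun e => h0 (Subtype.ext ((star_mul_self_eq_zero_iff _).1 e)), ?_⟩
    exact hJ.mul_left s (star h)
  have hn : 0 < ‖S‖ := norm_pos_iff.2 hS0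
  obtain ⟨E, k, hEs, hEE, hEc, hkc, hSk, hSE, -⟩ := spectral_proj S hpos (‖S‖ / 2) (by positivity)
  have memM : ∀ E : B(H), (∀ X, Commute S X → Commute E X) → E ∈ M := fun E hE => by
    rw [← M.commutant_commutant, mem_commutant_iff]
    intro g hg
    exact ((hE g (mem_commutant_iff.1 hg _ hSM)).eq).symm
  set q : MM M := ⟨E, memM E hEc⟩ with hq
  have hqs : star q = q := Subtype.ext hEs
  have hqq : q * q = q := Subtype.ext hEE
  have hqJ : Jset s q := by
    have : q = (⟨S, hSM⟩ : MM M) * ((⟨k, memM k hkc⟩ : MM M) * q) := by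
      rw [← mul_assoc]; exact Subtype.ext hSk.symm
    rw [this]; exact hJ2.mul_right s _
  have hq0 : q ≠ 0 := by
    intro e
    have e' : E = 0 := val_eq e
    rw [e', sub_zero, mul_one] at hSE
    linarith
  have hjq : 0 < ‖s.j q‖ := norm_pos_iff.2 fun e => hq0 (s.inj _ e)
  have sand : ∀ v : MM M, q * v = v → Jset s (star v * v) := fun v hv => by
    have e : star v * v = star v * (q * v) := by rw [hv]
    rw [e]
    exact (hqJ.mul_right s v).mul_left s (star v)
  have ind : ∀ n : ℕ, ∀ p : MM M, star p = p → p * p = p → ‖s.j p‖ ^ 2 ≤ n * ‖s.j q‖ ^ 2 →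
      Jset s p := by
    intro n
    induction n with
    | zero =>
      intro p hp hpp hle
      have h1 : ‖s.j p‖ = 0 := by
        have := norm_nonneg (s.j p)
        rw [Nat.cast_zero, zero_mul] at hle
        nlinarith
      rw [s.inj p (norm_eq_zero.1 h1)]
      intro l C _ _
      simp only [mul_zero, map_zero]
      exact tendsto_const_nhds
    | succ n ih =>
      intro p hp hpp hle
      rcases le_total ‖s.j p‖ ‖s.j q‖ with h1 | h1
      · obtain ⟨v, hv, hqv⟩ := comparability s hf hp hpp hqs hqq h1
        rw [← hv]; exact sand v hqv
      · obtain ⟨v, hv, hqv⟩ := comparability s hf hqs hqq hp hpp h1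
        have hvq : v * q = v := by
          have e1 : star (v - v * q) * (v - v * q) = 0 := by
            have : star (v - v * q) * (v - v * q) = star v * v - star v * v * q - q * (star v * v)
              + q * (star v * v) * q := by
              rw [star_sub, star_mul, hqs]; noncomm_ring
            rw [this, hv, hqq, hqq]; abel
          exact (sub_eq_zero.1 ((star_mul_self_eq_zero_iff _).1 e1)).symm
        have hJv : Jset s (v * star v) := by
          nth_rewrite 1 [← hvq]; exact (hqJ.mul_left s v).mul_right s _
        have hvp : star v * p = star v := by
          have := congrArg star hqv; rwa [star_mul, hp] at this
        have hvv : v * star v * (v * star v) = v * star v := by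
          rw [mul_assoc, ← mul_assoc (star v), hv, ← mul_assoc, hvq]
        have e1 : star (p - v * star v) = p - v * star v := by
          rw [star_sub, hp, star_mul, star_star]
        have e2 : (p - v * star v) * (p - v * star v) = p - v * star v := by
          rw [sub_mul, mul_sub, mul_sub, hpp, hvv, mul_assoc v _ p, hvp, ← mul_assoc p, hqv]; abel
        have e3 : ‖s.j (p - v * star v)‖ ^ 2 = ‖s.j p‖ ^ 2 - ‖s.j q‖ ^ 2 := by
          rw [← re_τ_proj s _ e1 e2, ← re_τ_proj s _ hp hpp, ← re_τ_proj s _ hqs hqq, s.τ_sub,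
            s.τ_mul_comm v, hv, sub_re]
        have := (ih _ e1 e2 (by rw [e3]; push_cast at hle; linarith)).add s hJv
        simpa using this
  obtain ⟨n, hn⟩ := exists_nat_gt (1 / ‖s.j q‖ ^ 2)
  refine ind n 1 (star_one _) (one_mul _) ?_
  rw [s.norm_one]
  rw [div_lt_iff₀ (by positivity)] at hn
  linarith

lemma sot2 (hf : IsFactorSet (M : Set B(H))) {α : Type} {l : Filter α} {x : α → MM M}
    {C : ℝ} (h1 : ∀ i, ‖x i‖ ≤ C)
    (h2 : ∀ η, Tendsto (fun i => (x i : B(H)) η) l (𝓝 0)) :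
    Tendsto (fun i => s.j (x i)) l (𝓝 0) := by
  have := J_one s hf (map x l) C (by rw [eventually_map]; exact .of_forall h1)
    (fun η => by rw [tendsto_map'_iff]; exact h2 η)
  rw [tendsto_map'_iff] at this
  exact this.congr fun i => by simp

lemma exists_dom (hf : IsFactorSet (M : Set B(H))) : ∃ η : H, η ≠ 0 ∧ ∃ C : ℝ,
    ∀ x : MM M, ‖(x : B(H)) η‖ ^ 2 ≤ C * ‖s.j x‖ ^ 2 := by
  obtain ⟨ξ, hξ⟩ := exists_ne_zero_vec s
  have hstep : ∀ n : ℕ, ∃ b : MM M, (n + 1 : ℝ) * (s.τ b).re ≤ ‖ξ‖ ^ 2 ∧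
      (0 : B(H)) ≤ b ∧ ∃ h : MM M, star h = h ∧ (h : B(H)) * h = 1 - b ∧
      ∀ x : MM M, ‖(x : B(H)) ((h : B(H)) ξ)‖ ^ 2 ≤ (n + 1) * ‖s.j (x * h)‖ ^ 2 := by
    intro n
    set c : ℝ := n + 1 with hc
    have hcpos : 0 < c := by positivity
    obtain ⟨b, hb, hb0, hb1, ⟨hbM, hPb⟩, hmax⟩ := zorn_contraction M
      (fun b => ∃ hb : b ∈ M, c * (s.τ ⟨b, hb⟩).re ≤ qf b ξ) ⟨zero_mem M, by
        rw [qf_zero, show (⟨0, zero_mem M⟩ : MM M) = 0 from rfl]; simp [Std.τ]⟩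
      (by
        intro α _ _ _ T S hT hT0 hT1 hP hS hi hS0 hS1 hl
        refine ⟨hS, ?_⟩
        have h1 : Tendsto (fun i => s.j ((⟨T i, hT i⟩ : MM M) - ⟨S, hS⟩)) atTop (𝓝 0) := by
          refine sot2 s hf (C := 1 + 1) (fun i => ?_) (fun η => ?_)
          · refine (norm_sub_le _ _).trans (add_le_add ?_ ?_)
            · exact (mem_Icc_iff_norm_le_one.1 ⟨hT0 i, hT1 i⟩).2
            · exact (mem_Icc_iff_norm_le_one.1 ⟨hS0, hS1⟩).2
          · have := (hl η).sub_const (S η)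
            rw [sub_self] at this
            exact this
        have h2 : Tendsto (fun i => (s.τ (⟨T i, hT i⟩ : MM M)).re) atTop
            (𝓝 (s.τ (⟨S, hS⟩ : MM M)).re) := by
          have h3 : Tendsto (fun i => s.τ (⟨T i, hT i⟩ : MM M)) atTop
              (𝓝 (s.τ (⟨S, hS⟩ : MM M))) := by
            have h4 : Tendsto (fun i => inner ℂ (s.j 1) (s.j ((⟨T i, hT i⟩ : MM M) - ⟨S, hS⟩)))
              atTop (𝓝 (inner ℂ (s.j 1) 0)) := tendsto_const_nhds.inner h1
            rw [inner_zero_right] at h4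
            have h5 := h4.add_const (s.τ (⟨S, hS⟩ : MM M))
            rw [zero_add] at h5
            refine h5.congr fun i => ?_
            show s.τ _ + _ = _
            rw [s.τ_sub]; ring
          exact (continuous_re.tendsto _).comp h3
        refine le_of_tendsto_of_tendsto (h2.const_mul c) (qf_tendsto hl ξ)
          (.of_forall fun i => ?_)
        obtain ⟨h1, h2⟩ := hP i
        exact h2)
    obtain ⟨h', hM, hs', hh, hmain⟩ := dom_step _ hb hb0 hb1 hmax
    set h : MM M := ⟨h', hM⟩ with hhdef
    have hs : star h = h := Subtype.ext hs'
    refine ⟨⟨b, hb⟩, hPb.trans ((qf_mono hb1 ξ).trans (qf_one ξ).le), hb0, h, hs, hh, fun x => ?_⟩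
    have key := homog s h ((h : B(H)) ξ) (-c) (-1) (fun x hx => by
      by_contra! hcon
      have h1' := hmain x x.2 hx ⟨add_mem hb (mul_mem (star_mem (mul_mem x.2 hM)) (mul_mem x.2 hM)), by
        have e : (⟨b + star ((x : B(H)) * h') * ((x : B(H)) * h'),
          add_mem hb (mul_mem (star_mem (mul_mem x.2 hM)) (mul_mem x.2 hM))⟩ : MM M) =
            (⟨b, hb⟩ : MM M) + star (x * h) * (x * h) := rfl
        rw [e, s.τ_add, add_re, re_τ_star_mul, qf_add]
        have e2 : qf (star ((x : B(H)) * h') * ((x : B(H)) * h')) ξ =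
          ‖(x : B(H)) (h' ξ)‖ ^ 2 := qf_conj ξ
        rw [e2]
        have hcon' := hcon
        simp only [hhdef] at hcon' ⊢
        linarith⟩
      have h1 : x * h = 0 := Subtype.ext h1'
      have h2 : (x : B(H)) ((h : B(H)) ξ) = 0 :=
        congrArg (fun A : MM M => (A : B(H)) ξ) h1
      rw [h1, h2] at hcon
      simp at hcon) x
    linarith
  choose b hb1 hb0 h hs hh hx using hstep
  by_cases hcase : ∃ n, (h n : B(H)) ξ ≠ 0
  · obtain ⟨n, hn⟩ := hcase
    refine ⟨_, hn, (n + 1) * ‖h n‖ ^ 2, fun x => (hx n x).trans ?_⟩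
    have := s.nj_mul' x (h n)
    calc (n + 1 : ℝ) * ‖s.j (x * h n)‖ ^ 2 ≤ (n + 1) * (‖s.j x‖ * ‖h n‖) ^ 2 := by gcongr
      _ = _ := by ring
  · exfalso
    push Not at hcase
    let U : Submodule ℂ H := ⨅ n, LinearMap.ker ((1 - (b n : B(H)) : B(H)) : H →ₗ[ℂ] H)
    have memU : ∀ v, v ∈ U ↔ ∀ n, (b n : B(H)) v = v := fun v => by
      simp only [U, Submodule.mem_iInf, LinearMap.mem_ker]
      refine forall_congr' fun n => ?_
      show v - (b n : B(H)) v = 0 ↔ _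
      rw [sub_eq_zero, eq_comm]
    have hcl : IsClosed (U : Set H) := by
      have : (U : Set H) = ⋂ n, {v | (b n : B(H)) v = v} := by
        ext v; simp [memU]
      rw [this]
      exact isClosed_iInter fun n => isClosed_eq (by fun_prop) continuous_id
    have : CompleteSpace U := hcl.completeSpace_coe
    have hpM : U.starProjection ∈ M := proj_mem M (fun g hg x hx => by
      rw [memU] at hx ⊢
      intro n
      have := congrArg (fun A : B(H) => A x) (mem_commutant_iff.1 hg _ (b n).2)
      simp only [mul_apply] at this
      rw [this, hx n])
    have hEs : IsStarProjection U.starProjection := isStarProjection_starProjection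
    set p := U.starProjection with hp
    have hps : star p = p := hEs.isSelfAdjoint.star_eq
    have hpp : p * p = p := hEs.isIdempotentElem
    have hbp : ∀ n, (b n : B(H)) * p = p := fun n => by
      ext v; exact (memU _).1 (starProjection_apply_mem U v) n
    have hpb : ∀ n, p * (b n : B(H)) = p := fun n => by
      have := congrArg star (hbp n)
      rwa [star_mul, hps, star_of_nonneg (hb0 n)] at this
    have hle : ∀ n, p ≤ (b n : B(H)) := fun n => by
      rw [← sub_nonneg]
      have : (b n : B(H)) - p = star (1 - p) * (b n : B(H)) * (1 - p) := by
        rw [star_sub, hps, star_one, sub_mul, one_mul, hpb, mul_sub, mul_one, sub_mul, hbp, hpp]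
        abel
      rw [this]
      exact star_left_conjugate_nonneg (hb0 n) _
    have hps' : star (⟨p, hpM⟩ : MM M) = ⟨p, hpM⟩ := Subtype.ext hps
    have hpp' : (⟨p, hpM⟩ : MM M) * ⟨p, hpM⟩ = ⟨p, hpM⟩ := Subtype.ext hpp
    have hτ : ∀ n : ℕ, (n + 1 : ℝ) * ‖s.j (⟨p, hpM⟩ : MM M)‖ ^ 2 ≤ ‖ξ‖ ^ 2 := fun n => by
      refine le_trans ?_ (hb1 n)
      gcongr
      rw [← re_τ_proj s _ hps' hpp']
      exact τ_mono s (hle n)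
    have h0 : ‖s.j (⟨p, hpM⟩ : MM M)‖ = 0 := by
      by_contra hne
      have hpos : 0 < ‖s.j (⟨p, hpM⟩ : MM M)‖ ^ 2 := by positivity
      obtain ⟨n, hn⟩ := exists_nat_gt (‖ξ‖ ^ 2 / ‖s.j (⟨p, hpM⟩ : MM M)‖ ^ 2)
      rw [div_lt_iff₀ hpos] at hn
      have := hτ n
      nlinarith
    have hp0 : p = 0 := val_eq (s.inj _ (norm_eq_zero.1 h0))
    have hξU : ξ ∈ U := (memU _).2 fun n => by
      have := congrArg (fun A : B(H) => A ξ) (hh n)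
      simp only [mul_apply, hcase n, map_zero] at this
      exact (sub_eq_zero.1 this.symm).symm
    apply hξ
    rw [← starProjection_eq_self_iff.2 hξU, ← hp, hp0]; rfl

lemma two_sot (hf : IsFactorSet (M : Set B(H))) {α : Type} {l : Filter α} {x : α → MM M}
    {C : ℝ} (h1 : ∀ i, ‖x i‖ ≤ C) (h2 : Tendsto (fun i => s.j (x i)) l (𝓝 0)) (η : H) :
    Tendsto (fun i => (x i : B(H)) η) l (𝓝 0) := by
  let U : Submodule ℂ H :=
    { carrier := {η | ∀ y : α → MM M, (∃ C, ∀ i, ‖y i‖ ≤ C) →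
        Tendsto (fun i => s.j (y i)) l (𝓝 0) → Tendsto (fun i => (y i : B(H)) η) l (𝓝 0)}
      add_mem' := fun ha hb y hy hy' => by
        have := (ha y hy hy').add (hb y hy hy')
        simpa using this
      zero_mem' := fun y hy hy' => by simp only [map_zero]; exact tendsto_const_nhds
      smul_mem' := fun c a ha y hy hy' => by
        have := (ha y hy hy').const_smul c
        simpa using this }
  have hcl : IsClosed (U : Set H) := by
    refine isClosed_of_closure_subset fun v hv y hy hy' => ?_
    obtain ⟨C, hC⟩ := hy
    rw [tendsto_zero_iff_norm_tendsto_zero, Metric.tendsto_nhds]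
    intro ε hε
    have hC0 : 0 < |C| + 1 := by positivity
    obtain ⟨w, hw, hvw⟩ := Metric.mem_closure_iff.1 hv (ε / 2 / (|C| + 1)) (by positivity)
    have h3 := hw y ⟨C, hC⟩ hy'
    rw [tendsto_zero_iff_norm_tendsto_zero, Metric.tendsto_nhds] at h3
    filter_upwards [h3 (ε / 2) (by positivity)] with i hi
    rw [Real.dist_eq, sub_zero, abs_norm] at hi ⊢
    have e : (y i : B(H)) v = (y i : B(H)) (v - w) + (y i : B(H)) w := by
      rw [map_sub]; abel
    have h4 : ‖(y i : B(H)) (v - w)‖ ≤ (|C| + 1) * (ε / 2 / (|C| + 1)) := by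
      refine (le_opNorm _ _).trans ?_
      have h5 : ‖(y i : B(H))‖ ≤ |C| + 1 := (hC i).trans (by linarith [le_abs_self C])
      have h6 : ‖v - w‖ ≤ ε / 2 / (|C| + 1) := by rw [← dist_eq_norm]; exact hvw.le
      exact mul_le_mul h5 h6 (norm_nonneg _) (by positivity)
    rw [mul_div_cancel₀ _ hC0.ne'] at h4
    rw [e]
    linarith [norm_add_le ((y i : B(H)) (v - w)) ((y i : B(H)) w)]
  have hU : U = ⊤ := by
    refine factor_top M hf hcl (fun g hg v hv y hy hy' => ?_) (fun g hg v hv y hy hy' => ?_) ?_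
    · obtain ⟨C, hC⟩ := hy
      refine hv (fun i => y i * ⟨g, hg⟩) ⟨C * ‖(⟨g, hg⟩ : MM M)‖, fun i => ?_⟩ ?_
      · exact (norm_mul_le _ _).trans (by gcongr; exact hC i)
      · have := ((s.R ⟨g, hg⟩).continuous.tendsto _).comp hy'
        rw [map_zero] at this
        exact this.congr fun i => by simp
    · have := (g.continuous.tendsto _).comp (hv y hy hy')
      rw [map_zero] at this
      refine this.congr fun i => ?_
      exact (congrArg (fun A : B(H) => A v)
        (mem_commutant_iff.1 hg _ (y i).2)).symm
    · obtain ⟨η, hη, C, hC⟩ := exists_dom s hf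
      intro hbot
      have : η ∈ U := by
        intro y _ hy'
        rw [tendsto_zero_iff_norm_tendsto_zero] at hy' ⊢
        have h3 : Tendsto (fun i => √(C * ‖s.j (y i)‖ ^ 2)) l (𝓝 0) := by
          have := ((hy'.pow 2).const_mul C).sqrt
          simpa using this
        exact squeeze_zero (fun _ => norm_nonneg _)
          (fun i => Real.le_sqrt_of_sq_le (hC _)) h3
      rw [hbot] at this
      exact hη this
  have : η ∈ U := by rw [hU]; trivial
  exact this x ⟨C, h1⟩ h2

lemma CB_of_factor (hf : IsFactorSet (M : Set B(H))) : CB s := by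
  intro x C hC hx
  obtain ⟨S, hS, hl⟩ := exists_strong_limit (l := atTop) (T := fun k => (x k : B(H))) hC
    (fun η => by
      show CauchySeq fun k => (x k : B(H)) η
      rw [cauchySeq_iff_tendsto_dist_atTop_0] at hx ⊢
      have h1 : Tendsto (fun p : ℕ × ℕ => s.j (x p.1 - x p.2)) atTop (𝓝 0) := by
        rw [tendsto_zero_iff_norm_tendsto_zero]
        refine hx.congr fun p => ?_
        rw [dist_eq_norm, map_sub]
      have h2 := two_sot s hf (C := C + C) (fun p : ℕ × ℕ => (norm_sub_le _ _).trans
        (add_le_add (hC p.1) (hC p.2))) h1 η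
      rw [tendsto_zero_iff_norm_tendsto_zero] at h2
      exact h2.congr fun p => (dist_eq_norm _ _).symm)
  have hSM : S ∈ M := mem_of_strong M (fun k => (x k).2) hl
  refine ⟨⟨S, hSM⟩, hS, ?_⟩
  have h1 := sot2 s hf (x := fun k => x k - ⟨S, hSM⟩) (l := atTop) (C := C + C)
    (fun k => (norm_sub_le _ _).trans (add_le_add (hC k) hS)) (fun η => by
      have := (hl η).sub_const (S η)
      rw [sub_self] at this
      exact this)
  have h2 := h1.add_const (s.j (⟨S, hSM⟩ : MM M))
  rw [zero_add] at h2
  exact h2.congr fun k => by rw [map_sub]; abel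
end

end

section Hilb

lemma closest {C : Set K} (ne : C.Nonempty) (hc : IsClosed C) (hcv : Convex ℝ C) (u : K) :
    ∃ v ∈ C, ∀ w ∈ C, (inner ℂ (u - v) (w - v)).re ≤ 0 := by
  letI : InnerProductSpace ℝ K := InnerProductSpace.complexToReal
  obtain ⟨v, hv, h⟩ := exists_norm_eq_iInf_of_complete_convex ne hc.isComplete hcv u
  exact ⟨v, hv, (norm_eq_iInf_iff_real_inner_le_zero hcv hv).1 h⟩

lemma avg_point {C : Set K} (ne : C.Nonempty) (hc : IsClosed C) (hcv : Convex ℝ C) :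
    ∃ v ∈ C, ∀ T : K → K, (∀ x, ‖T x‖ ≤ ‖x‖) → MapsTo T C C → T v = v := by
  obtain ⟨v, hv, h⟩ := closest ne hc hcv 0
  refine ⟨v, hv, fun T hT hm => ?_⟩
  have h1 := h _ (hm hv)
  rw [zero_sub, inner_neg_left, inner_sub_right, Complex.neg_re, sub_re, inner_selfC,
    ofReal_re] at h1
  have h2 : ‖T v - v‖ ^ 2 = ‖T v‖ ^ 2 - 2 * (inner ℂ v (T v)).re + ‖v‖ ^ 2 := by
    have := @norm_sub_sq ℂ K _ _ _ v (T v)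
    rw [norm_sub_rev, this]
    show _ - 2 * (inner ℂ v (T v)).re + _ = _
    ring
  have h3 : ‖T v‖ ^ 2 ≤ ‖v‖ ^ 2 := by gcongr; exact hT v
  have h4 : ‖T v - v‖ ^ 2 ≤ 0 := by linarith
  have h5 : ‖T v - v‖ = 0 := by nlinarith [norm_nonneg (T v - v)]
  exact sub_eq_zero.1 (norm_eq_zero.1 h5)

/-- invariant point in the closed convex hull of an orbit-like set -/
lemma avg_hull {S : Set K} (ne : S.Nonempty) :
    ∃ v ∈ closure (convexHull ℝ S), ∀ T : B(K), (∀ x, ‖T x‖ ≤ ‖x‖) → MapsTo T S S →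
      T v = v := by
  obtain ⟨v, hv, h⟩ := avg_point (C := closure (convexHull ℝ S)) (ne.convexHull.closure)
    isClosed_closure (convex_convexHull ℝ S).closure
  refine ⟨v, hv, fun T hT hm => h T hT ?_⟩
  refine MapsTo.closure ?_ T.continuous
  intro x hx
  have := (T.restrictScalars ℝ).toLinearMap.image_convexHull (s := S)
  have h2 : T x ∈ (T.restrictScalars ℝ).toLinearMap '' convexHull ℝ S := ⟨x, hx, rfl⟩
  rw [this] at h2
  exact convexHull_mono (by rintro _ ⟨y, hy, rfl⟩; exact hm hy) h2

end Hilb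

section
variable (s : Std Al K)

lemma re_τ_le (x : Al) : (s.τ x).re ≤ ‖x‖ :=
  (re_le_norm _).trans ((s.τ_norm_le x).trans (s.nj_le x))

/-- subset is 2-closed -/
def TwoClosed (S : Set Al) : Prop := ∀ x, s.j x ∈ closure (s.j '' S) → x ∈ S

variable {s}

lemma Std.j_cont : Continuous s.j :=
  (s.j.mkContinuous 1 fun x => by rw [one_mul]; exact s.nj_le x).continuous

lemma TwoClosed.isClosed {S : Set Al} (h : TwoClosed s S) : IsClosed S := by
  refine isClosed_of_closure_subset fun x hx => h x ?_
  exact image_closure_subset_closure_image Std.j_cont ⟨x, hx, rfl⟩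

lemma CB.mem (hcb : CB s) {S : Set Al} {C : ℝ} (hS : ∀ x ∈ S, ‖x‖ ≤ C) {ξ : K}
    (h : ξ ∈ closure (s.j '' S)) : ∃ y, ‖y‖ ≤ C ∧ s.j y = ξ := by
  obtain ⟨f, hf, hl⟩ := mem_closure_iff_seq_limit.1 h
  choose x hx hxf using hf
  obtain ⟨y, hy, hyl⟩ := hcb x C (fun k => hS _ (hx k)) (by simp only [hxf]; exact hl.cauchySeq)
  simp only [hxf] at hyl
  exact ⟨y, hy, tendsto_nhds_unique hyl hl⟩

/-- the 2-closure of a star-subalgebra -/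
def cl2 (s : Std Al K) (S : StarSubalgebra ℂ Al) : StarSubalgebra ℂ Al where
  carrier := {x | s.j x ∈ closure (s.j '' S)}
  mul_mem' := by
    intro x y hx hy
    have hcl : ∀ z : Al, z ∈ S → s.j (x * z) ∈ closure (s.j '' S) := fun z hz => by
      have h1 : MapsTo (s.R z) (s.j '' S) (s.j '' S) := by
        rintro _ ⟨a, ha, rfl⟩
        exact ⟨a * z, mul_mem ha hz, by simp⟩
      have := h1.closure (s.R z).continuous hx
      simpa using this
    have h2 : MapsTo (s.L x) (s.j '' S) (closure (s.j '' S)) := by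
      rintro _ ⟨a, ha, rfl⟩
      simpa using hcl a ha
    have := h2.closure (s.L x).continuous hy
    rw [closure_closure] at this
    simpa using this
  one_mem' := subset_closure ⟨1, one_mem S, rfl⟩
  add_mem' := by
    intro x y hx hy
    have h : ∀ a ∈ s.j '' (S : Set Al), ∀ b ∈ s.j '' (S : Set Al), a + b ∈ s.j '' (S : Set Al) := by
      rintro _ ⟨a, ha, rfl⟩ _ ⟨b, hb, rfl⟩
      exact ⟨a + b, add_mem ha hb, by simp⟩
    show s.j (x + y) ∈ closure (s.j '' (S : Set Al))
    rw [map_add]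
    exact map_mem_closure₂ continuous_add hx hy h
  zero_mem' := subset_closure ⟨0, zero_mem S, by simp⟩
  algebraMap_mem' r := subset_closure ⟨_, S.algebraMap_mem r, rfl⟩
  star_mem' := by
    intro x hx
    show s.j (star x) ∈ closure (s.j '' (S : Set Al))
    refine Metric.mem_closure_iff.2 fun ε hε => ?_
    have hx' : s.j x ∈ closure (s.j '' S) := hx
    obtain ⟨_, ⟨a, ha, rfl⟩, h⟩ := Metric.mem_closure_iff.1 hx' ε hε
    refine ⟨s.j (star a), ⟨star a, star_mem ha, rfl⟩, ?_⟩
    rwa [dist_eq_norm, ← map_sub, ← star_sub, s.nj_star, map_sub, ← dist_eq_norm]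

lemma cl2_twoClosed (S : StarSubalgebra ℂ Al) : TwoClosed s (cl2 s S : Set Al) := by
  intro x hx
  have h1 : s.j '' (cl2 s S : Set Al) ⊆ closure (s.j '' S) := by
    rintro _ ⟨a, ha, rfl⟩; exact ha
  have := closure_mono h1 hx
  rwa [closure_closure] at this

lemma le_cl2 {S : StarSubalgebra ℂ Al} {x : Al} (h : x ∈ S) : x ∈ cl2 s S :=
  subset_closure ⟨x, h, rfl⟩

/-- functional calculus for BV -/
lemma bv_aux (y : Al) {ε : ℝ} (hε : 0 < ε) {S : StarSubalgebra ℂ Al} (hS : IsClosed (S : Set Al))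
    (hy : y ∈ S) : ∃ k ∈ S, ∃ j ∈ S, star k = k ∧ star j = j ∧ k * j = 1 ∧ j * k = 1 ∧
      star y * y * (j * j) = k * k - ((ε : ℂ) • (((ε : ℂ) • j) * j)) ∧ ‖((ε : ℂ) • j) * j‖ ≤ 1 ∧ ‖y * (j * j)‖ ≤ 1 := by
  set a := star y * y with ha
  have haS : a ∈ S := mul_mem (star_mem hy) hy
  have hsa : IsSelfAdjoint a := star_mul_self y
  have hsp : ∀ x ∈ spectrum ℝ a, 0 ≤ x := spectrum_star_mul_self_nonneg
  have hid : cfc (fun x : ℝ => x) a = a := cfc_id' ℝ a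
  let f : ℝ → ℝ := fun x => √(√(|x| + ε ^ 2))
  have hpos : ∀ x : ℝ, 0 < |x| + ε ^ 2 := fun x => by positivity
  have hf0 : ∀ x, 0 < f x := fun x => sqrt_pos.2 (sqrt_pos.2 (hpos x))
  have hfc : Continuous f := by unfold f; fun_prop
  have hgc : Continuous fun x => (f x)⁻¹ := hfc.inv₀ fun x => (hf0 x).ne'
  have hgg : Continuous fun x => (f x)⁻¹ * (f x)⁻¹ := hgc.mul hgc
  have hff : Continuous fun x => f x * f x := hfc.mul hfc
  have hf2 : ∀ x, f x * f x = √(|x| + ε ^ 2) := fun x => mul_self_sqrt (by positivity)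
  have hf4 : ∀ x, f x * f x * (f x * f x) = |x| + ε ^ 2 := fun x => by
    rw [hf2]; exact mul_self_sqrt (hpos x).le
  have hεf : ∀ x, ε ≤ f x * f x := fun x => by
    rw [hf2]; apply Real.le_sqrt_of_sq_le; nlinarith [abs_nonneg x]
  have hm : ∀ f g : ℝ → ℝ, Continuous f → Continuous g →
      cfc f a * cfc g a = cfc (fun x => f x * g x) a := fun f g hf hg =>
    (cfc_mul f g a hf.continuousOn hg.continuousOn).symm
  refine ⟨cfc f a, cfcR_mem hsa _ S hS haS, cfc (fun x => (f x)⁻¹) a, cfcR_mem hsa _ S hS haS,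
    cfcR_sa _ _, cfcR_sa _ _, ?_, ?_, ?_, ?_, ?_⟩
  · rw [hm _ _ hfc hgc]
    simp only [fun x => mul_inv_cancel₀ (hf0 x).ne']
    exact cfc_const_one ℝ a
  · rw [hm _ _ hgc hfc]
    simp only [fun x => inv_mul_cancel₀ (hf0 x).ne']
    exact cfc_const_one ℝ a
  · rw [hm _ _ hgc hgc, smul_mul_assoc, hm _ _ hgc hgc, hm _ _ hfc hfc, smul_smul]
    nth_rewrite 1 [← hid]
    rw [hm _ _ continuous_id' hgg]
    have : ((ε : ℂ) * ε) • cfc (fun x => (f x)⁻¹ * (f x)⁻¹) a =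
        cfc (fun x => (ε * ε) * ((f x)⁻¹ * (f x)⁻¹)) a := by
      rw [cfc_const_mul _ _ a hgg.continuousOn, ← Complex.ofReal_mul, coe_smul]
    rw [this, ← cfc_sub _ _ a hff.continuousOn (by fun_prop)]
    refine cfc_congr fun x hx => ?_
    have h4 := hf4 x
    rw [abs_of_nonneg (hsp x hx)] at h4
    have := (hf0 x).ne'
    field_simp
    nlinarith
  · rw [smul_mul_assoc, hm _ _ hgc hgc, coe_smul,
      ← cfc_const_mul _ _ a hgg.continuousOn]
    refine norm_cfc_le zero_le_one fun x hx => ?_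
    have h1 := hεf x
    have h2 := hf0 x
    rw [norm_of_nonneg (by positivity), ← mul_inv, ← div_eq_mul_inv,
      div_le_one (by positivity)]
    exact h1
  · have h1 : ‖star (y * (cfc (fun x => (f x)⁻¹) a * cfc (fun x => (f x)⁻¹) a)) *
      (y * (cfc (fun x => (f x)⁻¹) a * cfc (fun x => (f x)⁻¹) a))‖ ≤ 1 := by
      rw [hm _ _ hgc hgc, star_mul, cfcR_sa, mul_assoc, ← mul_assoc (star y), ← ha]
      nth_rewrite 2 [← hid]
      rw [hm _ _ continuous_id' hgg, hm _ _ hgg (by fun_prop)]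
      refine norm_cfc_le zero_le_one fun x hx => ?_
      have h1 := hf4 x
      rw [abs_of_nonneg (hsp x hx)] at h1
      have h2 := hf0 x
      have h3 := hsp x hx
      rw [norm_of_nonneg (by positivity)]
      have : (f x)⁻¹ * (f x)⁻¹ * (x * ((f x)⁻¹ * (f x)⁻¹)) = x / (f x * f x * (f x * f x)) := by
        field_simp
      rw [this, h1, div_le_one (by positivity)]
      nlinarith
    rw [norm_star_mul_self] at h1
    nlinarith [norm_nonneg (y * (cfc (fun x => (f x)⁻¹) a * cfc (fun x => (f x)⁻¹) a))]

lemma bv_core (hcb : CB s) (S : StarSubalgebra ℂ Al) (hS : TwoClosed s (S : Set Al)) {ξ : K}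
    (hξ : ξ ∈ closure (s.j '' S)) {C : ℝ} (hC : 0 ≤ C)
    (h : ∀ y ∈ S, ∀ ε > 0, ∃ x ∈ S, ‖x‖ ≤ C ∧
      (inner ℂ (s.j y) ξ).re ≤ (inner ℂ (s.j y) (s.j x)).re + C * ε) : ∃ x ∈ S, s.j x = ξ := by
  set D : Set Al := {x | x ∈ S ∧ ‖x‖ ≤ C}
  have hDcl : IsClosed (s.j '' D) := by
    refine isClosed_of_closure_subset fun v hv => ?_
    obtain ⟨y, hy, rfl⟩ := hcb.mem (S := D) (fun x hx => hx.2) hv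
    exact ⟨y, ⟨hS y (closure_mono (Set.image_mono fun x hx => hx.1) hv), hy⟩, rfl⟩
  have hDcv : Convex ℝ (s.j '' D) := by
    have : Convex ℝ D := by
      intro x hx y hy a b ha hb hab
      refine ⟨?_, ?_⟩
      · rw [← coe_smul, ← coe_smul]
        exact add_mem (SMulMemClass.smul_mem _ hx.1) (SMulMemClass.smul_mem _ hy.1)
      · refine (norm_add_le _ _).trans ?_
        rw [norm_smul, norm_smul, norm_of_nonneg ha, norm_of_nonneg hb]
        nlinarith [hx.2, hy.2]
    exact this.linear_image (s.j.restrictScalars ℝ)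
  obtain ⟨η, ⟨x0, hx0, rfl⟩, hη⟩ := closest (C := s.j '' D)
    ⟨0, 0, ⟨zero_mem S, by simpa using hC⟩, by simp⟩ hDcl hDcv ξ
  by_contra hcon
  push Not at hcon
  have hne : ξ - s.j x0 ≠ 0 := fun e => hcon x0 hx0.1 (sub_eq_zero.1 e).symm
  set ζ := ξ - s.j x0 with hζ
  have hζpos : 0 < ‖ζ‖ ^ 2 := by positivity
  have hζcl : ζ ∈ closure (s.j '' (S : Set Al)) := by
    refine map_mem_closure₂ (f := fun a b : K => a - b) continuous_sub hξ
      (t := s.j '' (S : Set Al)) (subset_closure (Set.mem_image_of_mem _ hx0.1)) ?_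
    rintro _ ⟨a, ha, rfl⟩ _ ⟨b, hb, rfl⟩
    exact ⟨a - b, sub_mem ha hb, by simp⟩
  set r := ‖ζ‖ ^ 2 / (2 * (‖ξ‖ + C + 1)) with hr
  have hrpos : 0 < r := by positivity
  obtain ⟨_, ⟨y, hy, rfl⟩, hyd⟩ := Metric.mem_closure_iff.1 hζcl r hrpos
  rw [dist_eq_norm] at hyd
  obtain ⟨x, hx, hxC, hle⟩ := h y hy (‖ζ‖ ^ 2 / (4 * (C + 1))) (by positivity)
  have h1 := hη (s.j x) (Set.mem_image_of_mem _ (show x ∈ D from ⟨hx, hxC⟩))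
  have h2 : (inner ℂ ζ (ξ - s.j x)).re ≥ ‖ζ‖ ^ 2 := by
    have e : ξ - s.j x = ζ - (s.j x - s.j x0) := by rw [hζ]; abel
    rw [e, inner_sub_right, sub_re, inner_selfC, ofReal_re]
    linarith
  have h3 : (inner ℂ (s.j y) (ξ - s.j x)).re ≤ C * (‖ζ‖ ^ 2 / (4 * (C + 1))) := by
    rw [inner_sub_right, sub_re]; linarith
  have h4 : (inner ℂ ζ (ξ - s.j x)).re - (inner ℂ (s.j y) (ξ - s.j x)).re ≤ r * (‖ξ‖ + C) := by
    rw [← sub_re, ← inner_sub_left]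
    refine (re_le_norm _).trans ((norm_inner_le_norm _ _).trans ?_)
    have : ‖ξ - s.j x‖ ≤ ‖ξ‖ + C := (norm_sub_le _ _).trans (by
      have := (s.nj_le x).trans hxC; linarith)
    exact mul_le_mul hyd.le this (norm_nonneg _) hrpos.le
  have h5 : r * (‖ξ‖ + C) ≤ ‖ζ‖ ^ 2 / 2 := by
    rw [hr, div_mul_eq_mul_div, div_le_div_iff₀ (by positivity) (by positivity)]
    nlinarith
  have h6 : C * (‖ζ‖ ^ 2 / (4 * (C + 1))) ≤ ‖ζ‖ ^ 2 / 4 := by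
    rw [mul_div_assoc', div_le_div_iff₀ (by positivity) (by positivity)]
    nlinarith
  linarith

lemma bv_est {y k j : Al} {ε C : ℝ} (hε : 0 < ε) (hC : 0 ≤ C)
    (h5 : star y * y * (j * j) = k * k - ((ε : ℂ) • (((ε : ℂ) • j) * j)))
    (h6 : ‖((ε : ℂ) • j) * j‖ ≤ 1) :
    (s.τ (k * k)).re - ε ≤ (s.τ (star y * y * (j * j))).re := by
  rw [h5, s.τ_sub, s.τ_smul, sub_re, re_ofReal_mul]
  have := (re_τ_le s (((ε : ℂ) • j) * j)).trans h6
  nlinarith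

lemma bv_est2 {y k j : Al} {ε : ℝ} (hε : 0 < ε) (hj : star j = j)
    (h5 : star y * y * (j * j) = k * k - ((ε : ℂ) • (((ε : ℂ) • j) * j))) :
    (s.τ (star y * y * (j * j))).re ≤ (s.τ (k * k)).re := by
  rw [h5, s.τ_sub, s.τ_smul, sub_re, re_ofReal_mul, smul_mul_assoc, s.τ_smul,
    re_ofReal_mul]
  have := re_τ_star_mul s j
  rw [hj] at this
  rw [this]
  have : 0 ≤ ε * (ε * ‖s.j j‖ ^ 2) := by positivity
  linarith

lemma BV (hcb : CB s) (S : StarSubalgebra ℂ Al) (hS : TwoClosed s (S : Set Al)) {ξ : K}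
    (hξ : ξ ∈ closure (s.j '' S)) {C : ℝ} (hC : 0 ≤ C)
    (h : ∀ y ∈ S, ‖s.R y ξ‖ ≤ C * ‖s.j y‖) : ∃ x ∈ S, s.j x = ξ := by
  refine bv_core hcb S hS hξ hC fun y hy ε hε => ?_
  obtain ⟨k, hk, j, hj, hks, hjs, hkj, hjk, h5, h6, h7⟩ := bv_aux y hε hS.isClosed hy
  refine ⟨(C : ℂ) • (y * (j * j)), SMulMemClass.smul_mem _ (mul_mem hy (mul_mem hj hj)), ?_, ?_⟩
  · rw [norm_smul, norm_real, norm_of_nonneg hC]; nlinarith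
  have e1 := bv_est (s := s) hε hC h5 h6
  have e2 := bv_est2 (s := s) hε hjs h5
  have e3 : (inner ℂ (s.j y) (s.j ((C : ℂ) • (y * (j * j))))).re =
      C * (s.τ (star y * y * (j * j))).re := by
    rw [← s.τ_star_mul, mul_smul_comm, s.τ_smul, re_ofReal_mul, mul_assoc]
  have n1 : ‖s.j (y * j)‖ ^ 2 = (s.τ (star y * y * (j * j))).re := by
    rw [← re_τ_star_mul, star_mul, hjs, mul_assoc, s.τ_mul_comm]; congr 2; simp only [mul_assoc]
  have n2 : ‖s.j k‖ ^ 2 = (s.τ (k * k)).re := by rw [← re_τ_star_mul, hks]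
  have e4 : (inner ℂ (s.j y) ξ).re ≤ ‖s.j (y * j)‖ * (C * ‖s.j k‖) := by
    have : s.j y = s.R k (s.j (y * j)) := by rw [s.R_j, mul_assoc, hjk, mul_one]
    rw [this, s.inner_R, hks]
    refine (re_le_norm _).trans ((norm_inner_le_norm _ _).trans ?_)
    gcongr
    exact h k hk
  have n3 : ‖s.j (y * j)‖ ≤ ‖s.j k‖ := by
    refine abs_le_of_sq_le_sq' ?_ (norm_nonneg _) |>.2
    linarith
  have : ‖s.j (y * j)‖ * (C * ‖s.j k‖) ≤ C * (s.τ (k * k)).re := by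
    rw [← n2]
    have := mul_le_mul_of_nonneg_right n3 (mul_nonneg hC (norm_nonneg (s.j k)))
    nlinarith
  rw [e3]
  nlinarith

lemma BV' (hcb : CB s) (S : StarSubalgebra ℂ Al) (hS : TwoClosed s (S : Set Al)) {ξ : K}
    (hξ : ξ ∈ closure (s.j '' S)) {C : ℝ} (hC : 0 ≤ C)
    (h : ∀ y ∈ S, ‖s.L y ξ‖ ≤ C * ‖s.j y‖) : ∃ x ∈ S, s.j x = ξ := by
  refine bv_core hcb S hS hξ hC fun z hz ε hε => ?_
  obtain ⟨y, rfl⟩ : ∃ y, star y = z := ⟨star z, star_star z⟩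
  have hy : y ∈ S := by simpa using star_mem hz
  obtain ⟨k, hk, j, hj, hks, hjs, hkj, hjk, h5, h6, h7⟩ := bv_aux y hε hS.isClosed hy
  refine ⟨star ((C : ℂ) • (y * (j * j))),
    star_mem (SMulMemClass.smul_mem _ (mul_mem hy (mul_mem hj hj))), ?_, ?_⟩
  · rw [norm_star, norm_smul, norm_real, norm_of_nonneg hC]; nlinarith
  have e1 := bv_est (s := s) hε hC h5 h6
  have e2 := bv_est2 (s := s) hε hjs h5
  have e3 : (inner ℂ (s.j (star y)) (s.j (star ((C : ℂ) • (y * (j * j)))))).re =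
      C * (s.τ (star y * y * (j * j))).re := by
    rw [← s.inner_star, ← inner_conj_symm, Complex.conj_re]
    rw [← s.τ_star_mul, mul_smul_comm, s.τ_smul, re_ofReal_mul, mul_assoc]
  have n1 : ‖s.j (y * j)‖ ^ 2 = (s.τ (star y * y * (j * j))).re := by
    rw [← re_τ_star_mul, star_mul, hjs, mul_assoc, s.τ_mul_comm]; congr 2; simp only [mul_assoc]
  have n2 : ‖s.j k‖ ^ 2 = (s.τ (k * k)).re := by rw [← re_τ_star_mul, hks]
  have e4 : (inner ℂ (s.j (star y)) ξ).re ≤ ‖s.j (y * j)‖ * (C * ‖s.j k‖) := by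
    have : s.j (star y) = s.L k (s.j (star (y * j))) := by
      rw [s.L_j, star_mul, hjs, ← mul_assoc, hkj, one_mul]
    rw [this, s.inner_L, hks, ← s.nj_star (y * j)]
    refine (re_le_norm _).trans ((norm_inner_le_norm _ _).trans ?_)
    gcongr
    exact h k hk
  have n3 : ‖s.j (y * j)‖ ≤ ‖s.j k‖ := by
    refine abs_le_of_sq_le_sq' ?_ (norm_nonneg _) |>.2
    linarith
  have : ‖s.j (y * j)‖ * (C * ‖s.j k‖) ≤ C * (s.τ (k * k)).re := by
    rw [← n2]
    have := mul_le_mul_of_nonneg_right n3 (mul_nonneg hC (norm_nonneg (s.j k)))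
    nlinarith
  rw [e3]
  nlinarith

lemma BVtop (hcb : CB s) {ξ : K} {C : ℝ} (hC : 0 ≤ C)
    (h : ∀ y, ‖s.R y ξ‖ ≤ C * ‖s.j y‖) : ∃ x, s.j x = ξ := by
  obtain ⟨x, _, hx⟩ := BV hcb ⊤ (fun _ _ => trivial) (ξ := ξ)
    (by simpa using s.dense ξ) hC (fun y _ => h y)
  exact ⟨x, hx⟩

lemma BVtop' (hcb : CB s) {ξ : K} {C : ℝ} (hC : 0 ≤ C)
    (h : ∀ y, ‖s.L y ξ‖ ≤ C * ‖s.j y‖) : ∃ x, s.j x = ξ := by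
  obtain ⟨x, _, hx⟩ := BV' hcb ⊤ (fun _ _ => trivial) (ξ := ξ)
    (by simpa using s.dense ξ) hC (fun y _ => h y)
  exact ⟨x, hx⟩

/-- polar part -/
lemma polar_abs (hcb : CB s) (y : Al) : ∃ v : Al, y * (star v * v) = y ∧ v * (star v * v) = v ∧
    (∀ S : StarSubalgebra ℂ Al, IsClosed (S : Set Al) → star y * y ∈ S →
      s.j v ∈ closure (s.j '' {z | ∃ c ∈ S, z = y * c})) := by
  obtain ⟨c, hcs, hcc, hcn, hcS, hca, hcd⟩ := polar_aux y
  set a := star y * y with ha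
  have hmono : ∀ n k, n ≤ k → ‖s.j (y * c k - y * c n)‖ ^ 2 ≤
      ‖s.j (y * c k)‖ ^ 2 - ‖s.j (y * c n)‖ ^ 2 := by
    intro n k hnk
    obtain ⟨d, hd⟩ := hcd n k hnk
    have := congrArg (fun z => (s.τ z).re) hd
    simp only [s.τ_add, add_re, re_τ_star_mul] at this
    nlinarith [sq_nonneg ‖s.j d‖]
  have hcau : CauchySeq fun n => s.j (y * c n) := by
    have hM : Monotone fun n => ‖s.j (y * c n)‖ ^ 2 := fun n k h => by
      have := hmono n k h
      simp only
      nlinarith [sq_nonneg ‖s.j (y * c k - y * c n)‖]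
    have hB : BddAbove (Set.range fun n => ‖s.j (y * c n)‖ ^ 2) := ⟨1, by
      rintro _ ⟨n, rfl⟩
      have : ‖s.j (y * c n)‖ ≤ 1 := (s.nj_le _).trans (hcn n)
      simp only
      nlinarith [norm_nonneg (s.j (y * c n))]⟩
    have hl := (tendsto_atTop_ciSup hM hB).cauchySeq
    rw [Metric.cauchySeq_iff'] at hl ⊢
    intro ε hε
    obtain ⟨N, hN⟩ := hl (ε ^ 2) (by positivity)
    refine ⟨N, fun n hn => ?_⟩
    have h1 := hN n hn
    have h2 := hmono N n hn
    rw [Real.dist_eq] at h1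
    have h3 := lt_of_abs_lt h1
    rw [dist_eq_norm, ← map_sub]
    exact lt_of_pow_lt_pow_left₀ 2 hε.le (by linarith)
  obtain ⟨v, hv1, hv⟩ := hcb (fun n => y * c n) 1 hcn hcau
  have hvs : Tendsto (fun n => s.j (star (y * c n))) atTop (𝓝 (s.j (star v))) := by
    rw [tendsto_iff_norm_sub_tendsto_zero] at hv ⊢
    refine hv.congr fun n => ?_
    rw [← map_sub, ← map_sub, ← star_sub, s.nj_star]
  -- joint limits
  have hprod : Tendsto (fun n => s.j (star (y * c n) * (y * c n))) atTop (𝓝 (s.j (star v * v))) := by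
    rw [tendsto_iff_norm_sub_tendsto_zero] at hv ⊢
    have hvs' := hvs
    rw [tendsto_iff_norm_sub_tendsto_zero] at hvs'
    have h0 := hv.add hvs'
    rw [add_zero] at h0
    refine squeeze_zero (fun _ => norm_nonneg _) (fun n => ?_) h0
    rw [← map_sub, ← map_sub, ← map_sub]
    have e : star (y * c n) * (y * c n) - star v * v =
      star (y * c n) * (y * c n - v) + (star (y * c n) - star v) * v := by noncomm_ring
    rw [e, map_add]
    refine (norm_add_le _ _).trans (add_le_add ?_ ?_)
    · refine (s.nj_mul _ _).trans ?_
      rw [norm_star]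
      nlinarith [norm_nonneg (s.j (y * c n - v)), hcn n]
    · refine (s.nj_mul' _ _).trans ?_
      nlinarith [norm_nonneg (s.j (star (y * c n) - star v))]
  have hstar : ∀ n, star (y * c n) * (y * c n) = c n * a * c n := fun n => by
    rw [star_mul, hcs, ha]; simp only [mul_assoc]
  have hay : a * (star v * v) = a := by
    have h1 : Tendsto (fun n => s.j (a * (c n * a * c n))) atTop (𝓝 (s.j (a * (star v * v)))) := by
      have := ((s.L a).continuous.tendsto _).comp hprod
      simp only [hstar] at this
      simpa [comp_def] using this
    have h2 : Tendsto (fun n => s.j (a * (c n * a * c n))) atTop (𝓝 (s.j a)) := by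
      rw [tendsto_iff_norm_sub_tendsto_zero]
      refine squeeze_zero (fun _ => norm_nonneg _) (fun n => ?_)
        tendsto_one_div_add_atTop_nhds_zero_nat
      rw [norm_sub_rev, ← map_sub]
      exact (s.nj_le _).trans (hca n)
    exact s.inj' (tendsto_nhds_unique h1 h2)
  have hyy : y * (star v * v) = y := by
    have h1 : star (y - y * (star v * v)) * (y - y * (star v * v)) = 0 := by
      have : star (y - y * (star v * v)) * (y - y * (star v * v)) =
        a - a * (star v * v) - star v * v * (a - a * (star v * v)) := by
        rw [star_sub, star_mul, star_mul, star_star, ha]; noncomm_ring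
      rw [this, hay]; simp
    exact (sub_eq_zero.1 ((star_mul_self_eq_zero_iff _).1 h1)).symm
  refine ⟨v, hyy, ?_, fun S hS hyS => ?_⟩
  · have hsa : star v * v * star y = star y := by
      have := congrArg star hyy
      rwa [star_mul, star_mul, star_star] at this
    have h1 : star v * v * star v = star v := by
      refine s.inj' ?_
      have h2 := ((s.L (star v * v)).continuous.tendsto _).comp hvs
      have h3 : Tendsto (fun n => s.j (star (y * c n))) atTop (𝓝 (s.L (star v * v) (s.j (star v)))) := by
        refine h2.congr fun n => ?_
        have hva : star v * v * a = a := by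
          have := congrArg star hay
          rwa [star_mul, star_mul, star_star, ha, star_mul, star_star] at this
        have hcm : c n ∈ StarSubalgebra.centralizer ℂ {star v * v} := by
          refine hcS _ ?_ ?_ n
          · rw [coe_centralizer]
            exact Set.isClosed_centralizer _
          · rw [mem_centralizer_iff]
            rintro _ rfl
            constructor
            · rw [hva, hay]
            · rw [star_mul, star_star, hva, hay]
        rw [mem_centralizer_iff] at hcm
        have := (hcm _ rfl).1
        simp only [Function.comp_apply, s.L_j]
        rw [star_mul, hcs, ← mul_assoc, this, mul_assoc, hsa]
      rw [← s.L_j]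
      exact tendsto_nhds_unique h3 hvs
    have := congrArg star h1
    rwa [star_mul, star_mul, star_star] at this
  · exact mem_closure_of_tendsto hv (.of_forall fun n => ⟨y * c n, ⟨c n, hcS S hS hyS n, rfl⟩, rfl⟩)
end

section
/-- crossed product data in standard form -/
structure XD (G : Type) [Group G] (s : Std Al K) where
  A : StarSubalgebra ℂ Al
  u : G → Al
  u_one : u 1 = 1
  u_mul : ∀ g h, u g * u h = u (g * h)
  u_star : ∀ g, star (u g) = u g⁻¹
  conj : ∀ g, ∀ a ∈ A, u g * a * u g⁻¹ ∈ A
  E : Al →ₗ[ℂ] Al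
  mem : ∀ x, E x ∈ A
  fix : ∀ x ∈ A, E x = x
  bimod : ∀ a ∈ A, ∀ b ∈ A, ∀ x, E (a * x * b) = a * E x * b
  proj : ∀ x, ∀ a ∈ A, inner ℂ (s.j a) (s.j (E x)) = inner ℂ (s.j a) (s.j x)
  E_u : ∀ g, g ≠ 1 → E (u g) = 0
  sep : ∀ x, (∀ g, E (x * u g⁻¹) = 0) → x = 0
  comm : ∀ a ∈ A, ∀ b ∈ A, a * b = b * a
  free : ∀ g, g ≠ 1 → ∀ a ∈ A, (∀ b ∈ A, u g * b * u g⁻¹ * a = a * b) → a = 0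
  erg : ∀ a ∈ A, (∀ g, u g * a * u g⁻¹ = a) → ∃ c : ℂ, a = c • (1 : Al)

namespace XD
variable {G : Type} [Group G] {s : Std Al K} (D : XD G s)

lemma u_inv_mul (g : G) : D.u g⁻¹ * D.u g = 1 := by rw [D.u_mul, inv_mul_cancel, D.u_one]
lemma u_mul_inv (g : G) : D.u g * D.u g⁻¹ = 1 := by rw [D.u_mul, mul_inv_cancel, D.u_one]
lemma u_unit (g : G) : star (D.u g) * D.u g = 1 := by rw [D.u_star, D.u_inv_mul]
lemma u_unit' (g : G) : D.u g * star (D.u g) = 1 := by rw [D.u_star, D.u_mul_inv]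
lemma bimodl {a : Al} (ha : a ∈ D.A) (x : Al) : D.E (a * x) = a * D.E x := by
  simpa using D.bimod a ha 1 (one_mem _) x
lemma bimodr {a : Al} (ha : a ∈ D.A) (x : Al) : D.E (x * a) = D.E x * a := by
  simpa using D.bimod 1 (one_mem _) a ha x

lemma factor (D : XD G s) (z : Al) (hz : ∀ y, z * y = y * z) : ∃ c : ℂ, z = c • (1 : Al) := by
  have h1 : ∀ g, g ≠ 1 → D.E (z * D.u g⁻¹) = 0 := by
    intro g hg
    refine D.free g hg _ (D.mem _) fun b hb => ?_
    rw [D.comm _ (D.conj g b hb) _ (D.mem _), ← D.bimodr (D.conj g b hb)]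
    have : z * D.u g⁻¹ * (D.u g * b * D.u g⁻¹) = b * (z * D.u g⁻¹) := by
      calc z * D.u g⁻¹ * (D.u g * b * D.u g⁻¹) = z * (D.u g⁻¹ * D.u g) * b * D.u g⁻¹ := by
            simp only [mul_assoc]
        _ = b * (z * D.u g⁻¹) := by rw [D.u_inv_mul, mul_one, hz, mul_assoc]
    rw [this, D.bimodl hb, D.comm _ hb _ (D.mem _)]
  have h2 : z - D.E z = 0 := by
    refine D.sep _ fun g => ?_
    rw [sub_mul, map_sub, D.bimodl (D.mem _)]
    by_cases hg : g = 1
    · subst hg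
      rw [inv_one, D.u_one, mul_one, D.fix 1 (one_mem _), mul_one, sub_self]
    · rw [h1 g hg, D.E_u _ (by simpa using hg), mul_zero, sub_zero]
  have h3 : z ∈ D.A := by rw [sub_eq_zero.1 h2]; exact D.mem _
  refine D.erg z h3 fun g => ?_
  rw [← hz, mul_assoc, D.u_mul_inv, mul_one]

/-- closure of the Cartan part -/
def HA : Submodule ℂ K := ((toSubmodule D.A.toSubalgebra).map s.j).topologicalClosure

lemma coe_HA : (D.HA : Set K) = closure (s.j '' (D.A : Set Al)) := by
  rw [HA, topologicalClosure_coe]; rfl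

instance : CompleteSpace D.HA :=
  (isClosed_topologicalClosure _).completeSpace_coe

lemma mem_HA {a : Al} (ha : a ∈ D.A) : s.j a ∈ D.HA := by
  rw [← mem_coe, coe_HA]; exact subset_closure ⟨a, ha, rfl⟩

def PA : B(K) := D.HA.starProjection

lemma PA_mem (v : K) : D.PA v ∈ D.HA := starProjection_apply_mem _ _
lemma PA_fix {v : K} (hv : v ∈ D.HA) : D.PA v = v := starProjection_eq_self_iff.2 hv

lemma inner_PA {v w : K} (hw : w ∈ D.HA) : inner ℂ w (D.PA v) = inner ℂ w v := by
  have := sub_starProjection_mem_orthogonal (K := D.HA) v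
  have h2 := (mem_orthogonal _ _).1 this w hw
  rw [inner_sub_right, sub_eq_zero] at h2
  exact h2.symm

lemma HA_induction {p : K → Prop} (hc : IsClosed {v | p v}) (h : ∀ a ∈ D.A, p (s.j a)) {v : K}
    (hv : v ∈ D.HA) : p v := by
  rw [← mem_coe, coe_HA] at hv
  exact closure_minimal (by rintro _ ⟨a, ha, rfl⟩; exact h a ha) hc hv

lemma PA_j (x : Al) : D.PA (s.j x) = s.j (D.E x) := by
  refine Submodule.eq_starProjection_of_mem_orthogonal (D.mem_HA (D.mem x)) ?_
  rw [mem_orthogonal]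
  intro w hw
  refine D.HA_induction (p := fun w => inner ℂ w (s.j x - s.j (D.E x)) = 0) ?_ ?_ hw
  · exact isClosed_eq (by fun_prop) continuous_const
  · intro a ha
    rw [inner_sub_right, D.proj x a ha, sub_self]

lemma PA_norm (v : K) : ‖D.PA v‖ ≤ ‖v‖ := norm_starProjection_apply_le _ _

lemma E_norm (x : Al) : ‖s.j (D.E x)‖ ≤ ‖s.j x‖ := by rw [← PA_j]; exact D.PA_norm _

lemma A_twoClosed : TwoClosed s (D.A : Set Al) := by
  intro x hx
  rw [← coe_HA] at hx
  have h1 := D.PA_fix hx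
  rw [PA_j] at h1
  rw [← s.inj' h1]; exact D.mem x

lemma A_of_mem_HA {x : Al} (h : s.j x ∈ D.HA) : x ∈ D.A := by
  refine D.A_twoClosed x ?_
  rw [← coe_HA]; exact h

lemma R_norm_u (g : G) (v : K) : ‖s.R (D.u g) v‖ = ‖v‖ := by
  refine norm_eq_of_inner ?_
  rw [s.inner_R, D.u_star, ← mul_apply, ← s.R_mul, D.u_mul_inv, s.R_one]; rfl

lemma L_norm_u (g : G) (v : K) : ‖s.L (D.u g) v‖ = ‖v‖ := by
  refine norm_eq_of_inner ?_
  rw [s.inner_L, D.u_star, ← mul_apply, ← s.L_mul, D.u_inv_mul, s.L_one]; rfl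

/-- orthogonality -/
lemma orth {g h : G} (hgh : g ≠ h) {v w : K} (hv : v ∈ D.HA) (hw : w ∈ D.HA) :
    inner ℂ (s.R (D.u g) v) (s.R (D.u h) w) = 0 := by
  refine D.HA_induction (p := fun v => inner ℂ (s.R (D.u g) v) (s.R (D.u h) w) = 0)
    (isClosed_eq (by fun_prop) continuous_const) (fun a ha => ?_) hv
  refine D.HA_induction (p := fun w => inner ℂ (s.R (D.u g) (s.j a)) (s.R (D.u h) w) = 0)
    (isClosed_eq (by fun_prop) continuous_const) (fun b hb => ?_) hw
  rw [s.inner_R, D.u_star, s.R_j, s.R_j, mul_assoc, D.u_mul]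
  rw [← D.proj _ a ha, D.bimodl hb, D.E_u, mul_zero, map_zero, inner_zero_right]
  rwa [ne_eq, mul_inv_eq_one, eq_comm]

/-- algebraic crossed product -/
def alg : StarSubalgebra ℂ Al where
  carrier := Span {x | ∃ a ∈ D.A, ∃ g, x = a * D.u g}
  mul_mem' := by
    intro x y hx hy
    simp only [mem_coe] at *
    induction hx using Submodule.span_induction with
    | zero => simp
    | add a b _ _ ha hb => rw [add_mul]; exact add_mem ha hb
    | smul c a _ ha => rw [smul_mul_assoc]; exact Submodule.smul_mem _ _ ha
    | mem x hx =>
      obtain ⟨a, ha, g, rfl⟩ := hx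
      induction hy using Submodule.span_induction with
      | zero => simp
      | add a b _ _ ha hb => rw [mul_add]; exact add_mem ha hb
      | smul c a _ ha => rw [mul_smul_comm]; exact Submodule.smul_mem _ _ ha
      | mem y hy =>
        obtain ⟨b, hb, h, rfl⟩ := hy
        refine subset_span ⟨a * (D.u g * b * D.u g⁻¹), mul_mem ha (D.conj g b hb),
          g * h, ?_⟩
        rw [← D.u_mul]
        calc a * D.u g * (b * D.u h) = a * D.u g * b * 1 * D.u h := by simp only [mul_assoc, mul_one]
          _ = _ := by rw [← D.u_inv_mul g]; simp only [mul_assoc]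
  one_mem' := subset_span ⟨1, one_mem _, 1, by rw [D.u_one, one_mul]⟩
  add_mem' := fun hx hy => add_mem (S := Submodule ℂ Al) hx hy
  zero_mem' := zero_mem (Span _)
  algebraMap_mem' r := subset_span ⟨algebraMap ℂ Al r, D.A.algebraMap_mem r, 1,
    by rw [D.u_one, mul_one]⟩
  star_mem' := by
    intro x hx
    simp only [mem_coe] at *
    induction hx using Submodule.span_induction with
    | zero => simp
    | add a b _ _ ha hb => rw [star_add]; exact add_mem ha hb
    | smul c a _ ha => rw [star_smul]; exact Submodule.smul_mem _ _ ha
    | mem x hx =>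
      obtain ⟨a, ha, g, rfl⟩ := hx
      refine subset_span ⟨D.u g⁻¹ * star a * D.u g⁻¹⁻¹, D.conj _ _ (star_mem ha), g⁻¹, ?_⟩
      rw [star_mul, D.u_star, inv_inv, mul_assoc, D.u_mul_inv, mul_one]

lemma mem_alg {a : Al} (ha : a ∈ D.A) (g : G) : a * D.u g ∈ D.alg :=
  subset_span ⟨a, ha, g, rfl⟩

lemma cl2_alg (hcb : CB s) (x : Al) : x ∈ cl2 s D.alg := by
  let N : Submodule ℂ K := ((toSubmodule (cl2 s D.alg).toSubalgebra).map s.j).topologicalClosure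
  have hN : (N : Set K) = closure (s.j '' (cl2 s D.alg : Set Al)) := by
    simp only [N, topologicalClosure_coe]; rfl
  have : CompleteSpace N := (isClosed_topologicalClosure _).completeSpace_coe
  have hmem : ∀ z ∈ cl2 s D.alg, s.j z ∈ N := fun z hz => by
    rw [← mem_coe, hN]; exact subset_closure ⟨z, hz, rfl⟩
  have hRN : ∀ y ∈ cl2 s D.alg, ∀ v ∈ N, s.R y v ∈ N := by
    intro y hy v hv
    rw [← mem_coe, hN] at hv ⊢
    refine MapsTo.closure ?_ (s.R y).continuous hv
    rintro _ ⟨a, ha, rfl⟩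
    exact ⟨a * y, mul_mem ha hy, by simp⟩
  set P := N.starProjection with hP
  have hcomm : ∀ y ∈ cl2 s D.alg, s.R y (P (s.j x)) = P (s.R y (s.j x)) := by
    intro y hy
    refine Eq.symm <| Submodule.eq_starProjection_of_mem_orthogonal (hRN y hy _ (starProjection_apply_mem _ _)) ?_
    rw [← map_sub, mem_orthogonal]
    intro w hw
    have h1 := (mem_orthogonal _ _).1
      (sub_starProjection_mem_orthogonal (K := N) (s.j x)) _ (hRN (star y) (star_mem hy) w hw)
    rwa [s.inner_R, star_star] at h1
  obtain ⟨x', hx', he⟩ := BV hcb (cl2 s D.alg) (cl2_twoClosed _) (ξ := P (s.j x)) (C := ‖x‖)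
    (by rw [← hN]; exact starProjection_apply_mem _ _) (norm_nonneg _) (fun y hy => by
      rw [hcomm y hy]
      refine (norm_starProjection_apply_le _ _).trans ?_
      rw [s.R_j]; exact s.nj_mul x y)
  suffices x - x' = 0 by rw [sub_eq_zero.1 this]; exact hx'
  refine D.sep _ fun g => ?_
  refine s.inj _ ?_
  rw [← inner_self_eq_zero (𝕜 := ℂ), D.proj _ _ (D.mem _)]
  have h1 := (mem_orthogonal _ _).1
      (sub_starProjection_mem_orthogonal (K := N) (s.j x))
      (s.j (D.E ((x - x') * D.u g⁻¹) * D.u g)) (hmem _ (le_cl2 (D.mem_alg (D.mem _) g)))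
  rw [← hP, ← he, ← map_sub, ← s.R_j, s.inner_R, D.u_star, s.R_j] at h1
  exact h1

lemma ortho_top (hcb : CB s) {v : K} (h : ∀ g, ∀ w ∈ D.HA, inner ℂ (s.R (D.u g) w) v = 0) :
    v = 0 := by
  have h1 : ∀ x ∈ D.alg, inner ℂ (s.j x) v = 0 := by
    intro x hx
    change x ∈ Span _ at hx
    induction hx using Submodule.span_induction with
    | zero => simp
    | add a b _ _ ha hb => rw [map_add, inner_add_left, ha, hb, add_zero]
    | smul c a _ ha => rw [map_smul, inner_smul_left, ha, mul_zero]
    | mem x hx =>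
      obtain ⟨a, ha, g, rfl⟩ := hx
      rw [← s.R_j]; exact h g _ (D.mem_HA ha)
  have h2 : ∀ x, inner ℂ (s.j x) v = 0 := by
    intro x
    have : s.j x ∈ closure (s.j '' (D.alg : Set Al)) := D.cl2_alg hcb x
    refine closure_minimal (t := {w | inner ℂ w v = 0}) ?_ ?_ this
    · rintro _ ⟨a, ha, rfl⟩; exact h1 a ha
    · exact isClosed_eq (by fun_prop) continuous_const
  have h3 : (inner ℂ v v : ℂ) = 0 := by
    have : v ∈ closure (Set.range s.j) := s.dense v
    refine closure_minimal (t := {w | inner ℂ w v = 0}) ?_ ?_ this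
    · rintro _ ⟨a, rfl⟩; exact h2 a
    · exact isClosed_eq (by fun_prop) continuous_const
  exact inner_self_eq_zero.1 h3

end XD

lemma norm_unit_conj {u : Al} (h1 : star u * u = 1) (h2 : u * star u = 1) (x : Al) :
    ‖u * x * star u‖ = ‖x‖ := by
  have hu : u ∈ unitary Al := Unitary.mem_iff.2 ⟨h1, h2⟩
  rw [CStarRing.norm_mul_mem_unitary _ (Unitary.star_mem hu), CStarRing.norm_mem_unitary_mul _ hu]

lemma dix {s : Std Al K} (hcb : CB s) (U : Set Al) (hU : ∀ u ∈ U, star u * u = 1 ∧ u * star u = 1)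
    (hm : ∀ u ∈ U, ∀ v ∈ U, u * v ∈ U) (h1 : (1 : Al) ∈ U)
    (hsc : ∀ y, (∀ u ∈ U, u * y * star u = y) → ∃ c : ℂ, y = c • (1 : Al)) (x : Al) {ε : ℝ}
    (hε : 0 < ε) : ∃ z ∈ convexHull ℝ {z | ∃ u ∈ U, z = u * x * star u},
      ‖s.j (z - s.τ x • (1 : Al))‖ < ε := by
  set S : Set Al := {z | ∃ u ∈ U, z = u * x * star u} with hS
  have hSb : ∀ z ∈ convexHull ℝ S, ‖z‖ ≤ ‖x‖ := by
    intro z hz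
    have : convexHull ℝ S ⊆ closedBall 0 ‖x‖ := by
      refine convexHull_min ?_ (convex_closedBall _ _)
      rintro _ ⟨u, hu, rfl⟩
      rw [mem_closedBall_zero_iff, norm_unit_conj (hU u hu).1 (hU u hu).2]
    simpa using this hz
  have hSτ : ∀ z ∈ convexHull ℝ S, s.τ z = s.τ x := by
    intro z hz
    have : convexHull ℝ S ⊆ {z | s.τ z = s.τ x} := by
      refine convexHull_min ?_ ?_
      · rintro _ ⟨u, hu, rfl⟩
        show s.τ _ = _
        rw [s.τ_mul_comm, ← mul_assoc, (hU u hu).1, one_mul]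
      · intro a ha b hb p q hp hq hpq
        show s.τ (p • a + q • b) = s.τ x
        rw [s.τ_add, ← coe_smul, ← coe_smul, s.τ_smul, s.τ_smul, ha.out, hb.out, ← add_mul,
          ← ofReal_add, hpq, Complex.ofReal_one, one_mul]
    exact this hz
  obtain ⟨v, hv, hfix⟩ := avg_hull (S := s.j '' S) ⟨s.j x, x, ⟨1, h1, by simp⟩, rfl⟩
  have himg : convexHull ℝ (s.j '' S) = s.j '' convexHull ℝ S :=
    ((s.j.restrictScalars ℝ).image_convexHull S).symm
  rw [himg] at hv
  obtain ⟨y, hy, rfl⟩ := hcb.mem hSb hv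
  have hyc : ∀ u ∈ U, u * y * star u = y := by
    intro u hu
    have := hfix (s.R (star u) * s.L u) (fun w => by
      obtain ⟨a1, a2⟩ := hU u hu
      rw [mul_apply]
      have e1 : ∀ w, ‖s.R (star u) w‖ = ‖w‖ := fun w => by
        refine norm_eq_of_inner ?_
        rw [s.inner_R, star_star, ← mul_apply, ← s.R_mul, a1, s.R_one]; rfl
      have e2 : ∀ w, ‖s.L u w‖ = ‖w‖ := fun w => by
        refine norm_eq_of_inner ?_
        rw [s.inner_L, ← mul_apply, ← s.L_mul, a1, s.L_one]; rfl
      rw [e1, e2]) (by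
      rintro _ ⟨_, ⟨w, hw, rfl⟩, rfl⟩
      refine ⟨(u * w) * x * star (u * w), ⟨u * w, hm u hu w hw, rfl⟩, ?_⟩
      rw [mul_apply, s.L_j, s.R_j, star_mul]
      congr 1; simp only [mul_assoc])
    rw [mul_apply, s.L_j, s.R_j] at this
    exact s.inj' this
  obtain ⟨c, rfl⟩ := hsc y hyc
  have hcτ : c = s.τ x := by
    have : s.j (c • (1 : Al)) ∈ {w | inner ℂ (s.j 1) w = s.τ x} := by
      refine closure_minimal ?_ ?_ hv
      · rintro _ ⟨z, hz, rfl⟩; exact hSτ z hz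
      · exact isClosed_eq (by fun_prop) continuous_const
    have h2 : s.τ (c • (1 : Al)) = s.τ x := this
    rwa [s.τ_smul, s.τ_one, mul_one] at h2
  obtain ⟨_, ⟨z, hz, rfl⟩, hd⟩ := Metric.mem_closure_iff.1 hv ε hε
  refine ⟨z, hz, ?_⟩
  rw [dist_comm, dist_eq_norm, ← map_sub, hcτ] at hd
  exact hd

section TrU
variable {M : VonNeumannAlgebra H}

def Tr.mid (t1 t2 : Tr Al) : Tr Al where
  τ := (2⁻¹ : ℂ) • (t1.τ + t2.τ)
  one := by simp [t1.one, t2.one]; norm_num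
  comm x y := by simp [t1.comm x y, t2.comm x y]
  star_eq x := by
    have h2 : (starRingEnd ℂ) 2 = 2 := Complex.conj_ofNat 2
    simp [t1.star_eq, t2.star_eq, h2]
  nonneg x := by
    have h1 := t1.nonneg x
    have h2 := t2.nonneg x
    have : ((2⁻¹ : ℂ) • (t1.τ + t2.τ)) (star x * x) = ((2⁻¹ : ℝ) : ℂ) * (t1.τ (star x * x) + t2.τ (star x * x)) := by
      simp; ring
    rw [this, re_ofReal_mul, add_re]
    positivity
  faithful x hx := by
    have h1 := t1.nonneg x
    have h2 := t2.nonneg x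
    have h3 : (2⁻¹ : ℂ) * t1.τ (star x * x) + 2⁻¹ * t2.τ (star x * x) = 0 := by simpa using hx
    have h4 : t1.τ (star x * x) + t2.τ (star x * x) = 0 := by linear_combination 2 * h3
    have h5 := congrArg Complex.re h4
    rw [add_re, zero_re] at h5
    have him : (t1.τ (star x * x)).im = 0 := by
      have := t1.star_eq (star x * x)
      rw [star_mul, star_star] at this
      exact Complex.conj_eq_iff_im.1 this.symm
    exact t1.faithful x (Complex.ext (by rw [zero_re]; linarith) him)

lemma trace_unique_aux (t t' : Tr (MM M)) (hf : IsFactorSet (M : Set B(H)))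
    (hle : ∀ x, (t.τ (star x * x)).re ≤ 2 * (t'.τ (star x * x)).re) (x : MM M) : t.τ x = t'.τ x := by
  have hcb : CB t'.std := CB_of_factor _ hf
  have hτ : ∀ (t : Tr (MM M)) x, t.std.τ x = t.τ x := fun t x => by
    rw [Std.τ, Tr.std_inner, star_one, one_mul]
  by_contra hne
  have hpos : 0 < ‖t.τ x - t'.τ x‖ := norm_pos_iff.2 (sub_ne_zero.2 hne)
  obtain ⟨z, hz, hd⟩ := dix hcb {u : MM M | star u * u = 1 ∧ u * star u = 1} (fun u hu => hu)
    (fun u hu v hv => ⟨by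
      rw [star_mul, mul_assoc, ← mul_assoc (star u), hu.1, one_mul, hv.1], by
      rw [star_mul, mul_assoc, ← mul_assoc v, hv.2, one_mul, hu.2]⟩) (by simp) (fun y hy => by
      have hcom : ∀ z : MM M, y * z = z * y := by
        intro z
        have hz : z ∈ Span ((unitary (MM M)) : Set (MM M)) := by
          rw [CStarAlgebra.span_unitary]; trivial
        induction hz using Submodule.span_induction with
        | zero => simp
        | add a b _ _ ha hb => rw [add_mul, mul_add, ha, hb]
        | smul c a _ ha => rw [smul_mul_assoc, mul_smul_comm, ha]
        | mem u hu =>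
          have hu' := Unitary.mem_iff.1 hu
          have := hy u hu'
          calc y * u = u * y * star u * u := by rw [this]
            _ = u * y := by rw [mul_assoc, hu'.1, mul_one]
      obtain ⟨c, hc⟩ := hf y y.2 (fun z hz => val_eq (hcom ⟨z, hz⟩))
      exact ⟨c, Subtype.ext hc⟩) x (half_pos hpos)
  rw [hτ] at hd
  have hzτ : t.τ z = t.τ x := by
    have : convexHull ℝ {z | ∃ u ∈ {u : MM M | star u * u = 1 ∧ u * star u = 1}, z = u * x * star u} ⊆
        {z | t.τ z = t.τ x} := by
      refine convexHull_min ?_ ?_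
      · rintro _ ⟨u, hu, rfl⟩
        show t.τ _ = _
        rw [t.comm, ← mul_assoc, hu.1, one_mul]
      · intro a ha b hb p q hp hq hpq
        show t.τ (p • a + q • b) = t.τ x
        rw [map_add, ← coe_smul, ← coe_smul, map_smul, map_smul, ha.out, hb.out,
          ← add_smul, ← ofReal_add, hpq, Complex.ofReal_one, one_smul]
    exact this hz
  set b := z - t'.τ x • (1 : MM M) with hb
  have e1 : t.τ b = t.τ x - t'.τ x := by rw [hb, map_sub, map_smul, t.one, hzτ]; simp
  have e2 : ‖t.τ b‖ ≤ ‖t.std.j b‖ := by rw [← hτ]; exact t.std.τ_norm_le b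
  have e3 : ‖t.std.j b‖ ^ 2 ≤ 2 * ‖t'.std.j b‖ ^ 2 := by
    rw [← re_τ_star_mul, ← re_τ_star_mul, hτ, hτ]; exact hle b
  rw [e1] at e2
  nlinarith [norm_nonneg (t'.std.j b), norm_nonneg (t.std.j b)]

lemma trace_unique (t1 t2 : Tr (MM M)) (hf : IsFactorSet (M : Set B(H))) (x : MM M) :
    t1.τ x = t2.τ x := by
  have hm : ∀ x, ((t1.mid t2).τ (star x * x)).re = 2⁻¹ * ((t1.τ (star x * x)).re + (t2.τ (star x * x)).re) := by
    intro x
    have : (t1.mid t2).τ (star x * x) = ((2⁻¹ : ℝ) : ℂ) * (t1.τ (star x * x) + t2.τ (star x * x)) := by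
      simp [Tr.mid]; ring
    rw [this, re_ofReal_mul, add_re]
  have h1 := trace_unique_aux t1 (t1.mid t2) hf (fun x => by
    rw [hm]; have := t2.nonneg x; linarith) x
  have h2 := trace_unique_aux t2 (t1.mid t2) hf (fun x => by
    rw [hm]; have := t1.nonneg x; linarith) x
  rw [h1, h2]
end TrU

section XDof
variable {G : Type} [Group G]

/-- linear endomorphism of `MM M` from a conditional expectation -/
def exE (X : CrossedProduct G H) : MM X.M →ₗ[ℂ] MM X.M where
  toFun x := ⟨X.EA.E x, X.A_sub (X.EA.mem x x.2)⟩
  map_add' x y := Subtype.ext (by simp)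
  map_smul' c x := Subtype.ext (by simp)

def trOf (X : CrossedProduct G H) : Tr (MM X.M) where
  τ := X.tr.τ.comp X.M.toStarSubalgebra.toSubalgebra.toSubmodule.subtype
  one := X.tr.unital
  comm x y := X.tr.tracial x x.2 y y.2
  star_eq x := X.tr.star_eq x x.2
  nonneg x := (X.tr.nonneg x x.2).1
  faithful x h := Subtype.ext (X.tr.faithful x x.2 h)

/-- the Cartan subalgebra inside `MM` -/
def exA (X : CrossedProduct G H) : StarSubalgebra ℂ (MM X.M) :=
  X.A.toStarSubalgebra.comap X.M.toStarSubalgebra.subtype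

def xdOf (X : CrossedProduct G H) (φ : MM X.M ≃⋆ₐ[ℂ] Al) (s : Std Al K)
    (hτ : ∀ x, s.τ (φ x) = X.tr.τ x) (hab : IsAbelianSet (X.A : Set B(H)))
    (hfree : IsFree X) (herg : IsErgodic X) : XD G s where
  A := (exA X).map φ.toStarAlgHom
  u g := φ ⟨X.u g, X.u_mem g⟩
  u_one := by rw [← map_one φ]; congr 1; exact Subtype.ext X.u_one
  u_mul g h := by rw [← map_mul]; congr 1; exact Subtype.ext (X.u_mul g h)
  u_star g := by rw [← map_star]; congr 1; exact Subtype.ext (X.u_star g)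
  conj := by
    rintro g _ ⟨a, ha, rfl⟩
    refine ⟨⟨X.u g, X.u_mem g⟩ * a * ⟨X.u g⁻¹, X.u_mem g⁻¹⟩, ?_, ?_⟩
    · have := X.conj_mem g a ha
      rw [X.u_star] at this
      exact this
    · show φ _ = φ _ * φ _ * φ _
      rw [map_mul, map_mul]
  E := (φ : MM X.M →ₗ[ℂ] Al) ∘ₗ exE X ∘ₗ (φ.symm : Al →ₗ[ℂ] MM X.M)
  mem x := ⟨exE X (φ.symm x), X.EA.mem _ (φ.symm x).2, rfl⟩
  fix := by
    rintro _ ⟨a, ha, rfl⟩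
    show φ (exE X (φ.symm (φ a))) = φ a
    rw [symm_apply_apply]
    congr 1
    exact Subtype.ext (X.EA.fix a ha)
  bimod := by
    rintro _ ⟨a, ha, rfl⟩ _ ⟨b, hb, rfl⟩ x
    show φ (exE X (φ.symm (φ a * x * φ b))) = φ a * φ (exE X (φ.symm x)) * φ b
    rw [map_mul φ.symm, map_mul φ.symm, symm_apply_apply, symm_apply_apply, ← map_mul φ,
      ← map_mul φ]
    congr 1
    exact Subtype.ext (X.EA.bimod a ha b hb _ (φ.symm x).2)
  proj := by
    rintro x _ ⟨a, ha, rfl⟩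
    show inner ℂ (s.j (φ a)) (s.j (φ (exE X (φ.symm x)))) = inner ℂ (s.j (φ a)) (s.j x)
    rw [← s.τ_star_mul, ← s.τ_star_mul, ← map_star, ← map_mul, hτ]
    have hx : x = φ (φ.symm x) := (apply_symm_apply _ _).symm
    have e2 : s.τ (φ (star a) * x) = X.tr.τ ((star a * φ.symm x : MM X.M) : B(H)) := by
      rw [← hτ, map_mul, ← hx]
    rw [e2, ← X.EA.trace_eq _ (star a * φ.symm x).2]
    congr 1
    have := X.EA.bimod (star a) (star_mem ha) 1 (one_mem _) _ (φ.symm x).2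
    rw [mul_one, mul_one] at this
    exact this.symm
  E_u g hg := by
    show φ (exE X (φ.symm (φ _))) = 0
    rw [symm_apply_apply, ← map_zero φ]
    congr 1
    exact Subtype.ext (X.EA_u g hg)
  sep x hx := by
    have : φ.symm x = 0 := by
      refine Subtype.ext (X.fourier_sep _ (φ.symm x).2 fun g => ?_)
      have h1 : φ (exE X (φ.symm (x * φ ⟨X.u g⁻¹, X.u_mem g⁻¹⟩))) = 0 := hx g
      rw [map_mul, symm_apply_apply, ← map_zero φ] at h1
      have h2 := val_eq (φ.injective h1)
      rw [X.u_star]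
      exact h2
    rw [← apply_symm_apply φ x, this, map_zero]
  comm := by
    rintro _ ⟨a, ha, rfl⟩ _ ⟨b, hb, rfl⟩
    show φ a * φ b = φ b * φ a
    rw [← map_mul, ← map_mul]
    congr 1
    exact Subtype.ext (hab a ha b hb)
  free := by
    rintro g hg _ ⟨a, ha, rfl⟩ h
    show φ a = 0
    rw [← map_zero φ]
    congr 1
    refine Subtype.ext (hfree g hg a ha fun b hb => ?_)
    have h1 := h _ ⟨⟨b, X.A_sub hb⟩, hb, rfl⟩
    have h2 : φ (⟨X.u g, X.u_mem g⟩ * ⟨b, X.A_sub hb⟩ * ⟨X.u g⁻¹, X.u_mem g⁻¹⟩ * a) =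
        φ (a * ⟨b, X.A_sub hb⟩) := by rw [map_mul, map_mul, map_mul, map_mul]; exact h1
    have h3 := val_eq (φ.injective h2)
    rw [CrossedProduct.σ, X.u_star]
    exact h3
  erg := by
    rintro _ ⟨a, ha, rfl⟩ h
    obtain ⟨c, hc⟩ := herg a ha fun g => by
      have h1 := h g
      have h2 : φ (⟨X.u g, X.u_mem g⟩ * a * ⟨X.u g⁻¹, X.u_mem g⁻¹⟩) = φ a := by
        rw [map_mul, map_mul]; exact h1
      have h3 := val_eq (φ.injective h2)
      rw [CrossedProduct.σ, X.u_star]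
      exact h3
    refine ⟨c, ?_⟩
    show φ a = c • 1
    rw [← map_one φ, ← map_smul]
    congr 1
    exact Subtype.ext hc

lemma factorOf (X : CrossedProduct G H) (hab : IsAbelianSet (X.A : Set B(H)))
    (hfree : IsFree X) (herg : IsErgodic X) : IsFactorSet (X.M : Set B(H)) := by
  intro x hx hc
  let D := xdOf X (refl ℂ (MM X.M)) (trOf X).std (fun x => by
    show inner ℂ _ _ = _
    rw [Tr.std_inner, star_one, one_mul]; rfl) hab hfree herg
  obtain ⟨c, h⟩ := D.factor ⟨x, hx⟩ fun y => Subtype.ext (hc y y.2)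
  exact ⟨c, val_eq h⟩

/-- the star isomorphism -/
def isoOf {H₂ : Type} [NormedAddCommGroup H₂] [InnerProductSpace ℂ H₂] [CompleteSpace H₂]
    {M : VonNeumannAlgebra H} {N : VonNeumannAlgebra H₂}
    (Θ : StarIsoOn (M : Set B(H)) (N : Set (H₂ →L[ℂ] H₂))) : MM M ≃⋆ₐ[ℂ] MM N :=
  StarAlgEquiv.ofBijective (B := MM N)
    ({ toFun := fun x => ⟨Θ.Θ x, Θ.mem x x.2⟩
       map_one' := Subtype.ext Θ.map_one
       map_mul' := fun x y => Subtype.ext (Θ.map_mul x x.2 y y.2)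
       map_zero' := Subtype.ext (by
         have := Θ.map_smul 0 0 (zero_mem M)
         rw [zero_smul, zero_smul] at this
         exact this)
       map_add' := fun x y => Subtype.ext (Θ.map_add x x.2 y y.2)
       commutes' := fun r => Subtype.ext (by
         have := Θ.map_smul r 1 (one_mem M)
         rw [Θ.map_one] at this
         show Θ.Θ (algebraMap ℂ B(H) r) = algebraMap ℂ (H₂ →L[ℂ] H₂) r
         rw [Algebra.algebraMap_eq_smul_one, Algebra.algebraMap_eq_smul_one]
         exact this)
       map_star' := fun x => Subtype.ext (Θ.map_star x x.2) } : MM M →⋆ₐ[ℂ] MM N)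
    ⟨fun x y h => Subtype.ext (Θ.inj x x.2 y y.2 (val_eq h)),
     fun y => by
      obtain ⟨x, hx, h⟩ := Θ.surj y y.2
      exact ⟨⟨x, hx⟩, Subtype.ext h⟩⟩

end XDof

end

section

lemma enn_sq (v : K) : ‖v‖ₑ ^ 2 = ENNReal.ofReal (‖v‖ ^ 2) := by
  rw [ofReal_pow (norm_nonneg _), ofReal_norm]
lemma enn_sqC (v : ℂ) : ‖v‖ₑ ^ 2 = ENNReal.ofReal (‖v‖ ^ 2) := by
  rw [ofReal_pow (norm_nonneg _), ofReal_norm]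

lemma enn_conj (v w : K) : ‖inner ℂ v w‖ₑ = ‖inner ℂ w v‖ₑ := by
  rw [← ofReal_norm, ← ofReal_norm, norm_inner_symm]

lemma enn_of_norm {F E' : Type*} [NormedAddCommGroup F] [NormedAddCommGroup E'] {v : F} {w : E'}
    (h : ‖v‖ = ‖w‖) : ‖v‖ₑ = ‖w‖ₑ := by rw [← ofReal_norm, ← ofReal_norm, h]

lemma parse_hb {j : Type*} (b : HilbertBasis j ℂ K) (v : K) :
    ∑' i, ‖inner ℂ (b i) v‖ₑ ^ 2 = ‖v‖ₑ ^ 2 := by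
  have h := b.hasSum_inner_mul_inner v v
  have h2 : HasSum (fun i => ‖inner ℂ (b i) v‖ ^ 2) (‖v‖ ^ 2) := by
    have h3 := (Complex.hasSum_re h)
    rw [inner_selfC, ofReal_re] at h3
    convert h3 using 2 with i
    rw [← inner_conj_symm v (b i), ← Complex.normSq_eq_conj_mul_self, ofReal_re,
      Complex.normSq_eq_norm_sq]
  rw [enn_sq, ← h2.tsum_eq, ofReal_tsum_of_nonneg (fun _ => by positivity) h2.summable]
  exact tsum_congr fun i => enn_sqC _

lemma bessel {j : Type*} {f : j → K} (hf : Orthonormal ℂ f) (v : K) :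
    ∑' i, ‖inner ℂ (f i) v‖ₑ ^ 2 ≤ ‖v‖ₑ ^ 2 := by
  rw [enn_sq]
  simp only [enn_sqC]
  rw [← ofReal_tsum_of_nonneg (fun _ => by positivity) (hf.inner_products_summable v)]
  exact ofReal_le_ofReal (hf.tsum_inner_products_le v)

lemma parse_tot {j : Type*} {f : j → K} (hf : Orthonormal ℂ f)
    (ht : ∀ v, (∀ i, inner ℂ (f i) v = 0) → v = 0) (v : K) :
    ∑' i, ‖inner ℂ (f i) v‖ₑ ^ 2 = ‖v‖ₑ ^ 2 := by
  have hb : (Span (Set.range f))ᗮ = ⊥ := by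
    rw [eq_bot_iff]
    intro w hw
    exact (mem_bot ℂ).2 (ht w fun i =>
      (mem_orthogonal _ _).1 hw _ (subset_span ⟨i, rfl⟩))
  have := parse_hb (HilbertBasis.mkOfOrthogonalEqBot hf hb) v
  rwa [HilbertBasis.coe_mkOfOrthogonalEqBot] at this

lemma inner_star_swap (P : B(K)) (v w : K) : inner ℂ (star P v) w = inner ℂ v (P w) := by
  rw [star_eq_adjoint, adjoint_inner_left]
lemma inner_star_swap' (P : B(K)) (v w : K) : inner ℂ v (star P w) = inner ℂ (P v) w := by
  rw [star_eq_adjoint, adjoint_inner_right]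

lemma parse_proj {j : Type*} {f : j → K} (hf : Orthonormal ℂ f) {P : B(K)}
    (hPf : ∀ i, P (f i) = f i)
    (ht : ∀ v, (∀ i, inner ℂ (f i) v = 0) → P v = 0) (v : K) :
    ∑' i, ‖inner ℂ (f i) v‖ₑ ^ 2 = ‖P v‖ₑ ^ 2 := by
  let U : Submodule ℂ K := (Span (Set.range f)).topologicalClosure
  have : CompleteSpace U := (isClosed_topologicalClosure _).completeSpace_coe
  have hfU : ∀ i, f i ∈ U := fun i => le_topologicalClosure _ (subset_span ⟨i, rfl⟩)
  have hPU : ∀ w ∈ U, P w = w := by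
    intro w hw
    have : U ≤ LinearMap.eqLocus (P : K →ₗ[ℂ] K) LinearMap.id := by
      refine topologicalClosure_minimal _ ?_ ?_
      · rw [span_le]; rintro _ ⟨i, rfl⟩; exact hPf i
      · exact isClosed_eq P.continuous continuous_id
    exact this hw
  set w := U.starProjection v with hw
  have hwU : w ∈ U := starProjection_apply_mem _ _
  have ho : ∀ i, inner ℂ (f i) v = inner ℂ (f i) w := by
    intro i
    have := (mem_orthogonal _ _).1 (sub_starProjection_mem_orthogonal (K := U) v) _ (hfU i)
    rwa [inner_sub_right, sub_eq_zero] at this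
  have hPv : P v = w := by
    have := ht (v - w) fun i => by rw [inner_sub_right, ho, sub_self]
    rw [map_sub, hPU w hwU, sub_eq_zero] at this
    exact this
  rw [hPv]
  have := parse_tot (K := U) (f := fun i => (⟨f i, hfU i⟩ : U))
    (by rw [orthonormal_iff_ite] at hf ⊢; exact hf) (by
    rintro ⟨z, hz⟩ h
    refine Subtype.ext ?_
    have h2 : ∀ i, inner ℂ (f i) z = 0 := h
    have := ht z h2
    rwa [hPU z hz] at this) ⟨w, hwU⟩
  simp only [ho]
  exact this

/-- free unitary representation with a basis -/
structure FR (G : Type) [Group G] (K : Type) [NormedAddCommGroup K] [InnerProductSpace ℂ K]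
    [CompleteSpace K] where
  ρ : G → B(K)
  inn : ∀ g v w, inner ℂ (ρ g v) w = inner ℂ v (ρ g⁻¹ w)
  mul : ∀ g h v, ρ g (ρ h v) = ρ (g * h) v
  one : ∀ v, ρ 1 v = v
  I : Type
  e : I → K
  orth : Orthonormal ℂ (fun p : I × G => ρ p.2 (e p.1))
  tot : ∀ v, (∀ i g, inner ℂ (ρ g (e i)) v = 0) → v = 0

namespace FR
variable {G : Type} [Group G] (F : FR G K)

def Cm (T : B(K)) : Prop := ∀ g v, T (F.ρ g v) = F.ρ g (T v)
variable {F}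
lemma Cm.mul {S T : B(K)} (hS : F.Cm S) (hT : F.Cm T) : F.Cm (S * T) := fun g v => by
  simp only [mul_apply]; rw [hT, hS]
lemma Cm.add {S T : B(K)} (hS : F.Cm S) (hT : F.Cm T) : F.Cm (S + T) := fun g v => by
  simp only [add_apply]; rw [hT, hS, map_add]
lemma Cm.sub {S T : B(K)} (hS : F.Cm S) (hT : F.Cm T) : F.Cm (S - T) := fun g v => by
  simp only [sub_apply]; rw [hT, hS, map_sub]
lemma Cm.smul {T : B(K)} (c : ℂ) (hT : F.Cm T) : F.Cm (c • T) := fun g v => by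
  simp only [smul_apply]; rw [hT, map_smul]
lemma Cm.one : F.Cm (1 : B(K)) := fun g v => rfl
lemma Cm.zero : F.Cm (0 : B(K)) := fun g v => by simp
lemma Cm.star {T : B(K)} (hT : F.Cm T) : F.Cm (star T) := fun g v => by
  refine ext_inner_left ℂ fun w => ?_
  rw [inner_star_swap', ← inv_inv g, ← F.inn, ← F.inn, ← hT, inner_star_swap']

variable (F)
lemma parse (v : K) : ∑' i, ∑' g, ‖inner ℂ (F.ρ g (F.e i)) v‖ₑ ^ 2 = ‖v‖ₑ ^ 2 := by
  rw [← tsum_prod]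
  exact parse_tot F.orth (fun v h => F.tot v fun i g => h (i, g)) v

def hs (T : B(K)) : ℝ≥0∞ := ∑' i, ‖T (F.e i)‖ₑ ^ 2

lemma hs_zero : F.hs 0 = 0 := by simp [hs]

variable {F}

lemma tsum_inv {f : G → ℝ≥0∞} : ∑' g, f g⁻¹ = ∑' g, f g := (Equiv.inv G).tsum_eq f

/-- the basic double counting -/
lemma count {J : Type*} (T : B(K)) (hT : F.Cm T) (q : J → K) :
    ∑' i, ∑' t, ∑' g, ‖inner ℂ (F.ρ g (q t)) (T (F.e i))‖ₑ ^ 2 = ∑' t, ‖star T (q t)‖ₑ ^ 2 := by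
  rw [tsum_comm]
  refine tsum_congr fun t => ?_
  rw [← F.parse]
  refine tsum_congr fun i => ?_
  rw [← tsum_inv]
  refine tsum_congr fun g => ?_
  rw [enn_conj (F.ρ g (F.e i)), inner_star_swap, hT, F.inn, inv_inv]

lemma hs_star {T : B(K)} (hT : F.Cm T) : F.hs (star T) = F.hs T := by
  have := count T hT F.e
  simp only [F.parse] at this
  exact this.symm

lemma hs_mul_left (S T : B(K)) : F.hs (S * T) ≤ ‖S‖ₑ ^ 2 * F.hs T := by
  rw [hs, hs, ← ENNReal.tsum_mul_left]
  refine tsum_le_tsum fun i => ?_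
  rw [← mul_pow]
  gcongr
  exact le_opENorm _ _

lemma hs_mul_right {T X : B(K)} (hT : F.Cm T) (hX : F.Cm X) : F.hs (T * X) ≤ ‖X‖ₑ ^ 2 * F.hs T := by
  rw [← hs_star (hT.mul hX), ← hs_star hT, star_mul]
  refine (hs_mul_left _ _).trans ?_
  rw [enn_of_norm (norm_star X)]

lemma hs_iso {U : B(K)} (hU : ∀ v, ‖U v‖ = ‖v‖) (T : B(K)) : F.hs (U * T) = F.hs T :=
  tsum_congr fun i => by rw [mul_apply, enn_of_norm (hU _)]

lemma hs_iso_right {U T : B(K)} (hU : ∀ v, ‖star U v‖ = ‖v‖) (hT : F.Cm T) (hC : F.Cm U) :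
    F.hs (T * U) = F.hs T := by
  rw [← hs_star (hT.mul hC), star_mul, hs_iso hU, hs_star hT]

lemma enn_add_sq (a b : K) : ‖a + b‖ₑ ^ 2 ≤ 2 * (‖a‖ₑ ^ 2 + ‖b‖ₑ ^ 2) := by
  rw [enn_sq, enn_sq, enn_sq, ← ENNReal.ofReal_add (by positivity) (by positivity),
    ← ofReal_ofNat 2, ← ofReal_mul (by norm_num)]
  refine ofReal_le_ofReal ?_
  have := norm_add_le a b
  nlinarith [norm_nonneg (a + b), sq_nonneg (‖a‖ - ‖b‖)]

lemma hs_add (S T : B(K)) : F.hs (S + T) ≤ 2 * (F.hs S + F.hs T) := by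
  rw [hs, hs, hs, ← ENNReal.tsum_add, ← ENNReal.tsum_mul_left]
  exact tsum_le_tsum fun i => enn_add_sq _ _

lemma hs_neg (T : B(K)) : F.hs (-T) = F.hs T := tsum_congr fun i => by simp

lemma hs_sub (S T : B(K)) : F.hs (S - T) ≤ 2 * (F.hs S + F.hs T) := by
  rw [sub_eq_add_neg, ← hs_neg T]; exact hs_add _ _

lemma hs_smul (c : ℂ) (T : B(K)) : F.hs (c • T) = ‖c‖ₑ ^ 2 * F.hs T := by
  rw [hs, hs, ← ENNReal.tsum_mul_left]
  refine tsum_congr fun i => ?_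
  rw [smul_apply, enorm_smul, mul_pow]

lemma hs_eq_zero {T : B(K)} (hT : F.Cm T) (h : F.hs T = 0) : T = 0 := by
  have h1 : ∀ i, T (F.e i) = 0 := fun i => by
    have := ENNReal.tsum_eq_zero.1 h i
    simpa using this
  have h2 : ∀ v, star T v = 0 := fun v => F.tot _ fun i g => by
    rw [inner_star_swap', hT, h1, map_zero, inner_zero_left]
  ext v
  have : inner ℂ (T v) (T v) = (0 : ℂ) := by rw [← inner_star_swap', h2, inner_zero_right]
  simpa using this

/-- Hilbert-Schmidt norm through a basis of the range -/
lemma hsp {J : Type*} {p : B(K)} (hps : star p = p) {q : J → K}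
    (hq : Orthonormal ℂ (fun x : J × G => F.ρ x.2 (q x.1))) (hpC : F.Cm p) (hpq : ∀ t, p (q t) = q t)
    (ht : ∀ v, (∀ t g, inner ℂ (F.ρ g (q t)) v = 0) → p v = 0) {T : B(K)} (hT : F.Cm T) :
    F.hs (T * p) = ∑' t, ‖T (q t)‖ₑ ^ 2 := by
  rw [← hs_star (hT.mul hpC), star_mul, hps]
  have := count (star T) hT.star q
  rw [star_star] at this
  rw [← this]
  refine tsum_congr fun i => ?_
  rw [← tsum_prod, mul_apply]
  refine (parse_proj hq (fun x => ?_) (fun v h => ht v fun t g => h (t, g)) _).symm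
  rw [hpC, hpq]

lemma bs {J : Type} {p : B(K)} (hps : star p = p) {q : J → K} (hpC : F.Cm p)
    (hq : Orthonormal ℂ (fun x : J × G => F.ρ x.2 (q x.1))) (hpq : ∀ t, p (q t) = q t) :
    ∑' t, ‖q t‖ₑ ^ 2 ≤ F.hs p := by
  have h1 := count p hpC q
  rw [hps] at h1
  simp only [hpq] at h1
  rw [← h1]
  refine tsum_le_tsum fun i => ?_
  rw [← tsum_prod]
  exact bessel hq _

end FR

end

section

/-- property (T), quantitative form -/
lemma propT_near {G : Type} [Group G] (hT : HasPropertyT G) {δ : ℝ} (hδ : 0 < δ) :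
    ∃ S : Finset G, ∃ κ : ℝ, 0 < κ ∧ ∀ (K : Type) (_i1 : NormedAddCommGroup K)
      (_i2 : InnerProductSpace ℂ K) (_i3 : CompleteSpace K) (π : G → B(K)), π 1 = 1 →
      (∀ γ δ : G, π (γ * δ) = π γ * π δ) → (∀ (γ : G) (ξ : K), ‖π γ ξ‖ = ‖ξ‖) → ∀ ξ : K,
      (∀ s ∈ S, ‖π s ξ - ξ‖ ≤ κ * ‖ξ‖) → ∀ g, ‖π g ξ - ξ‖ ≤ δ * ‖ξ‖ := by
  obtain ⟨S, ε, hε, H⟩ := hT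
  refine ⟨S, ε * δ / 2 , by positivity, ?_⟩
  intro K _ _ _ π h1 hm hi ξ hξ g
  have hinn : ∀ g v w, inner ℂ (π g v) (π g w) = inner ℂ v w := fun g v w =>
    (⟨(π g).toLinearMap, hi g⟩ : K →ₗᵢ[ℂ] K).inner_map_map v w
  let N : Submodule ℂ K :=
    { carrier := {v | ∀ g, π g v = v}
      add_mem' := fun {a b} ha hb g => by rw [map_add, ha, hb]
      zero_mem' := fun g => map_zero _
      smul_mem' := fun c a ha g => by rw [map_smul, ha] }
  have hNc : IsClosed (N : Set K) := by
    have : (N : Set K) = ⋂ g, {v | π g v = v} := by ext; simp [N]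
    rw [this]
    exact isClosed_iInter fun g => isClosed_eq (π g).continuous continuous_id
  have : CompleteSpace N := hNc.completeSpace_coe
  have hperp : ∀ g, ∀ v ∈ Nᗮ, π g v ∈ Nᗮ := fun g v hv n hn => by
    have : inner ℂ (π g n) (π g v) = 0 := by rw [hinn]; exact hv n hn
    rwa [hn g] at this
  obtain ⟨η, hη, ζ, hζ, rfl⟩ := N.exists_add_mem_mem_orthogonal ξ
  have hd : ∀ g, π g (η + ζ) - (η + ζ) = π g ζ - ζ := fun g => by rw [map_add, hη g]; abel
  have key : ‖ζ‖ ≤ δ / 2 * ‖η + ζ‖ := by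
    by_contra hcon
    push Not at hcon
    have hζ0 : 0 < ‖ζ‖ := lt_of_le_of_lt (by positivity) hcon
    have := H Nᗮ inferInstance inferInstance inferInstance
      (fun g => ((π g).comp Nᗮ.subtypeL).codRestrict Nᗮ fun v => hperp g v v.2)
      (by ext v; simp [h1]) (fun a b => by ext v; simp [hm]; rfl) (fun g v => hi g v)
      ⟨((‖ζ‖⁻¹ : ℝ) : ℂ) • ⟨ζ, hζ⟩, by
        rw [norm_smul]; simp [hζ0.ne'], fun s hs => by
        rw [map_smul, ← smul_sub, norm_smul]
        have h3 := hξ s hs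
        rw [hd] at h3
        have h4 : ‖π s ζ - ζ‖ < ε * ‖ζ‖ := by
          calc _ ≤ _ := h3
            _ = ε * (δ / 2 * ‖η + ζ‖) := by ring
            _ < _ := by gcongr
        have h5 : ‖((‖ζ‖⁻¹ : ℝ) : ℂ)‖ = ‖ζ‖⁻¹ := by simp
        rw [h5]
        change ‖ζ‖⁻¹ * ‖π s ζ - ζ‖ < ε
        rw [inv_mul_lt_iff₀ hζ0, mul_comm]; exact h4⟩
    obtain ⟨v, hv0, hv⟩ := this
    apply hv0
    have hvN : (v : K) ∈ N := fun g => val_eq (hv g)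
    have := v.2 v hvN
    exact Subtype.ext (inner_self_eq_zero.1 this)
  rw [hd]
  have := norm_sub_le (π g ζ) ζ
  rw [hi] at this
  linarith

namespace FR
variable {G : Type} [Group G] (F : FR G K)

def V0 : Submodule ℂ B(K) where
  carrier := {T | F.Cm T ∧ F.hs T < ⊤}
  add_mem' := fun {a b} ha hb => ⟨ha.1.add hb.1, (hs_add a b).trans_lt
    (mul_lt_top (by simp) (ENNReal.add_lt_top.2 ⟨ha.2, hb.2⟩))⟩
  zero_mem' := ⟨Cm.zero, by simp [F.hs_zero]⟩
  smul_mem' := fun c a ha => ⟨ha.1.smul c, by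
    rw [hs_smul]; exact mul_lt_top (by finiteness) ha.2⟩

lemma summ_of_fin {I : Type*} {f : I → K} (h : ∑' i, ‖f i‖ₑ ^ 2 < ⊤) : Memℓp f 2 := by
  refine memℓp_gen ?_
  simp only [enn_sq] at h
  have := ENNReal.summable_toReal h.ne
  refine this.congr fun i => ?_
  rw [ENNReal.toReal_ofReal (by positivity)]
  norm_num

lemma lp_norm {I : Type*} (f : lp (fun _ : I => K) 2) : ‖f‖ₑ ^ 2 = ∑' i, ‖f i‖ₑ ^ 2 := by
  have h := lp.norm_rpow_eq_tsum (p := 2) (by norm_num) f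
  have hs := (lp.memℓp f).summable (by norm_num)
  norm_num at h hs
  rw [show ‖f‖ₑ ^ 2 = ENNReal.ofReal (‖f‖ ^ 2) by
    rw [← ofReal_norm_eq_enorm, ofReal_pow (norm_nonneg _)], h,
    ofReal_tsum_of_nonneg (fun i => by positivity) hs]
  exact tsum_congr fun i => (enn_sq _).symm

def vec0 : F.V0 →ₗ[ℂ] lp (fun _ : F.I => K) 2 where
  toFun := fun T => ⟨fun i => T.1 (F.e i), summ_of_fin T.2.2⟩
  map_add' := fun _ _ => rfl
  map_smul' := fun _ _ => rfl

abbrev HS : Type := (LinearMap.range F.vec0).topologicalClosure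

def vec : F.V0 →ₗ[ℂ] F.HS :=
  F.vec0.codRestrict _ fun T => le_topologicalClosure _ ⟨T, rfl⟩

lemma vec_enorm (T : F.V0) : ‖F.vec T‖ₑ ^ 2 = F.hs T.1 := lp_norm _

lemma vec_dense : DenseRange F.vec := by
  intro v
  have := v.2
  rw [← mem_coe, topologicalClosure_coe, mem_closure_iff_seq_limit] at this
  obtain ⟨f, hf, hl⟩ := this
  choose T hT using hf
  refine mem_closure_iff_seq_limit.2 ⟨fun n => F.vec (T n), fun n => ⟨_, rfl⟩, ?_⟩
  rw [tendsto_subtype_rng]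
  exact hl.congr fun n => (hT n).symm

lemma vec_inj {T : F.V0} (h : F.vec T = 0) : T = 0 := by
  have := F.vec_enorm T
  rw [h] at this
  exact Subtype.ext (hs_eq_zero T.2.1 (by rw [← this, ← ofReal_norm, norm_zero]; simp))

/-- unitary representation commuting with F -/
structure UR (F : FR G K) (Λ : Type) [Group Λ] where
  U : Λ → B(K)
  one : U 1 = 1
  mul : ∀ g h, U (g * h) = U g * U h
  st : ∀ g, star (U g) = U g⁻¹
  cm : ∀ g, F.Cm (U g)

namespace UR
variable {F} {Λ : Type} [Group Λ] (u : UR F Λ)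

lemma inv_mul (g : Λ) : u.U g⁻¹ * u.U g = 1 := by rw [← u.mul, inv_mul_cancel, u.one]
lemma mul_inv (g : Λ) : u.U g * u.U g⁻¹ = 1 := by rw [← u.mul, mul_inv_cancel, u.one]
lemma iso (g : Λ) (v : K) : ‖u.U g v‖ = ‖v‖ := by
  refine norm_eq_of_inner ?_
  rw [← inner_star_swap, u.st, ← mul_apply, u.inv_mul]; rfl
lemma norm_le (g : Λ) : ‖u.U g‖ ≤ 1 :=
  opNorm_le_bound _ zero_le_one fun v => by rw [u.iso, one_mul]
lemma iso' (g : Λ) (v : K) : ‖star (u.U g) v‖ = ‖v‖ := by rw [u.st, u.iso]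

lemma hs_cj (g : Λ) {T : B(K)} (hT : F.Cm T) : F.hs (u.U g * T * u.U g⁻¹) = F.hs T := by
  rw [mul_assoc, hs_iso (u.iso g), hs_iso_right (fun v => u.iso' _ v) hT (u.cm _)]

lemma hs_cj' (g : Λ) {T : B(K)} (hT : F.Cm T) :
    F.hs (u.U g * T - T * u.U g) = F.hs (u.U g * T * u.U g⁻¹ - T) := by
  rw [← hs_iso_right (U := u.U g⁻¹) (fun v => u.iso' _ v) (((u.cm g).mul hT).sub (hT.mul (u.cm g))) (u.cm _),
    sub_mul, mul_assoc T, u.mul_inv, mul_one]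

def cj (g : Λ) : F.V0 →ₗ[ℂ] F.V0 where
  toFun := fun T => ⟨u.U g * T.1 * u.U g⁻¹, ((u.cm g).mul T.2.1).mul (u.cm _), by
    rw [u.hs_cj g T.2.1]; exact T.2.2⟩
  map_add' := fun a b => Subtype.ext (by simp [mul_add, add_mul])
  map_smul' := fun c a => Subtype.ext (by simp)

lemma cj_norm (g : Λ) (T : F.V0) : ‖F.vec (u.cj g T)‖ = ‖F.vec T‖ := by
  have h1 := F.vec_enorm (u.cj g T)
  have h2 := F.vec_enorm T
  rw [show F.hs (u.cj g T).1 = F.hs T.1 from u.hs_cj g T.2.1, ← h2] at h1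
  have h3 : ‖F.vec (u.cj g T)‖ₑ = ‖F.vec T‖ₑ := by
    exact (pow_right_strictMono (n := 2) (by norm_num)).injective h1
  simpa using congrArg toReal h3

def π (g : Λ) : F.HS →L[ℂ] F.HS := (F.vec.comp (u.cj g)).extendOfNorm F.vec

lemma π_vec (g : Λ) (T : F.V0) : u.π g (F.vec T) = F.vec (u.cj g T) :=
  extendOfNorm_eq F.vec_dense ⟨1, fun T => by
    rw [one_mul]; exact (u.cj_norm g T).le⟩ T

lemma π_iso (g : Λ) (v : F.HS) : ‖u.π g v‖ = ‖v‖ := by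
  refine F.vec_dense.induction_on v (isClosed_eq (by fun_prop) (by fun_prop)) fun T => ?_
  rw [u.π_vec, u.cj_norm]

lemma π_mul (g h : Λ) : u.π (g * h) = u.π g * u.π h := by
  ext1 v
  refine F.vec_dense.induction_on v (isClosed_eq (by fun_prop) (by fun_prop)) fun T => ?_
  rw [mul_apply, u.π_vec, u.π_vec, u.π_vec]
  congr 1
  refine Subtype.ext ?_
  simp [cj, u.mul, mul_assoc]

lemma π_one : u.π 1 = 1 := by
  ext1 v
  refine F.vec_dense.induction_on v (isClosed_eq (by fun_prop) (by fun_prop)) fun T => ?_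
  rw [u.π_vec]
  refine congrArg F.vec (Subtype.ext ?_)
  simp [cj, u.one]

end UR

lemma dense_ρ : (Span (Set.range fun p : F.I × G => F.ρ p.2 (F.e p.1))).topologicalClosure = ⊤ := by
  rw [Submodule.topologicalClosure_eq_top_iff, Submodule.eq_bot_iff]
  intro v hv
  exact F.tot v fun i g => hv _ (subset_span ⟨(i, g), rfl⟩)

lemma enorm_sq_le_iff {E : Type*} [NormedAddCommGroup E] {v : E} {c : ℝ} (hc : 0 ≤ c) :
    ‖v‖ₑ ^ 2 ≤ ENNReal.ofReal (c ^ 2) ↔ ‖v‖ ≤ c := by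
  rw [ofReal_pow hc, ← ofReal_norm_eq_enorm, (pow_right_strictMono (n := 2) (by norm_num)).le_iff_le,
    ENNReal.ofReal_le_ofReal_iff hc]

/-- AVGHS -/
lemma avgHS {Λ : Type} [Group Λ] (u : UR F Λ) {T0 : B(K)} (hC : F.Cm T0) (hT0 : F.hs T0 < ⊤) :
    ∃ T : B(K), F.Cm T ∧ F.hs T < ⊤ ∧ (∀ g, u.U g * T = T * u.U g) ∧ ‖T‖ ≤ ‖T0‖ ∧
      (∃ Tn : ℕ → B(K), (∀ n, Tn n ∈ convexHull ℝ (Set.range fun g => u.U g * T0 * u.U g⁻¹)) ∧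
        ∀ x, Tendsto (fun n => Tn n x) atTop (𝓝 (T x))) ∧
      (∀ c : ℝ, 0 ≤ c → (∀ g, F.hs (u.U g * T0 * u.U g⁻¹ - T0) ≤ ENNReal.ofReal (c ^ 2)) →
        F.hs (T - T0) ≤ ENNReal.ofReal (c ^ 2)) := by
  let t0 : F.V0 := ⟨T0, hC, hT0⟩
  let S : Set F.V0 := Set.range fun g => u.cj g t0
  obtain ⟨v, hv, hfix⟩ := avg_hull (K := F.HS) (S := F.vec '' S) ⟨_, _, ⟨1, rfl⟩, rfl⟩
  have hπ : ∀ g, u.π g v = v := fun g => hfix (u.π g) (fun x => (u.π_iso g x).le) (by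
    rintro _ ⟨_, ⟨h, rfl⟩, rfl⟩
    refine ⟨_, ⟨g * h, rfl⟩, ?_⟩
    have h2 := u.π_vec (g * h) t0
    have h3 := u.π_vec h t0
    simp only
    rw [← h2, ← h3, u.π_mul]; rfl)
  have himg : convexHull ℝ (F.vec '' S) = F.vec '' convexHull ℝ S :=
    ((F.vec.restrictScalars ℝ).image_convexHull S).symm
  have hv : v ∈ closure (F.vec '' convexHull ℝ S) := by rw [← himg]; exact hv
  rw [mem_closure_iff_seq_limit] at hv
  obtain ⟨f, hf, hl⟩ := hv
  choose t ht htf using hf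
  have hl : Tendsto (fun n => F.vec (t n)) atTop (𝓝 v) := hl.congr fun n => (htf n).symm
  have hball : ∀ n, ‖(t n).1‖ ≤ ‖T0‖ := fun n => by
    have hcv : Convex ℝ {x : F.V0 | ‖x.1‖ ≤ ‖T0‖} := by
      have := (convex_closedBall (0 : B(K)) ‖T0‖).linear_preimage (F.V0.subtype.restrictScalars ℝ)
      have he : {x : F.V0 | ‖x.1‖ ≤ ‖T0‖} = (F.V0.subtype.restrictScalars ℝ) ⁻¹' closedBall (0 : B(K)) ‖T0‖ := by
        ext x; simp only [mem_setOf_eq, Set.mem_preimage, mem_closedBall_zero_iff]; rfl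
      rw [he]; exact this
    refine convexHull_min ?_ hcv (ht n)
    rintro _ ⟨g, rfl⟩
    change ‖u.U g * T0 * u.U g⁻¹‖ ≤ _
    calc _ ≤ ‖u.U g‖ * ‖T0‖ * ‖u.U g⁻¹‖ := (norm_mul_le _ _).trans (by gcongr; exact norm_mul_le _ _)
      _ ≤ 1 * ‖T0‖ * 1 := by gcongr <;> exact u.norm_le _
      _ = _ := by ring
  have hco : ∀ n i, (t n).1 (F.e i) = (F.vec (t n)).1 i := fun n i => rfl
  have hcoor : ∀ i, Tendsto (fun n => (t n).1 (F.e i)) atTop (𝓝 (v.1 i)) := fun i => by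
    have h1 : Tendsto (fun n => (F.vec (t n)).1) atTop (𝓝 v.1) := (continuous_subtype_val.tendsto v).comp hl
    rw [tendsto_iff_norm_sub_tendsto_zero] at h1 ⊢
    refine squeeze_zero (fun _ => norm_nonneg _) (fun n => ?_) h1
    exact lp.norm_apply_le_norm (by norm_num) ((F.vec (t n)).1 - v.1) i
  have hcau : ∀ x, Cauchy (map (fun n => (t n).1 x) atTop) := by
    let W : Submodule ℂ K :=
      { carrier := {x | CauchySeq fun n => (t n).1 x}
        add_mem' := fun {a b} ha hb => by
          have := CauchySeq.add (u := fun n => (t n).1 a) (v := fun n => (t n).1 b) ha hb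
          simp only [mem_setOf_eq, map_add]; exact this
        zero_mem' := by simpa using cauchySeq_const (0 : K)
        smul_mem' := fun c a ha => by
          have h1 := (uniformContinuous_const_smul c (X := K)).comp_cauchySeq (show CauchySeq fun n => (t n).1 a from ha)
          simp only [mem_setOf_eq, map_smul]; exact h1 }
    have hWc : IsClosed (W : Set K) := by
      refine isClosed_of_closure_subset fun x hx => ?_
      refine Metric.cauchySeq_iff.2 fun ε hε => ?_
      obtain ⟨y, hy, hxy⟩ := Metric.mem_closure_iff.1 hx (ε / (3 * (‖T0‖ + 1))) (by positivity)
      obtain ⟨N, hN⟩ := Metric.cauchySeq_iff.1 hy (ε / 3) (by positivity)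
      refine ⟨N, fun m hm n hn => ?_⟩
      have h1 : ∀ n, dist ((t n).1 x) ((t n).1 y) < ε / 3 := fun n => by
        rw [dist_eq_norm, ← map_sub]
        calc _ ≤ ‖(t n).1‖ * ‖x - y‖ := (t n).1.le_opNorm _
          _ ≤ (‖T0‖ + 1) * ‖x - y‖ := by gcongr; linarith [hball n]
          _ < (‖T0‖ + 1) * (ε / (3 * (‖T0‖ + 1))) := by
            rw [← dist_eq_norm]; gcongr
          _ = ε / 3 := by field_simp
      have h2 := h1 m
      have h3 := h1 n
      have h4 := hN m hm n hn
      rw [dist_comm] at h3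
      calc _ ≤ _ := dist_triangle4 _ ((t m).1 y) ((t n).1 y) _
        _ < ε := by linarith
    have hWt : W = ⊤ := by
      rw [eq_top_iff, ← F.dense_ρ]
      refine topologicalClosure_minimal _ (span_le.2 ?_) hWc
      rintro _ ⟨⟨i, g⟩, rfl⟩
      change CauchySeq _
      refine Tendsto.cauchySeq (x := F.ρ g (v.1 i)) ?_
      simp only [(t _).2.1 g]
      exact ((F.ρ g).continuous.tendsto _).comp (hcoor i)
    intro x
    have : x ∈ W := hWt ▸ trivial
    exact this
  obtain ⟨T, hTn, hT⟩ := exists_strong_limit hball hcau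
  have hTe : ∀ i, T (F.e i) = v.1 i := fun i => tendsto_nhds_unique (hT _) (hcoor i)
  have hTC : F.Cm T := fun g x => by
    refine tendsto_nhds_unique (hT _) ?_
    simp only [(t _).2.1 g]
    exact ((F.ρ g).continuous.tendsto _).comp (hT x)
  have hThs : F.hs T < ⊤ := by
    have := lp_norm v.1
    simp only [← hTe] at this
    rw [hs, ← this]; finiteness
  let tt : F.V0 := ⟨T, hTC, hThs⟩
  have hvt : F.vec tt = v := by
    refine Subtype.ext (lp.ext (funext fun i => ?_))
    exact hTe i
  refine ⟨T, hTC, hThs, fun g => ?_, hTn, ⟨fun n => (t n).1, fun n => ?_, hT⟩, fun c hc h => ?_⟩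
  · have h1 := hπ g
    rw [← hvt, u.π_vec, ← sub_eq_zero, ← map_sub] at h1
    have h2 := val_eq (F.vec_inj h1)
    have h3 : u.U g * T * u.U g⁻¹ = T := sub_eq_zero.1 h2
    calc u.U g * T = u.U g * T * (u.U g⁻¹ * u.U g) := by rw [u.inv_mul, mul_one]
      _ = _ := by rw [← mul_assoc, h3]
  · have h1 : (t n).1 ∈ F.V0.subtype.restrictScalars ℝ '' convexHull ℝ S := ⟨_, ht n, rfl⟩
    rw [LinearMap.image_convexHull] at h1
    convert h1 using 2
    ext x
    simp only [S, Set.mem_range, Set.mem_image]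
    constructor
    · rintro ⟨g, rfl⟩; exact ⟨_, ⟨g, rfl⟩, rfl⟩
    · rintro ⟨_, ⟨g, rfl⟩, rfl⟩; exact ⟨g, rfl⟩
  · have h1 : v ∈ closedBall (F.vec t0) c := by
      refine Metric.isClosed_closedBall.mem_of_tendsto hl (.of_forall fun n => ?_)
      have : F.vec (t n) ∈ convexHull ℝ (F.vec '' S) := himg ▸ ⟨_, ht n, rfl⟩
      refine convexHull_min ?_ (convex_closedBall _ _) this
      rintro _ ⟨_, ⟨g, rfl⟩, rfl⟩
      rw [mem_closedBall_iff_norm, ← map_sub, ← enorm_sq_le_iff hc, F.vec_enorm]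
      exact h g
    rw [mem_closedBall_iff_norm, ← hvt, ← map_sub, ← enorm_sq_le_iff hc, F.vec_enorm] at h1
    exact h1

/-- property (T) gives almost invariant => uniformly almost invariant, in HS -/
lemma propT_hs {Λ : Type} [Group Λ] (hT : HasPropertyT Λ) {δ : ℝ} (hδ : 0 < δ) :
    ∃ S : Finset Λ, ∃ κ : ℝ, 0 < κ ∧ ∀ (u : UR F Λ) (T0 : B(K)), F.Cm T0 → ∀ d : ℝ, 0 ≤ d →
      F.hs T0 = ENNReal.ofReal (d ^ 2) →
      (∀ g ∈ S, F.hs (u.U g * T0 * u.U g⁻¹ - T0) ≤ ENNReal.ofReal ((κ * d) ^ 2)) →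
      ∀ g, F.hs (u.U g * T0 * u.U g⁻¹ - T0) ≤ ENNReal.ofReal ((δ * d) ^ 2) := by
  obtain ⟨S, κ, hκ, H⟩ := propT_near hT hδ
  refine ⟨S, κ, hκ, fun u T0 hC d hd hs h g => ?_⟩
  let t0 : F.V0 := ⟨T0, hC, by rw [hs]; finiteness⟩
  have hn : ‖F.vec t0‖ = d := by
    have := F.vec_enorm t0
    rw [show F.hs t0.1 = F.hs T0 from rfl, hs, ofReal_pow hd] at this
    have := (pow_right_strictMono (n := 2) (by norm_num)).injective this
    have := congrArg toReal this
    simpa [hd] using this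
  have key : ∀ g c, 0 ≤ c → (‖u.π g (F.vec t0) - F.vec t0‖ ≤ c ↔
      F.hs (u.U g * T0 * u.U g⁻¹ - T0) ≤ ENNReal.ofReal (c ^ 2)) := fun g c hc => by
    rw [u.π_vec, ← map_sub, ← enorm_sq_le_iff hc, F.vec_enorm]; rfl
  have := H F.HS inferInstance inferInstance inferInstance u.π u.π_one u.π_mul u.π_iso (F.vec t0)
    (fun s hs => by rw [hn]; exact (key s _ (by positivity)).2 (h s hs)) g
  rw [hn] at this
  exact (key g _ (by positivity)).1 this

end FR

end

section
lemma proj_comm {N : Submodule ℂ K} [N.HasOrthogonalProjection] {T : B(K)} (h1 : ∀ v ∈ N, T v ∈ N)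
    (h2 : ∀ v ∈ N, star T v ∈ N) (v : K) : N.starProjection (T v) = T (N.starProjection v) := by
  refine Submodule.eq_starProjection_of_mem_orthogonal (h1 _ (starProjection_apply_mem _ _)) ?_
  rw [← map_sub, mem_orthogonal]
  intro w hw
  rw [← inner_star_swap]
  exact (mem_orthogonal _ _).1
      (sub_starProjection_mem_orthogonal (K := N) v) _ (h2 w hw)

lemma sp_star (N : Submodule ℂ K) [N.HasOrthogonalProjection] : star N.starProjection = N.starProjection := by
  exact isSelfAdjoint_starProjection N

/-- L2-closure of a star subalgebra -/
def clo (s : Std Al K) (S : StarSubalgebra ℂ Al) : Submodule ℂ K :=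
  ((toSubmodule S.toSubalgebra).map s.j).topologicalClosure

section clo
variable {s : Std Al K} (S : StarSubalgebra ℂ Al)

lemma coe_clo : (clo s S : Set K) = closure (s.j '' (S : Set Al)) := by
  rw [clo, topologicalClosure_coe]; rfl

instance : CompleteSpace (clo s S) :=
  (isClosed_topologicalClosure _).completeSpace_coe

variable {S}
lemma mem_clo {a : Al} (ha : a ∈ S) : s.j a ∈ clo s S := by
  rw [← mem_coe, coe_clo]; exact subset_closure ⟨a, ha, rfl⟩

lemma clo_maps {T : B(K)} (h : ∀ a ∈ S, T (s.j a) ∈ clo s S) : ∀ v ∈ clo s S, T v ∈ clo s S := by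
  intro v hv
  rw [← mem_coe, coe_clo] at hv
  have := MapsTo.closure (s := s.j '' (S : Set Al)) (t := (clo s S : Set K)) (f := T)
    (by rintro _ ⟨a, ha, rfl⟩; exact h a ha) T.continuous hv
  have hc : IsClosed (clo s S : Set K) := isClosed_topologicalClosure _
  rw [hc.closure_eq] at this; exact this

lemma of_clo (hS : TwoClosed s (S : Set Al)) {x : Al} (h : s.j x ∈ clo s S) : x ∈ S :=
  hS x (by rw [← coe_clo]; exact h)

def PP (s : Std Al K) (S : StarSubalgebra ℂ Al) : B(K) := (clo s S).starProjection

lemma PP_mem (v : K) : PP s S v ∈ clo s S := starProjection_apply_mem _ _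
lemma PP_fix {v : K} (hv : v ∈ clo s S) : PP s S v = v := starProjection_eq_self_iff.2 hv
lemma PP_norm (v : K) : ‖PP s S v‖ ≤ ‖v‖ := norm_starProjection_apply_le _ _
lemma PP_star : star (PP s S) = PP s S := sp_star _
lemma PP_comm_R {y : Al} (hy : y ∈ S) (v : K) : PP s S (s.R y v) = s.R y (PP s S v) :=
  proj_comm (clo_maps fun a ha => by rw [s.R_j]; exact mem_clo (mul_mem ha hy))
    (by rw [s.R_star]; exact clo_maps fun a ha => by rw [s.R_j]; exact mem_clo (mul_mem ha (star_mem hy))) v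
lemma PP_comm_L {y : Al} (hy : y ∈ S) (v : K) : PP s S (s.L y v) = s.L y (PP s S v) :=
  proj_comm (clo_maps fun a ha => by rw [s.L_j]; exact mem_clo (mul_mem hy ha))
    (by rw [s.L_star]; exact clo_maps fun a ha => by rw [s.L_j]; exact mem_clo (mul_mem (star_mem hy) ha)) v

lemma perp_j {v : K} (h : ∀ x, inner ℂ (s.j x) v = 0) : v = 0 := by
  have h3 : (inner ℂ v v : ℂ) = 0 := by
    have : v ∈ closure (Set.range s.j) := s.dense v
    refine closure_minimal (t := {w | inner ℂ w v = 0}) ?_ ?_ this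
    · rintro _ ⟨a, rfl⟩; exact h a
    · exact isClosed_eq (by fun_prop) continuous_const
  exact inner_self_eq_zero.1 h3

end clo

namespace XD
variable {G : Type} [Group G] {s : Std Al K} (D : XD G s)

def Ad (g : G) : B(K) := s.L (D.u g) * s.R (D.u g⁻¹)

lemma Ad_apply (g : G) (v : K) : D.Ad g v = s.L (D.u g) (s.R (D.u g⁻¹) v) := rfl
lemma Ad_j (g : G) (x : Al) : D.Ad g (s.j x) = s.j (D.u g * x * D.u g⁻¹) := by
  rw [Ad_apply, s.R_j, s.L_j, mul_assoc]
lemma Ad_mul (g h : G) : D.Ad (g * h) = D.Ad g * D.Ad h := s.ext_j fun x => by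
  simp only [mul_apply, Ad_j, mul_inv_rev, ← D.u_mul, mul_assoc]
lemma Ad_one : D.Ad 1 = 1 := s.ext_j fun x => by simp [Ad_j, D.u_one]
lemma Ad_inv (g : G) (v : K) : D.Ad g⁻¹ (D.Ad g v) = v := by
  rw [← mul_apply, ← Ad_mul, inv_mul_cancel, Ad_one]; rfl
lemma Ad_inv' (g : G) (v : K) : D.Ad g (D.Ad g⁻¹ v) = v := by
  rw [← mul_apply, ← Ad_mul, mul_inv_cancel, Ad_one]; rfl
lemma Ad_norm (g : G) (v : K) : ‖D.Ad g v‖ = ‖v‖ := by rw [Ad_apply, D.L_norm_u, D.R_norm_u]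
lemma Ad_star (g : G) : star (D.Ad g) = D.Ad g⁻¹ := by
  rw [Ad, star_mul, s.L_star, s.R_star, D.u_star, D.u_star, ← s.LR_comm]; rfl
lemma Ad_HA (g : G) {v : K} (hv : v ∈ D.HA) : D.Ad g v ∈ D.HA :=
  clo_maps (S := D.A) (fun a ha => by rw [Ad_j]; exact D.mem_HA (D.conj g a ha)) v hv
lemma Ad_PA (g : G) (v : K) : D.PA (D.Ad g v) = D.Ad g (D.PA v) :=
  proj_comm (fun v hv => D.Ad_HA g hv) (fun v hv => by rw [Ad_star]; exact D.Ad_HA _ hv) v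
lemma L_eq (g : G) (v : K) : s.L (D.u g) v = s.R (D.u g) (D.Ad g v) := by
  rw [Ad_apply, ← s.LR, ← mul_apply (s.R _), ← s.R_mul, D.u_inv_mul, s.R_one]; rfl

lemma R_R (g h : G) (v : K) : s.R (D.u g) (s.R (D.u h) v) = s.R (D.u (h * g)) v := by
  rw [← mul_apply, ← s.R_mul, D.u_mul]
lemma L_L (g h : G) (v : K) : s.L (D.u g) (s.L (D.u h) v) = s.L (D.u (g * h)) v := by
  rw [← mul_apply, ← s.L_mul, D.u_mul]

/-- a basis of HA -/
def bI : Type := (exists_hilbertBasis ℂ D.HA).choose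
def hb : HilbertBasis D.bI ℂ D.HA := (exists_hilbertBasis ℂ D.HA).choose_spec.choose
def be (i : D.bI) : K := (D.hb i : K)
lemma be_mem (i : D.bI) : D.be i ∈ D.HA := (D.hb i).2
lemma be_orth : Orthonormal ℂ D.be := by
  have := D.hb.orthonormal.comp_linearIsometry D.HA.subtypeₗᵢ
  exact this
lemma be_tot {v : K} (hv : v ∈ D.HA) (h : ∀ i, inner ℂ (D.be i) v = 0) : v = 0 := by
  have : (⟨v, hv⟩ : D.HA) = 0 := by
    refine D.hb.repr.map_eq_zero_iff.1 (lp.ext (funext fun i => ?_))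
    rw [D.hb.repr_apply_apply]
    exact h i
  exact val_eq this

lemma inner_Ru (g : G) (v w : K) : inner ℂ (s.R (D.u g) v) w = inner ℂ v (s.R (D.u g⁻¹) w) := by
  rw [s.inner_R, D.u_star]
lemma inner_Lu (g : G) (v w : K) : inner ℂ (s.L (D.u g) v) w = inner ℂ v (s.L (D.u g⁻¹) w) := by
  rw [s.inner_L, D.u_star]

lemma orth_R {g h : G} (i j : D.bI) (hne : (i, g) ≠ (j, h)) :
    inner ℂ (s.R (D.u g) (D.be i)) (s.R (D.u h) (D.be j)) = 0 := by
  by_cases hgh : g = h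
  · subst hgh
    rw [D.inner_Ru, R_R, mul_inv_cancel, D.u_one, s.R_one]
    exact D.be_orth.2 (fun hij => hne (by rw [hij]))
  · exact D.orth hgh (D.be_mem i) (D.be_mem j)

def FRR (hcb : CB s) : FR G K where
  ρ := fun g => s.R (D.u g⁻¹)
  inn := fun g v w => D.inner_Ru _ _ _
  mul := fun g h v => by rw [R_R, mul_inv_rev]
  one := fun v => by rw [inv_one, D.u_one, s.R_one]; rfl
  I := D.bI
  e := D.be
  orth := by
    refine ⟨fun p => ?_, fun p q hpq => ?_⟩
    · change ‖s.R _ _‖ = 1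
      rw [D.R_norm_u]; exact D.be_orth.1 _
    · refine D.orth_R _ _ fun h => hpq ?_
      simp only [Prod.mk.injEq, inv_inj] at h
      exact Prod.ext h.1 h.2
  tot := fun v h => D.ortho_top hcb fun g w hw => by
    have h1 : D.PA (s.R (D.u g⁻¹) v) = 0 := D.be_tot (D.PA_mem _) fun i => by
      have := h i g⁻¹
      rw [D.inner_PA (D.be_mem i), ← D.inner_Ru]
      rwa [inv_inv] at this
    rw [D.inner_Ru, ← D.inner_PA hw, h1, inner_zero_right]

def FRL (hcb : CB s) : FR G K where
  ρ := fun g => s.L (D.u g)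
  inn := fun g v w => D.inner_Lu _ _ _
  mul := fun g h v => D.L_L g h v
  one := fun v => by rw [D.u_one, s.L_one]; rfl
  I := D.bI
  e := D.be
  orth := by
    refine ⟨fun p => ?_, fun p q hpq => ?_⟩
    · change ‖s.L _ _‖ = 1
      rw [D.L_norm_u]; exact D.be_orth.1 _
    · obtain ⟨i, g⟩ := p
      obtain ⟨j, h⟩ := q
      change inner ℂ (s.L (D.u g) (D.be i)) (s.L (D.u h) (D.be j)) = 0
      by_cases hgh : g = h
      · subst hgh
        rw [D.inner_Lu, L_L, inv_mul_cancel, D.u_one, s.L_one]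
        exact D.be_orth.2 (fun hij => hpq (by rw [hij]))
      · rw [L_eq, L_eq]; exact D.orth hgh (D.Ad_HA _ (D.be_mem _)) (D.Ad_HA _ (D.be_mem _))
  tot := fun v h => D.ortho_top hcb fun g w hw => by
    have h1 : D.PA (s.L (D.u g⁻¹) v) = 0 := D.be_tot (D.PA_mem _) fun i => by
      have := h i g
      rwa [D.inner_PA (D.be_mem i), ← D.inner_Lu]
    have h2 : s.R (D.u g) w = s.L (D.u g) (D.Ad g⁻¹ w) := by rw [L_eq, Ad_inv']
    rw [h2, D.inner_Lu, ← D.inner_PA (D.Ad_HA _ hw), h1, inner_zero_right]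

lemma FRR_ρ (hcb : CB s) (g : G) : (D.FRR hcb).ρ g = s.R (D.u g⁻¹) := rfl

lemma CmR {hcb : CB s} {T : B(K)} :
    (D.FRR hcb).Cm T ↔ ∀ g v, T (s.R (D.u g) v) = s.R (D.u g) (T v) :=
  ⟨fun h g v => by have := h g⁻¹ v; rwa [FRR_ρ, inv_inv] at this, fun h g v => h g⁻¹ v⟩
lemma CmL {hcb : CB s} {T : B(K)} :
    (D.FRL hcb).Cm T ↔ ∀ g v, T (s.L (D.u g) v) = s.L (D.u g) (T v) := Iff.rfl
lemma CmR_L {hcb : CB s} (x : Al) : (D.FRR hcb).Cm (s.L x) := D.CmR.2 fun g v => s.LR _ _ _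
lemma CmL_R {hcb : CB s} (x : Al) : (D.FRL hcb).Cm (s.R x) := D.CmL.2 fun g v => (s.LR _ _ _).symm

/-- Fourier coefficients -/
def cf (v : K) (g : G) : K := D.PA (s.R (D.u g⁻¹) v)

lemma cf_sum (hcb : CB s) (v : K) : ∑' g, ‖D.cf v g‖ₑ ^ 2 = ‖v‖ₑ ^ 2 := by
  rw [← (D.FRR hcb).parse v, tsum_comm, ← FR.tsum_inv]
  refine tsum_congr fun g => ?_
  have h := parse_hb D.hb ⟨D.cf v g⁻¹, D.PA_mem _⟩
  refine h.symm.trans (tsum_congr fun i => ?_)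
  change ‖inner ℂ (D.be i) (D.cf v g⁻¹)‖ₑ ^ 2 = ‖inner ℂ (s.R (D.u g⁻¹) (D.be i)) v‖ₑ ^ 2
  rw [cf, D.inner_PA (D.be_mem i), D.inner_Ru]

lemma cf_sub (v w : K) (g : G) : D.cf (v - w) g = D.cf v g - D.cf w g := by simp [cf]

lemma cf_norm (v : K) (g : G) : ‖D.cf v g‖ ≤ ‖v‖ :=
  (D.PA_norm _).trans (D.R_norm_u _ _).le

lemma cf_Ad (h g : G) (v : K) : D.cf (D.Ad h v) (h * g * h⁻¹) = D.Ad h (D.cf v g) := by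
  rw [cf, cf, ← Ad_PA]
  congr 1
  rw [Ad_apply, Ad_apply, ← s.LR, R_R, R_R]
  congr 3
  group

lemma mem_HA_of_cf (hcb : CB s) {v : K} (h : ∀ g, g ≠ 1 → D.cf v g = 0) : v ∈ D.HA := by
  have : v - D.PA v = 0 := D.ortho_top hcb fun g w hw => by
    by_cases hg : g = 1
    · subst hg
      rw [D.u_one, s.R_one, one_apply, inner_sub_right, D.inner_PA hw, sub_self]
    · rw [inner_sub_right, D.inner_Ru, ← D.inner_PA hw]
      have h1 := h g hg
      rw [cf] at h1
      have h3 := D.orth (g := g) (h := 1) hg hw (D.PA_mem v)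
      rw [D.u_one, s.R_one, one_apply] at h3
      rw [h1, inner_zero_right, h3, sub_zero]
  rw [sub_eq_zero.1 this]; exact D.PA_mem v

/-- F4 -/
lemma F4 (hcb : CB s) (hicc : IsICC G) {v : K}
    (htb : TotallyBounded (Set.range fun g => D.Ad g v)) : v ∈ D.HA := by
  refine D.mem_HA_of_cf hcb fun g hg => ?_
  by_contra hne
  have hc : 0 < ‖D.cf v g‖ := norm_pos_iff.2 hne
  obtain ⟨t, ht, hcov⟩ := Metric.totallyBounded_iff.1 htb (‖D.cf v g‖ / 2) (by positivity)
  have hfin : ∀ y : K, {k : G | ‖D.cf v g‖ / 2 ≤ ‖D.cf y k‖}.Finite := fun y => by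
    have h1 : ∑' k, ‖D.cf y k‖ₑ ^ 2 ≠ ⊤ := by rw [D.cf_sum hcb]; finiteness
    have h2 := ENNReal.finite_const_le_of_tsum_ne_top h1
      (ε := ENNReal.ofReal ((‖D.cf v g‖ / 2) ^ 2)) (by simp; positivity)
    refine h2.subset fun k hk => ?_
    simp only [mem_setOf_eq] at hk ⊢
    rw [enn_sq]
    gcongr
  refine hicc g hg ((ht.biUnion fun y _ => hfin y).subset ?_)
  rintro _ ⟨h, rfl⟩
  obtain ⟨y, hy, hd⟩ := mem_iUnion₂.1 (hcov ⟨h, rfl⟩)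
  refine mem_iUnion₂.2 ⟨y, hy, ?_⟩
  rw [Metric.mem_ball, dist_eq_norm] at hd
  have h1 := D.cf_norm (D.Ad h v - y) (h * g * h⁻¹)
  rw [cf_sub, cf_Ad] at h1
  have h2 := norm_sub_norm_le (D.Ad h (D.cf v g)) (D.cf y (h * g * h⁻¹))
  rw [Ad_norm] at h2
  simp only [mem_setOf_eq]
  simp only at hd
  linarith

lemma inv_scalar (hcb : CB s) {v : K} (hv : v ∈ D.HA) (h : ∀ g, D.Ad g v = v) : ∃ c : ℂ, v = c • s.j 1 := by
  refine ⟨inner ℂ (s.j 1) v, ?_⟩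
  set w := v - inner ℂ (s.j 1) v • s.j 1 with hw
  have hw1 : inner ℂ (s.j 1) w = 0 := by
    rw [hw, inner_sub_right, inner_smul_right, inner_selfC, s.norm_one]; simp
  have hwA : ∀ g, D.Ad g w = w := fun g => by
    rw [hw, map_sub, h, map_smul, Ad_j, mul_one, D.u_mul_inv]
  have hwH : w ∈ D.HA := sub_mem hv (Submodule.smul_mem _ _ (D.mem_HA (one_mem _)))
  have key : ∀ a ∈ D.A, inner ℂ (s.j a) w = 0 := by
    intro a ha
    obtain ⟨v0, hv0, hfix⟩ := avg_hull (S := Set.range fun g => D.Ad g (s.j a)) ⟨_, 1, rfl⟩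
    have hinv : ∀ g, D.Ad g v0 = v0 := fun g => hfix _ (fun x => (D.Ad_norm g x).le) (by
      rintro _ ⟨h, rfl⟩; exact ⟨g * h, by simp only [Ad_mul]; rfl⟩)
    have hin : inner ℂ v0 w = inner ℂ (s.j a) w := by
      have hcl : IsClosed {z : K | inner ℂ z w = inner ℂ (s.j a) w} :=
        isClosed_eq (by fun_prop) continuous_const
      have hcv : Convex ℝ {z : K | inner ℂ z w = inner ℂ (s.j a) w} := by
        intro x hx y hy p q hp hq hpq
        simp only [mem_setOf_eq] at hx hy ⊢
        rw [← coe_smul, ← coe_smul q, inner_add_left, inner_smul_left, inner_smul_left, hx, hy, ← add_mul,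
          conj_ofReal, conj_ofReal, ← ofReal_add, hpq]; simp
      refine closure_minimal (convexHull_min ?_ hcv) hcl hv0
      rintro _ ⟨g, rfl⟩
      change inner ℂ _ w = _
      rw [← inner_star_swap', Ad_star, hwA]
    have hmem : v0 ∈ closure (s.j '' {x | x ∈ D.A ∧ ‖x‖ ≤ ‖a‖}) := by
      refine closure_mono ?_ hv0
      refine convexHull_min ?_ ?_
      · rintro _ ⟨g, rfl⟩
        refine ⟨_, ⟨D.conj g a ha, ?_⟩, (D.Ad_j g a).symm⟩
        rw [← D.u_star, norm_unit_conj (D.u_unit g) (D.u_unit' g)]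
      · have h1 : Convex ℝ {x | x ∈ D.A ∧ ‖x‖ ≤ ‖a‖} := by
          have := (((toSubmodule D.A.toSubalgebra).restrictScalars ℝ).convex).inter (convex_closedBall (0 : Al) ‖a‖)
          have he : {x | x ∈ D.A ∧ ‖x‖ ≤ ‖a‖} = (((toSubmodule D.A.toSubalgebra).restrictScalars ℝ : Submodule ℝ Al) : Set Al) ∩ closedBall (0 : Al) ‖a‖ := by
            ext x; simp only [mem_setOf_eq, Set.mem_inter_iff, mem_closedBall_zero_iff]; exact Iff.rfl
          rw [he]; exact this
        exact h1.linear_image (s.j.restrictScalars ℝ)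
    obtain ⟨y, hy, hyv⟩ := hcb.mem (C := ‖a‖) (fun x hx => hx.2) hmem
    have hyA : y ∈ D.A := D.A_of_mem_HA (by
      rw [hyv, ← mem_coe, coe_HA]
      exact closure_mono (Set.image_mono fun x hx => hx.1) hmem)
    obtain ⟨c, hc⟩ := D.erg y hyA fun g => s.inj' (by rw [← Ad_j, hyv, hinv])
    rw [← hin, ← hyv, hc, map_smul, inner_smul_left, hw1, mul_zero]
  have : w = 0 := by
    have : inner ℂ w w = (0 : ℂ) := D.HA_induction (p := fun z => inner ℂ z w = 0)
      (isClosed_eq (by fun_prop) continuous_const) key hwH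
    exact inner_self_eq_zero.1 this
  exact sub_eq_zero.1 this

lemma F3 (hcb : CB s) (hicc : IsICC G) {v : K} (h : ∀ g, D.Ad g v = v) : ∃ c : ℂ, v = c • s.j 1 := by
  refine D.inv_scalar hcb (D.F4 hcb hicc ?_) h
  refine (Set.Finite.subset (Set.finite_singleton v) ?_).totallyBounded
  rintro _ ⟨g, rfl⟩; exact h g

lemma F3' (hcb : CB s) (hicc : IsICC G) {x : Al} (h : ∀ g, D.u g * x * D.u g⁻¹ = x) :
    ∃ c : ℂ, x = c • (1 : Al) := by
  obtain ⟨c, hc⟩ := D.F3 hcb hicc (v := s.j x) fun g => by rw [Ad_j, h]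
  exact ⟨c, s.inj' (by rw [hc, map_smul])⟩

lemma dixG (hcb : CB s) (hicc : IsICC G) (x : Al) {ε : ℝ} (hε : 0 < ε) :
    ∃ z ∈ convexHull ℝ (Set.range fun g => D.u g * x * D.u g⁻¹), ‖s.j (z - s.τ x • (1 : Al))‖ < ε := by
  obtain ⟨z, hz, h⟩ := dix hcb (Set.range D.u)
    (by rintro _ ⟨g, rfl⟩; exact ⟨D.u_unit g, D.u_unit' g⟩)
    (by rintro _ ⟨g, rfl⟩ _ ⟨h, rfl⟩; exact ⟨g * h, (D.u_mul g h).symm⟩) ⟨1, D.u_one⟩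
    (fun y hy => D.F3' hcb hicc fun g => by rw [← D.u_star]; exact hy _ ⟨g, rfl⟩) x hε
  refine ⟨z, convexHull_mono ?_ hz, h⟩
  rintro _ ⟨_, ⟨g, rfl⟩, rfl⟩
  exact ⟨g, by simp only [D.u_star]⟩

/-- omega lemma -/
lemma omega (hcb : CB s) (hicc : IsICC G) {I : Type*} {v : I → K} (hv : Summable fun i => ‖v i‖ ^ 2)
    (A : Al →ₗ[ℂ] B(K)) (hA : ∀ x v, ‖A x v‖ ≤ ‖x‖ * ‖v‖) (hA1 : ∀ v, A 1 v = v)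
    (hAj : ∀ x y, ‖A x (s.j y)‖ ≤ ‖s.j x‖ * ‖y‖) (x : Al)
    (hinv : ∀ g, ∑' i, inner ℂ (v i) (A (D.u g * x * D.u g⁻¹) (v i)) = ∑' i, inner ℂ (v i) (A x (v i))) :
    ∑' i, inner ℂ (v i) (A x (v i)) = s.τ x * ((∑' i, ‖v i‖ ^ 2 : ℝ) : ℂ) := by
  have hbd : ∀ z i, ‖inner ℂ (v i) (A z (v i))‖ ≤ ‖z‖ * ‖v i‖ ^ 2 := fun z i => by
    calc _ ≤ ‖v i‖ * ‖A z (v i)‖ := norm_inner_le_norm _ _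
      _ ≤ ‖v i‖ * (‖z‖ * ‖v i‖) := by gcongr; exact hA _ _
      _ = _ := by ring
  have hsm : ∀ z, Summable fun i => inner ℂ (v i) (A z (v i)) := fun z =>
    Summable.of_norm_bounded (hv.mul_left _) (hbd z)
  choose z hz hzl using fun n : ℕ => D.dixG hcb hicc x (ε := 1 / ((n : ℝ) + 1)) (by positivity)
  have hzb : ∀ n, ‖z n‖ ≤ ‖x‖ := fun n => by
    have h1 := convexHull_min (t := closedBall (0 : Al) ‖x‖) (by
      rintro _ ⟨g, rfl⟩
      rw [mem_closedBall_zero_iff]; change ‖D.u g * x * D.u g⁻¹‖ ≤ _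
      rw [← D.u_star, norm_unit_conj (D.u_unit g) (D.u_unit' g)])
      (convex_closedBall _ _) (hz n)
    simpa using h1
  have hq : ∀ n, ∑' i, inner ℂ (v i) (A (z n) (v i)) = ∑' i, inner ℂ (v i) (A x (v i)) := fun n => by
    refine convexHull_min (t := {y | ∑' i, inner ℂ (v i) (A y (v i)) = ∑' i, inner ℂ (v i) (A x (v i))}) ?_ ?_ (hz n)
    · rintro _ ⟨g, rfl⟩; exact hinv g
    · intro a ha b hb p q hp hq hpq
      simp only [mem_setOf_eq] at ha hb ⊢
      have : ∀ i, inner ℂ (v i) (A (p • a + q • b) (v i)) =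
          (p : ℂ) * inner ℂ (v i) (A a (v i)) + (q : ℂ) * inner ℂ (v i) (A b (v i)) := fun i => by
        rw [← coe_smul, ← coe_smul q, map_add, map_smul, map_smul, add_apply, inner_add_right,
          smul_apply, smul_apply, inner_smul_right, inner_smul_right]
      simp only [this]
      rw [((hsm a).mul_left _).tsum_add ((hsm b).mul_left _), tsum_mul_left, tsum_mul_left, ha, hb, ← add_mul,
        ← ofReal_add, hpq]; simp
  have hstr : ∀ w : K, Tendsto (fun n => A (z n) w) atTop (𝓝 (s.τ x • w)) := by
    intro w
    rw [Metric.tendsto_atTop]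
    intro ε hε
    have hC : 0 < 3 * (‖x‖ + ‖s.τ x‖ + 1) := by positivity
    obtain ⟨y, hy⟩ := Metric.denseRange_iff.1 s.dense w (ε / (3 * (‖x‖ + ‖s.τ x‖ + 1))) (by positivity)
    have h0 : Tendsto (fun n : ℕ => 1 / ((n : ℝ) + 1) * ‖y‖) atTop (𝓝 (0 * ‖y‖)) :=
      tendsto_one_div_add_atTop_nhds_zero_nat.mul_const _
    rw [zero_mul] at h0
    obtain ⟨N, hN⟩ := (h0.eventually (gt_mem_nhds (show 0 < ε / 3 by positivity))).exists_forall_of_atTop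
    refine ⟨N, fun n hn => ?_⟩
    rw [dist_eq_norm] at hy ⊢
    have e1 : A (z n) w - s.τ x • w = A (z n) (w - s.j y) + A (z n - s.τ x • 1) (s.j y) - s.τ x • (w - s.j y) := by
      rw [map_sub, map_sub, map_smul, sub_apply, smul_apply, hA1, smul_sub]; abel
    rw [e1]
    have e2 : ‖A (z n) (w - s.j y)‖ ≤ ‖x‖ * ‖w - s.j y‖ := (hA _ _).trans (by gcongr; exact hzb n)
    have e3 : ‖A (z n - s.τ x • 1) (s.j y)‖ < ε / 3 := by
      refine (hAj _ _).trans_lt (lt_of_le_of_lt ?_ (hN n hn))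
      gcongr; exact (hzl n).le
    have e4 : ‖s.τ x • (w - s.j y)‖ = ‖s.τ x‖ * ‖w - s.j y‖ := norm_smul _ _
    rw [lt_div_iff₀ hC] at hy
    have e5 := norm_sub_le (A (z n) (w - s.j y) + A (z n - s.τ x • 1) (s.j y)) (s.τ x • (w - s.j y))
    have e6 := norm_add_le (A (z n) (w - s.j y)) (A (z n - s.τ x • 1) (s.j y))
    nlinarith [norm_nonneg (w - s.j y)]
  have hlim : Tendsto (fun n => ∑' i, inner ℂ (v i) (A (z n) (v i))) atTop (𝓝 (∑' i, inner ℂ (v i) (s.τ x • v i))) := by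
    refine tendsto_tsum_of_dominated_convergence (bound := fun i => ‖x‖ * ‖v i‖ ^ 2) (hv.mul_left _) (fun i => ?_)
      (.of_forall fun n i => ?_)
    · exact tendsto_const_nhds.inner (hstr (v i))
    · exact (hbd _ _).trans (by gcongr; exact hzb n)
  simp only [hq] at hlim
  rw [tendsto_nhds_unique tendsto_const_nhds hlim]
  simp only [inner_smul_right, inner_selfC]
  rw [tsum_mul_left, Complex.ofReal_tsum]

lemma summ_sq {I : Type*} {v : I → K} (h : ∑' i, ‖v i‖ₑ ^ 2 < ⊤) : Summable fun i => ‖v i‖ ^ 2 := by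
  simp only [enn_sq] at h
  have := ENNReal.summable_toReal h.ne
  refine this.congr fun i => ?_
  rw [ENNReal.toReal_ofReal (by positivity)]

lemma enn_tsum {I : Type*} {v : I → K} (h : Summable fun i => ‖v i‖ ^ 2) :
    ∑' i, ‖v i‖ₑ ^ 2 = ENNReal.ofReal (∑' i, ‖v i‖ ^ 2) := by
  simp only [enn_sq]
  rw [ofReal_tsum_of_nonneg (fun i => by positivity) h]

lemma re_tsum_eq {I : Type*} {a : I → ℂ} {r : I → ℝ} (h : ∀ i, a i = (r i : ℂ)) :
    ∑' i, a i = ((∑' i, r i : ℝ) : ℂ) := by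
  rw [Complex.ofReal_tsum]; exact tsum_congr h

lemma omegaL (hcb : CB s) (hicc : IsICC G) {I : Type*} {v : I → K} (hv : ∑' i, ‖v i‖ₑ ^ 2 < ⊤) (x : Al)
    (hinv : ∀ g, ∑' i, ‖s.L (x * D.u g) (v i)‖ₑ ^ 2 = ∑' i, ‖s.L x (v i)‖ₑ ^ 2) :
    ∑' i, ‖s.L x (v i)‖ₑ ^ 2 = ‖s.j x‖ₑ ^ 2 * ∑' i, ‖v i‖ₑ ^ 2 := by
  have hv' := summ_sq hv
  have hsm : ∀ x, Summable fun i => ‖s.L x (v i)‖ ^ 2 := fun x => by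
    refine Summable.of_nonneg_of_le (fun _ => by positivity) (fun i => ?_) (hv'.mul_left (‖x‖ ^ 2))
    rw [← mul_pow]; gcongr; exact s.nL _ _
  have hform : ∀ x i, inner ℂ (v i) (s.L (star x * x) (v i)) = ((‖s.L x (v i)‖ ^ 2 : ℝ) : ℂ) := fun x i => by
    rw [s.L_mul, mul_apply, ← s.inner_L, inner_selfC]
  have := D.omega hcb hicc hv' ⟨⟨s.L, s.L_add⟩, s.L_smul⟩ s.nL (fun v => by
    change s.L 1 v = v; rw [s.L_one]; rfl) (fun x y => by
    change ‖s.L x (s.j y)‖ ≤ _; rw [s.L_j]; exact s.nj_mul' _ _) (star x * x) (fun g => by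
    change ∑' i, inner ℂ (v i) (s.L _ (v i)) = ∑' i, inner ℂ (v i) (s.L _ (v i))
    have e : D.u g * (star x * x) * D.u g⁻¹ = star (x * D.u g⁻¹) * (x * D.u g⁻¹) := by
      rw [star_mul, D.u_star, inv_inv]; simp only [mul_assoc]
    rw [e, re_tsum_eq (hform _), re_tsum_eq (hform _)]
    have h1 := hinv g⁻¹
    rw [enn_tsum (hsm _), enn_tsum (hsm _), ofReal_eq_ofReal_iff (tsum_nonneg fun _ => by positivity)
      (tsum_nonneg fun _ => by positivity)] at h1
    rw [h1])
  change ∑' i, inner ℂ (v i) (s.L _ (v i)) = _ at this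
  rw [re_tsum_eq (hform _), s.τ_star_mul, inner_selfC, ← Complex.ofReal_mul, Complex.ofReal_inj] at this
  rw [enn_tsum (hsm x), this, enn_tsum hv', enn_sq, ofReal_mul (by positivity)]

lemma omegaR (hcb : CB s) (hicc : IsICC G) {I : Type*} {v : I → K} (hv : ∑' i, ‖v i‖ₑ ^ 2 < ⊤) (x : Al)
    (hinv : ∀ g, ∑' i, ‖s.R (D.u g * x) (v i)‖ₑ ^ 2 = ∑' i, ‖s.R x (v i)‖ₑ ^ 2) :
    ∑' i, ‖s.R x (v i)‖ₑ ^ 2 = ‖s.j x‖ₑ ^ 2 * ∑' i, ‖v i‖ₑ ^ 2 := by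
  have hv' := summ_sq hv
  have hsm : ∀ x, Summable fun i => ‖s.R x (v i)‖ ^ 2 := fun x => by
    refine Summable.of_nonneg_of_le (fun _ => by positivity) (fun i => ?_) (hv'.mul_left (‖x‖ ^ 2))
    rw [← mul_pow]; gcongr; exact s.nR _ _
  have hform : ∀ x i, inner ℂ (v i) (s.R (x * star x) (v i)) = ((‖s.R x (v i)‖ ^ 2 : ℝ) : ℂ) := fun x i => by
    rw [s.R_mul, mul_apply, ← s.inner_R, inner_selfC]
  have := D.omega hcb hicc hv' ⟨⟨s.R, s.R_add⟩, s.R_smul⟩ s.nR (fun v => by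
    change s.R 1 v = v; rw [s.R_one]; rfl) (fun x y => by
    change ‖s.R x (s.j y)‖ ≤ _; rw [s.R_j, mul_comm]; exact s.nj_mul _ _) (x * star x) (fun g => by
    change ∑' i, inner ℂ (v i) (s.R _ (v i)) = ∑' i, inner ℂ (v i) (s.R _ (v i))
    have e : D.u g * (x * star x) * D.u g⁻¹ = (D.u g * x) * star (D.u g * x) := by
      rw [star_mul, D.u_star]; simp only [mul_assoc]
    rw [e, re_tsum_eq (hform _), re_tsum_eq (hform _)]
    have h1 := hinv g
    rw [enn_tsum (hsm _), enn_tsum (hsm _), ofReal_eq_ofReal_iff (tsum_nonneg fun _ => by positivity)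
      (tsum_nonneg fun _ => by positivity)] at h1
    rw [h1])
  change ∑' i, inner ℂ (v i) (s.R _ (v i)) = _ at this
  rw [re_tsum_eq (hform _), s.τ_mul_comm, s.τ_star_mul, inner_selfC, ← Complex.ofReal_mul, Complex.ofReal_inj] at this
  rw [enn_tsum (hsm x), this, enn_tsum hv', enn_sq, ofReal_mul (by positivity)]

end XD

lemma hsL_scal {H G : Type} [Group H] [Group G] {s : Std Al K} {F : FR H K} (D : XD G s) (hcb : CB s)
    (hicc : IsICC G) (hL : ∀ x, F.Cm (s.L x)) {f : B(K)} (hf : F.Cm f)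
    (hfL : ∀ g v, f (s.L (D.u g) v) = s.L (D.u g) (f v)) (hfin : F.hs f < ⊤) (x : Al) :
    F.hs (s.L x * f) = ‖s.j x‖ₑ ^ 2 * F.hs f := by
  refine D.omegaL hcb hicc (v := fun i => f (F.e i)) hfin x fun g => ?_
  have e : s.L (x * D.u g) * f = s.L x * f * s.L (D.u g) := by
    ext v
    simp only [mul_apply, s.L_mul, hfL]
  have := FR.hs_iso_right (F := F) (U := s.L (D.u g)) (T := s.L x * f) (fun v => by
    rw [s.L_star, D.u_star, D.L_norm_u]) ((hL x).mul hf) (hL _)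
  rw [← e] at this
  exact this

lemma hsR_scal {H G : Type} [Group H] [Group G] {s : Std Al K} {F : FR H K} (D : XD G s) (hcb : CB s)
    (hicc : IsICC G) (hR : ∀ x, F.Cm (s.R x)) {f : B(K)} (hf : F.Cm f)
    (hfR : ∀ g v, f (s.R (D.u g) v) = s.R (D.u g) (f v)) (hfin : F.hs f < ⊤) (x : Al) :
    F.hs (s.R x * f) = ‖s.j x‖ₑ ^ 2 * F.hs f := by
  refine D.omegaR hcb hicc (v := fun i => f (F.e i)) hfin x fun g => ?_
  have e : s.R (D.u g * x) * f = s.R x * f * s.R (D.u g) := by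
    ext v
    simp only [mul_apply, s.R_mul, hfR]
  have := FR.hs_iso_right (F := F) (U := s.R (D.u g)) (T := s.R x * f) (fun v => by
    rw [s.R_star, D.u_star, D.R_norm_u]) ((hR x).mul hf) (hR _)
  rw [← e] at this
  exact this

/-- finite dimensional invariant subspaces -/
structure FW {G : Type} [Group G] {s : Std Al K} (D : XD G s) where
  W : Submodule ℂ Al
  fd : FiniteDimensional ℂ W
  le : ∀ w ∈ W, w ∈ D.A
  inv : ∀ g, ∀ w ∈ W, D.u g * w * D.u g⁻¹ ∈ W

namespace FW
variable {G : Type} [Group G] {s : Std Al K} {D : XD G s} (w : FW D)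

def N : Submodule ℂ K := (Span {v | ∃ g, ∃ a ∈ w.W, v = s.j (a * D.u g)}).topologicalClosure
instance : CompleteSpace w.N := (isClosed_topologicalClosure _).completeSpace_coe
def p : B(K) := w.N.starProjection

lemma mem_N {a : Al} (ha : a ∈ w.W) (g : G) : s.j (a * D.u g) ∈ w.N :=
  le_topologicalClosure _ (subset_span ⟨g, a, ha, rfl⟩)
lemma mem_N1 {a : Al} (ha : a ∈ w.W) : s.j a ∈ w.N := by
  have := w.mem_N ha 1
  rwa [D.u_one, mul_one] at this

lemma N_ind {P : Submodule ℂ K} (hP : IsClosed (P : Set K))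
    (h : ∀ g, ∀ a ∈ w.W, s.j (a * D.u g) ∈ P) : w.N ≤ P := by
  refine topologicalClosure_minimal _ (span_le.2 ?_) hP
  rintro _ ⟨g, a, ha, rfl⟩
  exact h g a ha

lemma isClosed_N : IsClosed (w.N : Set K) := isClosed_topologicalClosure _

lemma N_maps {P : Submodule ℂ K} (hP : IsClosed (P : Set K)) {T : B(K)}
    (h : ∀ g, ∀ a ∈ w.W, T (s.j (a * D.u g)) ∈ P) : ∀ v ∈ w.N, T v ∈ P := by
  intro v hv
  exact w.N_ind (P := P.comap (T : K →ₗ[ℂ] K)) (hP.preimage T.continuous) h hv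

lemma p_mem (v : K) : w.p v ∈ w.N := starProjection_apply_mem _ _
lemma p_fix {v : K} (hv : v ∈ w.N) : w.p v = v := starProjection_eq_self_iff.2 hv
lemma p_norm (v : K) : ‖w.p v‖ ≤ ‖v‖ := norm_starProjection_apply_le _ _
lemma p_star : star w.p = w.p := sp_star _
lemma p_idem : w.p * w.p = w.p := by ext v; exact w.p_fix (w.p_mem v)

lemma p_Ru (g : G) (v : K) : w.p (s.R (D.u g) v) = s.R (D.u g) (w.p v) := by
  have h : ∀ g, ∀ v ∈ w.N, s.R (D.u g) v ∈ w.N := fun g => w.N_maps w.isClosed_N fun h a ha => by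
    rw [s.R_j, mul_assoc, D.u_mul]; exact w.mem_N ha _
  exact proj_comm (h g) (by rw [s.R_star, D.u_star]; exact h _) v
lemma p_Lu (g : G) (v : K) : w.p (s.L (D.u g) v) = s.L (D.u g) (w.p v) := by
  have h : ∀ g, ∀ v ∈ w.N, s.L (D.u g) v ∈ w.N := fun g => w.N_maps w.isClosed_N fun h a ha => by
    rw [s.L_j]
    have := w.mem_N (w.inv g a ha) (g * h)
    rwa [← D.u_mul, mul_assoc, ← mul_assoc (D.u g⁻¹), D.u_inv_mul, one_mul, mul_assoc] at this
  exact proj_comm (h g) (by rw [s.L_star, D.u_star]; exact h _) v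

def WK : Submodule ℂ K := w.W.map s.j
instance : FiniteDimensional ℂ w.WK := by
  haveI := w.fd
  exact inferInstanceAs (FiniteDimensional ℂ (w.W.map s.j))
def d : ℕ := finrank ℂ w.WK
def q (t : Fin w.d) : K := (stdOrthonormalBasis ℂ w.WK t : K)
lemma q_mem (t : Fin w.d) : ∃ a ∈ w.W, s.j a = w.q t := (stdOrthonormalBasis ℂ w.WK t).2
lemma q_orth : Orthonormal ℂ w.q := by
  have := (stdOrthonormalBasis ℂ w.WK).orthonormal.comp_linearIsometry w.WK.subtypeₗᵢ
  exact this
lemma q_perp {v : K} (h : ∀ t, inner ℂ (w.q t) v = 0) {a : Al} (ha : a ∈ w.W) : inner ℂ (s.j a) v = 0 := by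
  have h1 := (stdOrthonormalBasis ℂ w.WK).sum_repr ⟨s.j a, a, ha, rfl⟩
  have h2 := congrArg (fun z : w.WK => (z : K)) h1
  simp only [Submodule.coe_sum, Submodule.coe_smul] at h2
  rw [← h2, sum_inner]
  refine sum_eq_zero fun t _ => ?_
  rw [inner_smul_left]
  have : inner ℂ ((stdOrthonormalBasis ℂ w.WK t : w.WK) : K) v = 0 := h t
  rw [this, mul_zero]
lemma q_HA (t : Fin w.d) : w.q t ∈ D.HA := by
  obtain ⟨a, ha, h⟩ := w.q_mem t
  rw [← h]; exact D.mem_HA (w.le a ha)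
lemma q_N (t : Fin w.d) : w.q t ∈ w.N := by
  obtain ⟨a, ha, h⟩ := w.q_mem t
  rw [← h]; exact w.mem_N1 ha

lemma p_zero {v : K} (h : ∀ g, ∀ a ∈ w.W, inner ℂ (s.j (a * D.u g)) v = 0) : w.p v = 0 := by
  rw [p, Submodule.starProjection_apply_eq_zero_iff, mem_orthogonal]
  intro z hz
  have := w.N_ind (P := (Span {v})ᗮ) (Submodule.isClosed_orthogonal _) (fun g a ha => by
    rw [Submodule.mem_orthogonal_singleton_iff_inner_left]; exact h g a ha) hz
  rwa [Submodule.mem_orthogonal_singleton_iff_inner_left] at this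

lemma hsR (hcb : CB s) {T : B(K)} (hT : (D.FRR hcb).Cm T) :
    (D.FRR hcb).hs (T * w.p) = ∑' t, ‖T (w.q t)‖ₑ ^ 2 := by
  refine FR.hsp w.p_star (q := w.q) ?_ (D.CmR.2 w.p_Ru) (fun t => w.p_fix (w.q_N t)) (fun v h => ?_) hT
  · refine ⟨fun x => ?_, fun x y hxy => ?_⟩
    · change ‖s.R _ _‖ = 1
      rw [D.R_norm_u]; exact w.q_orth.1 _
    · obtain ⟨t, g⟩ := x
      obtain ⟨t', h⟩ := y
      change inner ℂ (s.R (D.u g⁻¹) (w.q t)) (s.R (D.u h⁻¹) (w.q t')) = 0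
      by_cases hgh : g = h
      · subst hgh
        rw [D.inner_Ru, D.R_R, mul_inv_cancel, D.u_one, s.R_one]
        exact w.q_orth.2 (fun hij => hxy (by rw [hij]))
      · exact D.orth (by simpa using hgh) (w.q_HA _) (w.q_HA _)
  · refine w.p_zero fun g a ha => ?_
    rw [← s.R_j, D.inner_Ru]
    refine w.q_perp (fun t => ?_) ha
    rw [← D.inner_Ru]
    have := h t g⁻¹
    rwa [D.FRR_ρ, inv_inv] at this

lemma hsL (hcb : CB s) {T : B(K)} (hT : (D.FRL hcb).Cm T) :
    (D.FRL hcb).hs (T * w.p) = ∑' t, ‖T (w.q t)‖ₑ ^ 2 := by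
  refine FR.hsp w.p_star (q := w.q) ?_ (D.CmL.2 w.p_Lu) (fun t => w.p_fix (w.q_N t)) (fun v h => ?_) hT
  · refine ⟨fun x => ?_, fun x y hxy => ?_⟩
    · change ‖s.L _ _‖ = 1
      rw [D.L_norm_u]; exact w.q_orth.1 _
    · obtain ⟨t, g⟩ := x
      obtain ⟨t', h⟩ := y
      change inner ℂ (s.L (D.u g) (w.q t)) (s.L (D.u h) (w.q t')) = 0
      by_cases hgh : g = h
      · subst hgh
        rw [D.inner_Lu, D.L_L, inv_mul_cancel, D.u_one, s.L_one]
        exact w.q_orth.2 (fun hij => hxy (by rw [hij]))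
      · rw [D.L_eq, D.L_eq]
        exact D.orth hgh (D.Ad_HA _ (w.q_HA _)) (D.Ad_HA _ (w.q_HA _))
  · refine w.p_zero fun g a ha => ?_
    have e : s.j (a * D.u g) = s.L (D.u g) (s.j (D.u g⁻¹ * a * D.u g)) := by
      rw [s.L_j, ← mul_assoc, ← mul_assoc, D.u_mul_inv, one_mul]
    rw [e, D.inner_Lu]
    refine w.q_perp (fun t => ?_) (by have := w.inv g⁻¹ a ha; rwa [inv_inv] at this)
    rw [← D.inner_Lu]
    exact h t g

lemma sum_q : ∑' t, ‖w.q t‖ₑ ^ 2 = w.d := by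
  rw [tsum_fintype]
  simp [enn_sq, w.q_orth.1]

lemma hsR_p (hcb : CB s) : (D.FRR hcb).hs w.p = w.d := by
  have := w.hsR hcb FR.Cm.one
  rw [one_mul] at this
  rw [this, ← w.sum_q]; rfl
lemma hsL_p (hcb : CB s) : (D.FRL hcb).hs w.p = w.d := by
  have := w.hsL hcb FR.Cm.one
  rw [one_mul] at this
  rw [this, ← w.sum_q]; rfl

lemma hsR_Lp (hcb : CB s) (hicc : IsICC G) (x : Al) :
    (D.FRR hcb).hs (s.L x * w.p) = ‖s.j x‖ₑ ^ 2 * w.d := by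
  rw [hsL_scal D hcb hicc (fun x => D.CmR_L x) (D.CmR.2 w.p_Ru) w.p_Lu (by rw [hsR_p]; finiteness), hsR_p]
lemma hsL_Rp (hcb : CB s) (hicc : IsICC G) (x : Al) :
    (D.FRL hcb).hs (s.R x * w.p) = ‖s.j x‖ₑ ^ 2 * w.d := by
  rw [hsR_scal D hcb hicc (fun x => D.CmL_R x) (D.CmL.2 w.p_Lu) w.p_Ru (by rw [hsL_p]; finiteness), hsL_p]

lemma hsR_com (hcb : CB s) (hicc : IsICC G) (x : Al) :
    (D.FRR hcb).hs (s.L x * w.p - w.p * s.L x) ≤ 4 * (‖s.j x‖ₑ ^ 2 * w.d) := by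
  refine (FR.hs_sub _ _).trans ?_
  have : (D.FRR hcb).hs (w.p * s.L x) = ‖s.j x‖ₑ ^ 2 * w.d := by
    rw [← FR.hs_star ((D.CmR.2 w.p_Ru).mul (D.CmR_L x)), star_mul, w.p_star, s.L_star, w.hsR_Lp hcb hicc,
      enn_of_norm (s.nj_star x)]
  rw [this, w.hsR_Lp hcb hicc]
  apply le_of_eq; ring
lemma hsL_com (hcb : CB s) (hicc : IsICC G) (x : Al) :
    (D.FRL hcb).hs (s.R x * w.p - w.p * s.R x) ≤ 4 * (‖s.j x‖ₑ ^ 2 * w.d) := by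
  refine (FR.hs_sub _ _).trans ?_
  have : (D.FRL hcb).hs (w.p * s.R x) = ‖s.j x‖ₑ ^ 2 * w.d := by
    rw [← FR.hs_star ((D.CmL.2 w.p_Lu).mul (D.CmL_R x)), star_mul, w.p_star, s.R_star, w.hsL_Rp hcb hicc,
      enn_of_norm (s.nj_star x)]
  rw [this, w.hsL_Rp hcb hicc]
  apply le_of_eq; ring

/-- Σ ‖R_{q_t} v‖² = d‖v‖² -/
lemma sum_R (hcb : CB s) (hicc : IsICC G) {a : Fin w.d → Al} (ha : ∀ t, s.j (a t) = w.q t) (v : K) :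
    ∑ t, ‖s.R (a t) v‖ ^ 2 = w.d * ‖v‖ ^ 2 := by
  have hcl : IsClosed {v : K | ∑ t, ‖s.R (a t) v‖ ^ 2 = w.d * ‖v‖ ^ 2} :=
    isClosed_eq (by fun_prop) (by fun_prop)
  have : closure (Set.range s.j) ⊆ {v : K | ∑ t, ‖s.R (a t) v‖ ^ 2 = w.d * ‖v‖ ^ 2} := by
    refine closure_minimal ?_ hcl
    rintro _ ⟨x, rfl⟩
    have h1 := w.hsR_Lp hcb hicc x
    rw [w.hsR hcb (D.CmR_L x), tsum_fintype] at h1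
    simp only [enn_sq] at h1
    rw [← ENNReal.ofReal_sum_of_nonneg (fun _ _ => by positivity), ← ofReal_natCast,
      ← ofReal_mul (by positivity), ofReal_eq_ofReal_iff (by positivity) (by positivity)] at h1
    simp only [mem_setOf_eq]
    rw [mul_comm, ← h1]
    refine Finset.sum_congr rfl fun t _ => ?_
    rw [← ha, s.R_j, s.L_j]
  exact this (s.dense v)

end FW

namespace FW
variable {G : Type} [Group G] {s : Std Al K} {D : XD G s} (w : FW D)

lemma N_cf {v : K} (hv : v ∈ w.N) (g : G) : D.cf v g ∈ w.WK := by
  have hcl : IsClosed (w.WK : Set K) := Submodule.closed_of_finiteDimensional _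
  refine w.N_maps (T := D.PA * s.R (D.u g⁻¹)) hcl (fun h a ha => ?_) v hv
  rw [mul_apply, s.R_j, D.PA_j, mul_assoc, D.u_mul, D.bimodl (w.le a ha)]
  by_cases hgh : h * g⁻¹ = 1
  · rw [hgh, D.u_one, D.fix _ (one_mem _), mul_one]; exact ⟨a, ha, rfl⟩
  · rw [D.E_u _ hgh, mul_zero, map_zero]; exact zero_mem _

lemma R_WK {z : K} (hz : z ∈ w.WK) (g : G) : s.R (D.u g) z ∈ w.N := by
  obtain ⟨a, ha, rfl⟩ := hz
  rw [s.R_j]; exact w.mem_N ha g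

lemma mem_N_of_cf (hcb : CB s) {v : K} (h : ∀ g, D.cf v g ∈ w.WK) : v ∈ w.N := by
  have h0 : v - w.p v = 0 := D.ortho_top hcb fun g z hz => by
    rw [D.inner_Ru, ← D.inner_PA hz]
    change inner ℂ z (D.cf (v - w.p v) g) = 0
    have h1 : D.cf (v - w.p v) g ∈ w.WK := by
      rw [D.cf_sub]; exact sub_mem (h g) (w.N_cf (w.p_mem v) g)
    have h2 : inner ℂ (D.cf (v - w.p v) g) (D.cf (v - w.p v) g) = (0 : ℂ) := by
      have h3 : D.cf (v - w.p v) g ∈ D.HA := D.PA_mem _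
      conv_lhs => arg 3; rw [XD.cf]
      rw [D.inner_PA h3, ← D.inner_Ru]
      exact (mem_orthogonal _ _).1 (sub_starProjection_mem_orthogonal (K := w.N) v) _
        (w.R_WK h1 g)
    rw [inner_self_eq_zero.1 h2, inner_zero_right]
  rw [sub_eq_zero.1 h0]; exact w.p_mem v

end FW

structure FS {G : Type} [Group G] {s : Std Al K} (D : XD G s) where
  S : StarSubalgebra ℂ Al
  fd : FiniteDimensional ℂ S
  le : S ≤ D.A
  inv : ∀ g, ∀ w ∈ S, D.u g * w * D.u g⁻¹ ∈ S

namespace FS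
variable {G : Type} [Group G] {s : Std Al K} {D : XD G s} (w : FS D)

def fw : FW D where
  W := toSubmodule w.S.toSubalgebra
  fd := w.fd
  le := fun a ha => w.le ha
  inv := w.inv

lemma N_R {a : Al} (ha : a ∈ w.S) : ∀ v ∈ w.fw.N, s.R a v ∈ w.fw.N :=
  w.fw.N_maps w.fw.isClosed_N fun g b hb => by
    rw [s.R_j]
    have := w.fw.mem_N (a := b * (D.u g * a * D.u g⁻¹)) (show _ ∈ w.S from mul_mem (show b ∈ w.S from hb) (w.inv g a ha)) g
    simpa only [mul_assoc, D.u_inv_mul, mul_one] using this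
lemma N_Ru (g : G) : ∀ v ∈ w.fw.N, s.R (D.u g) v ∈ w.fw.N := fun v hv => by
  rw [← w.fw.p_fix hv, ← w.fw.p_Ru]; exact w.fw.p_mem _
lemma N_L {x : Al} (hx : s.j x ∈ w.fw.N) : ∀ v ∈ w.fw.N, s.L x v ∈ w.fw.N :=
  w.fw.N_maps w.fw.isClosed_N fun g b hb => by
    have := w.N_Ru g _ (w.N_R hb _ hx)
    rw [s.R_j, s.R_j] at this
    rwa [s.L_j, ← mul_assoc]

lemma N_star {x : Al} (hx : s.j x ∈ w.fw.N) : s.j (star x) ∈ w.fw.N := by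
  have h1 : (w.fw.N : Set K) = closure (s.j '' (Span {x | ∃ g, ∃ a ∈ w.S, x = a * D.u g} : Set Al)) := by
    rw [FW.N, topologicalClosure_coe, ← map_coe, map_span]
    congr 3
    ext v
    constructor
    · rintro ⟨g, a, ha, rfl⟩; exact ⟨_, ⟨g, a, ha, rfl⟩, rfl⟩
    · rintro ⟨_, ⟨g, a, ha, rfl⟩, rfl⟩; exact ⟨g, a, ha, rfl⟩
  have hst : ∀ y ∈ Span {x | ∃ g, ∃ a ∈ w.S, x = a * D.u g},
      star y ∈ Span {x | ∃ g, ∃ a ∈ w.S, x = a * D.u g} := by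
    intro y hy
    induction hy using Submodule.span_induction with
    | mem x h =>
      obtain ⟨g, a, ha, rfl⟩ := h
      refine subset_span ⟨g⁻¹, D.u g⁻¹ * star a * D.u g, ?_, ?_⟩
      · have := w.inv g⁻¹ (star a) (star_mem ha)
        rwa [inv_inv] at this
      · rw [star_mul, D.u_star, mul_assoc, mul_assoc, D.u_mul_inv, mul_one]
    | zero => rw [star_zero]; exact zero_mem _
    | add x y _ _ hx hy => rw [star_add]; exact add_mem hx hy
    | smul c x _ hx => rw [star_smul]; exact Submodule.smul_mem _ _ hx
  rw [← mem_coe, h1] at hx ⊢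
  rw [Metric.mem_closure_iff] at hx ⊢
  intro ε hε
  obtain ⟨_, ⟨y, hy, rfl⟩, hd⟩ := hx ε hε
  refine ⟨_, ⟨star y, hst y hy, rfl⟩, ?_⟩
  rw [dist_eq_norm, ← map_sub] at hd ⊢
  rwa [← star_sub, s.nj_star]

/-- the intermediate algebra -/
def M : StarSubalgebra ℂ Al where
  carrier := {x | s.j x ∈ w.fw.N}
  mul_mem' := fun {a b} ha hb => by
    simp only [mem_setOf_eq] at *
    rw [← s.L_j]; exact w.N_L ha _ hb
  add_mem' := fun {a b} ha hb => by
    simp only [mem_setOf_eq] at *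
    rw [map_add]; exact add_mem ha hb
  algebraMap_mem' := fun c => by
    simp only [mem_setOf_eq]
    rw [Algebra.algebraMap_eq_smul_one, map_smul]
    exact Submodule.smul_mem _ _ (w.fw.mem_N1 (one_mem w.S))
  star_mem' := fun {a} ha => w.N_star ha

lemma mem_M {x : Al} : x ∈ w.M ↔ s.j x ∈ w.fw.N := Iff.rfl
lemma clo_M : clo s w.M = w.fw.N := by
  refine le_antisymm ?_ ?_
  · refine topologicalClosure_minimal _ ?_ w.fw.isClosed_N
    rintro _ ⟨x, hx, rfl⟩; exact hx
  · refine w.fw.N_ind (isClosed_topologicalClosure _) fun g a ha => mem_clo (w.fw.mem_N ha g)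
lemma PP_M : PP s w.M = w.fw.p := by
  ext v
  refine (Submodule.eq_starProjection_of_mem_orthogonal (K := w.fw.N) ?_ ?_).symm
  · rw [← w.clo_M]; exact PP_mem v
  · rw [← w.clo_M]; exact sub_starProjection_mem_orthogonal v
lemma M_twoClosed : TwoClosed s (w.M : Set Al) := fun x hx => by
  rw [← coe_clo, w.clo_M] at hx; exact hx
lemma S_le_M : w.S ≤ w.M := fun a ha => w.fw.mem_N1 ha
lemma u_mem (g : G) : D.u g ∈ w.M := by
  have := w.fw.mem_N (one_mem w.S) g
  rwa [one_mul] at this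
lemma mem_M_iff (hcb : CB s) {x : Al} : x ∈ w.M ↔ ∀ g, D.E (x * D.u g⁻¹) ∈ w.S := by
  have h : ∀ g, D.cf (s.j x) g = s.j (D.E (x * D.u g⁻¹)) := fun g => by
    rw [XD.cf, s.R_j, D.PA_j]
  have h2 : ∀ g, D.cf (s.j x) g ∈ w.fw.WK ↔ D.E (x * D.u g⁻¹) ∈ w.S := fun g => by
    rw [h]
    constructor
    · rintro ⟨a, ha, hh⟩; rw [← s.inj' hh]; exact ha
    · intro ha; exact ⟨_, ha, rfl⟩
  rw [mem_M]
  constructor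
  · intro hx g; exact (h2 g).1 (w.fw.N_cf hx g)
  · intro hx; exact w.fw.mem_N_of_cf hcb fun g => (h2 g).2 (hx g)
lemma p_R {x : Al} (hx : x ∈ w.M) (v : K) : w.fw.p (s.R x v) = s.R x (w.fw.p v) := by
  rw [← w.PP_M]; exact PP_comm_R hx v
lemma p_L {x : Al} (hx : x ∈ w.M) (v : K) : w.fw.p (s.L x v) = s.L x (w.fw.p v) := by
  rw [← w.PP_M]; exact PP_comm_L hx v
end FS

structure TW {G : Type} [Group G] {s : Std Al K} (D : XD G s) where
  F : ℕ → FS D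
  mono : ∀ n, (F n).S ≤ (F (n + 1)).S
  dns : ∀ a ∈ D.A, ∀ ε > 0, ∃ n, ∃ b ∈ (F n).S, ‖s.j (a - b)‖ < ε

namespace TW
variable {G : Type} [Group G] {s : Std Al K} {D : XD G s} (t : TW D)

lemma S_mono {m n : ℕ} (h : m ≤ n) : (t.F m).S ≤ (t.F n).S :=
  monotone_nat_of_le_succ (f := fun n => (t.F n).S) t.mono h
lemma N_mono {m n : ℕ} (h : m ≤ n) : (t.F m).fw.N ≤ (t.F n).fw.N :=
  (t.F m).fw.N_ind (t.F n).fw.isClosed_N fun g a ha => (t.F n).fw.mem_N (t.S_mono h ha) g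
lemma M_mono {m n : ℕ} (h : m ≤ n) : (t.F m).M ≤ (t.F n).M := fun x hx => t.N_mono h hx

lemma dense (hcb : CB s) (v : K) {ε : ℝ} (hε : 0 < ε) : ∃ n, ∃ y ∈ (t.F n).M, ‖v - s.j y‖ < ε := by
  have hdir : Directed (· ≤ ·) fun n => (t.F n).fw.N := fun m n =>
    ⟨max m n, t.N_mono (le_max_left _ _), t.N_mono (le_max_right _ _)⟩
  have htop : (⨆ n, (t.F n).fw.N).topologicalClosure = ⊤ := by
    rw [Submodule.topologicalClosure_eq_top_iff, eq_bot_iff]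
    intro v hv
    rw [mem_orthogonal] at hv
    refine (mem_bot ℂ).2 (D.ortho_top hcb fun g z hz => ?_)
    refine D.HA_induction (p := fun z => inner ℂ (s.R (D.u g) z) v = 0)
      (isClosed_eq (by fun_prop) continuous_const) (fun a ha => ?_) hz
    by_contra hne
    have hpos : 0 < ‖inner ℂ (s.R (D.u g) (s.j a)) v‖ := norm_pos_iff.2 hne
    obtain ⟨n, b, hb, hd⟩ := t.dns a ha (‖inner ℂ (s.R (D.u g) (s.j a)) v‖ / (‖v‖ + 1)) (by positivity)
    have h1 : inner ℂ (s.R (D.u g) (s.j a)) v = inner ℂ (s.R (D.u g) (s.j (a - b))) v := by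
      rw [map_sub, map_sub, inner_sub_left, hv (s.R (D.u g) (s.j b)), sub_zero]
      refine (le_iSup (fun n => (t.F n).fw.N) n) ?_
      rw [s.R_j]; exact (t.F n).fw.mem_N hb g
    have h2 := norm_inner_le_norm (𝕜 := ℂ) (s.R (D.u g) (s.j (a - b))) v
    rw [← h1, D.R_norm_u] at h2
    rw [lt_div_iff₀ (by positivity)] at hd
    nlinarith [norm_nonneg v, norm_nonneg (s.j (a - b))]
  have hv : v ∈ (⨆ n, (t.F n).fw.N).topologicalClosure := by rw [htop]; trivial
  rw [← mem_coe, topologicalClosure_coe, Metric.mem_closure_iff] at hv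
  obtain ⟨z, hz, hd⟩ := hv (ε / 2) (by positivity)
  obtain ⟨n, hn⟩ := (Submodule.mem_iSup_of_directed _ hdir).1 hz
  rw [← FS.clo_M, ← mem_coe, coe_clo, Metric.mem_closure_iff] at hn
  obtain ⟨_, ⟨y, hy, rfl⟩, hd2⟩ := hn (ε / 2) (by positivity)
  refine ⟨n, y, hy, ?_⟩
  rw [← dist_eq_norm]
  linarith [dist_triangle v z (s.j y)]
end TW

def URL {H G : Type} [Group H] [Group G] {s : Std Al K} (D : XD G s) (F : FR H K)
    (hF : ∀ x, F.Cm (s.L x)) : FR.UR F G where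
  U := fun g => s.L (D.u g)
  one := by rw [D.u_one, s.L_one]
  mul := fun g h => by rw [← D.u_mul, s.L_mul]
  st := fun g => by rw [s.L_star, D.u_star]
  cm := fun g => hF _

def URR {H G : Type} [Group H] [Group G] {s : Std Al K} (D : XD G s) (F : FR H K)
    (hF : ∀ x, F.Cm (s.R x)) : FR.UR F G where
  U := fun g => s.R (D.u g⁻¹)
  one := by rw [inv_one, D.u_one, s.R_one]
  mul := fun g h => by rw [mul_inv_rev, ← D.u_mul, s.R_mul]
  st := fun g => by rw [s.R_star, D.u_star]
  cm := fun g => hF _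

lemma step1 {Γ Λ : Type} [Group Γ] [Group Λ] {s : Std Al K} (D1 : XD Γ s) (D2 : XD Λ s) (hcb : CB s)
    (hicc : IsICC Γ) (hT : HasPropertyT Λ) (t : TW D1) {δ : ℝ} (hδ : 0 < δ) (n0 : ℕ) :
    ∃ T1 : B(K), (D1.FRR hcb).Cm T1 ∧ (D1.FRR hcb).hs T1 < ⊤ ∧
      (∀ g v, T1 (s.L (D2.u g) v) = s.L (D2.u g) (T1 v)) ∧
      ∀ x ∈ (t.F n0).M, ‖T1 (s.j x) - s.j x‖ ≤ δ * ‖x‖ := by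
  obtain ⟨S, κ, hκ, HT⟩ := FR.propT_hs (F := D1.FRR hcb) hT hδ
  choose nn y hy hyd using fun g : Λ => t.dense hcb (s.j (D2.u g)) (ε := κ / 2) (by positivity)
  set n := max n0 (S.sup nn) with hn
  set w := (t.F n).fw with hw
  set u := URL D2 (D1.FRR hcb) (fun x => D1.CmR_L x) with hu
  have hUg : ∀ g, u.U g = s.L (D2.u g) := fun g => rfl
  have hpC : (D1.FRR hcb).Cm w.p := D1.CmR.2 w.p_Ru
  have hhs : (D1.FRR hcb).hs w.p = ENNReal.ofReal ((Real.sqrt w.d) ^ 2) := by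
    rw [w.hsR_p, sq_sqrt (by positivity), ofReal_natCast]
  have hnear := HT u w.p hpC (Real.sqrt w.d) (by positivity) hhs (fun g hg => by
    rw [← u.hs_cj' g hpC, hUg]
    have hyn : y g ∈ (t.F n).M := t.M_mono (le_trans (Finset.le_sup hg) (le_max_right _ _)) (hy g)
    have e : s.L (D2.u g) * w.p - w.p * s.L (D2.u g) =
        s.L (D2.u g - y g) * w.p - w.p * s.L (D2.u g - y g) := by
      ext v
      simp only [sub_apply, mul_apply, s.L_sub, map_sub]
      rw [hw, (t.F n).p_L hyn]; abel
    rw [e]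
    refine (w.hsR_com hcb hicc _).trans ?_
    have h1 : ‖s.j (D2.u g - y g)‖ ≤ κ / 2 := by rw [map_sub]; exact (hyd g).le
    rw [enn_sq, ← ofReal_natCast, ← ofReal_mul (by positivity), ← ofReal_ofNat 4,
      ← ofReal_mul (by positivity)]
    refine ofReal_le_ofReal ?_
    rw [mul_pow, sq_sqrt (by positivity)]
    have h2 : ‖s.j (D2.u g - y g)‖ ^ 2 ≤ (κ / 2) ^ 2 := by gcongr
    have h3 : (0 : ℝ) ≤ w.d := by positivity
    nlinarith)
  obtain ⟨T, hTC, hTf, hTU, -, ⟨Tn, hTn, hlim⟩, -⟩ := FR.avgHS _ u hpC (by rw [hhs]; finiteness)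
  refine ⟨T, hTC, hTf, fun g v => ?_, fun x hx => ?_⟩
  · have := congrArg (fun S : B(K) => S v) (hTU g)
    exact this.symm
  · have hxn : x ∈ (t.F n).M := t.M_mono (le_max_left _ _) hx
    -- estimate on the unit vectors
    have hd : 0 < w.d := by
      by_contra h0
      have h0 : w.d = 0 := by omega
      have h1 := w.hsR_p hcb
      rw [h0] at h1
      have h2 := FR.hs_eq_zero hpC (by simpa using h1)
      have h3 := w.p_fix (w.mem_N1 (a := 1) (one_mem (t.F n).S))
      rw [h2] at h3
      have := s.norm_one
      rw [← h3] at this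
      simp at this
    have hest : ∀ g, ‖s.j (D2.u g) - w.p (s.j (D2.u g))‖ ≤ δ := by
      intro g
      choose a ha haq using w.q_mem
      have h1 := w.sum_R hcb hicc haq (s.j (D2.u g) - w.p (s.j (D2.u g)))
      have h2 : (D1.FRR hcb).hs ((1 - w.p) * s.L (D2.u g) * w.p) ≤ ENNReal.ofReal ((δ * Real.sqrt w.d) ^ 2) := by
        refine le_trans ?_ (hnear g)
        rw [← u.hs_cj' g hpC, hUg]
        have e : (1 - w.p) * s.L (D2.u g) * w.p = (1 - w.p) * (s.L (D2.u g) * w.p - w.p * s.L (D2.u g)) := by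
          rw [mul_sub, ← mul_assoc (1 - w.p) w.p, sub_mul 1 w.p w.p, w.p_idem, one_mul, sub_self, zero_mul,
            sub_zero, mul_assoc]
        rw [e]
        refine (FR.hs_mul_left _ _).trans ?_
        have : ‖1 - w.p‖ₑ ≤ 1 := by
          rw [← ofReal_norm, ← ENNReal.ofReal_one]
          refine ofReal_le_ofReal (opNorm_le_bound _ (by norm_num) fun v => ?_)
          rw [one_mul]
          have h := norm_starProjection_apply_le (w.N)ᗮ v
          rw [Submodule.starProjection_orthogonal'] at h
          exact h
        calc _ ≤ (1 : ℝ≥0∞) ^ 2 * _ := by gcongr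
          _ = _ := by rw [one_pow, one_mul]
      rw [w.hsR hcb ((FR.Cm.one.sub hpC).mul (D1.CmR_L _)), tsum_fintype] at h2
      simp only [enn_sq] at h2
      rw [← ENNReal.ofReal_sum_of_nonneg (fun _ _ => by positivity),
        ENNReal.ofReal_le_ofReal_iff (by positivity)] at h2
      have h3 : ∀ tt, ((1 - w.p) * s.L (D2.u g)) (w.q tt) = s.R (a tt) (s.j (D2.u g) - w.p (s.j (D2.u g))) := by
        intro tt
        have ham : a tt ∈ (t.F n).M := (t.F n).S_le_M (ha tt)
        rw [map_sub, ← (t.F n).p_R ham, s.R_j, mul_apply, sub_apply,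
          ← haq, s.L_j]; rfl
      simp only [h3] at h2
      rw [h1, mul_pow, sq_sqrt (by positivity)] at h2
      have h4 : (0 : ℝ) < w.d := by exact_mod_cast hd
      have h5 : ‖s.j (D2.u g) - w.p (s.j (D2.u g))‖ ^ 2 ≤ δ ^ 2 := by
        by_contra hh
        push Not at hh
        nlinarith
      exact abs_le_of_sq_le_sq' h5 hδ.le |>.2
    have hall : ∀ m, ‖Tn m (s.j x) - s.j x‖ ≤ δ * ‖x‖ := by
      intro m
      refine convexHull_min (t := {Z : B(K) | ‖Z (s.j x) - s.j x‖ ≤ δ * ‖x‖}) ?_ ?_ (hTn m)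
      · rintro _ ⟨g, rfl⟩
        simp only [mem_setOf_eq, hUg, mul_apply]
        have e : s.L (D2.u g) (w.p (s.L (D2.u g⁻¹) (s.j x))) - s.j x =
            - s.L (D2.u g) (s.R x (s.j (D2.u g⁻¹) - w.p (s.j (D2.u g⁻¹)))) := by
          rw [map_sub, ← (t.F n).p_R hxn, map_sub, s.L_j, s.R_j, s.L_j, ← mul_assoc, D2.u_mul_inv, one_mul]
          abel
        rw [e, norm_neg, D2.L_norm_u, mul_comm]
        refine (s.nR _ _).trans ?_
        gcongr; exact hest _
      · intro a ha b hb p q hp hq hpq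
        simp only [mem_setOf_eq] at ha hb ⊢
        have e : (p • a + q • b) (s.j x) - s.j x = p • (a (s.j x) - s.j x) + q • (b (s.j x) - s.j x) := by
          have : s.j x = p • s.j x + q • s.j x := by rw [← add_smul, hpq, one_smul]
          conv_lhs => arg 2; rw [this]
          simp only [add_apply, smul_apply, smul_sub]; abel
        rw [e]
        refine (norm_add_le _ _).trans ?_
        rw [norm_smul, norm_smul, norm_of_nonneg hp, norm_of_nonneg hq]
        calc _ ≤ p * (δ * ‖x‖) + q * (δ * ‖x‖) := by gcongr
          _ = _ := by rw [← add_mul, hpq, one_mul]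
    exact le_of_tendsto (((hlim (s.j x)).sub tendsto_const_nhds).norm) (.of_forall hall)

lemma finD (N : Submodule ℂ K) [CompleteSpace N] {C : ℝ≥0∞} (hC : C < ⊤)
    (h : ∀ (J : Type) (q : J → K), Orthonormal ℂ q → (∀ j, q j ∈ N) → ∑' j : J, ‖q j‖ₑ ^ 2 ≤ C) :
    FiniteDimensional ℂ N := by
  obtain ⟨J, b, hb⟩ := exists_hilbertBasis ℂ N
  have ho : Orthonormal ℂ (fun j => (b j : K)) := by
    have := b.orthonormal.comp_linearIsometry N.subtypeₗᵢ
    exact this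
  have h1 := h J (fun j => (b j : K)) ho (fun j => (b j).2)
  have h2 : ∑' j : J, (1 : ℝ≥0∞) ≠ ⊤ := by
    refine ne_top_of_le_ne_top hC.ne (le_trans (le_of_eq ?_) h1)
    refine tsum_congr fun j => ?_
    rw [enn_sq, ho.1 j]; simp
  have hfin : Finite J := by
    have := ENNReal.finite_const_le_of_tsum_ne_top h2 (ε := 1) (by norm_num)
    rw [Set.finite_coe_iff]
    have h3 : (Set.univ : Set J).Finite := this.subset fun x _ => by simp
    exact Set.finite_coe_iff.1 (Set.finite_univ_iff.1 h3)
  have h4 := b.dense_span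
  have : FiniteDimensional ℂ (Span (Set.range b)) :=
    span_of_finite ℂ (Set.finite_range b)
  rw [IsClosed.submodule_topologicalClosure_eq (Submodule.closed_of_finiteDimensional _)] at h4
  rw [h4] at this
  exact equiv (Submodule.topEquiv (R := ℂ) (M := N))

def FR1I (K : Type) [NormedAddCommGroup K] [InnerProductSpace ℂ K] [CompleteSpace K] : Type :=
  (exists_hilbertBasis ℂ K).choose
def FR1b (K : Type) [NormedAddCommGroup K] [InnerProductSpace ℂ K] [CompleteSpace K] :
    HilbertBasis (FR1I K) ℂ K := (exists_hilbertBasis ℂ K).choose_spec.choose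

def FR1 (K : Type) [NormedAddCommGroup K] [InnerProductSpace ℂ K] [CompleteSpace K] : FR Unit K where
  ρ := fun _ => 1
  inn := fun _ _ _ => rfl
  mul := fun _ _ _ => rfl
  one := fun _ => rfl
  I := FR1I K
  e := fun i => FR1b K i
  orth := by
    refine (FR1b K).orthonormal.comp (fun p : FR1I K × Unit => p.1) ?_
    rintro ⟨i, _⟩ ⟨j, _⟩ h; exact Prod.ext h rfl
  tot := fun v h => by
    refine (FR1b K).repr.map_eq_zero_iff.1 (lp.ext (funext fun i => ?_))
    rw [(FR1b K).repr_apply_apply]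
    exact h i ()

lemma FR1_Cm (T : B(K)) : (FR1 K).Cm T := fun _ _ => rfl

/-- rank one operator -/
def rk (v : K) : B(K) := (innerSL ℂ v).smulRight v
lemma rk_apply (v z : K) : rk v z = inner ℂ v z • v := rfl
lemma rk_hs (v : K) : (FR1 K).hs (rk v) < ⊤ := by
  have : (FR1 K).hs (rk v) = ‖v‖ₑ ^ 2 * ‖v‖ₑ ^ 2 := by
    conv_rhs => arg 1; rw [← parse_hb (FR1b K) v]
    rw [FR.hs, ← tsum_mul_right]
    refine tsum_congr fun i => ?_
    rw [rk_apply, enorm_smul, mul_pow, enn_conj]; rfl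
  rw [this]; finiteness

namespace XD
variable {G : Type} [Group G] {s : Std Al K} (D : XD G s)

def URAd : FR.UR (FR1 K) G where
  U := D.Ad
  one := D.Ad_one
  mul := D.Ad_mul
  st := D.Ad_star
  cm := fun g => FR1_Cm _

lemma rk_conj (g : G) (v z : K) : (D.Ad g * rk v * D.Ad g⁻¹) z = inner ℂ (D.Ad g v) z • D.Ad g v := by
  rw [mul_apply, mul_apply, rk_apply, map_smul]
  congr 1
  rw [← inner_star_swap', Ad_star]

/-- Peter-Weyl -/
lemma pw (hcb : CB s) {f : Al} (hf : f ∈ D.A) (htb : TotallyBounded (Set.range fun g => D.Ad g (s.j f)))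
    {ε : ℝ} (hε : 0 < ε) : ∃ w : FW D, ∃ a ∈ w.W, ‖s.j (f - a)‖ < ε := by
  set v := s.j f with hv
  obtain ⟨T, -, hTf, hTU, -, ⟨Tn, hTn, hlim⟩, -⟩ := FR.avgHS _ D.URAd (FR1_Cm (rk v)) (rk_hs v)
  have hTU' : ∀ g, Commute T (D.Ad g) := fun g => (hTU g).symm
  -- quadratic form
  have hlin : ∀ {Q : Set B(K)} (hQ : Convex ℝ Q), (∀ g, D.Ad g * rk v * D.Ad g⁻¹ ∈ Q) → ∀ n, Tn n ∈ Q :=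
    fun hQ h n => convexHull_min (by rintro _ ⟨g, rfl⟩; exact h g) hQ (hTn n)
  have hTs : star T = T := by
    have h1 : ∀ n x y, inner ℂ (Tn n x) y = inner ℂ x (Tn n y) := fun n => by
      refine hlin (Q := {S | ∀ x y, inner ℂ (S x) y = inner ℂ x (S y)}) ?_ (fun g x y => ?_) n
      · intro a ha b hb p q hp hq hpq x y
        simp only [add_apply, smul_apply, inner_add_left, inner_add_right]
        rw [← coe_smul, ← coe_smul, ← coe_smul, ← coe_smul]
        simp only [inner_smul_left, inner_smul_right, conj_ofReal]
        rw [ha, hb]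
      · rw [rk_conj, rk_conj, inner_smul_left, inner_smul_right, inner_conj_symm, mul_comm]
    ext x
    refine ext_inner_left ℂ fun y => ?_
    rw [inner_star_swap']
    exact tendsto_nhds_unique ((hlim y).inner tendsto_const_nhds)
      (by simp only [h1]; exact tendsto_const_nhds.inner (hlim x))
  have hTpos : 0 ≤ T := by
    refine nonneg_of_qf (fun x => ?_) hTs
    change 0 ≤ (inner ℂ (T x) x).re
    refine ge_of_tendsto ((continuous_re.tendsto _).comp ((hlim x).inner tendsto_const_nhds))
      (.of_forall fun n => ?_)
    refine hlin (Q := {S | 0 ≤ (inner ℂ (S x) x).re}) ?_ (fun g => ?_) n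
    · intro a ha b hb p q hp hq hpq
      simp only [mem_setOf_eq] at ha hb ⊢
      simp only [add_apply, smul_apply, inner_add_left]
      rw [← coe_smul, ← coe_smul]
      simp only [inner_smul_left, conj_ofReal, add_re, re_ofReal_mul]
      positivity
    · simp only [mem_setOf_eq]
      rw [rk_conj, inner_smul_left, ← Complex.normSq_eq_conj_mul_self, ofReal_re]
      exact Complex.normSq_nonneg _
  have hTA : ∀ x, ∃ a ∈ D.A, s.j a = T x := by
    intro x
    have hmem : T x ∈ closure (s.j '' {a | a ∈ D.A ∧ ‖a‖ ≤ ‖v‖ * ‖x‖ * ‖f‖}) := by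
      refine mem_closure_of_tendsto (hlim x) (.of_forall fun n => ?_)
      refine hlin (Q := {S | S x ∈ s.j '' {a | a ∈ D.A ∧ ‖a‖ ≤ ‖v‖ * ‖x‖ * ‖f‖}}) ?_ (fun g => ?_) n
      · rintro a ⟨a', ⟨ha1, ha2⟩, ha⟩ b ⟨b', ⟨hb1, hb2⟩, hb⟩ p q hp hq hpq
        refine ⟨p • a' + q • b', ⟨?_, ?_⟩, ?_⟩
        · rw [← coe_smul, ← coe_smul]
          exact add_mem (SMulMemClass.smul_mem _ ha1) (SMulMemClass.smul_mem _ hb1)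
        · refine (norm_add_le _ _).trans ?_
          rw [norm_smul, norm_smul, norm_of_nonneg hp, norm_of_nonneg hq]
          calc _ ≤ p * (‖v‖ * ‖x‖ * ‖f‖) + q * (‖v‖ * ‖x‖ * ‖f‖) := by gcongr
            _ = _ := by rw [← add_mul, hpq, one_mul]
        · rw [← coe_smul, ← coe_smul q, map_add, map_smul, map_smul, ha, hb]
          simp only [add_apply, smul_apply, coe_smul]
      · refine ⟨inner ℂ (D.Ad g v) x • (D.u g * f * D.u g⁻¹), ⟨SMulMemClass.smul_mem _ (D.conj g f hf), ?_⟩, ?_⟩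
        · rw [norm_smul, ← D.u_star, norm_unit_conj (D.u_unit g) (D.u_unit' g)]
          gcongr
          refine (norm_inner_le_norm _ _).trans ?_
          rw [D.Ad_norm]
        · rw [rk_conj, map_smul, hv, Ad_j]
    obtain ⟨y, hy, hyv⟩ := hcb.mem (C := ‖v‖ * ‖x‖ * ‖f‖) (fun x hx => hx.2) hmem
    refine ⟨y, D.A_of_mem_HA ?_, hyv⟩
    rw [hyv, ← mem_coe, coe_HA]
    exact closure_mono (Set.image_mono fun x hx => hx.1) hmem
  -- the kernel
  have hker : ∀ x, T x = 0 → inner ℂ v x = 0 := by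
    intro x hx
    have key : ∀ η > 0, ‖inner ℂ v x‖ ≤ η * ‖x‖ := by
      intro η hη
      obtain ⟨t, ht, hfin, hcov⟩ := htb.exists_subset (Metric.dist_mem_uniformity hη)
      obtain ⟨I, hI⟩ : ∃ I : Finset G, ∀ g, ∃ h ∈ I, ‖D.Ad g v - D.Ad h v‖ ≤ η := by
        choose! k hk using fun y (hy : y ∈ t) => ht hy
        refine ⟨hfin.toFinset.image k, fun g => ?_⟩
        obtain ⟨y, hy, hd⟩ := mem_iUnion₂.1 (hcov ⟨g, rfl⟩)
        refine ⟨k y, Finset.mem_image.2 ⟨y, hfin.mem_toFinset.2 hy, rfl⟩, ?_⟩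
        have h1 := hk y hy
        simp only at h1
        rw [h1]
        have hd' : dist (D.Ad g v) y < η := hd
        rw [dist_eq_norm] at hd'
        exact hd'.le
      by_contra hlt
      push Not at hlt
      set m := ‖inner ℂ v x‖ - η * ‖x‖ with hm
      have hmpos : 0 < m := by linarith
      have hb : ∀ n, m ^ 2 ≤ ∑ h ∈ I, (inner ℂ (Tn n (D.Ad h x)) (D.Ad h x)).re := fun n => by
        refine hlin (Q := {S | m ^ 2 ≤ ∑ h ∈ I, (inner ℂ (S (D.Ad h x)) (D.Ad h x)).re}) ?_ (fun g => ?_) n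
        · intro a ha b hb p q hp hq hpq
          simp only [mem_setOf_eq] at ha hb ⊢
          have e : ∀ h, (inner ℂ ((p • a + q • b) (D.Ad h x)) (D.Ad h x)).re =
              p * (inner ℂ (a (D.Ad h x)) (D.Ad h x)).re + q * (inner ℂ (b (D.Ad h x)) (D.Ad h x)).re := fun h => by
            simp only [add_apply, smul_apply, inner_add_left]
            rw [← coe_smul, ← coe_smul]
            simp only [inner_smul_left, conj_ofReal, add_re, re_ofReal_mul]
          simp only [e]
          rw [Finset.sum_add_distrib, ← Finset.mul_sum, ← Finset.mul_sum]
          calc m ^ 2 = p * m ^ 2 + q * m ^ 2 := by rw [← add_mul, hpq, one_mul]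
            _ ≤ _ := by gcongr
        · simp only [mem_setOf_eq]
          have e : ∀ h, (inner ℂ ((D.Ad g * rk v * D.Ad g⁻¹) (D.Ad h x)) (D.Ad h x)).re =
              ‖inner ℂ (D.Ad g v) (D.Ad h x)‖ ^ 2 := fun h => by
            rw [rk_conj, inner_smul_left, ← Complex.normSq_eq_conj_mul_self, ofReal_re,
              Complex.normSq_eq_norm_sq]
          simp only [e]
          obtain ⟨h, hh, hd⟩ := hI g
          refine le_trans ?_ (Finset.single_le_sum (f := fun h => ‖inner ℂ (D.Ad g v) (D.Ad h x)‖ ^ 2)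
            (fun _ _ => by positivity) hh)
          have h1 : inner ℂ v x = inner ℂ (D.Ad h v) (D.Ad h x) := by
            rw [← inner_star_swap', Ad_star, Ad_inv]
          have h2 : inner ℂ (D.Ad g v) (D.Ad h x) = inner ℂ v x + inner ℂ (D.Ad g v - D.Ad h v) (D.Ad h x) := by
            rw [h1, inner_sub_left]; ring
          have h3 := norm_inner_le_norm (𝕜 := ℂ) (D.Ad g v - D.Ad h v) (D.Ad h x)
          rw [D.Ad_norm] at h3
          have h4 : ‖inner ℂ (D.Ad g v - D.Ad h v) (D.Ad h x)‖ ≤ η * ‖x‖ := h3.trans (by gcongr)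
          have h5 : m ≤ ‖inner ℂ (D.Ad g v) (D.Ad h x)‖ := by
            rw [h2]
            have := norm_sub_le (inner ℂ v x + inner ℂ (D.Ad g v - D.Ad h v) (D.Ad h x))
              (inner ℂ (D.Ad g v - D.Ad h v) (D.Ad h x))
            rw [add_sub_cancel_right] at this
            linarith
          exact pow_le_pow_left₀ hmpos.le h5 2
      have h0 : Tendsto (fun n => ∑ h ∈ I, (inner ℂ (Tn n (D.Ad h x)) (D.Ad h x)).re) atTop
          (𝓝 (∑ h ∈ I, (inner ℂ (T (D.Ad h x)) (D.Ad h x)).re)) :=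
        tendsto_finsetSum _ fun h _ => (continuous_re.tendsto _).comp ((hlim _).inner tendsto_const_nhds)
      have h1 := ge_of_tendsto h0 (.of_forall hb)
      have h2 : ∀ h, T (D.Ad h x) = 0 := fun h => by
        have := congrArg (fun S : B(K) => S x) (hTU h)
        simp only [mul_apply] at this
        have h3 : D.Ad h (T x) = T (D.Ad h x) := this
        rw [← h3, hx, map_zero]
      simp only [h2, inner_zero_left, zero_re, Finset.sum_const_zero] at h1
      nlinarith
    by_contra hne
    have hpos : 0 < ‖inner ℂ v x‖ := norm_pos_iff.2 hne
    have := key (‖inner ℂ v x‖ / (2 * (‖x‖ + 1))) (by positivity)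
    have h3 : ‖inner ℂ v x‖ / (2 * (‖x‖ + 1)) * ‖x‖ ≤ ‖inner ℂ v x‖ / 2 := by
      rw [div_mul_eq_mul_div, div_le_div_iff₀ (by positivity) (by norm_num)]
      nlinarith [norm_nonneg x]
    linarith
  have hvcl : v ∈ closure (Set.range T) := by
    let N := (LinearMap.range (T : K →ₗ[ℂ] K)).topologicalClosure
    have : CompleteSpace N := (isClosed_topologicalClosure _).completeSpace_coe
    have hy : inner ℂ (v - N.starProjection v) (v - N.starProjection v) = (0 : ℂ) := by
      have h1 := sub_starProjection_mem_orthogonal (K := N) v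
      rw [mem_orthogonal] at h1
      have h2 : T (v - N.starProjection v) = 0 := by
        refine ext_inner_left ℂ fun z => ?_
        rw [inner_zero_right, ← hTs, inner_star_swap']
        exact h1 _ (le_topologicalClosure _ ⟨z, rfl⟩)
      have h3 := hker _ h2
      rw [inner_sub_left, h3, h1 _ (starProjection_apply_mem _ _), sub_zero]
    have h4 : v ∈ N := by
      rw [sub_eq_zero.1 (inner_self_eq_zero.1 hy)]; exact starProjection_apply_mem _ _
    rw [← mem_coe, topologicalClosure_coe] at h4
    exact h4
  obtain ⟨_, ⟨x, rfl⟩, hx⟩ := Metric.mem_closure_iff.1 hvcl (ε / 2) (by positivity)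
  obtain ⟨E, k, hEs, hEE, hEc, hkc, hSk, hSE, -⟩ := spectral_proj T hTpos (ε / (2 * (‖x‖ + 1))) (by positivity)
  have hEr : ∀ z, ∃ a ∈ D.A, s.j a = E z := fun z => by
    obtain ⟨a, ha, h⟩ := hTA (k (E z))
    refine ⟨a, ha, h.trans ?_⟩
    exact congrArg (fun S : B(K) => S z) hSk
  let N : Submodule ℂ K := LinearMap.ker ((1 - E : B(K)) : K →ₗ[ℂ] K)
  have hN : ∀ z, z ∈ N ↔ E z = z := fun z => by
    change (1 - E) z = 0 ↔ _
    rw [sub_apply, one_apply, sub_eq_zero, eq_comm]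
  have : CompleteSpace N := (ContinuousLinearMap.isClosed_ker (1 - E)).completeSpace_coe
  have hhsE : (FR1 K).hs E < ⊤ := by
    have hk1 : Commute E T := hEc T (Commute.refl T)
    have e : E = k * E * T := by
      have h2 : T * k = k * T := ((hkc T (Commute.refl T)).eq).symm
      rw [mul_assoc, hk1.eq, ← mul_assoc, ← h2]; exact hSk.symm
    rw [e]
    refine (FR.hs_mul_left _ _).trans_lt ?_
    finiteness
  have hNf : FiniteDimensional ℂ N := finD N hhsE fun J q hq hqN => by
    refine FR.bs hEs (FR1_Cm E) ?_ (fun t => (hN _).1 (hqN t))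
    refine hq.comp (fun p : J × Unit => p.1) ?_
    rintro ⟨i, _⟩ ⟨j, _⟩ h; exact Prod.ext h rfl
  let W : Submodule ℂ Al := N.comap s.j
  have hWN : ∀ a, a ∈ W ↔ E (s.j a) = s.j a := fun a => hN _
  have hWf : FiniteDimensional ℂ W := by
    refine of_injective (s.j.restrict (p := W) (q := N) fun x hx => hx) ?_
    intro a b hab
    have := val_eq hab
    exact Subtype.ext (s.inj' this)
  refine ⟨⟨W, hWf, fun a ha => ?_, fun g a ha => ?_⟩, ?_⟩
  · obtain ⟨b, hb, h⟩ := hEr (s.j a)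
    rw [(hWN a).1 ha] at h
    rw [← s.inj' h]; exact hb
  · rw [hWN, ← Ad_j]
    have h1 := congrArg (fun S : B(K) => S (s.j a)) (hEc _ (hTU' g)).eq
    simp only [mul_apply] at h1
    rw [h1, (hWN a).1 ha]
  · obtain ⟨a, ha, h⟩ := hEr (T x)
    refine ⟨a, ?_, ?_⟩
    · change a ∈ W
      rw [hWN, h, ← mul_apply, hEE]
    · rw [map_sub, h]
      have h1 : ‖T x - E (T x)‖ ≤ ε / (2 * (‖x‖ + 1)) * ‖x‖ := by
        have hk1 : Commute E T := hEc T (Commute.refl T)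
        have e : T x - E (T x) = (T * (1 - E)) x := by
          rw [mul_sub, mul_one, ← hk1.eq]; rfl
        rw [e]
        exact ContinuousLinearMap.le_of_opNorm_le _ hSE x
      have h3 : ε / (2 * (‖x‖ + 1)) * ‖x‖ < ε / 2 := by
        rw [div_mul_eq_mul_div, div_lt_div_iff₀ (by positivity) (by norm_num)]
        nlinarith [norm_nonneg x]
      rw [dist_eq_norm] at hx
      have h4 := norm_add_le (v - T x) (T x - E (T x))
      rw [sub_add_sub_cancel] at h4
      linarith

end XD

lemma growth {R : Type*} [CommRing R] [Algebra ℂ R] {d : ℕ} (v : Fin d → R) (n : ℕ) :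
    (Span (Set.range v)) ^ n ≤
      Span (Set.range fun k : Fin d → Fin (n + 1) => ∏ i, v i ^ (k i : ℕ)) := by
  induction n with
  | zero =>
    rw [pow_zero, Submodule.one_eq_span, span_le]
    rintro _ rfl
    exact subset_span ⟨fun _ => 0, by simp⟩
  | succ n ih =>
    rw [pow_succ]
    refine (mul_le_mul' ih le_rfl).trans ?_
    rw [Submodule.span_mul_span, span_le]
    rintro _ ⟨_, ⟨k, rfl⟩, _, ⟨j, rfl⟩, rfl⟩
    refine subset_span ⟨fun i => if i = j then ⟨k i + 1, by omega⟩ else ⟨k i, by omega⟩, ?_⟩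
    simp only
    have : v j = ∏ i, (if i = j then v i else 1) := by simp
    conv_rhs => rw [this]
    rw [← Finset.prod_mul_distrib]
    refine Finset.prod_congr rfl fun i _ => ?_
    split_ifs
    · rw [pow_succ]
    · rw [mul_one]

lemma growth_dim {R : Type*} [CommRing R] [Algebra ℂ R] (V : Submodule ℂ R) (hV : V.FG) :
    ∃ D : ℕ, ∀ n, finrank ℂ ↥(V ^ n) ≤ (n + 1) ^ D := by
  obtain ⟨d, v, hv⟩ := Submodule.fg_iff_exists_fin_generating_family.1 hV
  refine ⟨d, fun n => ?_⟩
  have h1 := growth v n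
  rw [hv] at h1
  have : FiniteDimensional ℂ (Span (Set.range fun k : Fin d → Fin (n + 1) => ∏ i, v i ^ (k i : ℕ))) :=
    span_of_finite ℂ (Set.finite_range _)
  refine (Submodule.finrank_mono h1).trans ((finrank_range_le_card (R := ℂ) _).trans ?_)
  simp

lemma poly_exp {d : ℕ → ℝ} (h0 : 0 < d 0) {D : ℕ} (hD : ∀ n, d n ≤ ((n : ℝ) + 2) ^ D) {ε : ℝ} (hε : 0 < ε) :
    ∃ n, d (n + 1) - d n ≤ ε * d n := by
  by_contra hc
  push Not at hc
  have h1 : ∀ n, (1 + ε) ^ n * d 0 ≤ d n := fun n => by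
    induction n with
    | zero => simp
    | succ n ih =>
      have := hc n
      rw [pow_succ]
      nlinarith
  have h2 := tendsto_pow_const_div_const_pow_of_one_lt D (r := 1 + ε) (by linarith)
  have h3 := (h2.comp (tendsto_add_atTop_nat 2)).eventually_lt_const (u := d 0 / (1 + ε) ^ 2) (by positivity)
  obtain ⟨n, hn⟩ := h3.exists
  simp only [Function.comp] at hn
  rw [div_lt_div_iff₀ (by positivity) (by positivity), pow_add] at hn
  have h4 := h1 n
  have h5 := hD n
  push_cast at hn
  have h6 : (0 : ℝ) < (1 + ε) ^ 2 := by positivity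
  nlinarith

lemma FR.hs_pyth {G : Type} [Group G] {F : FR G K} {p : B(K)} (hs : star p = p) (hp : p * p = p) (T : B(K)) :
    F.hs T = F.hs (p * T) + F.hs ((1 - p) * T) := by
  rw [FR.hs, FR.hs, FR.hs, ← ENNReal.tsum_add]
  refine tsum_congr fun i => ?_
  set v := T (F.e i)
  have h : ‖v‖ ^ 2 = ‖p v‖ ^ 2 + ‖v - p v‖ ^ 2 := by
    have h0 : inner ℂ (p v) (v - p v) = 0 := by
      rw [← inner_star_swap', hs, map_sub]
      have : p (p v) = p v := congrArg (fun Z : B(K) => Z v) hp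
      rw [this, sub_self, inner_zero_right]
    have := norm_add_sq_eq_norm_sq_add_norm_sq_of_inner_eq_zero (𝕜 := ℂ) _ _ h0
    rw [add_sub_cancel] at this
    rw [pow_two, pow_two, pow_two, this]
  change _ = ‖p v‖ₑ ^ 2 + ‖v - p v‖ₑ ^ 2
  rw [enn_sq, enn_sq, enn_sq, h, ENNReal.ofReal_add (by positivity) (by positivity)]

namespace FW
variable {G : Type} [Group G] {s : Std Al K} {D : XD G s}

def sup (w w' : FW D) : FW D where
  W := w.W ⊔ w'.W
  fd := by haveI := w.fd; haveI := w'.fd; infer_instance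
  le := fun x hx => by
    obtain ⟨a, ha, b, hb, rfl⟩ := mem_sup.1 hx
    exact add_mem (w.le a ha) (w'.le b hb)
  inv := fun g x hx => by
    obtain ⟨a, ha, b, hb, rfl⟩ := mem_sup.1 hx
    rw [mul_add, add_mul]
    exact add_mem_sup (w.inv g a ha) (w'.inv g b hb)

def one : FW D where
  W := Span {1}
  fd := inferInstance
  le := fun x hx => by
    obtain ⟨c, rfl⟩ := mem_span_singleton.1 hx
    exact SMulMemClass.smul_mem c (one_mem D.A)
  inv := fun g x hx => by
    obtain ⟨c, rfl⟩ := mem_span_singleton.1 hx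
    rw [mul_smul_comm, smul_mul_assoc, mul_one, D.u_mul_inv]
    exact mem_span_singleton.2 ⟨c, rfl⟩

def mul (w w' : FW D) : FW D where
  W := w.W * w'.W
  fd := iff_fg.2 (Submodule.FG.mul (iff_fg.1 w.fd) (iff_fg.1 w'.fd))
  le := fun x hx => by
    induction hx using Submodule.mul_induction_on' with
    | mem_mul_mem a ha b hb => exact mul_mem (w.le a ha) (w'.le b hb)
    | add a ha b hb h1 h2 => exact add_mem h1 h2
  inv := fun g x hx => by
    induction hx using Submodule.mul_induction_on' with
    | mem_mul_mem a ha b hb =>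
      have : D.u g * (a * b) * D.u g⁻¹ = (D.u g * a * D.u g⁻¹) * (D.u g * b * D.u g⁻¹) := by
        simp only [mul_assoc]
        rw [← mul_assoc (D.u g⁻¹) (D.u g), D.u_inv_mul, one_mul]
      rw [this]
      exact mul_mem_mul (w.inv g a ha) (w'.inv g b hb)
    | add a ha b hb h1 h2 => rw [mul_add, add_mul]; exact add_mem h1 h2

def pw (w : FW D) : ℕ → FW D
  | 0 => w
  | n + 1 => mul (pw w n) w

lemma pw_W (w : FW D) (n : ℕ) : (w.pw n).W = w.W ^ (n + 1) := by
  induction n with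
  | zero => simp [pw]
  | succ n ih => rw [pow_succ, ← ih]; rfl

lemma N_mono {w w' : FW D} (h : w.W ≤ w'.W) : w.N ≤ w'.N :=
  w.N_ind w'.isClosed_N fun g a ha => w'.mem_N (h ha) g

lemma pw_growth (w : FW D) : ∃ d : ℕ, ∀ n, (w.pw n).d ≤ (n + 2) ^ d := by
  letI : CommRing D.A := { (inferInstance : Ring D.A) with
    mul_comm := fun a b => Subtype.ext (D.comm _ a.2 _ b.2) }
  let f : D.A →ₐ[ℂ] Al := AlgHom.ofLinearMap { toFun := fun a => a.1, map_add' := fun _ _ => rfl, map_smul' := fun _ _ => rfl } rfl (fun _ _ => rfl)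
  let V : Submodule ℂ D.A := w.W.comap f.toLinearMap
  have hVW : V.map f.toLinearMap = w.W := by
    refine le_antisymm (Submodule.map_comap_le _ _) fun a ha => ⟨⟨a, w.le a ha⟩, ha, rfl⟩
  have hV : V.FG := by
    refine Submodule.fg_of_fg_map_injective f.toLinearMap (fun a b h => Subtype.ext h) ?_
    rw [hVW]; exact iff_fg.1 w.fd
  obtain ⟨d, hd⟩ := growth_dim V hV
  refine ⟨d, fun n => ?_⟩
  have e : (w.pw n).W = (V ^ (n + 1)).map f.toLinearMap := by
    rw [pw_W, ← hVW, Submodule.map_pow]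
  have : FiniteDimensional ℂ ↥(V ^ (n + 1)) := iff_fg.2 (hV.pow _)
  haveI := (w.pw n).fd
  have h1 : (w.pw n).d ≤ finrank ℂ (w.pw n).W := Submodule.finrank_map_le _ _
  refine h1.trans ?_
  rw [e]
  exact (Submodule.finrank_map_le _ _).trans (hd _)

variable (w : FW D)

lemma pw_mono (h1 : (1 : Al) ∈ w.W) (n : ℕ) : (w.pw n).W ≤ (w.pw (n + 1)).W := fun a ha => by
  have := mul_mem_mul ha h1
  rwa [mul_one] at this

lemma p_mul {w w' : FW D} (h : w.N ≤ w'.N) : w'.p * w.p = w.p := by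
  ext v
  exact w'.p_fix (h (w.p_mem v))

lemma p_mul' {w w' : FW D} (h : w.N ≤ w'.N) : w.p * w'.p = w.p := by
  have := congrArg star (p_mul h)
  rwa [star_mul, w.p_star, w'.p_star] at this

lemma delta (hcb : CB s) {w w' : FW D} (h : w.N ≤ w'.N) :
    (D.FRL hcb).hs (w'.p - w.p) = ENNReal.ofReal ((w'.d : ℝ) - w.d) := by
  have h1 := FR.hs_pyth (F := D.FRL hcb) w.p_star w.p_idem w'.p
  rw [p_mul' h, sub_mul, one_mul, p_mul' h, hsL_p, hsL_p] at h1
  rw [ENNReal.ofReal_sub _ (by positivity), ofReal_natCast, ofReal_natCast, h1]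
  rw [ENNReal.add_sub_cancel_left (by finiteness)]

lemma com_a (hcb : CB s) (hicc : IsICC G) (h1 : (1 : Al) ∈ w.W) {a : Al} (ha : a ∈ w.W) (n : ℕ) :
    (D.FRL hcb).hs (s.R a * (w.pw n).p - (w.pw n).p * s.R a) ≤
      4 * ‖a‖ₑ ^ 2 * ENNReal.ofReal (((w.pw (n + 1)).d : ℝ) - (w.pw n).d) := by
  set p := (w.pw n).p with hp
  set p' := (w.pw (n + 1)).p with hp'
  have hpC : (D.FRL hcb).Cm p := D.CmL.2 (w.pw n).p_Lu
  have hpC' : (D.FRL hcb).Cm p' := D.CmL.2 (w.pw (n + 1)).p_Lu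
  have hRC : ∀ a, (D.FRL hcb).Cm (s.R a) := fun a => D.CmL_R a
  have hNN := N_mono (w.pw_mono h1 n)
  have hpp : p * p = p := (w.pw n).p_idem
  have hps : star p = p := (w.pw n).p_star
  have hA : (D.FRL hcb).hs ((1 - p) * (s.R a * p)) ≤
      ‖a‖ₑ ^ 2 * ENNReal.ofReal (((w.pw (n + 1)).d : ℝ) - (w.pw n).d) := by
    have e : (1 - p) * (s.R a * p) = (p' - p) * (s.R a * p) := by
      ext v
      have hm : s.R a (p v) ∈ (w.pw (n + 1)).N := by
        refine (w.pw n).N_maps (w.pw (n + 1)).isClosed_N (fun g b hb => ?_) _ ((w.pw n).p_mem v)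
        rw [s.R_j]
        have := (w.pw (n + 1)).mem_N (mul_mem_mul hb (w.inv g a ha)) g
        rwa [mul_assoc, mul_assoc, D.u_inv_mul, mul_one, ← mul_assoc] at this
      have := (w.pw (n + 1)).p_fix hm
      simp only [mul_apply, sub_apply, one_apply]
      rw [hp', this]
    rw [e, ← delta hcb hNN]
    refine (FR.hs_mul_right (hpC'.sub hpC) ((hRC a).mul hpC)).trans ?_
    gcongr
    rw [← ofReal_norm, ← ofReal_norm]
    refine ofReal_le_ofReal (opNorm_le_bound _ (norm_nonneg _) fun v => ?_)
    refine (s.nR _ _).trans ?_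
    gcongr; exact (w.pw n).p_norm v
  have hB : (D.FRL hcb).hs (p * s.R a * (1 - p)) = (D.FRL hcb).hs ((1 - p) * (s.R a * p)) := by
    have e1 := FR.hs_pyth (F := D.FRL hcb) hps hpp (s.R a * p)
    have e2 := FR.hs_pyth (F := D.FRL hcb) hps hpp (s.R (star a) * p)
    have hsw : (D.FRL hcb).hs (p * (s.R (star a) * p)) = (D.FRL hcb).hs (p * (s.R a * p)) := by
      rw [← FR.hs_star (hpC.mul ((hRC _).mul hpC))]
      simp only [star_mul, hps, s.R_star, star_star, mul_assoc]
    have hst : (D.FRL hcb).hs (p * s.R a * (1 - p)) = (D.FRL hcb).hs ((1 - p) * (s.R (star a) * p)) := by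
      rw [← FR.hs_star ((hpC.mul (hRC a)).mul (FR.Cm.one.sub hpC))]
      simp only [star_mul, star_sub, star_one, hps, s.R_star]
    rw [(w.pw n).hsL_Rp hcb hicc] at e1 e2
    rw [enn_of_norm (s.nj_star a), hsw] at e2
    rw [hst]
    have hfin : (D.FRL hcb).hs (p * (s.R a * p)) ≠ ⊤ := by
      refine ne_top_of_le_ne_top (b := ‖s.j a‖ₑ ^ 2 * ((w.pw n).d : ℝ≥0∞)) (by finiteness) ?_
      rw [e1]; exact le_self_add
    exact (ENNReal.add_right_inj hfin).1 (e2.symm.trans e1)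
  have e : s.R a * p - p * s.R a = (1 - p) * (s.R a * p) - p * s.R a * (1 - p) := by
    rw [sub_mul, one_mul, mul_sub, mul_one, mul_assoc p]; abel
  rw [e]
  refine (FR.hs_sub _ _).trans ?_
  rw [hB]
  calc _ = 4 * (D.FRL hcb).hs ((1 - p) * (s.R a * p)) := by ring
    _ ≤ 4 * (‖a‖ₑ ^ 2 * ENNReal.ofReal (((w.pw (n + 1)).d : ℝ) - (w.pw n).d)) := by gcongr
    _ = _ := by ring

/-- algebraic span -/
def P : Submodule ℂ Al := Span {x | ∃ g, ∃ a ∈ w.W, x = a * D.u g}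

lemma P_mono {w w' : FW D} (h : w.W ≤ w'.W) : w.P ≤ w'.P := by
  refine Submodule.span_mono ?_
  rintro _ ⟨g, a, ha, rfl⟩
  exact ⟨g, a, h ha, rfl⟩

lemma com_P (hcb : CB s) (hicc : IsICC G) (h1 : (1 : Al) ∈ w.W) {y : Al} (hy : y ∈ w.P) :
    ∃ C : ℝ, 0 ≤ C ∧ ∀ n, (D.FRL hcb).hs (s.R y * (w.pw n).p - (w.pw n).p * s.R y) ≤
      ENNReal.ofReal C * ENNReal.ofReal (((w.pw (n + 1)).d : ℝ) - (w.pw n).d) := by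
  induction hy using Submodule.span_induction with
  | mem x hx =>
    obtain ⟨g, a, ha, rfl⟩ := hx
    refine ⟨4 * ‖a‖ ^ 2, by positivity, fun n => ?_⟩
    have e : s.R (a * D.u g) * (w.pw n).p - (w.pw n).p * s.R (a * D.u g) =
        s.R (D.u g) * (s.R a * (w.pw n).p - (w.pw n).p * s.R a) := by
      ext v
      simp only [mul_apply, sub_apply, s.R_mul, (w.pw n).p_Ru, map_sub]
    rw [e, FR.hs_iso (D.R_norm_u g)]
    refine (w.com_a hcb hicc h1 ha n).trans (le_of_eq ?_)
    rw [ofReal_mul (by norm_num), ofReal_pow (norm_nonneg _), ofReal_norm]; norm_num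
  | zero => exact ⟨0, le_rfl, fun n => by rw [s.R_zero]; simp [FR.hs_zero]⟩
  | add x y _ _ hx hy =>
    obtain ⟨C, hC, h⟩ := hx
    obtain ⟨C', hC', h'⟩ := hy
    refine ⟨2 * (C + C'), by positivity, fun n => ?_⟩
    have e : s.R (x + y) * (w.pw n).p - (w.pw n).p * s.R (x + y) =
        (s.R x * (w.pw n).p - (w.pw n).p * s.R x) + (s.R y * (w.pw n).p - (w.pw n).p * s.R y) := by
      rw [s.R_add, add_mul, mul_add]; abel
    rw [e]
    refine (FR.hs_add _ _).trans ?_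
    rw [ofReal_mul (by norm_num), ENNReal.ofReal_add hC hC', ofReal_ofNat, mul_assoc, add_mul]
    gcongr
    · exact h n
    · exact h' n
  | smul c x _ hx =>
    obtain ⟨C, hC, h⟩ := hx
    refine ⟨‖c‖ ^ 2 * C, by positivity, fun n => ?_⟩
    have e : s.R (c • x) * (w.pw n).p - (w.pw n).p * s.R (c • x) =
        c • (s.R x * (w.pw n).p - (w.pw n).p * s.R x) := by
      rw [s.R_smul, smul_mul_assoc, mul_smul_comm, smul_sub]
    rw [e, FR.hs_smul, ofReal_mul (by positivity), enn_sqC, mul_assoc]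
    gcongr
    exact h n

lemma P_dense (hcb : CB s) (hc : ∀ b ∈ D.A, ∀ ε : ℝ, 0 < ε → ∃ w : FW D, ∃ a ∈ w.W, ‖s.j (b - a)‖ < ε)
    (v : K) {ε : ℝ} (hε : 0 < ε) : ∃ w : FW D, ∃ y ∈ w.P, ‖v - s.j y‖ < ε := by
  have hdir : Directed (· ≤ ·) fun w : FW D => w.P.map s.j := fun m n =>
    ⟨m.sup n, map_mono (P_mono le_sup_left), map_mono (P_mono le_sup_right)⟩
  have htop : (⨆ w : FW D, w.P.map s.j).topologicalClosure = ⊤ := by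
    rw [Submodule.topologicalClosure_eq_top_iff, eq_bot_iff]
    intro v hv
    rw [mem_orthogonal] at hv
    refine (mem_bot ℂ).2 (D.ortho_top hcb fun g z hz => ?_)
    refine D.HA_induction (p := fun z => inner ℂ (s.R (D.u g) z) v = 0)
      (isClosed_eq (by fun_prop) continuous_const) (fun a ha => ?_) hz
    by_contra hne
    have hpos : 0 < ‖inner ℂ (s.R (D.u g) (s.j a)) v‖ := norm_pos_iff.2 hne
    obtain ⟨w, b, hb, hd⟩ := hc a ha (‖inner ℂ (s.R (D.u g) (s.j a)) v‖ / (‖v‖ + 1)) (by positivity)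
    have h1 : inner ℂ (s.R (D.u g) (s.j a)) v = inner ℂ (s.R (D.u g) (s.j (a - b))) v := by
      rw [map_sub, map_sub, inner_sub_left, hv (s.R (D.u g) (s.j b)), sub_zero]
      refine (le_iSup (fun w : FW D => w.P.map s.j) w) ?_
      rw [s.R_j]; exact ⟨_, subset_span ⟨g, b, hb, rfl⟩, rfl⟩
    have h2 := norm_inner_le_norm (𝕜 := ℂ) (s.R (D.u g) (s.j (a - b))) v
    rw [← h1, D.R_norm_u] at h2
    rw [lt_div_iff₀ (by positivity)] at hd
    nlinarith [norm_nonneg v, norm_nonneg (s.j (a - b))]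
  have hv : v ∈ (⨆ w : FW D, w.P.map s.j).topologicalClosure := by rw [htop]; trivial
  rw [← mem_coe, topologicalClosure_coe, Metric.mem_closure_iff] at hv
  obtain ⟨z, hz, hd⟩ := hv ε hε
  have : Nonempty (FW D) := ⟨one⟩
  obtain ⟨w, y, hy, rfl⟩ := (Submodule.mem_iSup_of_directed _ hdir).1 hz
  exact ⟨w, y, hy, by rwa [← dist_eq_norm]⟩

end FW

lemma step2 {Γ Λ : Type} [Group Γ] [Group Λ] {s : Std Al K} (D1 : XD Γ s) (D2 : XD Λ s) (hcb : CB s)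
    (hicc : IsICC Λ) (hT : HasPropertyT Γ)
    (hc : ∀ b ∈ D2.A, ∀ ε : ℝ, 0 < ε → ∃ w : FW D2, ∃ a ∈ w.W, ‖s.j (b - a)‖ < ε) :
    ∃ T : B(K), (D2.FRL hcb).Cm T ∧ (D2.FRL hcb).hs T < ⊤ ∧
      (∀ g v, T (s.R (D1.u g) v) = s.R (D1.u g) (T v)) ∧ T ≠ 0 := by
  obtain ⟨S, κ, hκ, HT⟩ := FR.propT_hs (F := D2.FRL hcb) hT (δ := 1 / 2) (by norm_num)
  choose ww y hy hyd using fun g : Γ => FW.P_dense hcb hc (s.j (D1.u g⁻¹)) (ε := κ / 4) (by positivity)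
  obtain ⟨w, h1, hw⟩ : ∃ w : FW D2, (1 : Al) ∈ w.W ∧ ∀ g ∈ S, (ww g).W ≤ w.W := by
    clear HT
    induction S using Finset.induction_on with
    | empty => exact ⟨FW.one, Submodule.mem_span_singleton_self _, by simp⟩
    | insert g S _ ih =>
      obtain ⟨w, h1, h2⟩ := ih
      refine ⟨w.sup (ww g), (le_sup_left : w.W ≤ _) h1, fun h hh => ?_⟩
      rcases Finset.mem_insert.1 hh with rfl | hh
      · exact le_sup_right
      · exact (h2 h hh).trans le_sup_left
  choose! C hC0 hC using fun g (hg : g ∈ S) => w.com_P hcb hicc h1 (FW.P_mono (hw g hg) (hy g))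
  set C' : ℝ := ∑ g ∈ S, C g with hC'
  have hC'0 : 0 ≤ C' := Finset.sum_nonneg hC0
  have hCg : ∀ g ∈ S, C g ≤ C' := fun g hg => Finset.single_le_sum (f := C) hC0 hg
  obtain ⟨e, he⟩ := w.pw_growth
  have hd0 : ∀ n, 1 ∈ (w.pw n).W := fun n => by
    induction n with
    | zero => exact h1
    | succ n ih => exact w.pw_mono h1 n ih
  have hdpos : ∀ n, 0 < (w.pw n).d := fun n => by
    by_contra h0
    have h0 : (w.pw n).d = 0 := by omega
    have h1 := (w.pw n).hsL_p hcb
    rw [h0] at h1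
    have h2 := FR.hs_eq_zero (D2.CmL.2 (w.pw n).p_Lu) (by simpa using h1)
    have h3 := (w.pw n).p_fix ((w.pw n).mem_N1 (hd0 n))
    rw [h2] at h3
    have := s.norm_one
    rw [← h3] at this
    simp at this
  obtain ⟨n, hn⟩ := poly_exp (d := fun n => ((w.pw n).d : ℝ)) (by exact_mod_cast hdpos 0) (D := e)
    (fun n => by exact_mod_cast he n) (ε := κ ^ 2 / (4 * (C' + 1))) (by positivity)
  set v := w.pw n with hv
  set d : ℝ := (v.d : ℝ) with hd
  have hdp : 0 < d := Nat.cast_pos.2 (hdpos n)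
  set u := URR D1 (D2.FRL hcb) (fun x => D2.CmL_R x) with hu
  have hUg : ∀ g, u.U g = s.R (D1.u g⁻¹) := fun g => rfl
  have hpC : (D2.FRL hcb).Cm v.p := D2.CmL.2 v.p_Lu
  have hhs : (D2.FRL hcb).hs v.p = ENNReal.ofReal ((Real.sqrt d) ^ 2) := by
    rw [v.hsL_p, sq_sqrt (by positivity), ofReal_natCast]
  have hnear := HT u v.p hpC (Real.sqrt d) (by positivity) hhs (fun g hg => by
    rw [← u.hs_cj' g hpC, hUg]
    have e : s.R (D1.u g⁻¹) * v.p - v.p * s.R (D1.u g⁻¹) =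
        (s.R (D1.u g⁻¹ - y g) * v.p - v.p * s.R (D1.u g⁻¹ - y g)) + (s.R (y g) * v.p - v.p * s.R (y g)) := by
      rw [s.R_sub, sub_mul, mul_sub]; abel
    rw [e]
    refine (FR.hs_add _ _).trans ((mul_le_mul_right (add_le_add (v.hsL_com hcb hicc _) (hC g hg n)) 2).trans ?_)
    have h1 : ‖s.j (D1.u g⁻¹ - y g)‖ ≤ κ / 4 := by rw [map_sub]; exact (hyd g).le
    rw [← ofReal_mul (hC0 g hg), enn_sq, ← ofReal_natCast, ← ofReal_mul (by positivity), ← ofReal_ofNat 4,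
      ← ofReal_mul (by positivity), ← ofReal_ofNat 2]
    refine (mul_le_mul_right (c := ENNReal.ofReal (4 * (‖s.j (D1.u g⁻¹ - y g)‖ ^ 2 * d)) + ENNReal.ofReal (κ ^ 2 / 4 * d)) (add_le_add le_rfl (ofReal_le_ofReal ?_)) _).trans ?_
    · calc C g * (((w.pw (n + 1)).d : ℝ) - (w.pw n).d) ≤ C g * (κ ^ 2 / (4 * (C' + 1)) * d) :=
            mul_le_mul_of_nonneg_left hn (hC0 g hg)
        _ ≤ (C' + 1) * (κ ^ 2 / (4 * (C' + 1)) * d) := by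
            have := hCg g hg
            gcongr; linarith
        _ = _ := by field_simp
    · rw [← ENNReal.ofReal_add (by positivity) (by positivity), ← ofReal_mul (by norm_num)]
      refine ofReal_le_ofReal ?_
      rw [mul_pow, sq_sqrt (by positivity)]
      have h2 : ‖s.j (D1.u g⁻¹ - y g)‖ ^ 2 ≤ (κ / 4) ^ 2 := by gcongr
      nlinarith)
  obtain ⟨T, hTC, hTf, hTU, -, -, hclose⟩ := FR.avgHS _ u hpC (by rw [hhs]; finiteness)
  refine ⟨T, hTC, hTf, fun g v => ?_, fun h0 => ?_⟩
  · have := congrArg (fun S : B(K) => S v) (hTU g⁻¹)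
    simp only [hUg, inv_inv] at this
    exact this.symm
  · have h3 := hclose _ (by positivity) hnear
    rw [h0, zero_sub, FR.hs_neg, hhs, ENNReal.ofReal_le_ofReal_iff (by positivity), mul_pow,
      sq_sqrt (by positivity)] at h3
    nlinarith

lemma combine {Γ Λ : Type} [Group Γ] [Group Λ] {s : Std Al K} (D1 : XD Γ s) (D2 : XD Λ s) (hcb : CB s)
    (hiccΓ : IsICC Γ) (hTΓ : HasPropertyT Γ) (hicc : IsICC Λ) (hTΛ : HasPropertyT Λ) (t : TW D1)
    (hc : ∀ b ∈ D2.A, ∀ ε : ℝ, 0 < ε → ∃ w : FW D2, ∃ a ∈ w.W, ‖s.j (b - a)‖ < ε) :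
    ∃ f : B(K), star f = f ∧ f * f = f ∧ f ≠ 0 ∧ (D1.FRR hcb).Cm f ∧ (D2.FRL hcb).Cm f ∧
      (D1.FRR hcb).hs f < ⊤ ∧ (D2.FRL hcb).hs f < ⊤ := by
  obtain ⟨T, hT1, hT2, hT3, hT0⟩ := step2 D1 D2 hcb hicc hTΓ hc
  obtain ⟨n, x, hx, hTx⟩ : ∃ n, ∃ x ∈ (t.F n).M, T (s.j x) ≠ 0 := by
    by_contra hcon
    push Not at hcon
    refine hT0 (ContinuousLinearMap.ext fun v => ?_)
    have hmem : v ∈ closure {z | T z = 0} := by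
      rw [Metric.mem_closure_iff]
      intro ε hε
      obtain ⟨n, y, hy, hd⟩ := t.dense hcb v hε
      exact ⟨s.j y, hcon n y hy, by rwa [dist_eq_norm]⟩
    rw [(isClosed_eq T.continuous continuous_const).closure_eq] at hmem
    exact hmem
  have hpos : 0 < ‖T (s.j x)‖ := norm_pos_iff.2 hTx
  obtain ⟨T1, h1, h2, h3, h4⟩ := step1 D1 D2 hcb hiccΓ hTΛ t
    (δ := ‖T (s.j x)‖ / (2 * (‖T‖ + 1) * (‖x‖ + 1))) (by positivity) n
  have h5 := h4 x hx
  set S := T * T1 with hS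
  have hS0 : S ≠ 0 := fun h0 => by
    have e : T (s.j x) = - T (T1 (s.j x) - s.j x) := by
      have : T (T1 (s.j x)) = 0 := congrArg (fun Z : B(K) => Z (s.j x)) h0
      rw [map_sub, this]; abel
    have h6 : ‖T (s.j x)‖ ≤ ‖T‖ * (‖T (s.j x)‖ / (2 * (‖T‖ + 1) * (‖x‖ + 1)) * ‖x‖) := by
      conv_lhs => rw [e, norm_neg]
      exact (T.le_opNorm _).trans (by gcongr)
    have h7 : ‖T‖ * (‖T (s.j x)‖ / (2 * (‖T‖ + 1) * (‖x‖ + 1)) * ‖x‖) < ‖T (s.j x)‖ := by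
      rw [div_mul_eq_mul_div, mul_div_assoc', div_lt_iff₀ (by positivity)]
      have a1 := norm_nonneg T
      have a2 := norm_nonneg x
      have : ‖T‖ * ‖x‖ < 2 * (‖T‖ + 1) * (‖x‖ + 1) := by nlinarith
      calc _ = ‖T (s.j x)‖ * (‖T‖ * ‖x‖) := by ring
        _ < _ := by gcongr
    exact absurd h6 (not_le.2 h7)
  have hTR : (D1.FRR hcb).Cm T := D1.CmR.2 hT3
  have hT1L : (D2.FRL hcb).Cm T1 := D2.CmL.2 h3
  have hSR : (D1.FRR hcb).Cm S := hTR.mul h1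
  have hSL : (D2.FRL hcb).Cm S := hT1.mul hT1L
  have hSRf : (D1.FRR hcb).hs S < ⊤ := (FR.hs_mul_left _ _).trans_lt (by finiteness)
  have hSLf : (D2.FRL hcb).hs S < ⊤ := (FR.hs_mul_right hT1 hT1L).trans_lt (by finiteness)
  have hQ : 0 ≤ star S * S := star_mul_self_nonneg S
  have hQ0 : 0 < ‖star S * S‖ := norm_pos_iff.2 (by
    intro h; exact hS0 (star_mul_self_eq_zero_iff S |>.1 h))
  obtain ⟨E, k, hEs, hEE, hEc, hkc, hSk, hSE, -⟩ := spectral_proj (star S * S) hQ (‖star S * S‖ / 2) (by positivity)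
  have hcomm : ∀ U : B(K), (∀ v, S (U v) = U (S v)) → (∀ v, star S (U v) = U (star S v)) →
      Commute (star S * S) U := fun U hU1 hU2 => by
    ext v
    simp only [mul_apply]
    rw [hU1, hU2]
  have hcR : ∀ g, Commute (star S * S) ((D1.FRR hcb).ρ g) := fun g => hcomm _ (hSR g) (hSR.star g)
  have hcL : ∀ g, Commute (star S * S) ((D2.FRL hcb).ρ g) := fun g => hcomm _ (hSL g) (hSL.star g)
  have toCm : ∀ {G : Type} [Group G] (F : FR G K) (X : B(K)), (∀ g, Commute X (F.ρ g)) → F.Cm X :=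
    fun F X h g v => congrArg (fun Z : B(K) => Z v) (h g).eq
  have hER := toCm (D1.FRR hcb) E fun g => hEc _ (hcR g)
  have hEL := toCm (D2.FRL hcb) E fun g => hEc _ (hcL g)
  have hkR := toCm (D1.FRR hcb) k fun g => hkc _ (hcR g)
  have hkL := toCm (D2.FRL hcb) k fun g => hkc _ (hcL g)
  have hE : E = star S * (S * (k * E)) := by
    have h := hSk.symm
    rw [mul_assoc, mul_assoc] at h
    exact h
  refine ⟨E, hEs, hEE, fun h0 => ?_, hER, hEL, ?_, ?_⟩
  · rw [h0, sub_zero, mul_one] at hSE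
    linarith
  · rw [hE]
    refine (FR.hs_mul_left _ _).trans_lt (mul_lt_top (by finiteness) ?_)
    exact (FR.hs_mul_right hSR (hkR.mul hER)).trans_lt (by finiteness)
  · rw [hE]
    refine (FR.hs_mul_left _ _).trans_lt (mul_lt_top (by finiteness) ?_)
    exact (FR.hs_mul_right hSL (hkL.mul hEL)).trans_lt (by finiteness)

lemma pol {E E' : Type*} [NormedAddCommGroup E] [InnerProductSpace ℂ E] [NormedAddCommGroup E']
    [InnerProductSpace ℂ E'] {a b : E} {a' b' : E'} (h1 : ‖a + b‖ = ‖a' + b'‖) (h2 : ‖a - b‖ = ‖a' - b'‖)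
    (h3 : ‖a - Complex.I • b‖ = ‖a' - Complex.I • b'‖) (h4 : ‖a + Complex.I • b‖ = ‖a' + Complex.I • b'‖) :
    inner ℂ a b = inner ℂ a' b' := by
  rw [inner_eq_sum_norm_sq_div_four, inner_eq_sum_norm_sq_div_four a' b', h1, h2]
  change (_ + ((‖a - Complex.I • b‖ : ℂ) ^ 2 - (‖a + Complex.I • b‖ : ℂ) ^ 2) * _) / _ =
    (_ + ((‖a' - Complex.I • b'‖ : ℂ) ^ 2 - (‖a' + Complex.I • b'‖ : ℂ) ^ 2) * _) / _
  rw [h3, h4]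

lemma enorm_sq_inj {E E' : Type*} [NormedAddCommGroup E] [NormedAddCommGroup E'] {a : E} {b : E'}
    (h : ‖a‖ₑ ^ 2 = ‖b‖ₑ ^ 2) : ‖a‖ = ‖b‖ := by
  have : ‖a‖ₑ = ‖b‖ₑ := (pow_right_strictMono (n := 2) (by norm_num)).injective h
  rw [← ofReal_norm, ← ofReal_norm] at this
  exact (ofReal_eq_ofReal_iff (norm_nonneg _) (norm_nonneg _)).1 this

lemma pol_lin {E E' V : Type*} [NormedAddCommGroup E] [InnerProductSpace ℂ E] [NormedAddCommGroup E']
    [InnerProductSpace ℂ E'] [AddCommGroup V] [Module ℂ V] (A : V →ₗ[ℂ] E) (B : V →ₗ[ℂ] E')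
    (h : ∀ v, ‖A v‖ = ‖B v‖) (v w : V) : inner ℂ (A v) (A w) = inner ℂ (B v) (B w) := by
  refine pol ?_ ?_ ?_ ?_
  · rw [← map_add, ← map_add, h]
  · rw [← map_sub, ← map_sub, h]
  · rw [← map_smul, ← map_smul, ← map_sub, ← map_sub, h]
  · rw [← map_smul, ← map_smul, ← map_add, ← map_add, h]

lemma enn_le_sqrt {E E' : Type*} [NormedAddCommGroup E] [NormedAddCommGroup E'] {a : E} {b : E'} {r : ℝ≥0∞}
    (hr : r < ⊤) (h : ‖a‖ₑ ^ 2 ≤ ‖b‖ₑ ^ 2 * r) : ‖a‖ ≤ Real.sqrt r.toReal * ‖b‖ := by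
  have h1 := ENNReal.toReal_mono (by finiteness) h
  simp only [ENNReal.toReal_pow, ENNReal.toReal_mul, toReal_enorm] at h1
  refine abs_le_of_sq_le_sq' ?_ (by positivity) |>.2
  rw [mul_pow, sq_sqrt ENNReal.toReal_nonneg, mul_comm]; exact h1

lemma sum_ext {I : Type*} {s : Std Al K} {T : I → B(K)} {c : ℝ≥0∞} (hc : c < ⊤)
    (h : ∀ x, ∑' i, ‖T i (s.j x)‖ₑ ^ 2 ≤ ‖s.j x‖ₑ ^ 2 * c) (v : K) :
    ∑' i, ‖T i v‖ₑ ^ 2 ≤ ‖v‖ₑ ^ 2 * c := by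
  rw [ENNReal.tsum_eq_iSup_sum]
  refine iSup_le fun J => ?_
  have hcl : IsClosed {v : K | ∑ i ∈ J, ‖T i v‖ₑ ^ 2 ≤ ‖v‖ₑ ^ 2 * c} := by
    refine isClosed_le ?_ ?_
    · refine continuous_finset_sum _ fun i _ => ?_
      exact (ENNReal.continuous_pow 2).comp (T i).continuous.enorm
    · exact (ENNReal.continuous_mul_const hc.ne).comp ((ENNReal.continuous_pow 2).comp continuous_enorm)
  have : closure (Set.range s.j) ⊆ _ := hcl.closure_subset_iff.2 (by
    rintro _ ⟨x, rfl⟩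
    exact (ENNReal.sum_le_tsum J).trans (h x))
  exact this (s.dense v)

lemma tb_fd {U : Submodule ℂ K} [FiniteDimensional ℂ U] {S : Set K} (hS : S ⊆ U) {C : ℝ}
    (hC : ∀ v ∈ S, ‖v‖ ≤ C) : TotallyBounded S := by
  have : ProperSpace U := proper ℂ U
  have h1 : IsCompact (Subtype.val '' (closedBall (0 : U) C) : Set K) :=
    (isCompact_closedBall _ _).image continuous_subtype_val
  refine TotallyBounded.subset (fun v hv => ?_) h1.totallyBounded
  refine ⟨⟨v, hS hv⟩, ?_, rfl⟩
  rw [mem_closedBall_zero_iff]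
  exact hC v hv

lemma stab {V : Type*} [AddCommGroup V] [Module ℂ V] {S : ℕ → Submodule ℂ V} (hm : ∀ n, S n ≤ S (n + 1))
    (hf : ∀ n, FiniteDimensional ℂ (S n)) {C : ℕ} (hC : ∀ n, finrank ℂ (S n) ≤ C) :
    ∃ m, ∀ n, S n ≤ S m := by
  have hmono : Monotone S := monotone_nat_of_le_succ hm
  have hb : BddAbove (Set.range fun n => finrank ℂ (S n)) := ⟨C, by rintro _ ⟨n, rfl⟩; exact hC n⟩
  obtain ⟨m, hm'⟩ := Nat.sSup_mem (Set.range_nonempty fun n => finrank ℂ (S n)) hb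
  refine ⟨m, fun n => ?_⟩
  haveI := hf (max n m)
  have h1 : S m ≤ S (max n m) := hmono (le_max_right _ _)
  have h2 : S m = S (max n m) := Submodule.eq_of_le_of_finrank_le h1 (by
    rw [show finrank ℂ (S m) = _ from hm']
    exact le_csSup hb ⟨_, rfl⟩)
  rw [h2]; exact hmono (le_max_left _ _)

namespace FR
variable {G : Type} [Group G] (F : FR G K)
lemma vec0_enorm (T : F.V0) : ‖F.vec0 T‖ₑ ^ 2 = F.hs T.1 := lp_norm _
lemma vec0_apply (T : F.V0) (i : F.I) : F.vec0 T i = T.1 (F.e i) := rfl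
def V0star (T : F.V0) : F.V0 := ⟨star T.1, T.2.1.star, by rw [hs_star T.2.1]; exact T.2.2⟩
lemma vec0_star_norm (T : F.V0) : ‖F.vec0 (F.V0star T)‖ = ‖F.vec0 T‖ :=
  enorm_sq_inj (by rw [vec0_enorm, vec0_enorm]; exact hs_star T.2.1)

lemma vec0_star_inner (S T : F.V0) :
    inner ℂ (F.vec0 S) (F.vec0 T) = inner ℂ (F.vec0 (F.V0star T)) (F.vec0 (F.V0star S)) := by
  have e1 : F.V0star T + F.V0star S = F.V0star (S + T) := Subtype.ext (by simp [V0star, add_comm])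
  have e2 : F.V0star T - F.V0star S = - F.V0star (S - T) := Subtype.ext (by simp [V0star])
  have e3 : F.V0star T - Complex.I • F.V0star S = - (Complex.I • F.V0star (S - Complex.I • T)) :=
    Subtype.ext (by simp [V0star, smul_sub, smul_smul, sub_eq_add_neg, star_smul, add_comm])
  have e4 : F.V0star T + Complex.I • F.V0star S = Complex.I • F.V0star (S + Complex.I • T) :=
    Subtype.ext (by simp [V0star, smul_sub, smul_smul, sub_eq_add_neg, star_smul, add_comm])
  refine pol ?_ ?_ ?_ ?_
  · rw [← map_add, ← map_add, e1, vec0_star_norm]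
  · rw [← map_sub, ← map_sub, e2, map_neg, norm_neg, vec0_star_norm]
  · rw [← map_smul, ← map_smul, ← map_sub, ← map_sub, e3, map_neg, norm_neg, map_smul, norm_smul, vec0_star_norm]
    simp
  · rw [← map_smul, ← map_smul, ← map_add, ← map_add, e4, map_smul, norm_smul, vec0_star_norm]
    simp

/-- moving an operator to the other side of the inner product -/
lemma vec0_move {S T S' T' : F.V0} (A : B(K)) (hS : S.1 = A * S'.1) (hT : T'.1 = star A * T.1) :
    inner ℂ (F.vec0 S) (F.vec0 T) = inner ℂ (F.vec0 S') (F.vec0 T') := by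
  rw [lp.inner_eq_tsum, lp.inner_eq_tsum]
  refine tsum_congr fun i => ?_
  simp only [vec0_apply]
  rw [hS, hT, mul_apply, mul_apply, inner_star_swap']
end FR

lemma FW.hsL_one {G : Type} [Group G] {s : Std Al K} {D : XD G s} (hcb : CB s) {T : B(K)}
    (hT : (D.FRL hcb).Cm T) : (D.FRL hcb).hs (T * (FW.one (D := D)).p) = ‖T (s.j 1)‖ₑ ^ 2 := by
  rw [FW.hsL _ hcb hT]
  have hWK : (FW.one (D := D)).WK = Span {s.j 1} := by
    rw [FW.WK, FW.one, map_span, Set.image_singleton]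
  have h1 : s.j 1 ≠ 0 := fun h => by have := s.norm_one; rw [h, norm_zero] at this; norm_num at this
  have hd : (FW.one (D := D)).d = 1 := by
    rw [FW.d, hWK]; exact finrank_span_singleton h1
  have h2 : ∀ t, ‖T ((FW.one (D := D)).q t)‖ₑ ^ 2 = ‖T (s.j 1)‖ₑ ^ 2 := fun t => by
    have h3 : (FW.one (D := D)).q t ∈ Span {s.j 1} := by
      rw [← hWK]; exact (stdOrthonormalBasis ℂ (FW.one (D := D)).WK t).2
    obtain ⟨c, hc⟩ := mem_span_singleton.1 h3
    have h4 := (FW.one (D := D)).q_orth.1 t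
    rw [← hc, norm_smul, s.norm_one, mul_one] at h4
    rw [← hc, map_smul, enorm_smul, show ‖c‖ₑ = 1 by rw [← ofReal_norm, h4]; simp, one_mul]
  rw [tsum_congr h2, tsum_fintype, Finset.sum_const, Finset.card_univ, Fintype.card_fin, hd, one_smul]

/-- the trace identity -/
lemma trace_id {G : Type} [Group G] {s : Std Al K} (D : XD G s) (hcb : CB s) (β η : Al)
    {X Z : (D.FRL hcb).V0} (hZ : Z.1 = s.R β * ((FW.one (D := D)).p * s.R (star η))) :
    inner ℂ ((D.FRL hcb).vec0 Z) ((D.FRL hcb).vec0 X) = inner ℂ (s.j β) (X.1 (s.j η)) := by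
  let F := D.FRL hcb
  set P := (FW.one (D := D)).p with hP
  have hPC : F.Cm P := D.CmL.2 (FW.one (D := D)).p_Lu
  have hPs : star P = P := FW.p_star _
  have hPP : P * P = P := FW.p_idem _
  have fin : ∀ T, F.Cm T → F.hs (T * P) < ⊤ := fun T hT => by rw [FW.hsL_one hcb hT]; finiteness
  have hRη : F.Cm (s.R η) := D.CmL_R η
  let Y : F.V0 := ⟨s.R η * P, hRη.mul hPC, fin _ hRη⟩
  let B : F.V0 := ⟨star (star (s.R β) * X.1) * P, (((D.CmL_R β).star.mul X.2.1).star).mul hPC,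
    fin _ ((D.CmL_R β).star.mul X.2.1).star⟩
  let Ys := F.V0star Y
  let Bs := F.V0star B
  have e1 : inner ℂ (F.vec0 Z) (F.vec0 X) = inner ℂ (F.vec0 Ys) (F.vec0 Bs) := by
    refine F.vec0_move (s.R β * P) ?_ ?_
    · change _ = _ * star (s.R η * P)
      rw [hZ, star_mul, hPs, s.R_star, mul_assoc, ← mul_assoc P P, hPP]
    · change star (star (star (s.R β) * X.1) * P) = _
      rw [star_mul, star_star, star_mul, hPs, mul_assoc]
  have e2 : F.V0star Ys = Y := Subtype.ext (star_star _)
  have e3 : F.V0star Bs = B := Subtype.ext (star_star _)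
  refine e1.trans ?_
  rw [F.vec0_star_inner, e2, e3]
  let CS : Submodule ℂ B(K) :=
    { carrier := {T | F.Cm T}
      add_mem' := fun ha hb => ha.add hb
      zero_mem' := FR.Cm.zero
      smul_mem' := fun c _ h => h.smul c }
  let A1 : CS →ₗ[ℂ] F.V0 :=
    { toFun := fun T => ⟨T.1 * P, FR.Cm.mul T.2 hPC, fin _ T.2⟩
      map_add' := fun a b => Subtype.ext (add_mul _ _ _)
      map_smul' := fun c a => Subtype.ext (smul_mul_assoc _ _ _) }
  let A2 : CS →ₗ[ℂ] K :=
    { toFun := fun T => T.1 (s.j 1)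
      map_add' := fun a b => rfl
      map_smul' := fun c a => rfl }
  have := pol_lin (F.vec0.comp A1) A2 (fun T => enorm_sq_inj (by
    change ‖F.vec0 (A1 T)‖ₑ ^ 2 = _
    rw [F.vec0_enorm]; exact FW.hsL_one hcb T.2))
    ⟨star (star (s.R β) * X.1), ((D.CmL_R β).star.mul X.2.1).star⟩ ⟨s.R η, hRη⟩
  refine this.trans ?_
  change inner ℂ (star (star (s.R β) * X.1) (s.j 1)) (s.R η (s.j 1)) = _
  rw [star_mul, star_star, mul_apply, inner_star_swap, s.R_j, s.R_j, one_mul, one_mul]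

structure BF {Γ Λ : Type} [Group Γ] [Group Λ] {s : Std Al K} (D1 : XD Γ s) (D2 : XD Λ s) (hcb : CB s) where
  f : B(K)
  fs : star f = f
  ff : f * f = f
  R : (D1.FRR hcb).Cm f
  L : (D2.FRL hcb).Cm f
  fR : (D1.FRR hcb).hs f < ⊤
  fL : (D2.FRL hcb).hs f < ⊤
  i1 : IsICC Γ
  i2 : IsICC Λ

namespace BF
variable {Γ Λ : Type} [Group Γ] [Group Λ] {s : Std Al K} {D1 : XD Γ s} {D2 : XD Λ s} {hcb : CB s}
  (b : BF D1 D2 hcb)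

lemma f_Ru (g : Γ) (v : K) : b.f (s.R (D1.u g) v) = s.R (D1.u g) (b.f v) := D1.CmR.1 b.R g v
lemma f_Lu (g : Λ) (v : K) : b.f (s.L (D2.u g) v) = s.L (D2.u g) (b.f v) := D2.CmL.1 b.L g v
lemma f_f (v : K) : b.f (b.f v) = b.f v := congrArg (fun T : B(K) => T v) b.ff
lemma f_inner (v w : K) : inner ℂ (b.f v) w = inner ℂ v (b.f w) := by
  conv_lhs => rw [← b.fs]
  exact inner_star_swap _ _ _
lemma f_norm (v : K) : ‖b.f v‖ ≤ ‖v‖ := by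
  have h : ‖b.f v‖ ^ 2 ≤ ‖v‖ * ‖b.f v‖ := by
    have h1 : inner ℂ (b.f v) (b.f v) = inner ℂ v (b.f v) := by rw [b.f_inner, b.f_f]
    have h2 := norm_inner_le_norm (𝕜 := ℂ) v (b.f v)
    rw [← h1, inner_selfC] at h2
    simpa using h2
  by_contra hc
  push Not at hc
  nlinarith [norm_nonneg v, norm_nonneg (b.f v)]

lemma hsLx (x : Al) : (D1.FRR hcb).hs (s.L x * b.f) = ‖s.j x‖ₑ ^ 2 * (D1.FRR hcb).hs b.f :=
  hsL_scal D2 hcb b.i2 (fun x => D1.CmR_L x) b.R b.f_Lu b.fR x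
lemma hsRx (x : Al) : (D2.FRL hcb).hs (s.R x * b.f) = ‖s.j x‖ₑ ^ 2 * (D2.FRL hcb).hs b.f :=
  hsR_scal D1 hcb b.i1 (fun x => D2.CmL_R x) b.L b.f_Ru b.fL x

lemma ex_β (k : (D1.FRR hcb).I) : ∃ x, s.j x = b.f ((D1.FRR hcb).e k) :=
  BVtop' hcb (Real.sqrt_nonneg _) fun y => enn_le_sqrt b.fR (by
    rw [← b.hsLx]; exact le_tsum k)
lemma ex_η (k : (D2.FRL hcb).I) : ∃ x, s.j x = b.f ((D2.FRL hcb).e k) :=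
  BVtop hcb (Real.sqrt_nonneg _) fun y => enn_le_sqrt b.fL (by
    rw [← b.hsRx]; exact le_tsum k)
def β (k : (D1.FRR hcb).I) : Al := (b.ex_β k).choose
def η (k : (D2.FRL hcb).I) : Al := (b.ex_η k).choose
lemma β_eq (k) : s.j (b.β k) = b.f ((D1.FRR hcb).e k) := (b.ex_β k).choose_spec
lemma η_eq (k) : s.j (b.η k) = b.f ((D2.FRL hcb).e k) := (b.ex_η k).choose_spec

lemma sum_β (v : K) : ∑' k, ‖s.R (b.β k) v‖ₑ ^ 2 ≤ ‖v‖ₑ ^ 2 * (D1.FRR hcb).hs b.f :=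
  sum_ext b.fR (fun x => by
    rw [← b.hsLx]
    refine le_of_eq (tsum_congr fun k => ?_)
    rw [s.R_j, mul_apply, ← b.β_eq, s.L_j]) v
lemma sum_η (v : K) : ∑' k, ‖s.L (b.η k) v‖ₑ ^ 2 ≤ ‖v‖ₑ ^ 2 * (D2.FRL hcb).hs b.f :=
  sum_ext b.fL (fun x => by
    rw [← b.hsRx]
    refine le_of_eq (tsum_congr fun k => ?_)
    rw [s.L_j, mul_apply, ← b.η_eq, s.R_j]) v

lemma sum_fη (v : K) : ∑' k, ‖b.f (s.L (b.η k) v)‖ₑ ^ 2 ≤ ‖v‖ₑ ^ 2 * (D2.FRL hcb).hs b.f :=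
  (tsum_le_tsum fun k => by
    gcongr
    exact enorm_le_iff_norm_le.2 (b.f_norm _)).trans (b.sum_η v)

abbrev LL : Type := lp (fun _ : (D2.FRL hcb).I => K) 2

def Dl : K →ₗ[ℂ] lp (fun _ : (D2.FRL hcb).I => K) 2 where
  toFun := fun v => ⟨fun k => b.f (s.L (b.η k) v), FR.summ_of_fin ((b.sum_fη v).trans_lt
    (mul_lt_top (by finiteness) b.fL))⟩
  map_add' := fun v w => by ext k; simp; rfl
  map_smul' := fun c v => by ext k; simp

def Dm : K →L[ℂ] lp (fun _ : (D2.FRL hcb).I => K) 2 :=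
  b.Dl.mkContinuous _ fun v => enn_le_sqrt b.fL (by
    rw [FR.lp_norm]; exact b.sum_fη v)

lemma Dm_apply (v : K) (k) : b.Dm v k = b.f (s.L (b.η k) v) := rfl

def X (x : Al) : (D2.FRL hcb).V0 := ⟨b.f * (s.R x * b.f), b.L.mul ((D2.CmL_R x).mul b.L), by
  refine (FR.hs_mul_left _ _).trans_lt (mul_lt_top (by finiteness) ?_)
  rw [b.hsRx]; exact mul_lt_top (by finiteness) b.fL⟩

lemma Dm_j (x : Al) : b.Dm (s.j x) = (D2.FRL hcb).vec0 (b.X x) := by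
  ext k
  rw [Dm_apply, FR.vec0_apply]
  change _ = b.f (s.R x (b.f _))
  rw [← b.η_eq, s.L_j, s.R_j]

lemma Dm_R (g : Γ) (v : K) : ‖b.Dm (s.R (D1.u g) v)‖ = ‖b.Dm v‖ := by
  refine enorm_sq_inj ?_
  rw [FR.lp_norm, FR.lp_norm]
  refine tsum_congr fun k => ?_
  rw [Dm_apply, Dm_apply, s.LR, b.f_Ru, enn_of_norm (D1.R_norm_u _ _)]

lemma Dm_L (g : Γ) (v : K) : ‖b.Dm (s.L (D1.u g) v)‖ = ‖b.Dm v‖ := by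
  have hcl : IsClosed {v : K | ‖b.Dm (s.L (D1.u g) v)‖ = ‖b.Dm v‖} :=
    isClosed_eq (by fun_prop) (by fun_prop)
  have : closure (Set.range s.j) ⊆ _ := hcl.closure_subset_iff.2 (by
    rintro _ ⟨x, rfl⟩
    refine enorm_sq_inj ?_
    rw [s.L_j, b.Dm_j, b.Dm_j, FR.vec0_enorm, FR.vec0_enorm]
    have e : (b.X (D1.u g * x)).1 = (b.X x).1 * s.R (D1.u g) := by
      ext v
      change b.f (s.R (D1.u g * x) (b.f v)) = b.f (s.R x (b.f (s.R (D1.u g) v)))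
      rw [b.f_Ru, s.R_mul]; rfl
    rw [e]
    refine FR.hs_iso_right (fun v => ?_) (b.X x).2.1 (D2.CmL_R _)
    rw [s.R_star, D1.u_star, D1.R_norm_u])
  exact this (s.dense v)

lemma Dm_Ad (g : Γ) (v : K) : ‖b.Dm (D1.Ad g v)‖ = ‖b.Dm v‖ := by
  rw [D1.Ad_apply, b.Dm_L, b.Dm_R]

def Gp : B(K) := (ContinuousLinearMap.adjoint b.Dm).comp b.Dm

lemma Gp_inner (v w : K) : inner ℂ (b.Gp v) w = inner ℂ (b.Dm v) (b.Dm w) := by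
  rw [Gp, ContinuousLinearMap.comp_apply, adjoint_inner_left]
lemma Gp_inner' (v w : K) : inner ℂ v (b.Gp w) = inner ℂ (b.Dm v) (b.Dm w) := by
  rw [Gp, ContinuousLinearMap.comp_apply, adjoint_inner_right]

lemma Gp_R (g : Γ) (v : K) : b.Gp (s.R (D1.u g) v) = s.R (D1.u g) (b.Gp v) := by
  refine ext_inner_right ℂ fun w => ?_
  rw [D1.inner_Ru, b.Gp_inner, b.Gp_inner]
  have := pol_lin (b.Dm.comp (s.R (D1.u g))).toLinearMap b.Dm.toLinearMap (fun v => b.Dm_R g v) v (s.R (D1.u g⁻¹) w)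
  refine Eq.trans ?_ this
  change _ = inner ℂ (b.Dm (s.R (D1.u g) v)) (b.Dm (s.R (D1.u g) (s.R (D1.u g⁻¹) w)))
  rw [D1.R_R, inv_mul_cancel, D1.u_one, s.R_one]; rfl

lemma Gp_Ad (g : Γ) (v : K) : b.Gp (D1.Ad g v) = D1.Ad g (b.Gp v) := by
  refine ext_inner_right ℂ fun w => ?_
  have e : inner ℂ (D1.Ad g (b.Gp v)) w = inner ℂ (b.Gp v) (D1.Ad g⁻¹ w) := by
    rw [← D1.Ad_star, inner_star_swap']
  rw [e, b.Gp_inner, b.Gp_inner]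
  have := pol_lin (b.Dm.comp (D1.Ad g)).toLinearMap b.Dm.toLinearMap (fun v => b.Dm_Ad g v) v (D1.Ad g⁻¹ w)
  refine Eq.trans ?_ this
  change _ = inner ℂ (b.Dm (D1.Ad g v)) (b.Dm (D1.Ad g (D1.Ad g⁻¹ w)))
  rw [D1.Ad_inv']

end BF

lemma TW.HA_ind {Γ : Type} [Group Γ] {s : Std Al K} {D1 : XD Γ s} (t : TW D1) {p : K → Prop}
    (hc : IsClosed {v | p v}) (h : ∀ n, ∀ a ∈ (t.F n).S, p (s.j a)) {v : K} (hv : v ∈ D1.HA) : p v := by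
  refine D1.HA_induction hc (fun a ha => ?_) hv
  have : s.j a ∈ closure {v | p v} := Metric.mem_closure_iff.2 fun ε hε => by
    obtain ⟨n, b, hb, hlt⟩ := t.dns a ha ε hε
    exact ⟨s.j b, h n b hb, by rwa [dist_eq_norm, ← map_sub]⟩
  rwa [hc.closure_eq] at this

lemma FW.WK_Ad {Γ : Type} [Group Γ] {s : Std Al K} {D1 : XD Γ s} (w : FW D1) (g : Γ) {v : K}
    (hv : v ∈ w.WK) : D1.Ad g v ∈ w.WK := by
  obtain ⟨a, ha, rfl⟩ := hv
  rw [D1.Ad_j]; exact ⟨_, w.inv g a ha, rfl⟩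

namespace BF
variable {Γ Λ : Type} [Group Γ] [Group Λ] {s : Std Al K} {D1 : XD Γ s} {D2 : XD Λ s} {hcb : CB s}
  (b : BF D1 D2 hcb)

lemma Gp_HA1 (w : FW D1) {v : K} (hv : v ∈ w.WK) : b.Gp v ∈ D1.HA := by
  refine D1.F4 hcb b.i1 ?_
  refine tb_fd (U := w.WK.map b.Gp.toLinearMap) (C := ‖b.Gp v‖) ?_ ?_
  · rintro _ ⟨g, rfl⟩
    exact ⟨D1.Ad g v, w.WK_Ad g hv, b.Gp_Ad g v⟩
  · rintro _ ⟨g, rfl⟩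
    rw [D1.Ad_norm]

lemma isClosed_HA : IsClosed (D1.HA : Set K) := by
  rw [D1.coe_HA]; exact isClosed_closure

lemma Gp_HA (t : TW D1) {v : K} (hv : v ∈ D1.HA) : b.Gp v ∈ D1.HA :=
  t.HA_ind (p := fun v => b.Gp v ∈ D1.HA) (isClosed_HA.preimage b.Gp.continuous)
    (fun n a ha => b.Gp_HA1 (t.F n).fw ⟨a, ha, rfl⟩) hv

lemma S_enorm (l : (D2.FRL hcb).I) : (D2.FRL hcb).hs ((FW.one (D := D2)).p * s.R (star (b.η l))) =
    ‖s.j (b.η l)‖ₑ ^ 2 := by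
  have hPC : (D2.FRL hcb).Cm (FW.one (D := D2)).p := D2.CmL.2 (FW.one (D := D2)).p_Lu
  rw [← FR.hs_star (hPC.mul (D2.CmL_R _)), star_mul, FW.p_star, s.R_star, star_star, FW.hsL_one hcb (D2.CmL_R _),
    s.R_j, one_mul]

lemma Z_fin (k : (D1.FRR hcb).I) (l : (D2.FRL hcb).I) : (D2.FRL hcb).hs (s.R (b.β k) *
    ((FW.one (D := D2)).p * s.R (star (b.η l)))) < ⊤ := by
  refine (FR.hs_mul_left _ _).trans_lt (mul_lt_top (by finiteness) ?_)
  rw [S_enorm]; finiteness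

def Z (k : (D1.FRR hcb).I) (l : (D2.FRL hcb).I) : (D2.FRL hcb).V0 :=
  ⟨s.R (b.β k) * ((FW.one (D := D2)).p * s.R (star (b.η l))),
    (D2.CmL_R _).mul ((D2.CmL.2 (FW.one (D := D2)).p_Lu).mul (D2.CmL_R _)), b.Z_fin k l⟩

lemma sum_Z : ∑' l, ∑' k, ‖(D2.FRL hcb).vec0 (b.Z k l)‖ₑ ^ 2 ≤
    (D2.FRL hcb).hs b.f * (D1.FRR hcb).hs b.f := by
  have h : ∀ l, ∑' k, ‖(D2.FRL hcb).vec0 (b.Z k l)‖ₑ ^ 2 ≤ ‖s.j (b.η l)‖ₑ ^ 2 * (D1.FRR hcb).hs b.f := fun l => by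
    rw [← b.S_enorm l, FR.hs, ← tsum_mul_right]
    simp only [FR.vec0_enorm]
    simp only [FR.hs]
    rw [tsum_comm]
    exact tsum_le_tsum fun j => b.sum_β _
  refine (tsum_le_tsum h).trans ?_
  rw [tsum_mul_right]
  refine le_of_eq (congrArg (· * _) (tsum_congr fun l => ?_))
  rw [b.η_eq]

lemma dim_bound {N : ℕ} (w : FW D1) (a : Fin N → Al) (ha : ∀ i, a i ∈ w.W)
    (ho : Orthonormal ℂ fun i => b.Dm (s.j (a i))) :
    (N : ℝ≥0∞) ≤ (D2.FRL hcb).hs b.f * (D1.FRR hcb).hs b.f := by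
  let y : Fin N × Γ → lp (fun _ : (D2.FRL hcb).I => K) 2 := fun x => b.Dm (s.R (D1.u x.2) (s.j (a x.1)))
  have hin : ∀ i g j h, inner ℂ (y (i, g)) (y (j, h)) =
      inner ℂ (s.R (D1.u g) (b.Gp (s.j (a i)))) (s.R (D1.u h) (s.j (a j))) := fun i g j h => by
    rw [← b.Gp_R, b.Gp_inner]
  have hy : Orthonormal ℂ y := by
    refine ⟨fun x => ?_, fun x x' hxx => ?_⟩
    · change ‖b.Dm (s.R (D1.u x.2) (s.j (a x.1)))‖ = 1
      rw [b.Dm_R]; exact ho.1 _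
    · obtain ⟨i, g⟩ := x
      obtain ⟨j, h⟩ := x'
      change inner ℂ (y (i, g)) (y (j, h)) = 0
      rw [hin]
      by_cases hgh : g = h
      · subst hgh
        have hij : i ≠ j := fun e => hxx (by rw [e])
        rw [D1.inner_Ru, D1.R_R, mul_inv_cancel, D1.u_one, s.R_one, one_apply, b.Gp_inner]
        exact ho.2 hij
      · exact D1.orth hgh (b.Gp_HA1 w ⟨_, ha i, rfl⟩) (D1.mem_HA (w.le _ (ha j)))
  have e1 : (N : ℝ≥0∞) = ∑' i, ‖b.Dm (s.j (a i))‖ₑ ^ 2 := by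
    rw [tsum_fintype, Finset.sum_congr rfl (g := fun _ => 1)]
    · simp
    · intro i _
      rw [← ofReal_norm, ho.1 i]; simp
  have e2 : ∀ i, ‖b.Dm (s.j (a i))‖ₑ ^ 2 =
      ∑' l, ∑' k, ∑' g, ‖inner ℂ (y (i, g)) ((D2.FRL hcb).vec0 (b.Z k l))‖ₑ ^ 2 := fun i => by
    rw [FR.lp_norm]
    refine tsum_congr fun l => ?_
    rw [← (D1.FRR hcb).parse]
    refine tsum_congr fun k => tsum_congr fun g => ?_
    congr 1
    have h1 : y (i, g) = (D2.FRL hcb).vec0 (b.X (a i * D1.u g)) := by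
      rw [← b.Dm_j, ← s.R_j]
    rw [h1, ← ofReal_norm, ← ofReal_norm, norm_inner_symm ((D2.FRL hcb).vec0 (b.X (a i * D1.u g))), trace_id D2 hcb (b.β k) (b.η l) rfl,
      Dm_apply, D1.FRR_ρ, D1.inner_Ru, inv_inv]
    congr 2
    change _ = inner ℂ _ (b.f (s.R (a i * D1.u g) (b.f (s.j (b.η l)))))
    rw [b.η_eq, b.f_f, ← b.η_eq, s.R_j, ← b.f_Ru, s.L_j, s.R_j, b.β_eq, b.f_inner, b.f_f, mul_assoc]
  calc (N : ℝ≥0∞) = ∑' l, ∑' k, ∑' x, ‖inner ℂ (y x) ((D2.FRL hcb).vec0 (b.Z k l))‖ₑ ^ 2 := by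
        rw [e1]
        simp only [e2]
        rw [tsum_comm]
        refine tsum_congr fun l => ?_
        rw [tsum_comm]
        refine tsum_congr fun k => ?_
        rw [ENNReal.tsum_prod']
    _ ≤ ∑' l, ∑' k, ‖(D2.FRL hcb).vec0 (b.Z k l)‖ₑ ^ 2 :=
        tsum_le_tsum fun l => tsum_le_tsum fun k => bessel hy _
    _ ≤ _ := b.sum_Z
end BF

lemma TW.WK_mono {Γ : Type} [Group Γ] {s : Std Al K} {D1 : XD Γ s} (t : TW D1) {m n : ℕ} (h : m ≤ n) :
    (t.F m).fw.WK ≤ (t.F n).fw.WK := map_mono (t.S_mono h)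

lemma FW.WK_le_HA {Γ : Type} [Group Γ] {s : Std Al K} {D1 : XD Γ s} (w : FW D1) {v : K} (hv : v ∈ w.WK) :
    v ∈ D1.HA := by
  obtain ⟨a, ha, rfl⟩ := hv
  exact D1.mem_HA (w.le a ha)

lemma FW.WK_le_N {Γ : Type} [Group Γ] {s : Std Al K} {D1 : XD Γ s} (w : FW D1) {v : K} (hv : v ∈ w.WK) :
    v ∈ w.N := by
  obtain ⟨a, ha, rfl⟩ := hv
  exact w.mem_N1 ha

namespace BF
variable {Γ Λ : Type} [Group Γ] [Group Λ] {s : Std Al K} {D1 : XD Γ s} {D2 : XD Λ s} {hcb : CB s}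
  (b : BF D1 D2 hcb)

lemma dim_bound' (w : FW D1) : finrank ℂ (w.WK.map b.Dm.toLinearMap) ≤
    ⌈((D2.FRL hcb).hs b.f * (D1.FRR hcb).hs b.f).toReal⌉₊ := by
  set U := w.WK.map b.Dm.toLinearMap with hU
  have : FiniteDimensional ℂ U := inferInstance
  let o := stdOrthonormalBasis ℂ U
  have h : ∀ i, ∃ a ∈ w.W, b.Dm (s.j a) = o i := fun i => by
    obtain ⟨z, ⟨a, ha, rfl⟩, hz⟩ := (o i).2
    exact ⟨a, ha, hz⟩
  choose a ha hao using h
  have h1 := b.dim_bound w a ha (by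
    simp only [hao]
    exact o.orthonormal.comp_linearIsometry U.subtypeₗᵢ)
  have hfin : (D2.FRL hcb).hs b.f * (D1.FRR hcb).hs b.f < ⊤ := mul_lt_top b.fL b.fR
  have h2 := ENNReal.toReal_mono hfin.ne h1
  rw [ENNReal.toReal_natCast] at h2
  exact_mod_cast h2.trans (Nat.le_ceil _)

lemma fdim (t : TW D1) : ∃ V : Submodule ℂ K, FiniteDimensional ℂ V ∧ ∀ v ∈ D1.HA, b.Gp v ∈ V := by
  obtain ⟨m, hm⟩ := stab (S := fun n => (t.F n).fw.WK.map b.Dm.toLinearMap)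
    (fun n => map_mono (t.WK_mono (Nat.le_succ n))) (fun n => inferInstance)
    (fun n => b.dim_bound' (t.F n).fw)
  let U := (t.F m).fw.WK.map b.Dm.toLinearMap
  have : FiniteDimensional ℂ U := inferInstance
  refine ⟨U.map (ContinuousLinearMap.adjoint b.Dm).toLinearMap, inferInstance, fun v hv => ?_⟩
  have hcl : IsClosed (U : Set (lp (fun _ : (D2.FRL hcb).I => K) 2)) := Submodule.closed_of_finiteDimensional _
  have : b.Dm v ∈ U := t.HA_ind (p := fun v => b.Dm v ∈ U) (hcl.preimage b.Dm.continuous)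
    (fun n a ha => hm n ⟨s.j a, ⟨a, ha, rfl⟩, rfl⟩) hv
  exact ⟨_, this, rfl⟩

lemma Gq (t : TW D1) (hcyc : ∀ n, ∃ e ∈ (t.F n).S, ∀ a ∈ (t.F n).S,
      a ∈ Span (Set.range fun g => D1.u g * e * D1.u g⁻¹)) :
    ∃ m, ∀ v ∈ D1.HA, b.Gp v = b.Gp ((t.F m).fw.WK.starProjection v) := by
  obtain ⟨V, hV, hGV⟩ := b.fdim t
  let q : ℕ → B(K) := fun n => (t.F n).fw.WK.starProjection
  have qm : ∀ n v, q n v ∈ (t.F n).fw.WK := fun n v => starProjection_apply_mem _ _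
  have qf : ∀ n, ∀ v ∈ (t.F n).fw.WK, q n v = v := fun n v hv => starProjection_eq_self_iff.2 hv
  have qs : ∀ n, star (q n) = q n := fun n => sp_star _
  have qq : ∀ m n, m ≤ n → q n * q m = q m := fun m n h => by
    ext v; exact qf n _ (t.WK_mono h (qm m v))
  have qq' : ∀ m n, m ≤ n → q m * q n = q m := fun m n h => by
    have := congrArg star (qq m n h)
    rwa [star_mul, qs, qs] at this
  have qA : ∀ n g v, q n (D1.Ad g v) = D1.Ad g (q n v) := fun n g v =>
    proj_comm (fun v hv => (t.F n).fw.WK_Ad g hv) (fun v hv => by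
      rw [D1.Ad_star]; exact (t.F n).fw.WK_Ad _ hv) v
  let TT : ℕ → Submodule ℂ B(K) := fun n =>
    { carrier := {T | (∀ g v, T (D1.Ad g v) = D1.Ad g (T v)) ∧ (∀ v, T v ∈ V) ∧ T * q n = T}
      add_mem' := fun {a c} ha hc => ⟨fun g v => by
          rw [add_apply, add_apply, ha.1, hc.1, map_add],
        fun v => V.add_mem (ha.2.1 v) (hc.2.1 v), by rw [add_mul, ha.2.2, hc.2.2]⟩
      zero_mem' := ⟨fun g v => by simp, fun v => V.zero_mem, zero_mul _⟩
      smul_mem' := fun c a ha => ⟨fun g v => by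
          rw [smul_apply, smul_apply, ha.1, map_smul],
        fun v => V.smul_mem c (ha.2.1 v), by rw [smul_mul_assoc, ha.2.2]⟩ }
  have hTm : ∀ n, TT n ≤ TT (n + 1) := fun n T hT => ⟨hT.1, hT.2.1, by
    conv_lhs => rw [← hT.2.2]
    rw [mul_assoc, qq' n (n + 1) (Nat.le_succ n), hT.2.2]⟩
  have hinj : ∀ n, ∃ ev : TT n →ₗ[ℂ] V, Injective ev := fun n => by
    obtain ⟨e, he, hsp⟩ := hcyc n
    refine ⟨{ toFun := fun T => ⟨T.1 (s.j e), T.2.2.1 _⟩, map_add' := fun _ _ => rfl, map_smul' := fun _ _ => rfl }, ?_⟩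
    rw [← LinearMap.ker_eq_bot, LinearMap.ker_eq_bot']
    rintro ⟨T, hT1, hT2, hT3⟩ h0
    have h0' : T (s.j e) = 0 := val_eq h0
    have h1 : ∀ a ∈ (t.F n).S, T (s.j a) = 0 := fun a ha => by
      have h2 : Span (Set.range fun g => D1.u g * e * D1.u g⁻¹) ≤
          LinearMap.ker (T.toLinearMap.comp s.j) := span_le.2 (by
        rintro _ ⟨g, rfl⟩
        change T (s.j (D1.u g * e * D1.u g⁻¹)) = 0
        rw [← D1.Ad_j, hT1, h0', map_zero])
      exact h2 (hsp a ha)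
    refine Subtype.ext ?_
    change T = 0
    rw [← hT3]
    ext v
    obtain ⟨a, ha, hav⟩ := qm n v
    change T (q n v) = 0
    rw [← hav]; exact h1 a ha
  choose ev hev using hinj
  obtain ⟨m, hm⟩ := stab hTm (fun n => Module.Finite.of_injective (ev n) (hev n))
    (fun n => LinearMap.finrank_le_finrank_of_injective (hev n))
  refine ⟨m, fun v hv => ?_⟩
  have hGq : ∀ n, m ≤ n → b.Gp * q n = b.Gp * q m := fun n hn => by
    have h1 : b.Gp * q n ∈ TT n := ⟨fun g v => by
        change b.Gp (q n _) = D1.Ad g (b.Gp (q n v))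
        rw [qA, b.Gp_Ad], fun v => hGV _ ((t.F n).fw.WK_le_HA (qm n v)), by
        rw [mul_assoc, qq n n le_rfl]⟩
    have h2 := (hm n h1).2.2
    rw [← h2, mul_assoc, qq m n hn]
  refine t.HA_ind (p := fun v => b.Gp v = b.Gp (q m v)) (isClosed_eq (by fun_prop) (by fun_prop)) (fun n a ha => ?_) hv
  have h3 : s.j a ∈ (t.F (max n m)).fw.WK := t.WK_mono (le_max_left _ _) ⟨a, ha, rfl⟩
  have h4 := congrArg (fun T : B(K) => T (s.j a)) (hGq _ (le_max_right n m))
  simp only [mul_apply] at h4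
  rwa [qf _ _ h3] at h4

lemma step3 (hf0 : b.f ≠ 0) (t : TW D1) (hcyc : ∀ n, ∃ e ∈ (t.F n).S, ∀ a ∈ (t.F n).S,
      a ∈ Span (Set.range fun g => D1.u g * e * D1.u g⁻¹)) :
    ∃ m, ∃ ξ : Al, ξ ≠ 0 ∧ b.f (s.j ξ) = s.j ξ ∧ ∀ g, star ξ * D2.u g * ξ ∈ (t.F m).M := by
  obtain ⟨m, hm⟩ := b.Gq t hcyc
  set q := (t.F m).fw.WK.starProjection with hq
  have qm : ∀ v, q v ∈ (t.F m).fw.WK := fun v => starProjection_apply_mem _ _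
  have qs : star q = q := sp_star _
  have hGm : ∀ v ∈ D1.HA, b.Gp v ∈ (t.F m).fw.WK := fun v hv => by
    have hd : b.Gp v - q (b.Gp v) ∈ D1.HA := sub_mem (b.Gp_HA t hv) ((t.F m).fw.WK_le_HA (qm _))
    have h0 : ∀ w ∈ D1.HA, inner ℂ (b.Gp v - q (b.Gp v)) w = 0 := fun w hw => by
      rw [inner_sub_left, sub_eq_zero]
      have : inner ℂ (q (b.Gp v)) w = inner ℂ (b.Gp v) (q w) := by
        conv_lhs => rw [← qs]
        exact inner_star_swap _ _ _
      rw [this, b.Gp_inner, b.Gp_inner, ← b.Gp_inner', ← b.Gp_inner', ← hm w hw]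
    have h1 := inner_self_eq_zero.1 (h0 _ hd)
    rw [sub_eq_zero.1 h1]; exact qm _
  have hk : ∀ v ∈ (t.F m).fw.Nᗮ, b.Dm v = 0 := fun v hv => by
    have h1 : b.Gp v = 0 := D1.ortho_top hcb fun g w hw => by
      rw [b.Gp_inner', ← b.Gp_inner, b.Gp_R]
      exact hv _ ((t.F m).N_Ru g _ ((t.F m).fw.WK_le_N (hGm w hw)))
    have h2 := b.Gp_inner v v
    rw [h1, inner_zero_left] at h2
    exact inner_self_eq_zero.1 h2.symm
  obtain ⟨j, hj⟩ : ∃ j, b.η j ≠ 0 := by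
    by_contra hcon
    push Not at hcon
    refine hf0 (FR.hs_eq_zero b.L ?_)
    rw [FR.hs, ENNReal.tsum_eq_zero]
    intro j
    rw [← b.η_eq, hcon, map_zero]; simp
  have hfξ : b.f (s.j (b.η j)) = s.j (b.η j) := by rw [b.η_eq, b.f_f]
  refine ⟨m, b.η j, hj, hfξ, fun g => ?_⟩
  rw [FS.mem_M, ← Submodule.orthogonal_orthogonal (t.F m).fw.N, Submodule.mem_orthogonal']
  intro v hv
  have h1 : b.f (s.L (b.η j) v) = 0 := by rw [← b.Dm_apply, hk v hv]; rfl
  rw [mul_assoc, ← s.L_j, s.inner_L, star_star, ← s.L_j, ← hfξ, ← b.f_Lu, b.f_inner, h1, inner_zero_right]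
end BF

lemma gen_ind {S : Set K} {V : Submodule ℂ K} (hV : IsClosed (V : Set K)) (T : B(K))
    (h : ∀ x ∈ S, T x ∈ V) : ∀ v ∈ (Span S).topologicalClosure, T v ∈ V := by
  have h1 : Span S ≤ V.comap T.toLinearMap := span_le.2 h
  exact fun v hv => topologicalClosure_minimal _ h1 (hV.preimage T.continuous) hv

section pis
variable {s : Std Al K}

lemma pi_proj {w : Al} (h : w * (star w * w) = w) : (star w * w) * (star w * w) = star w * w := by
  rw [mul_assoc, h]

lemma pi_norm {w : Al} (h : w * (star w * w) = w) : ‖w‖ ≤ 1 := by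
  have h1 := norm_star_mul_self (x := w)
  have h2 := norm_star_mul_self (x := star w * w)
  rw [star_mul, star_star, pi_proj h] at h2
  by_contra hc
  rw [not_le] at hc
  have h3 : 1 < ‖star w * w‖ := by rw [h1]; nlinarith
  nlinarith

lemma pi_pnorm {w : Al} (h : w * (star w * w) = w) : ‖star w * w‖ ≤ 1 := by
  have h1 := norm_star_mul_self (x := w)
  have := pi_norm h
  nlinarith [norm_nonneg w]

lemma pi_diff {w w' : Al} (h : w * (star w * w) = w) (hr : w' * (star w * w) = w) :
    ‖s.j (w' - w)‖ ^ 2 = ‖s.j w'‖ ^ 2 - ‖s.j w‖ ^ 2 := by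
  have h1 : inner ℂ (s.j w') (s.j w) = inner ℂ (s.j w) (s.j w) := by
    have : s.j w = s.R (star w * w) (s.j w') := by rw [s.R_j, hr]
    conv_rhs => rw [this, s.inner_R, star_mul, star_star, s.R_j, s.R_j, mul_assoc, pi_proj h, hr]
  have h2 := norm_sub_sq (𝕜 := ℂ) (s.j w') (s.j w)
  rw [h1, inner_self_eq_norm_sq] at h2
  rw [map_sub, h2]; ring

lemma pi_trans {a b c : Al} (ha : a * (star a * a) = a) (hb : b * (star b * b) = b)
    (hab : b * (star a * a) = a) (hbc : c * (star b * b) = b) : c * (star a * a) = a := by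
  set p := star a * a with hp
  set q := star b * b with hq
  have hps : star p = p := by rw [hp, star_mul, star_star]
  have hqs : star q = q := by rw [hq, star_mul, star_star]
  have hqq : q * q = q := pi_proj hb
  have hpp : p * p = p := pi_proj ha
  have h1 : p * q * p = p := by
    conv_rhs => rw [hp, ← hab, star_mul, hps]
    rw [hq]; simp only [mul_assoc]
  have h2 : star ((1 - q) * p) * ((1 - q) * p) = 0 := by
    have : star ((1 - q) * p) * ((1 - q) * p) = p * p - p * q * p - p * q * p + p * (q * q) * p := by
      rw [star_mul, star_sub, star_one, hps, hqs]; noncomm_ring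
    rw [this, hqq, h1, hpp]; simp
  have h3 := star_mul_self_eq_zero_iff _ |>.1 h2
  have h4 : q * p = p := by
    rw [sub_mul, one_mul, sub_eq_zero] at h3; exact h3.symm
  rw [← h4, ← mul_assoc, hbc, hab]

lemma zornPI (hcb : CB s) (Q : Set Al) (h0 : (0 : Al) ∈ Q) (hQ : ∀ w ∈ Q, w * (star w * w) = w)
    (hcl : TwoClosed s Q) : ∃ w ∈ Q, ∀ w' ∈ Q, w' * (star w * w) = w → w' = w := by
  have key : ∀ c : Set Q, IsChain (fun a b : Q => b.1 * (star a.1 * a.1) = a.1) c →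
      ∃ ub : Q, ∀ a ∈ c, ub.1 * (star a.1 * a.1) = a.1 := by
    intro c hc
    rcases c.eq_empty_or_nonempty with rfl | hne
    · exact ⟨⟨0, h0⟩, by simp⟩
    set V : Set ℝ := (fun a : Q => ‖s.j a.1‖ ^ 2) '' c with hV
    have hb : BddAbove V := by
      refine ⟨1, ?_⟩
      rintro _ ⟨a, _, rfl⟩
      have := (s.nj_le a.1).trans (pi_norm (hQ a.1 a.2))
      have := norm_nonneg (s.j a.1)
      show ‖s.j a.1‖ ^ 2 ≤ 1
      nlinarith
    obtain ⟨u, -, hu, huV⟩ := exists_seq_tendsto_sSup (hne.image _) hb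
    choose x hx hxu using huV
    have tot : ∀ a ∈ c, ∀ b ∈ c, ‖s.j (a.1 - b.1)‖ ^ 2 = |‖s.j a.1‖ ^ 2 - ‖s.j b.1‖ ^ 2| := by
      have aux : ∀ a b : Q, b.1 * (star a.1 * a.1) = a.1 →
          ‖s.j (b.1 - a.1)‖ ^ 2 = |‖s.j b.1‖ ^ 2 - ‖s.j a.1‖ ^ 2| := by
        intro a b h
        have := pi_diff (s := s) (hQ a.1 a.2) h
        rw [← this, abs_of_nonneg (by positivity)]
      intro a ha b hb
      by_cases hab : a = b
      · subst hab; simp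
      rcases hc ha hb hab with h | h
      · rw [← neg_sub, map_neg, norm_neg, aux a b h, abs_sub_comm]
      · exact aux b a h
    have hcau : CauchySeq fun n => s.j (x n).1 := by
      have h1 := hu.cauchySeq
      rw [Metric.cauchySeq_iff] at h1 ⊢
      intro ε hε
      obtain ⟨N, hN⟩ := h1 (ε ^ 2) (by positivity)
      refine ⟨N, fun m hm n hn => ?_⟩
      have h2 := hN m hm n hn
      have h3 := tot _ (hx m) _ (hx n)
      have e1 := hxu m
      have e2 := hxu n
      simp only at e1 e2
      rw [Real.dist_eq, ← e1, ← e2, ← h3] at h2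
      rw [dist_eq_norm, ← map_sub]
      exact lt_of_pow_lt_pow_left₀ 2 hε.le h2
    obtain ⟨y, -, hy⟩ := hcb _ 1 (fun k => pi_norm (hQ _ (x k).2)) hcau
    have hyQ : y ∈ Q := hcl y (mem_closure_of_tendsto hy
      (.of_forall fun n => ⟨_, (x n).2, rfl⟩))
    refine ⟨⟨y, hyQ⟩, fun a ha => s.inj' ?_⟩
    have h1 : Tendsto (fun n => s.j ((x n).1 * (star a.1 * a.1))) atTop (𝓝 (s.j (y * (star a.1 * a.1)))) := by
      have := ((s.R (star a.1 * a.1)).continuous.tendsto _).comp hy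
      simpa [comp_def] using this
    refine tendsto_nhds_unique h1 ?_
    have h2 : ∀ n, ‖s.j ((x n).1 * (star a.1 * a.1)) - s.j a.1‖ ^ 2 ≤ sSup V - u n := by
      intro n
      have hle : u n ≤ sSup V := le_csSup hb ⟨_, hx n, hxu n⟩
      have haa := hQ a.1 a.2
      have e1 := hxu n
      simp only at e1
      by_cases hax : a = x n
      · rw [← hax, haa, sub_self]; simpa using hle
      rcases hc ha (hx n) hax with h | h
      · rw [h, sub_self]; simpa using hle
      · have h3 := pi_diff (s := s) (hQ _ (x n).2) h
        have h4 : ‖s.j a.1‖ ^ 2 ≤ sSup V := le_csSup hb ⟨_, ha, rfl⟩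
        have h5 : s.j ((x n).1 * (star a.1 * a.1)) - s.j a.1 = -s.j ((a.1 - (x n).1) * (star a.1 * a.1)) := by
          rw [sub_mul, haa, ← map_sub, ← map_neg, neg_sub]
        rw [h5, norm_neg]
        have h6 := s.nj_mul' (a.1 - (x n).1) (star a.1 * a.1)
        have h7 := pi_pnorm haa
        have h8 : ‖s.j ((a.1 - (x n).1) * (star a.1 * a.1))‖ ≤ ‖s.j (a.1 - (x n).1)‖ := by
          nlinarith [norm_nonneg (s.j (a.1 - (x n).1))]
        have h9 := pow_le_pow_left₀ (norm_nonneg _) h8 2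
        linarith
    rw [tendsto_iff_norm_sub_tendsto_zero]
    have h3 : Tendsto (fun n => ‖s.j ((x n).1 * (star a.1 * a.1)) - s.j a.1‖ ^ 2) atTop (𝓝 0) := by
      refine squeeze_zero (fun n => by positivity) h2 ?_
      have := (tendsto_const_nhds (x := sSup V)).sub hu
      rwa [sub_self] at this
    have := (Real.continuous_sqrt.tendsto 0).comp h3
    simpa [comp_def, Real.sqrt_sq] using this
  obtain ⟨m, hm⟩ := exists_maximal_of_chains_bounded key fun {a b c} hab hbc =>
    pi_trans (hQ _ a.2) (hQ _ b.2) hab hbc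
  refine ⟨m.1, m.2, fun w' hw' h => ?_⟩
  have h1 := hm ⟨w', hw'⟩ h
  have h2 := pi_diff (s := s) (hQ _ m.2) h
  have h3 := pi_diff (s := s) (hQ _ hw') h1
  have h4 : ‖s.j (w' - m.1)‖ ^ 2 = 0 := le_antisymm (by nlinarith [sq_nonneg ‖s.j (m.1 - w')‖]) (by positivity)
  have h5 : s.j (w' - m.1) = 0 := by simpa using h4
  exact sub_eq_zero.1 (s.inj' (by rw [h5, map_zero]))

lemma pi_closed (hcb : CB s) {P : Al → Prop} (hP : TwoClosed s {x | P x}) :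
    TwoClosed s {w | P w ∧ w * (star w * w) = w} := by
  intro x hx
  refine ⟨hP x (closure_mono (Set.image_mono fun w hw => hw.1) hx), ?_⟩
  have hn : ‖x‖ ≤ 1 := by
    obtain ⟨y, hy, he⟩ := hcb.mem (C := 1) (fun z hz => pi_norm hz.2) hx
    rwa [← s.inj' he]
  refine s.inj' (sub_eq_zero.1 (norm_le_zero_iff.1 (le_of_forall_pos_le_add fun ε hε => ?_)))
  obtain ⟨_, ⟨z, ⟨_, hz⟩, rfl⟩, hd⟩ := Metric.mem_closure_iff.1 hx (ε / 4) (by positivity)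
  rw [dist_eq_norm, ← map_sub] at hd
  have hzn := pi_norm hz
  have e : x * (star x * x) - x = (x - z) * (star x * x) + z * (star (x - z) * x) + z * (star z * (x - z))
      - (x - z) := by
    have : x * (star x * x) - x - z * (star z * z) + z = (x - z) * (star x * x) + z * (star (x - z) * x)
        + z * (star z * (x - z)) - (x - z) := by
      rw [star_sub]; noncomm_ring
    rw [← this, hz]; abel
  have hxz : ‖s.j (star (x - z))‖ = ‖s.j (x - z)‖ := s.nj_star _
  set δ := ‖s.j (x - z)‖
  have d0 : 0 ≤ δ := norm_nonneg _
  have hxx : ‖star x * x‖ ≤ 1 := by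
    rw [norm_star_mul_self]; nlinarith [norm_nonneg x]
  have b1 : ‖s.j ((x - z) * (star x * x))‖ ≤ δ :=
    (s.nj_mul' _ _).trans (by nlinarith)
  have b2 : ‖s.j (z * (star (x - z) * x))‖ ≤ δ := by
    have i1 := s.nj_mul z (star (x - z) * x)
    have i2 := s.nj_mul' (star (x - z)) x
    rw [hxz] at i2
    nlinarith [norm_nonneg (s.j (star (x - z) * x)), norm_nonneg x, norm_nonneg z]
  have b3 : ‖s.j (z * (star z * (x - z)))‖ ≤ δ := by
    have i1 := s.nj_mul z (star z * (x - z))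
    have i2 := s.nj_mul (star z) (x - z)
    rw [norm_star] at i2
    nlinarith [norm_nonneg (s.j (star z * (x - z))), norm_nonneg z]
  rw [← map_sub, e, map_sub, map_add, map_add]
  have := norm_sub_le (s.j ((x - z) * (star x * x)) + s.j (z * (star (x - z) * x)) +
    s.j (z * (star z * (x - z)))) (s.j (x - z))
  have := norm_add₃_le (a := s.j ((x - z) * (star x * x))) (b := s.j (z * (star (x - z) * x))) (c :=
    s.j (z * (star z * (x - z))))
  linarith

lemma XD.avg1 {G : Type} [Group G] (D : XD G s) (hcb : CB s) (hicc : IsICC G) {a b : Al}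
    (h : ∀ g, b * (D.u g * a * D.u g⁻¹) = 0) : s.τ a • b = 0 := by
  refine s.inj' ?_
  rw [map_zero]
  refine norm_le_zero_iff.1 (le_of_forall_pos_le_add fun ε hε => ?_)
  obtain ⟨z, hz, hl⟩ := D.dixG hcb hicc a (ε := ε / (‖b‖ + 1)) (by positivity)
  have hbz : b * z = 0 := by
    have hc : Convex ℝ {z : Al | b * z = 0} := by
      intro x hx y hy α β _ _ _
      simp only [mem_setOf_eq] at *
      rw [mul_add, mul_smul_comm, mul_smul_comm, hx, hy]; simp
    exact convexHull_min (by rintro _ ⟨g, rfl⟩; exact h g) hc hz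
  have e : s.τ a • b = -(b * (z - s.τ a • (1 : Al))) := by
    rw [mul_sub, hbz]; simp
  rw [e, map_neg, norm_neg]
  have := s.nj_mul b (z - s.τ a • (1 : Al))
  have h3 : ‖b‖ * ‖s.j (z - s.τ a • (1 : Al))‖ ≤ ‖b‖ * (ε / (‖b‖ + 1)) :=
    mul_le_mul_of_nonneg_left hl.le (norm_nonneg _)
  have h4 : ‖b‖ * (ε / (‖b‖ + 1)) ≤ ε := by
    rw [mul_div_assoc', div_le_iff₀ (by positivity)]; nlinarith [norm_nonneg b]
  linarith

lemma proj_eq_one {p : Al} (hs : star p = p) (hp : p * p = p) (h : s.τ (1 - p) = 0) : p = 1 := by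
  have e : star (1 - p) * (1 - p) = 1 - p := by
    rw [star_sub, star_one, hs]
    have : (1 - p) * (1 - p) = 1 - p - p + p * p := by noncomm_ring
    rw [this, hp]; abel
  rw [← e, s.τ_star_mul, inner_self_eq_zero] at h
  exact (sub_eq_zero.1 (s.inj' (by rw [h, map_zero]))).symm

lemma step4 {Γ Λ : Type} [Group Γ] [Group Λ] (D1 : XD Γ s) (D2 : XD Λ s) (hcb : CB s)
    (i1 : IsICC Γ) (i2 : IsICC Λ) (M : StarSubalgebra ℂ Al) (hM : TwoClosed s (M : Set Al))
    (hu : ∀ g, D1.u g ∈ M) {ξ : Al} (hξ : ξ ≠ 0) (h : ∀ g, star ξ * D2.u g * ξ ∈ M) :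
    ∃ w : Al, star w * w = 1 ∧ w * star w = 1 ∧ (∀ g, star w * D2.u g * w ∈ M) ∧ star w * ξ ∈ M := by
  set Gn : Set K := {v | ∃ g, ∃ y ∈ M, v = s.j (D2.u g * ξ * y)} with hGn
  set Hc : Submodule ℂ K := (Span Gn).topologicalClosure with hHc
  have hHcl : IsClosed (Hc : Set K) := isClosed_topologicalClosure _
  have hgen : ∀ g, ∀ y ∈ M, s.j (D2.u g * ξ * y) ∈ Hc := fun g y hy =>
    le_topologicalClosure _ (subset_span ⟨g, y, hy, rfl⟩)
  have hR : ∀ x, s.j x ∈ Hc → ∀ y ∈ M, s.j (x * y) ∈ Hc := by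
    intro x hx y hy
    rw [← s.R_j]
    refine gen_ind hHcl (s.R y) ?_ _ hx
    rintro _ ⟨g, z, hz, rfl⟩
    rw [s.R_j, mul_assoc]; exact hgen g _ (mul_mem hz hy)
  have hL : ∀ x, s.j x ∈ Hc → ∀ g, s.j (D2.u g * x) ∈ Hc := by
    intro x hx g
    rw [← s.L_j]
    refine gen_ind hHcl (s.L (D2.u g)) ?_ _ hx
    rintro _ ⟨k, z, hz, rfl⟩
    rw [s.L_j, ← mul_assoc, ← mul_assoc, D2.u_mul]; exact hgen _ _ hz
  have hξ' : s.j ξ ∈ Hc := by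
    have := hgen 1 1 (one_mem M)
    rwa [D2.u_one, one_mul, mul_one] at this
  have hMc : IsClosed (clo s M : Set K) := isClosed_topologicalClosure _
  have hg1 : ∀ x, s.j x ∈ Hc → ∀ g, ∀ y ∈ M, star (D2.u g * ξ * y) * x ∈ M := by
    intro x hx g y hy
    refine of_clo hM ?_
    rw [← s.L_j]
    refine gen_ind hMc _ ?_ _ hx
    rintro _ ⟨k, z, hz, rfl⟩
    rw [s.L_j]
    refine mem_clo ?_
    have : star (D2.u g * ξ * y) * (D2.u k * ξ * z) = star y * (star ξ * D2.u (g⁻¹ * k) * ξ) * z := by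
      rw [star_mul, star_mul, D2.u_star, ← D2.u_mul]; simp only [mul_assoc]
    rw [this]
    exact mul_mem (mul_mem (star_mem hy) (h _)) hz
  have hhM : ∀ x, s.j x ∈ Hc → ∀ z, s.j z ∈ Hc → star x * z ∈ M := by
    intro x hx z hz
    refine of_clo hM ?_
    rw [← s.L_j]
    refine gen_ind hMc _ ?_ _ hz
    rintro _ ⟨k, y, hy, rfl⟩
    rw [s.L_j]
    refine mem_clo ?_
    have := star_mem (hg1 x hx k y hy)
    rwa [star_mul, star_star] at this
  have hcl : TwoClosed s {x | s.j x ∈ Hc} := by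
    intro x hx
    have : closure (s.j '' {x | s.j x ∈ Hc}) ⊆ (Hc : Set K) :=
      closure_minimal (by rintro _ ⟨y, hy, rfl⟩; exact hy) hHcl
    exact this hx
  obtain ⟨w, ⟨hw, hww⟩, hmax⟩ := zornPI hcb {w | s.j w ∈ Hc ∧ w * (star w * w) = w}
    ⟨by rw [map_zero]; exact Hc.zero_mem, by simp⟩ (fun w hw => hw.2) (pi_closed hcb hcl)
  set p := star w * w with hp
  set e := w * star w with he
  have hpM : p ∈ M := hhM w hw w hw
  have hps : star p = p := by rw [hp, star_mul, star_star]
  have hes : star e = e := by rw [he, star_mul, star_star]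
  have hpp : p * p = p := pi_proj hww
  have hew : e * w = w := by rw [he, mul_assoc, ← hp, hww]
  have hee : e * e = e := by
    conv_lhs => rw [he, ← mul_assoc, ← he, hew]
  have hpw : p * star w = star w := by
    have := congrArg star hww; rwa [star_mul, hps] at this
  have hwe : star w * e = star w := by
    have := congrArg star hew; rwa [star_mul, hes] at this
  have K1 : ∀ x, s.j x ∈ Hc → (1 - e) * x * (1 - p) = 0 := by
    intro x hx
    set y := (1 - e) * x * (1 - p) with hy
    have hyH : s.j y ∈ Hc := by
      have : (1 - e) * x = x - w * (star w * x) := by rw [sub_mul, one_mul, he, mul_assoc]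
      rw [hy, this]
      refine hR _ ?_ _ (sub_mem (one_mem M) hpM)
      rw [map_sub]
      exact Hc.sub_mem hx (hR _ hw _ (hhM w hw x hx))
    have hyp : y * p = 0 := by rw [hy, mul_assoc, sub_mul 1 p, one_mul, hpp, sub_self, mul_zero]
    have hwy : star w * y = 0 := by
      rw [hy, ← mul_assoc, ← mul_assoc, mul_sub _ 1 e, mul_one, hwe, sub_self, zero_mul, zero_mul]
    have hpy : p * star y = 0 := by
      have := congrArg star hyp; rwa [star_mul, hps, star_zero] at this
    obtain ⟨v, hv1, hv2, hv3⟩ := polar_abs hcb y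
    have hcc : IsClosed ((M ⊓ StarSubalgebra.centralizer ℂ {p} : StarSubalgebra ℂ Al) : Set Al) := by
      rw [StarSubalgebra.coe_inf, coe_centralizer]
      exact hM.isClosed.inter (Set.isClosed_centralizer _)
    have hv4 := hv3 _ hcc (by
      refine ⟨hhM y hyH y hyH, ?_⟩
      rw [mem_coe, mem_centralizer_iff]
      rintro g hg
      rw [Set.mem_singleton_iff] at hg
      rw [hg, hps, ← mul_assoc, hpy, mul_assoc, hyp]; simp)
    have hvH : s.j v ∈ Hc := by
      refine (closure_minimal ?_ hHcl) hv4
      rintro _ ⟨_, ⟨c, hc, rfl⟩, rfl⟩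
      exact hR _ hyH c hc.1
    have hvp : v * p = 0 := by
      refine s.inj' ?_
      rw [map_zero, ← s.R_j]
      have : IsClosed {v : K | s.R p v = 0} := isClosed_eq (s.R p).continuous continuous_const
      refine (closure_minimal ?_ this) hv4
      rintro _ ⟨_, ⟨c, hc, rfl⟩, rfl⟩
      have h1 := ((mem_centralizer_iff ℂ).1 hc.2 p rfl).1
      show s.R p (s.j _) = 0
      rw [s.R_j, mul_assoc, ← h1, ← mul_assoc, hyp, zero_mul, map_zero]
    have hwv : star w * v = 0 := by
      refine s.inj' ?_
      rw [map_zero, ← s.L_j]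
      have : IsClosed {v : K | s.L (star w) v = 0} := isClosed_eq (s.L _).continuous continuous_const
      refine (closure_minimal ?_ this) hv4
      rintro _ ⟨_, ⟨c, hc, rfl⟩, rfl⟩
      show s.L (star w) (s.j _) = 0
      rw [s.L_j, ← mul_assoc, hwy, zero_mul, map_zero]
    have hvw : star v * w = 0 := by
      have := congrArg star hwv; rwa [star_mul, star_star, star_zero] at this
    have hwsv : w * star v = 0 := by
      have h1 := congrArg star hvp
      rw [star_mul, hps, star_zero] at h1
      rw [← hww, mul_assoc, h1, mul_zero]
    have h1 : (w + v) * (star (w + v) * (w + v)) = w + v := by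
      have : (w + v) * (star (w + v) * (w + v)) = w * p + (w * star v) * (v + w) + w * (star w * v) + v * p
          + v * (star w * v) + v * (star v * w) + v * (star v * v) := by
        rw [star_add, hp]; noncomm_ring
      rw [this, hww, hwsv, hwv, hvp, hvw, hv2]; simp
    have h2 := hmax (w + v) ⟨by rw [map_add]; exact Hc.add_mem hw hvH, h1⟩ (by
      rw [add_mul, hww, hvp, add_zero])
    have h3 : v = 0 := by simpa using h2
    rw [← hv1, h3]; simp
  have hτ : s.τ (1 - e) = s.τ (1 - p) := by
    rw [s.τ_sub, s.τ_sub, he, hp, s.τ_mul_comm]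
  have hτ0 : s.τ (1 - p) = 0 := by
    by_contra hne
    have h1 : ∀ g, (1 - e) * (D2.u g * w) = 0 := by
      intro g
      have := D1.avg1 hcb i1 (a := 1 - p) (b := (1 - e) * (D2.u g * w)) (by
        intro k
        have h2 := K1 _ (hR _ (hL _ hw g) _ (hu k))
        calc _ = ((1 - e) * (D2.u g * w * D1.u k) * (1 - p)) * D1.u k⁻¹ := by simp only [mul_assoc]
          _ = 0 := by rw [h2, zero_mul])
      exact (smul_eq_zero.1 this).resolve_left hne
    have h2 := D2.avg1 hcb i2 (a := 1 - e) (b := star w) (by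
      intro k
      have h3 := congrArg star (h1 k⁻¹)
      rw [star_mul, star_mul, D2.u_star, inv_inv, star_sub, star_one, hes, star_zero] at h3
      calc _ = star w * D2.u k * (1 - e) * D2.u k⁻¹ := by simp only [mul_assoc]
        _ = 0 := by rw [h3, zero_mul])
    rw [hτ] at h2
    have h3 : w = 0 := star_eq_zero.1 ((smul_eq_zero.1 h2).resolve_left hne)
    have h4 := K1 ξ hξ'
    rw [he, hp, h3] at h4
    simp at h4
    exact hξ h4
  have p1 : p = 1 := proj_eq_one (s := s) hps hpp hτ0
  have e1 : e = 1 := proj_eq_one (s := s) hes hee (hτ.trans hτ0)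
  refine ⟨w, p1, e1, fun g => ?_, hhM w hw ξ hξ'⟩
  rw [mul_assoc]; exact hhM w hw _ (hL _ hw g)

end pis

end

section
variable {s : Std Al K}
/-- `e` is the family of atoms of the finite-dimensional algebra `F.S`. -/
structure Atoms {G : Type} [Group G] {D : XD G s} (F : FS D) (n : ℕ) (e : Fin n → Al) : Prop where
  mem : ∀ i, e i ∈ F.S
  sa : ∀ i, star (e i) = e i
  idem : ∀ i, e i * e i = e i
  orth : ∀ i j, i ≠ j → e i * e j = 0
  sum : ∑ i, e i = 1
  span : ∀ a ∈ F.S, ∃ c : Fin n → ℂ, a = ∑ i, c i • e i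
  ne : ∀ i, e i ≠ 0

lemma clo_ind {S : StarSubalgebra ℂ Al} {P : K → Prop} (hP : IsClosed {v | P v}) (h : ∀ a ∈ S, P (s.j a))
    {v : K} (hv : v ∈ clo s S) : P v := by
  rw [← mem_coe, coe_clo] at hv
  exact closure_minimal (by rintro _ ⟨a, ha, rfl⟩; exact h a ha) hP hv

namespace Atoms
variable {G : Type} [Group G] {D : XD G s} {F : FS D} {n : ℕ} {e : Fin n → Al}

lemma mul_e (ha : Atoms F n e) (c : Fin n → ℂ) (j : Fin n) : (∑ i, c i • e i) * e j = c j • e j := by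
  rw [sum_mul, sum_eq_single j]
  · rw [smul_mul_assoc, ha.idem]
  · intro i _ hij; rw [smul_mul_assoc, ha.orth i j hij, smul_zero]
  · simp

lemma perm (ha : Atoms F n e) (g : G) (i : Fin n) : ∃ j, D.u g * e i * D.u g⁻¹ = e j := by
  set a := D.u g * e i * D.u g⁻¹ with hadef
  have haa : a * a = a := by
    rw [hadef]
    calc _ = D.u g * (e i * ((D.u g⁻¹ * D.u g) * e i)) * D.u g⁻¹ := by simp only [mul_assoc]
      _ = _ := by rw [D.u_inv_mul, one_mul, ha.idem]
  have ha0 : a ≠ 0 := fun h => ha.ne i (by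
    calc e i = (D.u g⁻¹ * D.u g) * e i * (D.u g⁻¹ * D.u g) := by rw [D.u_inv_mul, one_mul, mul_one]
      _ = D.u g⁻¹ * a * D.u g := by rw [hadef]; simp only [mul_assoc]
      _ = 0 := by rw [h, mul_zero, zero_mul])
  obtain ⟨c, hc⟩ := ha.span a (F.inv g _ (ha.mem i))
  obtain ⟨j, hj⟩ : ∃ j, a * e j ≠ 0 := by
    by_contra hcon
    push Not at hcon
    exact ha0 (by rw [← mul_one a, ← ha.sum, Finset.mul_sum]; simp [hcon])
  have h1 : a * e j = c j • e j := by rw [hc]; exact ha.mul_e c j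
  obtain ⟨d, hd⟩ := ha.span _ (F.inv g⁻¹ _ (ha.mem j))
  rw [inv_inv] at hd
  have h2 : e j * a = d i • a := by
    have := ha.mul_e d i
    rw [← hd] at this
    calc e j * a = (D.u g * D.u g⁻¹) * e j * (D.u g * e i * D.u g⁻¹) := by rw [D.u_mul_inv, one_mul]
      _ = D.u g * (D.u g⁻¹ * e j * D.u g * e i) * D.u g⁻¹ := by simp only [mul_assoc]
      _ = _ := by rw [this, mul_smul_comm, smul_mul_assoc]
  rw [D.comm _ (F.le (ha.mem j)) _ (F.le (F.inv g _ (ha.mem i)))] at h2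
  rw [h2] at h1 hj
  have hd0 : d i ≠ 0 := fun h => hj (by rw [h, zero_smul])
  have h3 : a = ((d i)⁻¹ * c j) • e j := by rw [mul_smul, ← h1, smul_smul, inv_mul_cancel₀ hd0, one_smul]
  set r := (d i)⁻¹ * c j
  have hr : r ≠ 0 := fun h => ha0 (by rw [h3, h, zero_smul])
  rw [h3, smul_mul_smul_comm, ha.idem] at haa
  have h4 := smul_left_injective ℂ (ha.ne j) haa
  exact ⟨j, by rw [h3, mul_left_cancel₀ hr (h4.trans (mul_one r).symm), one_smul]⟩

lemma inj_e (ha : Atoms F n e) : Injective e := by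
  intro i j h
  by_contra hne
  have h1 := ha.orth i j hne
  rw [← h, ha.idem] at h1
  exact ha.ne i h1

/-- averaging an operator over the atoms -/
def avg (e : Fin n → Al) (s : Std Al K) (f : B(K)) : B(K) := ∑ i, s.R (e i) * f * s.R (e i)

lemma avg_apply (f : B(K)) (v : K) : avg e s f v = ∑ i, s.R (e i) (f (s.R (e i) v)) := by
  simp [avg, ContinuousLinearMap.sum_apply]

lemma avg_e (ha : Atoms F n e) (f : B(K)) (j : Fin n) (v : K) : avg e s f (s.R (e j) v) = s.R (e j) (avg e s f v) := by
  have hRR : ∀ i j v, s.R (e i) (s.R (e j) v) = if i = j then s.R (e j) v else 0 := by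
    intro i j v
    rw [← mul_apply, ← s.R_mul]
    split_ifs with h
    · rw [h, ha.idem]
    · rw [ha.orth _ _ (Ne.symm h), s.R_zero]; rfl
  rw [avg_apply, avg_apply, map_sum, Finset.sum_congr rfl fun i _ => by rw [hRR i j v],
    Finset.sum_congr rfl fun i _ => hRR j i _]
  rw [sum_eq_single j, sum_eq_single j]
  · simp
  · intro i _ h; rw [if_neg (Ne.symm h)]
  · simp
  · intro i _ h; rw [if_neg h]; simp
  · simp

lemma avg_u (ha : Atoms F n e) (f : B(K)) (hf : ∀ g v, f (s.R (D.u g) v) = s.R (D.u g) (f v)) (g : G) (v : K) :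
    avg e s f (s.R (D.u g) v) = s.R (D.u g) (avg e s f v) := by
  choose σ hσ using ha.perm g
  have hinj : Injective σ := by
    intro i j h
    apply ha.inj_e
    have h1 : D.u g * e i * D.u g⁻¹ = D.u g * e j * D.u g⁻¹ := by rw [hσ, hσ, h]
    have h2 := congrArg (fun x => D.u g⁻¹ * x * D.u g) h1
    simp only [mul_assoc, D.u_inv_mul, mul_one] at h2
    simpa only [← mul_assoc, D.u_inv_mul, one_mul] using h2
  have hb := Finite.injective_iff_bijective.1 hinj
  rw [avg_apply, avg_apply, map_sum, ← hb.sum_comp (fun i => s.R (D.u g) (s.R (e i) (f (s.R (e i) v))))]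
  refine Finset.sum_congr rfl fun i _ => ?_
  have hcomm : ∀ v, s.R (e i) (s.R (D.u g) v) = s.R (D.u g) (s.R (e (σ i)) v) := fun v => by
    rw [← mul_apply, ← s.R_mul, ← mul_apply, ← s.R_mul, ← hσ,
      mul_assoc _ _ (D.u g), D.u_inv_mul, mul_one]
  rw [hcomm, hf, hcomm]

lemma avg_M (ha : Atoms F n e) (f : B(K)) (hf : ∀ g v, f (s.R (D.u g) v) = s.R (D.u g) (f v)) {y : Al} (hy : y ∈ F.M)
    (v : K) : avg e s f (s.R y v) = s.R y (avg e s f v) := by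
  set T := avg e s f
  have hsp : ∀ y ∈ Span {x | ∃ g, ∃ a ∈ F.S, x = a * D.u g}, T * s.R y = s.R y * T := by
    intro y hy
    induction hy using Submodule.span_induction with
    | mem y h =>
      obtain ⟨g, a, haS, rfl⟩ := h
      obtain ⟨c, rfl⟩ := ha.span a haS
      have h1 : T * s.R (∑ i, c i • e i) = s.R (∑ i, c i • e i) * T := by
        have : s.R (∑ i, c i • e i) = ∑ i, c i • s.R (e i) :=
          s.ext_j fun z => by simp [Finset.mul_sum, ContinuousLinearMap.sum_apply]
        rw [this, Finset.mul_sum, sum_mul]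
        refine Finset.sum_congr rfl fun i _ => ?_
        ext v; simp [T, ha.avg_e]
      have h2 : T * s.R (D.u g) = s.R (D.u g) * T := by ext v; exact ha.avg_u f hf g v
      rw [s.R_mul, ← mul_assoc, h2, mul_assoc, h1, mul_assoc]
    | zero => simp
    | add x y _ _ hx hy => rw [s.R_add, mul_add, hx, hy, add_mul]
    | smul c x _ hx => rw [s.R_smul, mul_smul_comm, hx, smul_mul_assoc]
  have h1 : (F.fw.N : Set K) = closure (s.j '' (Span {x | ∃ g, ∃ a ∈ F.S, x = a * D.u g} : Set Al)) := by
    rw [FW.N, topologicalClosure_coe, ← map_coe, map_span]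
    congr 3
    ext v
    constructor
    · rintro ⟨g, a, h, rfl⟩; exact ⟨_, ⟨g, a, h, rfl⟩, rfl⟩
    · rintro ⟨_, ⟨g, a, h, rfl⟩, rfl⟩; exact ⟨g, a, h, rfl⟩
  have hy' : s.j y ∈ closure (s.j '' (Span {x | ∃ g, ∃ a ∈ F.S, x = a * D.u g} : Set Al)) := by
    rw [← h1]; exact hy
  obtain ⟨q, hq, hql⟩ := mem_closure_iff_seq_limit.1 hy'
  choose x hx hxq using hq
  obtain rfl : q = fun k => s.j (x k) := funext fun k => (hxq k).symm
  have hql' : Tendsto (fun k => s.j (star (x k))) atTop (𝓝 (s.j (star y))) := by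
    rw [tendsto_iff_norm_sub_tendsto_zero] at hql ⊢
    refine hql.congr fun k => ?_
    rw [← map_sub, ← map_sub, ← star_sub, s.nj_star]
  have key : T * s.R y = s.R y * T := by
    refine s.ext_j fun a => ?_
    refine sub_eq_zero.1 (perp_j (s := s) fun z => ?_)
    rw [inner_sub_right, sub_eq_zero]
    have e1 : Tendsto (fun k => inner ℂ (s.j z) (T (s.L a (s.j (x k))))) atTop
        (𝓝 (inner ℂ (s.j z) (T (s.L a (s.j y))))) :=
      ((by fun_prop : Continuous fun v => inner ℂ (s.j z) (T (s.L a v))).tendsto _).comp hql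
    have e2 : Tendsto (fun k => inner ℂ (s.L z (s.j (star (x k)))) (T (s.j a))) atTop
        (𝓝 (inner ℂ (s.L z (s.j (star y))) (T (s.j a)))) :=
      ((by fun_prop : Continuous fun v => inner ℂ (s.L z v) (T (s.j a))).tendsto _).comp hql'
    have e3 := tendsto_nhds_unique (e1.congr fun k => ?_) e2
    · rw [mul_apply, mul_apply, s.R_j, ← s.L_j, e3, s.L_j, ← s.R_j,
        s.inner_R, star_star]
    · have := congrArg (fun S : B(K) => S (s.j a)) (hsp _ (hx k))
      simp only [mul_apply, s.R_j] at this
      rw [s.L_j, this, s.L_j, ← s.R_j, s.inner_R, star_star]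
  have := congrArg (fun S : B(K) => S v) key
  simpa using this

end Atoms

/-- conjugation by a unitary -/
def cj {w : Al} (h1 : star w * w = 1) (h2 : w * star w = 1) : Al →⋆ₐ[ℂ] Al where
  toFun x := star w * x * w
  map_one' := by rw [mul_one, h1]
  map_mul' x y := by
    calc _ = star w * x * 1 * y * w := by rw [mul_one]; simp only [mul_assoc]
      _ = _ := by rw [← h2]; simp only [mul_assoc]
  map_zero' := by simp
  map_add' x y := by rw [mul_add, add_mul]
  commutes' c := by
    rw [Algebra.algebraMap_eq_smul_one, mul_smul_comm, smul_mul_assoc, mul_one, h1]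
  map_star' x := by rw [star_mul, star_mul, star_star, mul_assoc]

lemma R_app (a b : Al) (v : K) : s.R a (s.R b v) = s.R (b * a) v := by rw [s.R_mul]; rfl
lemma L_app (a b : Al) (v : K) : s.L a (s.L b v) = s.L (a * b) v := by rw [s.L_mul]; rfl

lemma step5 {Γ Λ : Type} [Group Γ] [Group Λ] {D1 : XD Γ s} {D2 : XD Λ s} {hcb : CB s} (b : BF D1 D2 hcb)
    (F : FS D1) {n : ℕ} {e : Fin n → Al} (ha : Atoms F n e) {w ξ : Al} (h1 : star w * w = 1)
    (h2 : w * star w = 1) (hw : ∀ g, star w * D2.u g * w ∈ F.M) (hξ : ξ ≠ 0) (hfξ : b.f (s.j ξ) = s.j ξ)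
    (hwξ : star w * ξ ∈ F.M)
    (hc : ∀ b ∈ D2.A, ∀ ε : ℝ, 0 < ε → ∃ w : FW D2, ∃ a ∈ w.W, ‖s.j (b - a)‖ < ε) :
    ∃ F' : FS D2, (∀ x, x ∈ F'.M ↔ star w * x * w ∈ F.M) ∧
      ∀ x, x ∈ F'.S ↔ x ∈ D2.A ∧ star w * x * w ∈ F.M := by
  set N : StarSubalgebra ℂ Al := F.M.comap (cj h1 h2) with hN
  have memN : ∀ x, x ∈ N ↔ star w * x * w ∈ F.M := fun x => Iff.rfl
  have uN : ∀ g, D2.u g ∈ N := hw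
  have hNcl : TwoClosed s (N : Set Al) := by
    intro x hx
    refine F.M_twoClosed _ ?_
    have : s.j (star w * x * w) = (s.R w * s.L (star w)) (s.j x) := by simp
    change s.j (star w * x * w) ∈ _
    rw [this]
    refine MapsTo.closure (s := s.j '' (N : Set Al)) ?_ (s.R w * s.L (star w)).continuous hx
    rintro _ ⟨z, hz, rfl⟩
    exact ⟨star w * z * w, hz, by simp⟩
  -- the projection onto `N` preserves the closure of `D2.A`
  have hPH : ∀ v ∈ D2.HA, PP s N v ∈ D2.HA := by
    have hcl : IsClosed (D2.HA : Set K) := by rw [D2.coe_HA]; exact isClosed_closure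
    intro v hv
    refine D2.HA_induction (p := fun v => PP s N v ∈ D2.HA) (hcl.preimage (PP s N).continuous) ?_ hv
    intro x hx
    refine hcl.closure_subset (Metric.mem_closure_iff.2 fun ε hε => ?_)
    obtain ⟨W, a, haW, hd⟩ := hc x hx ε hε
    refine ⟨PP s N (s.j a), ?_, ?_⟩
    · refine D2.F4 hcb b.i2 ?_
      haveI := W.fd
      have : FiniteDimensional ℂ (W.W.map s.j) := inferInstance
      have ht : TotallyBounded (Set.range fun g => D2.Ad g (s.j a)) :=
        tb_fd (U := W.W.map s.j) (C := ‖s.j a‖)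
          (by rintro _ ⟨g, rfl⟩; exact ⟨_, W.inv g a haW, (D2.Ad_j g a).symm⟩)
          (by rintro _ ⟨g, rfl⟩; exact (D2.Ad_norm g _).le)
      have := ht.image (PP s N).uniformContinuous
      rw [← Set.range_comp] at this
      refine this.subset ?_
      rintro _ ⟨g, rfl⟩
      exact ⟨g, by simp only [Function.comp_apply, D2.Ad_apply]; rw [PP_comm_L (uN g), PP_comm_R (uN _)]⟩
    · rw [dist_eq_norm, ← map_sub, ← map_sub]
      exact (PP_norm _).trans_lt hd
  have hEN : ∀ x ∈ N, D2.E x ∈ N := by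
    intro x hx
    refine of_clo hNcl ?_
    have h3 := proj_comm (N := D2.HA) (T := PP s N) hPH (by rw [PP_star]; exact hPH) (s.j x)
    rw [PP_fix (mem_clo hx)] at h3
    change D2.PA (s.j x) = PP s N (D2.PA (s.j x)) at h3
    rw [D2.PA_j] at h3
    rw [h3]; exact PP_mem _
  -- the projection onto the closure of `w M`
  set p : B(K) := s.L w * PP s F.M * s.L (star w) with hp
  have hps : star p = p := by
    rw [hp, star_mul, star_mul, s.L_star, s.L_star, PP_star, star_star, mul_assoc]
  have p_app : ∀ v, p v = s.L w (PP s F.M (s.L (star w) v)) := fun v => rfl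
  have pR : ∀ y ∈ F.M, ∀ v, p (s.R y v) = s.R y (p v) := fun y hy v => by
    rw [p_app, p_app, s.LR, PP_comm_R hy, s.LR]
  have pL : (D2.FRL hcb).Cm p := D2.CmL.2 fun g v => by
    have : s.L (star w) (s.L (D2.u g) v) = s.L (star w * D2.u g * w) (s.L (star w) v) := by
      rw [L_app, L_app, mul_assoc _ w, h2, mul_one]
    rw [p_app, p_app, this, PP_comm_L (hw g), L_app, L_app]
    rw [← mul_assoc, ← mul_assoc, h2, one_mul]
  have p_fix : ∀ u ∈ clo s F.M, p (s.L w u) = s.L w u := fun u hu => by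
    rw [p_app, L_app, h1, s.L_one, one_apply, PP_fix hu]
  have p_j : ∀ y ∈ F.M, p (s.j (w * y)) = s.j (w * y) := fun y hy => by
    rw [← s.L_j]; exact p_fix _ (mem_clo hy)
  set f₁ := Atoms.avg e s b.f with hf₁
  have f₁R : ∀ y ∈ F.M, ∀ v, f₁ (s.R y v) = s.R y (f₁ v) := fun y hy v => ha.avg_M b.f (D1.CmR.1 b.R) hy v
  have f₁V : f₁ ∈ (D2.FRL hcb).V0 := by
    refine Submodule.sum_mem _ fun i _ => ⟨((D2.CmL_R _).mul b.L).mul (D2.CmL_R _), ?_⟩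
    refine (FR.hs_mul_right ((D2.CmL_R _).mul b.L) (D2.CmL_R _)).trans_lt (mul_lt_top (by finiteness) ?_)
    exact (FR.hs_mul_left _ _).trans_lt (mul_lt_top (by finiteness) b.fL)
  set T := p * f₁ * p with hT
  have TC : (D2.FRL hcb).Cm T := (pL.mul f₁V.1).mul pL
  have Tfin : (D2.FRL hcb).hs T < ⊤ := by
    refine (FR.hs_mul_right (pL.mul f₁V.1) pL).trans_lt (mul_lt_top (by finiteness) ?_)
    exact (FR.hs_mul_left _ _).trans_lt (mul_lt_top (by finiteness) f₁V.2)
  have TR : ∀ y ∈ F.M, ∀ v, T (s.R y v) = s.R y (T v) := fun y hy v => by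
    simp only [hT, mul_apply]; rw [pR y hy, f₁R y hy, pR y hy]
  obtain ⟨c, hcw⟩ : ∃ c : ℂ, T (s.j w) = c • s.j w := by
    obtain ⟨c, hc⟩ := D2.F3 hcb b.i2 (v := s.R (star w) (T (s.j w))) (by
      intro g
      rw [D2.Ad_apply, R_app, s.LR, ← D2.CmL.1 TC, s.L_j]
      have : s.j (D2.u g * w) = s.R (star w * D2.u g * w) (s.j w) := by
        rw [s.R_j, ← mul_assoc, ← mul_assoc, h2, one_mul]
      rw [this, TR _ (hw g), R_app]
      congr 2
      calc _ = star w * (D2.u g * (w * star w) * D2.u g⁻¹) := by simp only [mul_assoc]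
        _ = _ := by rw [h2, mul_one, D2.u_mul_inv, mul_one])
    refine ⟨c, ?_⟩
    have := congrArg (s.R w) hc
    rwa [R_app, h1, s.R_one, one_apply, map_smul, s.R_j, one_mul] at this
  have Tcp : T = c • p := by
    have h3 : ∀ u ∈ clo s F.M, T (s.L w u) = c • s.L w u := fun u hu => by
      refine clo_ind (P := fun u => T (s.L w u) = c • s.L w u)
        (isClosed_eq (by fun_prop) (by fun_prop)) (fun y hy => ?_) hu
      rw [s.L_j, ← s.R_j, TR y hy, hcw, map_smul]
    have pp : p * p = p := by ext v; exact p_fix _ (PP_mem _)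
    ext v
    have h4 : T v = T (p v) := by
      have : T * p = T := by rw [hT, mul_assoc, pp]
      rw [← mul_apply, this]
    rw [h4]
    exact h3 _ (PP_mem _)
  have hc0 : c ≠ 0 := by
    rintro rfl
    rw [zero_smul] at Tcp
    have pξ : p (s.j ξ) = s.j ξ := by
      have := p_j _ hwξ
      rwa [← mul_assoc, h2, one_mul] at this
    have h3 : inner ℂ (s.j ξ) (f₁ (s.j ξ)) = (0 : ℂ) := by
      have : inner ℂ (s.j ξ) (T (s.j ξ)) = (0 : ℂ) := by rw [Tcp]; simp
      rwa [hT, mul_apply, mul_apply, ← hps, inner_star_swap', hps, pξ] at this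
    have h4 : ∀ i, b.f (s.R (e i) (s.j ξ)) = 0 := by
      have h5 : ∑ i, ‖b.f (s.R (e i) (s.j ξ))‖ ^ 2 = 0 := by
        have : ((∑ i, ‖b.f (s.R (e i) (s.j ξ))‖ ^ 2 : ℝ) : ℂ) = 0 := by
          rw [← h3, hf₁, Atoms.avg_apply, inner_sum, Complex.ofReal_sum]
          refine Finset.sum_congr rfl fun i _ => ?_
          rw [← inner_selfC, ← ha.sa i, ← s.inner_R, ha.sa i, ← inner_star_swap', b.fs, ← mul_apply b.f b.f,
            b.ff]
        exact_mod_cast this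
      intro i
      have := (Finset.sum_eq_zero_iff_of_nonneg (fun i _ => by positivity)).1 h5 i (Finset.mem_univ i)
      simpa using this
    apply hξ
    refine s.inj' ?_
    rw [map_zero, ← hfξ, ← mul_one ξ, ← ha.sum, Finset.mul_sum, map_sum, map_sum]
    exact sum_eq_zero fun i _ => by rw [← s.R_j, h4]
  have pfin : (D2.FRL hcb).hs p < ⊤ := by
    have : p = c⁻¹ • T := by rw [Tcp, smul_smul, inv_mul_cancel₀ hc0, one_smul]
    rw [this, FR.hs_smul]; exact mul_lt_top (by finiteness) Tfin
  -- finite-dimensionality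
  have hfdV : FiniteDimensional ℂ (D2.HA ⊓ clo s N : Submodule ℂ K) := by
    have : CompleteSpace (D2.HA ⊓ clo s N : Submodule ℂ K) := by
      have hcl : IsClosed (D2.HA : Set K) := by rw [D2.coe_HA]; exact isClosed_closure
      have hcl' : IsClosed ((D2.HA ⊓ clo s N : Submodule ℂ K) : Set K) := by
        rw [Submodule.coe_inf]
        exact hcl.inter (isClosed_topologicalClosure _)
      exact hcl'.completeSpace_coe
    refine finD _ pfin fun J q hq hqN => ?_
    have hRw : ∀ v v', inner ℂ (s.R w v) (s.R w v') = inner ℂ v v' := fun v v' => by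
      rw [s.inner_R, R_app, h2, s.R_one, one_apply]
    have hnq : ∀ j, ‖q j‖ₑ = ‖s.R w (q j)‖ₑ := fun j => enn_of_norm (norm_eq_of_inner (hRw _ _).symm)
    rw [tsum_congr fun j => by rw [hnq j]]
    refine FR.bs hps pL ?_ fun j => ?_
    · have hLu : ∀ g v v', inner ℂ (s.L (D2.u g) v) (s.L (D2.u g) v') = inner ℂ v v' := fun g v v' => by
        rw [s.inner_L, L_app, D2.u_star, D2.u_inv_mul, s.L_one, one_apply]
      have hval : ∀ x y : J × Λ, inner ℂ (s.L (D2.u x.2) (s.R w (q x.1))) (s.L (D2.u y.2) (s.R w (q y.1))) =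
          if x = y then (1 : ℂ) else 0 := by
        rintro ⟨i, g⟩ ⟨j, k⟩
        simp only [s.LR, hRw]
        by_cases hgk : g = k
        · subst hgk
          rw [hLu, orthonormal_iff_ite.1 hq]; simp
        · rw [D2.L_eq, D2.L_eq, D2.orth hgk (D2.Ad_HA _ (hqN i).1) (D2.Ad_HA _ (hqN j).1)]
          simp [hgk]
      exact orthonormal_iff_ite.2 hval
    · refine clo_ind (P := fun v => p (s.R w v) = s.R w v) (isClosed_eq (by fun_prop) (by fun_prop)) ?_ (hqN j).2
      intro x hx
      have := p_j _ ((memN x).1 hx)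
      rw [← mul_assoc, ← mul_assoc, h2, one_mul] at this
      change p (s.R w (s.j x)) = s.R w (s.j x)
      rw [s.R_j]; exact this
  let F' : FS D2 :=
    { S := D2.A ⊓ N
      fd := by
        let φ : (D2.A ⊓ N : StarSubalgebra ℂ Al) →ₗ[ℂ] (D2.HA ⊓ clo s N : Submodule ℂ K) :=
          LinearMap.codRestrict _ (s.j.comp (toSubmodule (D2.A ⊓ N : StarSubalgebra ℂ Al).toSubalgebra).subtype)
            fun x => ⟨D2.mem_HA x.2.1, mem_clo x.2.2⟩
        refine of_injective φ fun x y hxy => Subtype.ext (s.inj' ?_)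
        exact val_eq hxy
      le := inf_le_left
      inv := fun g x hx => ⟨D2.conj g x hx.1, mul_mem (mul_mem (uN g) hx.2) (uN g⁻¹)⟩ }
  refine ⟨F', fun x => ⟨fun hx => ?_, fun hx => ?_⟩, fun x => Iff.rfl⟩
  · rw [← memN]
    refine of_clo hNcl ?_
    refine F'.fw.N_ind (P := clo s N) (isClosed_topologicalClosure _) (fun g a haS => ?_) hx
    exact mem_clo (mul_mem haS.2 (uN g))
  · rw [F'.mem_M_iff hcb]
    exact fun g => ⟨D2.mem _, hEN _ (mul_mem hx (uN _))⟩

namespace Atoms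
variable {G : Type} [Group G] {D : XD G s} {F : FS D} {n : ℕ} {e : Fin n → Al}

lemma trans (ha : Atoms F n e) (i j : Fin n) : ∃ g, D.u g * e i * D.u g⁻¹ = e j := by
  set O : Finset (Fin n) := Finset.univ.filter fun j => ∃ g, D.u g * e i * D.u g⁻¹ = e j with hO
  have memO : ∀ j, j ∈ O ↔ ∃ g, D.u g * e i * D.u g⁻¹ = e j := fun j => by simp [hO]
  set q := ∑ j ∈ O, e j with hq
  have qe : ∀ j, q * e j = if j ∈ O then e j else 0 := by
    intro j
    rw [hq, sum_mul]
    split_ifs with h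
    · rw [Finset.sum_eq_single_of_mem j h fun k _ hk => ha.orth k j hk, ha.idem]
    · exact sum_eq_zero fun k hk => ha.orth k j fun hkj => h (hkj ▸ hk)
  obtain ⟨c, hc⟩ := D.erg q (sum_mem fun j _ => F.le (ha.mem j)) (by
    intro g
    choose σ hσ using ha.perm g
    have hinj : Injective σ := by
      intro i j h
      apply ha.inj_e
      have h1 : D.u g * e i * D.u g⁻¹ = D.u g * e j * D.u g⁻¹ := by rw [hσ, hσ, h]
      have h2 := congrArg (fun x => D.u g⁻¹ * x * D.u g) h1
      simp only [mul_assoc, D.u_inv_mul, mul_one] at h2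
      simpa only [← mul_assoc, D.u_inv_mul, one_mul] using h2
    have him : O.image σ = O := by
      refine Finset.eq_of_subset_of_card_le ?_ (Finset.card_image_of_injective _ hinj).ge
      intro k hk
      obtain ⟨j, hj, rfl⟩ := Finset.mem_image.1 hk
      obtain ⟨h, hh⟩ := (memO j).1 hj
      refine (memO _).2 ⟨g * h, ?_⟩
      rw [← hσ, ← hh, ← D.u_mul, mul_inv_rev, ← D.u_mul]
      simp only [mul_assoc]
    conv_rhs => rw [hq, ← him, Finset.sum_image hinj.injOn]
    rw [hq, Finset.mul_sum, sum_mul]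
    exact Finset.sum_congr rfl fun j _ => hσ j)
  have hi : i ∈ O := (memO i).2 ⟨1, by rw [inv_one, D.u_one, one_mul, mul_one]⟩
  have h1 := qe i
  rw [if_pos hi, hc, smul_mul_assoc, one_mul] at h1
  have h2 : c = 1 := smul_left_injective ℂ (ha.ne i) (h1.trans (one_smul ℂ _).symm)
  rw [← memO]
  by_contra hj
  have h3 := qe j
  rw [if_neg hj, hc, h2, one_smul, one_mul] at h3
  exact ha.ne j h3

lemma cyc (ha : Atoms F n e) (h : (1 : Al) ≠ 0) : ∃ e ∈ F.S, ∀ a ∈ F.S,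
    a ∈ Span (Set.range fun g => D.u g * e * D.u g⁻¹) := by
  rcases n with _ | n
  · exact absurd ha.sum.symm (by simpa using h)
  refine ⟨e 0, ha.mem 0, fun a haS => ?_⟩
  obtain ⟨c, rfl⟩ := ha.span a haS
  refine Submodule.sum_mem _ fun i _ => Submodule.smul_mem _ _ (subset_span ?_)
  exact ha.trans 0 i

end Atoms

lemma FS.atoms {G : Type} [Group G] {D : XD G s} (F : FS D) : ∃ n, ∃ e : Fin n → Al, Atoms F n e := by
  letI : CommRing F.S := { (inferInstance : Ring F.S) with
    mul_comm := fun a b => Subtype.ext (D.comm _ (F.le a.2) _ (F.le b.2)) }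
  haveI := F.fd
  have : IsArtinianRing F.S := isArtinian_of_tower ℂ inferInstance
  have : IsReduced F.S := by
    rw [isReduced_iff_pow_one_lt 2 (by norm_num)]
    intro x hx
    have hx' : (x : Al) * x = 0 := by rw [pow_two] at hx; exact val_eq hx
    have hc : star (x : Al) * x = x * star (x : Al) := D.comm _ (F.le (star_mem x.2)) _ (F.le x.2)
    have h1 : star (star (x : Al) * x) * (star (x : Al) * x) = 0 := by
      rw [star_mul, star_star, hc, mul_assoc, ← mul_assoc (star (x : Al)), hc, mul_assoc, ← mul_assoc, hx', zero_mul]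
    exact Subtype.ext (star_mul_self_eq_zero_iff _ |>.1 (star_mul_self_eq_zero_iff _ |>.1 h1))
  set Φ := IsArtinianRing.equivPi F.S
  let I := MaximalSpectrum F.S
  obtain ⟨n, ⟨ψ⟩⟩ := Finite.exists_equiv_fin I
  letI : Fintype I := Fintype.ofEquiv _ ψ.symm
  let E : I → F.S := fun i => Φ.symm (Pi.single i 1)
  have hE : ∀ i, Φ (E i) = Pi.single i 1 := fun i => Φ.apply_symm_apply _
  have id1 : ∀ i, E i * E i = E i := fun i => Φ.injective (by
    rw [map_mul, hE, ← Pi.single_mul, one_mul])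
  have or1 : ∀ i j, i ≠ j → E i * E j = 0 := fun i j h => Φ.injective (by
    rw [map_mul, hE, hE, map_zero]
    ext k
    by_cases hk : k = i
    · subst hk; simp [Pi.single_eq_of_ne h]
    · simp [Pi.single_eq_of_ne hk])
  have su1 : ∑ i, E i = 1 := Φ.injective (by
    rw [map_sum, map_one, Finset.sum_congr rfl fun i _ => hE i]
    exact Finset.univ_sum_single 1)
  have sp1 : ∀ (a : F.S) i, ∃ c : ℂ, a * E i = c • E i := by
    intro a i
    haveI := i.isMaximal
    letI : Field (F.S ⧸ i.asIdeal) := Ideal.Quotient.field _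
    have : FiniteDimensional ℂ (F.S ⧸ i.asIdeal) :=
      FiniteDimensional.of_surjective (i.asIdeal.restrictScalars ℂ).mkQ (Submodule.mkQ_surjective _)
    obtain ⟨c, hc⟩ := (IsAlgClosed.algebraMap_bijective_of_isIntegral (k := ℂ) (K := F.S ⧸ i.asIdeal)).2
      (Ideal.Quotient.mk _ a)
    refine ⟨c, Φ.injective ?_⟩
    have h1 : c • E i = (c • (1 : F.S)) * E i := by rw [smul_mul_assoc, one_mul]
    rw [h1, map_mul, map_mul, hE]
    ext k
    by_cases hk : k = i
    · subst hk
      simp only [Pi.mul_apply, Pi.single_eq_same, mul_one]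
      exact hc.symm.trans (by rw [Algebra.algebraMap_eq_smul_one]; rfl)
    · simp [Pi.single_eq_of_ne hk]
  refine ⟨n, fun i => (E (ψ.symm i) : Al), fun i => (E _).2, fun i => ?_, fun i => val_eq (id1 _),
    fun i j h => val_eq (or1 _ _ fun h' => h (ψ.symm.injective h')), ?_, fun a ha => ?_, fun i h0 => ?_⟩
  · have hn : IsStarNormal (E (ψ.symm i) : Al) := ⟨D.comm _ (F.le (star_mem (E _).2)) _ (F.le (E _).2)⟩
    exact (isStarProjection_iff_isIdempotentElem_and_isStarNormal.2
      ⟨val_eq (id1 (ψ.symm i)), hn⟩).isSelfAdjoint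
  · rw [Equiv.sum_comp ψ.symm fun i => (E i : Al)]
    have := congrArg (F.S.subtype) su1
    rw [map_sum] at this
    exact this
  · choose c hc using sp1 ⟨a, ha⟩
    refine ⟨fun i => c (ψ.symm i), ?_⟩
    rw [Equiv.sum_comp ψ.symm fun i => c i • (E i : Al)]
    have h1 : (⟨a, ha⟩ : F.S) = ∑ i, c i • E i := by
      rw [← Finset.sum_congr rfl fun i _ => hc i, ← Finset.mul_sum, su1, mul_one]
    have := congrArg (F.S.subtype) h1
    rw [map_sum] at this
    exact this
  · have h1 : E (ψ.symm i) = 0 := Subtype.ext h0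
    have h2 := hE (ψ.symm i)
    rw [h1, map_zero] at h2
    haveI := (ψ.symm i).isMaximal
    haveI := Ideal.Quotient.nontrivial_iff.2 (ψ.symm i).isMaximal.ne_top
    have := congrFun h2 (ψ.symm i)
    rw [Pi.single_eq_same] at this
    exact zero_ne_one this

lemma main_abs {Γ Λ : Type} [Group Γ] [Group Λ] (D1 : XD Γ s) (D2 : XD Λ s) (hcb : CB s)
    (hiccΓ : IsICC Γ) (hTΓ : HasPropertyT Γ) (hiccΛ : IsICC Λ) (hTΛ : HasPropertyT Λ) (t : TW D1)
    (hc : ∀ b ∈ D2.A, ∀ ε : ℝ, 0 < ε → ∃ w : FW D2, ∃ a ∈ w.W, ‖s.j (b - a)‖ < ε) :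
    ∃ m, ∃ w : Al, star w * w = 1 ∧ w * star w = 1 ∧ ∃ F' : ℕ → FS D2,
      (∀ k x, x ∈ (F' k).M ↔ star w * x * w ∈ (t.F (k + m)).M) ∧ (∀ k, (F' k).S ≤ (F' (k + 1)).S) ∧
      ∀ a ∈ D2.A, ∀ ε : ℝ, 0 < ε → ∃ k, ∃ b ∈ (F' k).S, ‖s.j (a - b)‖ < ε := by
  have h10 : (1 : Al) ≠ 0 := fun h => by
    have := s.norm_one
    rw [h, map_zero, norm_zero] at this
    exact zero_ne_one this
  obtain ⟨f, fs, ff, f0, fR, fL, f1, f2⟩ := combine D1 D2 hcb hiccΓ hTΓ hiccΛ hTΛ t hc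
  let b : BF D1 D2 hcb := ⟨f, fs, ff, fR, fL, f1, f2, hiccΓ, hiccΛ⟩
  choose nn ee hat using fun n => (t.F n).atoms
  obtain ⟨m, ξ, hξ, hfξ, hm⟩ := b.step3 f0 t fun n => (hat n).cyc h10
  obtain ⟨w, h1, h2, hw, hwξ⟩ := step4 D1 D2 hcb hiccΓ hiccΛ (t.F m).M (t.F m).M_twoClosed (t.F m).u_mem hξ hm
  choose F' hM hS using fun k => step5 b (t.F (k + m)) (hat _) h1 h2
    (fun g => t.M_mono (Nat.le_add_left m k) (hw g)) hξ hfξ (t.M_mono (Nat.le_add_left m k) hwξ) hc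
  refine ⟨m, w, h1, h2, F', hM, fun k x hx => ?_, fun a ha ε hε => ?_⟩
  · rw [hS] at hx ⊢
    exact ⟨hx.1, t.M_mono (by omega) hx.2⟩
  · obtain ⟨k, y, hy, hd⟩ := t.dense hcb (s.j (star w * a * w)) hε
    refine ⟨k, D2.E (w * y * star w), ?_, ?_⟩
    · have : w * y * star w ∈ (F' k).M := by
        rw [hM]
        have : star w * (w * y * star w) * w = y := by
          calc _ = (star w * w) * y * (star w * w) := by simp only [mul_assoc]
            _ = y := by rw [h1, one_mul, mul_one]
        rw [this]; exact t.M_mono (Nat.le_add_right k m) hy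
      rw [(F' k).mem_M_iff hcb] at this
      have := this 1
      rwa [inv_one, D2.u_one, mul_one] at this
    · have e1 : a - D2.E (w * y * star w) = D2.E (a - w * y * star w) := by rw [map_sub, D2.fix a ha]
      rw [e1]
      refine (D2.E_norm _).trans_lt ?_
      have e2 : star w * a * w - y = star w * (a - w * y * star w) * w := by
        calc _ = star w * a * w - (star w * w) * y * (star w * w) := by rw [h1, one_mul, mul_one]
          _ = _ := by simp only [mul_sub, sub_mul, mul_assoc]
      rw [← map_sub, e2, ← s.nj_star, star_mul, s.nj_unitary_mul (by rw [star_star, h2]), s.nj_star,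
        s.nj_unitary_mul (by rw [star_star, h2])] at hd
      exact hd

/-- a finite-dimensional abelian algebra of operators is its own double commutant -/
lemma vn_aux
    (S : StarSubalgebra ℂ B(H)) {n : ℕ} {e : Fin n → B(H)} (mem : ∀ i, e i ∈ S)
    (idem : ∀ i, e i * e i = e i) (sa : ∀ i, star (e i) = e i) (orth : ∀ i j, i ≠ j → e i * e j = 0)
    (sum : ∑ i, e i = 1) (span : ∀ a ∈ S, ∃ c : Fin n → ℂ, a = ∑ i, c i • e i) :
    Set.centralizer (Set.centralizer (S : Set B(H))) = S := by
  refine Set.Subset.antisymm (fun x hx => ?_) Set.subset_centralizer_centralizer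
  have h1 : ∀ i, ∀ T : B(H), e i * T * e i * x = x * (e i * T * e i) := fun i T => by
    refine hx _ fun a ha => ?_
    obtain ⟨c, rfl⟩ := span a ha
    have e1 : (∑ j, c j • e j) * e i = c i • e i := by
      rw [sum_mul, sum_eq_single i, smul_mul_assoc, idem]
      · intro j _ h; rw [smul_mul_assoc, orth j i h, smul_zero]
      · simp
    have e2 : e i * (∑ j, c j • e j) = c i • e i := by
      rw [Finset.mul_sum, sum_eq_single i, mul_smul_comm, idem]
      · intro j _ h; rw [mul_smul_comm, orth i j h.symm, smul_zero]
      · simp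
    rw [← mul_assoc, ← mul_assoc, e1, mul_assoc _ (e i), e2, smul_mul_assoc, smul_mul_assoc, mul_smul_comm]
  have h2 : ∀ i, ∃ c : ℂ, x * e i = c • e i := by
    intro i
    by_cases h0 : e i = 0
    · exact ⟨0, by rw [h0]; simp⟩
    obtain ⟨v, hv⟩ : ∃ v, e i v ≠ 0 := by
      by_contra hcon
      push Not at hcon
      exact h0 (ContinuousLinearMap.ext hcon)
    refine ⟨inner ℂ (e i v) (e i (x (e i v))) / inner ℂ (e i v) (e i v), ContinuousLinearMap.ext fun ζ => ?_⟩
    have hii : ∀ z, e i (e i z) = e i z := fun z => congrArg (fun T : B(H) => T z) (idem i)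
    have := congrArg (fun T : B(H) => T (e i v)) (h1 i (InnerProductSpace.rankOne ℂ ζ (e i v)))
    simp only [mul_apply, InnerProductSpace.rankOne_apply, map_smul, hii] at this
    have hne : inner ℂ (e i v) (e i v) ≠ (0 : ℂ) := inner_self_ne_zero.2 hv
    rw [mul_apply, smul_apply, div_eq_inv_mul, mul_smul, this, smul_smul,
      inv_mul_cancel₀ hne, one_smul]
  choose c hc using h2
  rw [← mul_one x, ← sum, Finset.mul_sum, Finset.sum_congr rfl fun i _ => hc i]
  exact sum_mem fun i _ => S.smul_mem (mem i) _

end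

section
variable {s : Std Al K}
  {G : Type} [Group G]

lemma mem_mapφ {M : VonNeumannAlgebra H} (φ : MM M ≃⋆ₐ[ℂ] Al) (S : StarSubalgebra ℂ (MM M)) (x : MM M) :
    φ x ∈ S.map φ.toStarAlgHom ↔ x ∈ S :=
  ⟨fun ⟨y, hy, h⟩ => φ.injective h ▸ hy, fun h => ⟨x, h, rfl⟩⟩

lemma nrm2 {X : CrossedProduct G H} {φ : MM X.M ≃⋆ₐ[ℂ] Al} (hτ : ∀ x, s.τ (φ x) = X.tr.τ x) (x : MM X.M) :
    X.tr.norm2 x = ‖s.j (φ x)‖ := by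
  have : X.tr.τ (star (x : B(H)) * x) = s.τ (star (φ x) * φ x) := by
    rw [← map_star, ← map_mul, hτ]; rfl
  rw [TraceOn.norm2, this, re_τ_star_mul, Real.sqrt_sq (norm_nonneg _)]

section
variable (X : CrossedProduct G H) (φ : MM X.M ≃⋆ₐ[ℂ] Al) (s)
    (hτ : ∀ x, s.τ (φ x) = X.tr.τ x) (hab : IsAbelianSet (X.A : Set B(H)))
    (hfree : IsFree X) (herg : IsErgodic X)

/-- a finite-dimensional invariant subalgebra of the concrete crossed product -/
def fsOf (Q : VonNeumannAlgebra H) (hQ : (Q : Set B(H)) ⊆ X.A)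
    (hinv : InvariantUnder X (Q : Set B(H))) (hfd : IsFinDimSet (Q : Set B(H))) :
    FS (xdOf X φ s hτ hab hfree herg) where
  S := (Q.toStarSubalgebra.comap X.M.toStarSubalgebra.subtype).map φ.toStarAlgHom
  fd := by
    obtain ⟨n, v, hv, hs⟩ := hfd
    have : FiniteDimensional ℂ (Span (Set.range fun i => φ ⟨v i, X.A_sub (hQ (hv i))⟩)) :=
      span_of_finite ℂ (Set.finite_range _)
    refine Submodule.finiteDimensional_of_le (S₁ := toSubmodule
      ((Q.toStarSubalgebra.comap X.M.toStarSubalgebra.subtype).map φ.toStarAlgHom).toSubalgebra)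
      (S₂ := Span (Set.range fun i => φ ⟨v i, X.A_sub (hQ (hv i))⟩)) ?_
    rintro _ ⟨x, hx, rfl⟩
    obtain ⟨c, hc⟩ := hs x hx
    have : x = ∑ i, c i • (⟨v i, X.A_sub (hQ (hv i))⟩ : MM X.M) := by
      apply X.M.toStarSubalgebra.subtype_injective
      rw [map_sum]; exact hc
    rw [this]
    change φ _ ∈ _
    rw [map_sum]
    refine Submodule.sum_mem _ fun i _ => ?_
    rw [map_smul]
    exact Submodule.smul_mem _ _ (subset_span ⟨i, rfl⟩)
  le := by rintro _ ⟨x, hx, rfl⟩; exact ⟨x, hQ hx, rfl⟩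
  inv := by
    rintro g _ ⟨x, hx, rfl⟩
    refine ⟨⟨X.u g, X.u_mem g⟩ * x * ⟨X.u g⁻¹, X.u_mem g⁻¹⟩, ?_, ?_⟩
    · have := hinv g x hx
      rw [CrossedProduct.σ, X.u_star] at this
      exact this
    · show φ _ = φ _ * φ _ * φ _
      rw [map_mul, map_mul]

lemma mid_iff (hcb : CB s) (F : FS (xdOf X φ s hτ hab hfree herg)) (Q : Set B(H))
    (hFQ : ∀ x : MM X.M, φ x ∈ F.S ↔ (x : B(H)) ∈ Q) (x : MM X.M) :
    φ x ∈ F.M ↔ (x : B(H)) ∈ CD.midCP X Q := by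
  rw [F.mem_M_iff hcb]
  have h1 : ∀ g, (xdOf X φ s hτ hab hfree herg).E (φ x * (xdOf X φ s hτ hab hfree herg).u g⁻¹) ∈ F.S ↔
      X.EA.E (x * star (X.u g)) ∈ Q := by
    intro g
    change φ (exE X (φ.symm (φ x * φ ⟨X.u g⁻¹, X.u_mem g⁻¹⟩))) ∈ F.S ↔ _
    rw [← map_mul, symm_apply_apply, hFQ, X.u_star]
    rfl
  exact ⟨fun h => ⟨x.2, fun g => (h1 g).1 (h g)⟩, fun h g => (h1 g).2 (h.2 g)⟩

lemma hc_of (hcb : CB s) (hcpt : IsCompactAction X) :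
    ∀ b ∈ (xdOf X φ s hτ hab hfree herg).A, ∀ ε : ℝ, 0 < ε →
      ∃ w : FW (xdOf X φ s hτ hab hfree herg), ∃ a ∈ w.W, ‖s.j (b - a)‖ < ε := by
  set D := xdOf X φ s hτ hab hfree herg with hD
  obtain ⟨F, hFA, hdense, horb⟩ := hcpt
  let P : Submodule ℂ Al :=
    { carrier := {b | ∀ ε : ℝ, 0 < ε → ∃ w : FW D, ∃ a ∈ w.W, ‖s.j (b - a)‖ < ε}
      zero_mem' := fun ε hε => ⟨⟨⊥, inferInstance, fun w hw => by rw [(mem_bot ℂ).1 hw]; exact zero_mem _,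
        fun g w hw => by rw [(mem_bot ℂ).1 hw]; simp⟩, 0, zero_mem _, by simpa using hε⟩
      add_mem' := by
        intro b c hb hc ε hε
        obtain ⟨w, a, ha, h1⟩ := hb (ε / 2) (half_pos hε)
        obtain ⟨w', a', ha', h2⟩ := hc (ε / 2) (half_pos hε)
        haveI := w.fd
        haveI := w'.fd
        refine ⟨⟨w.W ⊔ w'.W, inferInstance, fun x hx => ?_, fun g x hx => ?_⟩, a + a',
          add_mem_sup ha ha', ?_⟩
        · obtain ⟨y, hy, z, hz, rfl⟩ := mem_sup.1 hx
          exact add_mem (w.le y hy) (w'.le z hz)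
        · obtain ⟨y, hy, z, hz, rfl⟩ := mem_sup.1 hx
          rw [mul_add, add_mul]
          exact add_mem_sup (w.inv g y hy) (w'.inv g z hz)
        · rw [add_sub_add_comm, map_add]
          exact (norm_add_le _ _).trans_lt (by linarith)
      smul_mem' := by
        intro c b hb ε hε
        have hc : 0 < ‖c‖ + 1 := by positivity
        obtain ⟨w, a, ha, h1⟩ := hb (ε / (‖c‖ + 1)) (by positivity)
        refine ⟨w, c • a, w.W.smul_mem c ha, ?_⟩
        rw [← smul_sub, map_smul, norm_smul]
        rw [lt_div_iff₀ hc] at h1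
        nlinarith [norm_nonneg (s.j (b - a))] }
  have hF : ∀ f : MM X.M, (f : B(H)) ∈ F → φ f ∈ P := by
    intro f hf ε hε
    refine D.pw hcb ⟨f, hFA hf, rfl⟩ ?_ hε
    rw [Metric.totallyBounded_iff]
    intro δ hδ
    obtain ⟨n, ξ, C, hξ, hg⟩ := horb f hf (δ / 3) (by positivity)
    choose κ hκ hκC hd using hg
    choose c hc using hκ
    let ζ : Fin n → MM X.M := fun i => ⟨ξ i, X.A_sub (hξ i)⟩
    let q : G → K := fun g => s.j (φ (∑ i, c g i • ζ i))
    have hq : ∀ g, ‖D.Ad g (s.j (φ f)) - q g‖ ≤ δ / 3 := by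
      intro g
      have h1 := hd g
      set y : MM X.M := ⟨X.u g, X.u_mem g⟩ * f * ⟨X.u g⁻¹, X.u_mem g⁻¹⟩ - ∑ i, c g i • ζ i with hy
      have h2 : X.σ g f - ∑ i, κ g i * ξ i = y := by
        have : X.M.toStarSubalgebra.subtype y = X.u g * f * X.u g⁻¹ - ∑ i, c g i • ξ i := by
          rw [hy, map_sub, map_sum]; rfl
        change _ = X.M.toStarSubalgebra.subtype y
        rw [this, CrossedProduct.σ, X.u_star]
        congr 1
        refine Finset.sum_congr rfl fun i _ => ?_
        rw [← hc]; simp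
      rw [h2, nrm2 hτ, hy, map_sub, map_mul, map_mul, map_sub] at h1
      rw [D.Ad_j]
      exact h1
    have htb : TotallyBounded (Set.range q) := by
      have : FiniteDimensional ℂ (Span (Set.range fun i => s.j (φ (ζ i)))) :=
        span_of_finite ℂ (Set.finite_range _)
      refine tb_fd (U := Span (Set.range fun i => s.j (φ (ζ i)))) (C := ‖s.j (φ f)‖ + δ / 3) ?_ ?_
      · rintro _ ⟨g, rfl⟩
        simp only [q, map_sum, map_smul]
        exact Submodule.sum_mem _ fun i _ => Submodule.smul_mem _ _ (subset_span ⟨i, rfl⟩)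
      · rintro _ ⟨g, rfl⟩
        have h1 := norm_sub_norm_le (q g) (D.Ad g (s.j (φ f)))
        rw [D.Ad_norm, norm_sub_rev] at h1
        linarith [hq g]
    obtain ⟨t, ht, hcov⟩ := Metric.totallyBounded_iff.1 htb (δ / 3) (by positivity)
    refine ⟨t, ht, ?_⟩
    rintro _ ⟨g, rfl⟩
    obtain ⟨z, hz, hzq⟩ := mem_iUnion₂.1 (hcov ⟨g, rfl⟩)
    refine mem_iUnion₂.2 ⟨z, hz, ?_⟩
    rw [Metric.mem_ball] at hzq ⊢
    have h1 := hq g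
    rw [← dist_eq_norm] at h1
    exact (dist_triangle _ (q g) z).trans_lt ((add_lt_add_of_le_of_lt h1 hzq).trans (by linarith))
  rintro _ ⟨b, hb, rfl⟩ ε hε
  obtain ⟨n, c, f, hf, hd⟩ := hdense b hb (ε / 3) (by positivity)
  let z : MM X.M := ∑ i, c i • ⟨f i, X.A_sub (hFA (hf i))⟩
  have hz : φ z ∈ P := by
    simp only [z, map_sum, map_smul]
    exact Submodule.sum_mem _ fun i _ => Submodule.smul_mem _ _ (hF _ (hf i))
  obtain ⟨w, a, ha, h1⟩ := hz (ε / 3) (by positivity)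
  refine ⟨w, a, ha, ?_⟩
  have h2 : (b : B(H)) - ∑ i, c i • f i = (b - z : MM X.M) := by
    change _ = X.M.toStarSubalgebra.subtype (b - z)
    rw [map_sub, map_sum]; rfl
  rw [h2, nrm2 hτ, map_sub] at hd
  change ‖s.j (φ b - a)‖ < ε
  have h3 : φ b - a = (φ b - φ z) + (φ z - a) := by abel
  rw [h3, map_add]
  exact (norm_add_le _ _).trans_lt (by linarith)

/-- the tower attached to a profinite action -/
def twOf (An : ℕ → VonNeumannAlgebra H) (hp : IsProfiniteTower X An) : TW (xdOf X φ s hτ hab hfree herg) where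
  F n := fsOf s X φ hτ hab hfree herg (An n) (hp.1 n) (hp.2.2.1 n) (hp.2.2.2.1 n)
  mono n := by rintro _ ⟨x, hx, rfl⟩; exact ⟨x, hp.2.1 n hx, rfl⟩
  dns := by
    rintro _ ⟨a, ha, rfl⟩ ε hε
    obtain ⟨n, b, hb, hd⟩ := hp.2.2.2.2.2 a ha (ε / 2) (half_pos hε)
    let b' : MM X.M := ⟨b, X.A_sub (hp.1 n hb)⟩
    refine ⟨n, φ b', ⟨b', hb, rfl⟩, ?_⟩
    have h2 : (a : B(H)) - b = (a - b' : MM X.M) := rfl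
    rw [h2, nrm2 hτ, map_sub] at hd
    exact hd.trans_lt (half_lt_self hε)

end

/-- the von Neumann algebra given by the atoms of a finite-dimensional subalgebra -/
def vnOf {M : VonNeumannAlgebra H} {s : Std (MM M) K} {D : XD G s} (F : FS D) : VonNeumannAlgebra H where
  toStarSubalgebra := F.S.map M.toStarSubalgebra.subtype
  centralizer_centralizer' := by
    obtain ⟨n, e, ha⟩ := F.atoms
    refine vn_aux _ (e := fun i => (e i : B(H))) (fun i => ⟨_, ha.mem i, rfl⟩)
      (fun i => val_eq (ha.idem i)) (fun i => val_eq (ha.sa i))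
      (fun i j h => val_eq (ha.orth i j h)) ?_ ?_
    · have := congrArg M.toStarSubalgebra.subtype ha.sum
      rw [map_sum] at this
      exact this
    · rintro _ ⟨a, haS, rfl⟩
      obtain ⟨c, rfl⟩ := ha.span a haS
      exact ⟨c, by rw [map_sum]; rfl⟩

lemma mem_vnOf {M : VonNeumannAlgebra H} {s : Std (MM M) K} {D : XD G s} (F : FS D) (x : B(H)) :
    x ∈ vnOf F ↔ ∃ y ∈ F.S, (y : B(H)) = x := Iff.rfl

/-- pull back of a trace -/
def Tr.pull {𝓠 : Type} [CStarAlgebra 𝓠] (t : Tr Al) (φ : 𝓠 ≃⋆ₐ[ℂ] Al) : Tr 𝓠 where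
  τ := t.τ.comp (φ : 𝓠 →ₗ[ℂ] Al)
  one := by show t.τ (φ 1) = 1; rw [map_one, t.one]
  comm x y := by show t.τ (φ _) = t.τ (φ _); rw [map_mul φ, map_mul φ, t.comm]
  star_eq x := by show t.τ (φ _) = _; rw [map_star, t.star_eq]; rfl
  nonneg x := by show 0 ≤ (t.τ (φ _)).re; rw [map_mul, map_star]; exact t.nonneg _
  faithful x h := by
    change t.τ (φ _) = 0 at h
    rw [map_mul, map_star] at h
    exact φ.injective ((t.faithful _ h).trans (map_zero φ).symm)

end

end CDP

open CD CDP in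
/-- Theorem `virtualmain4`. Let `Γ, Λ` be icc property (T) groups,
`Γ ↷ X = lim← X_n` a free ergodic profinite action and `Λ ↷ Y` a free ergodic compact
action. If `Θ : L^∞(X) ⋊ Γ → L^∞(Y) ⋊ Λ` is a `*`-isomorphism, then `Λ ↷ Y = lim← Y_n`
is profinite, and there are `l ∈ ℕ` and a unitary `w ∈ L^∞(Y) ⋊ Λ` with
`Θ(L^∞(X_{k+l}) ⋊ Γ) = w (L^∞(Y_{k+1}) ⋊ Λ) w*` for all `k ≥ 0`. -/
theorem stmt4_profinite_strong_rigidity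
    (Γ : Type) [Group Γ] [Countable Γ] (hiccΓ : IsICC Γ) (hTΓ : HasPropertyT Γ)
    (Λ : Type) [Group Λ] [Countable Λ] (hiccΛ : IsICC Λ) (hTΛ : HasPropertyT Λ)
    (H₁ : Type) [NormedAddCommGroup H₁] [InnerProductSpace ℂ H₁] [CompleteSpace H₁]
    (H₂ : Type) [NormedAddCommGroup H₂] [InnerProductSpace ℂ H₂] [CompleteSpace H₂]
    -- the group measure space algebras of `Γ ↷ X` (free ergodic profinite) and
    -- `Λ ↷ Y` (free ergodic compact)
    (X : CrossedProduct Γ H₁) (Y : CrossedProduct Λ H₂)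
    (habelX : IsAbelianSet (X.A : Set (H₁ →L[ℂ] H₁)))
    (habelY : IsAbelianSet (Y.A : Set (H₂ →L[ℂ] H₂)))
    (hfreeX : IsFree X) (hergX : IsErgodic X)
    (hfreeY : IsFree Y) (hergY : IsErgodic Y)
    (An : ℕ → VonNeumannAlgebra H₁) (hprofX : IsProfiniteTower X An)
    (hcptY : IsCompactAction Y)
    -- the `*`-isomorphism
    (Θ : StarIsoOn (X.M : Set (H₁ →L[ℂ] H₁)) (Y.M : Set (H₂ →L[ℂ] H₂))) :
    -- `Λ ↷ Y` is profinite, via a tower `(Y_n)`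
    ∃ Bn : ℕ → VonNeumannAlgebra H₂, IsProfiniteTower Y Bn ∧
      -- and there are `l ∈ ℕ` and a unitary `w` with
      -- `Θ(L^∞(X_{k+l}) ⋊ Γ) = w (L^∞(Y_{k+1}) ⋊ Λ) w*` for all `k ≥ 0`
      ∃ (l : ℕ) (w : H₂ →L[ℂ] H₂), IsUnitaryIn (Y.M : Set (H₂ →L[ℂ] H₂)) w ∧
        ∀ k : ℕ, Θ.Θ '' midCP X (An (k + l) : Set (H₁ →L[ℂ] H₁)) =
          conjSet w (midCP Y (Bn (k + 1) : Set (H₂ →L[ℂ] H₂))) := by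
  set s := (trOf Y).std with hs
  have hτs : ∀ x, s.τ x = (trOf Y).τ x := fun x => by rw [Std.τ, hs, Tr.std_inner, star_one, one_mul]
  let φ : MM X.M ≃⋆ₐ[ℂ] MM Y.M := isoOf Θ
  let ψ : MM Y.M ≃⋆ₐ[ℂ] MM Y.M := StarAlgEquiv.refl ℂ (MM Y.M)
  have hφ : ∀ x, s.τ (φ x) = X.tr.τ x := fun x => by
    rw [hτs]
    exact trace_unique ((trOf Y).pull φ) (trOf X) (factorOf X habelX hfreeX hergX) x
  have hψ : ∀ x, s.τ (ψ x) = Y.tr.τ x := fun x => hτs x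
  have hcb : CB s := CB_of_factor s (factorOf Y habelY hfreeY hergY)
  let t := twOf s X φ hφ habelX hfreeX hergX An hprofX
  obtain ⟨m, w, h1, h2, F', hM, hmono, hdns⟩ := main_abs (xdOf X φ s hφ habelX hfreeX hergX)
    (xdOf Y ψ s hψ habelY hfreeY hergY) hcb hiccΓ hTΓ hiccΛ hTΛ t (hc_of s Y ψ hψ habelY hfreeY hergY hcb hcptY)
  have hmem : ∀ k (x : MM Y.M), ψ x ∈ (F' k).S ↔ (x : H₂ →L[ℂ] H₂) ∈ vnOf (F' k) := fun k x => by
    rw [mem_vnOf]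
    exact ⟨fun h => ⟨x, h, rfl⟩, fun ⟨y, hy, h⟩ => (Subtype.ext h : y = x) ▸ hy⟩
  have hA : ∀ k, ∀ y ∈ (F' k).S, (y : H₂ →L[ℂ] H₂) ∈ Y.A := fun k y hy => by
    obtain ⟨a, ha, h⟩ := (F' k).le hy
    rw [← h]; exact ha
  refine ⟨fun j => vnOf (F' (j - 1)), ⟨?_, ?_, ?_, ?_, ?_, ?_⟩, m, (star w : MM Y.M), ⟨(star w).2, ?_, ?_⟩, fun k => ?_⟩
  · rintro n _ ⟨y, hy, rfl⟩
    exact hA _ y hy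
  · rintro n _ ⟨y, hy, rfl⟩
    refine ⟨y, ?_, rfl⟩
    rcases n with _ | n
    · exact hy
    · exact hmono n hy
  · rintro n g _ ⟨y, hy, rfl⟩
    refine ⟨_, (F' (n - 1)).inv g y hy, ?_⟩
    rw [CrossedProduct.σ, Y.u_star]
    rfl
  · intro n
    obtain ⟨N, e, ha⟩ := (F' (n - 1)).atoms
    refine ⟨N, fun i => (e i : H₂ →L[ℂ] H₂), fun i => ⟨_, ha.mem i, rfl⟩, ?_⟩
    rintro _ ⟨a, haS, rfl⟩
    obtain ⟨c, rfl⟩ := ha.span a haS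
    exact ⟨c, by rw [map_sum]; rfl⟩
  · intro n
    obtain ⟨N, e, ha⟩ := (F' (n - 1)).atoms
    refine ⟨N, fun i => (e i : H₂ →L[ℂ] H₂), fun i => ⟨⟨_, ha.mem i, rfl⟩, val_eq (ha.sa i),
      val_eq (ha.idem i)⟩, fun i j h => val_eq (ha.orth i j h), ?_, ?_, ?_⟩
    · have := congrArg Y.M.toStarSubalgebra.subtype ha.sum
      rw [map_sum] at this
      exact this
    · rintro _ ⟨a, haS, rfl⟩
      obtain ⟨c, rfl⟩ := ha.span a haS
      exact ⟨c, by rw [map_sum]; rfl⟩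
    · intro i j
      obtain ⟨g, hg⟩ := ha.trans i j
      refine ⟨g, ?_⟩
      rw [CrossedProduct.σ, Y.u_star]
      exact val_eq hg
  · intro a ha ε hε
    obtain ⟨k, b, hb, hd⟩ := hdns (⟨a, Y.A_sub ha⟩ : MM Y.M) ⟨⟨a, Y.A_sub ha⟩, ha, rfl⟩ ε hε
    refine ⟨k + 1, b, ⟨b, hb, rfl⟩, ?_⟩
    have h3 := nrm2 hψ (⟨a, Y.A_sub ha⟩ - b)
    exact h3.le.trans hd.le
  · rw [← StarMemClass.coe_star, star_star]; exact val_eq h2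
  · rw [← StarMemClass.coe_star, star_star]; exact val_eq h1
  · have e1 : ∀ x : MM X.M, φ x ∈ (t.F (k + m)).M ↔ (x : H₁ →L[ℂ] H₁) ∈ midCP X (An (k + m) : Set (H₁ →L[ℂ] H₁)) :=
      mid_iff s X φ hφ habelX hfreeX hergX hcb _ _ fun x => mem_mapφ φ _ x
    have e2 : ∀ z : MM Y.M, ψ z ∈ (F' k).M ↔ (z : H₂ →L[ℂ] H₂) ∈ midCP Y (vnOf (F' k) : Set (H₂ →L[ℂ] H₂)) :=
      mid_iff s Y ψ hψ habelY hfreeY hergY hcb _ _ (hmem k)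
    ext y
    constructor
    · rintro ⟨x, hx, rfl⟩
      let x' : MM X.M := ⟨x, hx.1⟩
      have h3 : star w * (w * φ x' * star w) * w = φ x' := by
        calc _ = (star w * w) * φ x' * (star w * w) := by simp only [mul_assoc]
          _ = _ := by rw [h1, one_mul, mul_one]
      refine ⟨(w * φ x' * star w : MM Y.M), (e2 _).1 ((hM k _).2 ?_), ?_⟩
      · change star w * (w * φ x' * star w) * w ∈ _
        rw [h3]; exact (e1 x').2 hx
      · have := val_eq h3
        rw [← StarMemClass.coe_star, star_star]
        exact this
    · rintro ⟨z, hz, rfl⟩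
      let z' : MM Y.M := ⟨z, hz.1⟩
      have h3 := (hM k _).1 ((e2 z').2 hz)
      obtain ⟨x, hx⟩ := φ.surjective (star w * z' * w)
      change star w * z' * w ∈ _ at h3
      rw [← hx] at h3
      refine ⟨x, (e1 x).1 h3, ?_⟩
      have := val_eq hx
      simp only
      rw [← StarMemClass.coe_star, star_star]
      exact this
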